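/- Let D ⋐ X, where for the couple (D,X) at least one of the following holds: (A) D is an irreducible, locally irreducible weakly parabolic Stein space and X is a Stein space, or (B) D is a Stein manifold and X is a Josefson manifold. Let A ⊆ D be nonpluripolar, and for r ∈ (0,1] set Δ(r) := {z ∈ D : h*_{A,D}(z) < r}. Then for all 0 < r < s ≤ 1 one has h*_{Δ(r),Δ(s)} = max{0, (h*_{A,D} − r)/(s − r)} on Δ(s). -/

import Mathlib

/-!
Common framework: plurisubharmonic functions, (reduced) complex spaces modeled by
charts onto analytic subvarieties of open subsets of finite-dimensional complex
normed spaces, relative extremal functions, pluripolarity, Stein spaces,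
Monge–Ampère operators, and crosses in products of complex spaces.
-/

open Set Filter Topology Metric

noncomputable section

/-- `ℂⁿ`, modeled as functions `Fin n → ℂ`. -/
abbrev Cn (n : ℕ) : Type := Fin n → ℂ

/-- A real-valued function is harmonic on a subset of `ℂ` if it is locally
the real part of a holomorphic function. -/
def HarmonicOnCC (h : ℂ → ℝ) (Ω : Set ℂ) : Prop :=
  ∀ z ∈ Ω, ∃ W : Set ℂ, IsOpen W ∧ z ∈ W ∧ W ⊆ Ω ∧
    ∃ f : ℂ → ℂ, DifferentiableOn ℂ f W ∧ ∀ w ∈ W, h w = (f w).re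

/-- Subharmonicity for `[-∞,∞)`-valued functions (modeled as `EReal`-valued, with value
`⊤` excluded in applications): upper semicontinuity together with domination on closed
discs by harmonic comparison functions. -/
def SubharmonicOnCC (u : ℂ → EReal) (Ω : Set ℂ) : Prop :=
  UpperSemicontinuousOn u Ω ∧
  ∀ (a : ℂ) (r : ℝ), 0 < r → closedBall a r ⊆ Ω →
    ∀ h : ℂ → ℝ, ContinuousOn h (closedBall a r) → HarmonicOnCC h (ball a r) →
      (∀ z ∈ sphere a r, u z ≤ (h z : EReal)) →
      ∀ z ∈ closedBall a r, u z ≤ (h z : EReal)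

section NormedE

variable {E : Type*} [NormedAddCommGroup E] [NormedSpace ℂ E]

/-- Plurisubharmonicity on an open subset `Ω` of a complex normed space: the function is
`< ⊤`, upper semicontinuous, not identically `-∞` on any nonempty open subset (equivalently,
on no irreducible = connected component of `Ω`), and subharmonic along every complex line. -/
def PSHOnE (u : E → EReal) (Ω : Set E) : Prop :=
  (∀ z ∈ Ω, u z < ⊤) ∧ UpperSemicontinuousOn u Ω ∧
  (¬ ∃ U : Set E, U ⊆ Ω ∧ IsOpen U ∧ U.Nonempty ∧ ∀ z ∈ U, u z = ⊥) ∧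
  ∀ a b : E, SubharmonicOnCC (fun w : ℂ => u (a + w • b)) {w : ℂ | a + w • b ∈ Ω}

/-- Strong (strict) plurisubharmonicity of a real-valued function: locally, subtracting a
small multiple of `‖z‖²` preserves plurisubharmonicity. -/
def StronglyPSHOnE (u : E → ℝ) (Ω : Set E) : Prop :=
  ∀ x ∈ Ω, ∃ ε : ℝ, 0 < ε ∧ ∃ U : Set E, IsOpen U ∧ x ∈ U ∧ U ⊆ Ω ∧
    PSHOnE (fun z => ((u z - ε * ‖z‖ ^ 2 : ℝ) : EReal)) U

/-- An analytic subvariety `B` of an open set `V`: locally the common zero locus of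
finitely many holomorphic functions. -/
def IsSubvariety (B V : Set E) : Prop :=
  IsOpen V ∧ B ⊆ V ∧
  ∀ z ∈ V, ∃ W : Set E, IsOpen W ∧ z ∈ W ∧ W ⊆ V ∧
    ∃ (m : ℕ) (F : Fin m → E → ℂ), (∀ i, DifferentiableOn ℂ (F i) W) ∧
      B ∩ W = {w ∈ W | ∀ i, F i w = 0}

end NormedE

/-- A chart `(U, φ, B, V)` of a complex space `X`: a homeomorphism `φ` of an open set
`U ⊆ X` onto an analytic subvariety `B` of an open subset `V` of a finite-dimensional
complex normed space. -/
structure CChart (X : Type*) [TopologicalSpace X] where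
  E : Type
  [nacg : NormedAddCommGroup E]
  [nsp : NormedSpace ℂ E]
  [fd : FiniteDimensional ℂ E]
  U : Set X
  V : Set E
  B : Set E
  φ : X → E
  openU : IsOpen U
  subvariety : IsSubvariety B V
  mapsToB : ∀ x ∈ U, φ x ∈ B
  injOn : Set.InjOn φ U
  image_eq : φ '' U = B
  contOn : ContinuousOn φ U
  open_image : ∀ W : Set X, W ⊆ U → IsOpen W → ∃ V'' : Set E, IsOpen V'' ∧ φ '' W = B ∩ V''

attribute [instance] CChart.nacg CChart.nsp CChart.fd

/-- Holomorphic compatibility of two charts: the transition map extends to a holomorphic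
map of ambient open sets near every point of the overlap. -/
def ChartCompat {X : Type*} [TopologicalSpace X] (c d : CChart X) : Prop :=
  ∀ x ∈ c.U ∩ d.U, ∃ W : Set c.E, IsOpen W ∧ c.φ x ∈ W ∧
    ∃ F : c.E → d.E, DifferentiableOn ℂ F W ∧
      ∀ y ∈ c.U ∩ d.U, c.φ y ∈ W → F (c.φ y) = d.φ y

/-- A (reduced) complex space structure on a topological space `X`: an atlas of pairwise
holomorphically compatible charts onto analytic subvarieties covering `X`. -/
structure CSpace (X : Type*) [TopologicalSpace X] where
  atlas : Set (CChart X)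
  chart_cover : ∀ x : X, ∃ c ∈ atlas, x ∈ c.U
  compat : ∀ c ∈ atlas, ∀ d ∈ atlas, ChartCompat c d

section Space

variable {X : Type*} [TopologicalSpace X]

/-- A function `f` is holomorphic on an open subset `D` of the complex space: near every
point it is, in some chart, the restriction of an ambient holomorphic function. -/
def SpaceHolOn (S : CSpace X) (f : X → ℂ) (D : Set X) : Prop :=
  ∀ x ∈ D, ∃ c ∈ S.atlas, x ∈ c.U ∧ ∃ V' : Set c.E, IsOpen V' ∧ V' ⊆ c.V ∧ c.φ x ∈ V' ∧
    {y ∈ c.U | c.φ y ∈ V'} ⊆ D ∧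
    ∃ F : c.E → ℂ, DifferentiableOn ℂ F V' ∧ ∀ y ∈ c.U, c.φ y ∈ V' → F (c.φ y) = f y

/-- A holomorphic map from a subset of `ℂ` into a complex space: continuous, and
holomorphic when read in any chart. -/
def HolMapTo (S : CSpace X) (f : ℂ → X) (Ω : Set ℂ) : Prop :=
  ContinuousOn f Ω ∧
  ∀ c ∈ S.atlas, DifferentiableOn ℂ (fun w => c.φ (f w)) (Ω ∩ f ⁻¹' c.U)

/-- An analytic subset `A` of an open subset `D` of a complex space: locally (in charts)
cut out in `D` by finitely many holomorphic equations. -/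
def IsAnalyticIn (S : CSpace X) (A D : Set X) : Prop :=
  A ⊆ D ∧ ∀ x ∈ D, ∃ c ∈ S.atlas, x ∈ c.U ∧ ∃ V' : Set c.E, IsOpen V' ∧ V' ⊆ c.V ∧ c.φ x ∈ V' ∧
    ∃ (m : ℕ) (F : Fin m → c.E → ℂ), (∀ i, DifferentiableOn ℂ (F i) V') ∧
      ∀ y ∈ c.U, c.φ y ∈ V' → y ∈ D → (y ∈ A ↔ ∀ i, F i (c.φ y) = 0)

/-- Irreducibility of the open subset `D` of a complex space. -/
def IsIrreducibleIn (S : CSpace X) (D : Set X) : Prop :=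
  D.Nonempty ∧ ∀ A₁ A₂ : Set X, IsAnalyticIn S A₁ D → IsAnalyticIn S A₂ D →
    A₁ ∪ A₂ = D → A₁ = D ∨ A₂ = D

/-- An irreducible analytic subset of `D`. -/
def IsIrreducibleAnalyticIn (S : CSpace X) (C D : Set X) : Prop :=
  IsAnalyticIn S C D ∧ C.Nonempty ∧
  ∀ A₁ A₂ : Set X, IsAnalyticIn S A₁ D → IsAnalyticIn S A₂ D →
    C ⊆ A₁ ∪ A₂ → C ⊆ A₁ ∨ C ⊆ A₂

/-- An irreducible component of `D`: a maximal irreducible analytic subset. -/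
def IsIrredComponentIn (S : CSpace X) (C D : Set X) : Prop :=
  IsIrreducibleAnalyticIn S C D ∧
  ∀ C' : Set X, IsIrreducibleAnalyticIn S C' D → C ⊆ C' → C' = C

/-- Local irreducibility (on `D`): every point has arbitrarily small irreducible open
neighborhoods. -/
def IsLocallyIrreducibleIn (S : CSpace X) (D : Set X) : Prop :=
  ∀ x ∈ D, ∀ W : Set X, IsOpen W → x ∈ W →
    ∃ D' : Set X, IsOpen D' ∧ x ∈ D' ∧ D' ⊆ W ∩ D ∧ IsIrreducibleIn S D'

/-- Plurisubharmonicity of `u : X → [-∞,∞)` on an open subset `D` of a complex space: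
`u` is not identically `-∞` on any irreducible component of `D` and, locally in charts,
`u` is the restriction of an ambient plurisubharmonic function. -/
def SpacePSHOn (S : CSpace X) (u : X → EReal) (D : Set X) : Prop :=
  (∀ x ∈ D, u x < ⊤) ∧
  (∀ C : Set X, IsIrredComponentIn S C D → ∃ x ∈ C, u x ≠ ⊥) ∧
  ∀ x ∈ D, ∃ c ∈ S.atlas, x ∈ c.U ∧ ∃ V' : Set c.E, IsOpen V' ∧ V' ⊆ c.V ∧ c.φ x ∈ V' ∧
    {y ∈ c.U | c.φ y ∈ V'} ⊆ D ∧
    ∃ ψ : c.E → EReal, PSHOnE ψ V' ∧ ∀ y ∈ c.U, c.φ y ∈ V' → ψ (c.φ y) = u y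

/-- Real analyticity on an open subset of a complex space, via charts. -/
def SpaceRealAnalyticOn (S : CSpace X) (f : X → ℝ) (D : Set X) : Prop :=
  ∀ x ∈ D, ∃ c ∈ S.atlas, x ∈ c.U ∧ ∃ V' : Set c.E, IsOpen V' ∧ V' ⊆ c.V ∧ c.φ x ∈ V' ∧
    {y ∈ c.U | c.φ y ∈ V'} ⊆ D ∧
    ∃ g : c.E → ℝ, AnalyticOnNhd ℝ g V' ∧ ∀ y ∈ c.U, c.φ y ∈ V' → g (c.φ y) = f y

/-- Strong plurisubharmonicity on an open subset of a complex space, via charts. -/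
def SpaceStronglyPSHOn (S : CSpace X) (f : X → ℝ) (D : Set X) : Prop :=
  ∀ x ∈ D, ∃ c ∈ S.atlas, x ∈ c.U ∧ ∃ V' : Set c.E, IsOpen V' ∧ V' ⊆ c.V ∧ c.φ x ∈ V' ∧
    {y ∈ c.U | c.φ y ∈ V'} ⊆ D ∧
    ∃ g : c.E → ℝ, StronglyPSHOnE g V' ∧ ∀ y ∈ c.U, c.φ y ∈ V' → g (c.φ y) = f y

/-- `ψ` is an exhaustion function of `D`: all sublevel sets are relatively compact in `D`. -/
def IsExhaustionOn (ψ : X → ℝ) (D : Set X) : Prop :=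
  ∀ c : ℝ, IsCompact (closure {x ∈ D | ψ x < c}) ∧ closure {x ∈ D | ψ x < c} ⊆ D

/-- The holomorphically convex hull of `K` with respect to holomorphic functions on the
open set `G`. -/
def holHull (S : CSpace X) (K G : Set X) : Set X :=
  {x ∈ G | ∀ f : X → ℂ, SpaceHolOn S f G → ‖f x‖ ≤ sSup ((fun y => ‖f y‖) '' K)}

/-- The open subset `G` of the complex space is Stein: holomorphically convex and
holomorphically separable. -/
def IsSteinIn (S : CSpace X) (G : Set X) : Prop :=
  (∀ K : Set X, K ⊆ G → IsCompact K → IsCompact (holHull S K G)) ∧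
  ∀ x ∈ G, ∀ y ∈ G, x ≠ y → ∃ f : X → ℂ, SpaceHolOn S f G ∧ f x ≠ f y

/-- All points of `D` are manifold points (charts onto open subsets of complex normed
spaces). -/
def IsManifoldIn (S : CSpace X) (D : Set X) : Prop :=
  ∀ x ∈ D, ∃ c ∈ S.atlas, x ∈ c.U ∧ c.B = c.V

/-- The function `h_{A,D}` of Definition 2.8 (before regularization). -/
def relExtRaw (S : CSpace X) (A D : Set X) : X → EReal := fun z =>
  ⨆ u ∈ {u : X → EReal | SpacePSHOn S u D ∧ (∀ x ∈ D, u x ≤ 1) ∧ ∀ x ∈ A, u x ≤ 0}, u z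

/-- The relative extremal function `h*_{A,D}`: the upper semicontinuous regularization
(within `D`) of `h_{A,D}`. -/
def relExt (S : CSpace X) (A D : Set X) : X → EReal := fun z =>
  limsup (relExtRaw S A D) (𝓝[D] z)

/-- `P` is (locally) pluripolar in the open set `D`. -/
def IsPluripolarIn (S : CSpace X) (P D : Set X) : Prop :=
  ∀ x ∈ P, ∃ U : Set X, IsOpen U ∧ x ∈ U ∧ U ⊆ D ∧
    ∃ u : X → EReal, SpacePSHOn S u U ∧ ∀ y ∈ P ∩ U, u y = ⊥

/-- `A` is pluriregular at the point `a`. -/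
def PluriregularAt (S : CSpace X) (A : Set X) (a : X) : Prop :=
  a ∈ closure A ∧ ∀ U : Set X, IsOpen U → a ∈ U → relExt S (A ∩ U) U a = 0

/-- `A` is locally pluriregular: nonempty and pluriregular at each of its points. -/
def LocallyPluriregular (S : CSpace X) (A : Set X) : Prop :=
  A.Nonempty ∧ ∀ a ∈ A, PluriregularAt S A a

/-- A Josefson manifold: a complex manifold on which every (locally) pluripolar set is
globally pluripolar. -/
def IsJosefsonManifold (S : CSpace X) : Prop :=
  IsManifoldIn S univ ∧ ∀ P : Set X, IsPluripolarIn S P univ →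
    ∃ u : X → EReal, SpacePSHOn S u univ ∧ ∀ x ∈ P, u x = ⊥

/-- Local (two-sided) boundedness of an `EReal`-valued function on `D`. -/
def LocBoundedOn (u : X → EReal) (D : Set X) : Prop :=
  ∀ x ∈ D, ∃ U : Set X, IsOpen U ∧ x ∈ U ∧
    ∃ m M : ℝ, ∀ y ∈ U ∩ D, (m : EReal) ≤ u y ∧ u y ≤ (M : EReal)

/-- (Global) boundedness of an `EReal`-valued function on `D`. -/
def BoundedOn (u : X → EReal) (D : Set X) : Prop :=
  ∃ m M : ℝ, ∀ y ∈ D, (m : EReal) ≤ u y ∧ u y ≤ (M : EReal)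

/-- `E` is locally `L`-regular (in the sense of Zeriahi): each of its points has a basis of
open neighborhoods in which the corresponding relative extremal functions are continuous
and vanish on `E`. -/
def LocallyLRegular (S : CSpace X) (E : Set X) : Prop :=
  ∀ x ∈ E, ∀ W : Set X, IsOpen W → x ∈ W →
    ∃ U₀ : Set X, IsOpen U₀ ∧ x ∈ U₀ ∧ U₀ ⊆ W ∧
      ContinuousOn (relExt S (E ∩ U₀) U₀) U₀ ∧
      ∀ y ∈ E ∩ U₀, relExt S (E ∩ U₀) U₀ y = 0

end Space

open MeasureTheory

/-! ### The complex Monge–Ampère operator -/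

/-- Second directional derivative. -/
def d2 {n : ℕ} (u : Cn n → ℝ) (z v w : Cn n) : ℝ :=
  fderiv ℝ (fun x => fderiv ℝ u x v) z w

/-- The complex Hessian `(∂²u/∂z_j ∂z̄_k)_{j,k}` of a real-valued function on `ℂⁿ`. -/
def cHess {n : ℕ} (u : Cn n → ℝ) (z : Cn n) : Matrix (Fin n) (Fin n) ℂ :=
  Matrix.of fun j k =>
    (((d2 u z (Pi.single j 1) (Pi.single k 1) +
        d2 u z (Pi.single j Complex.I) (Pi.single k Complex.I) : ℝ) : ℂ) +
      Complex.I * ((d2 u z (Pi.single j 1) (Pi.single k Complex.I) -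
        d2 u z (Pi.single j Complex.I) (Pi.single k 1) : ℝ) : ℂ)) / 4

/-- The density of `(dd^c u)^n` for a smooth `u`. -/
def maDensity {n : ℕ} (u : Cn n → ℝ) (z : Cn n) : ℝ :=
  (4 : ℝ) ^ n * (n.factorial : ℝ) * ((cHess u z).det).re

/-- The Monge–Ampère measure `(dd^c u)^n` of a smooth function on `ℂⁿ`. -/
def smoothMA {n : ℕ} (u : Cn n → ℝ) : Measure (Cn n) :=
  volume.withDensity fun z => ENNReal.ofReal (maDensity u z)

/-- `μ` is the Bedford–Taylor Monge–Ampère measure `(dd^c u)^n` of a locally bounded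
plurisubharmonic `u` on the open set `Ω ⊆ ℂⁿ`: `μ` is carried by `Ω` and is the weak-*
limit of the Monge–Ampère measures of any decreasing smooth plurisubharmonic
approximation of `u`. -/
def IsMAOn {n : ℕ} (u : Cn n → EReal) (Ω : Set (Cn n)) (μ : Measure (Cn n)) : Prop :=
  (∀ A : Set (Cn n), MeasurableSet A → Disjoint A Ω → μ A = 0) ∧
  ∀ v : ℕ → Cn n → ℝ, (∀ j, ContDiff ℝ (⊤ : ℕ∞) (v j)) →
    (∀ j, PSHOnE (fun z => ((v j z : ℝ) : EReal)) Ω) →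
    (∀ z ∈ Ω, Antitone fun j => v j z) →
    (∀ z ∈ Ω, Tendsto (fun j => ((v j z : ℝ) : EReal)) atTop (𝓝 (u z))) →
    ∀ f : Cn n → ℝ, Continuous f → HasCompactSupport f → tsupport f ⊆ Ω →
      Tendsto (fun j => ∫ z, f z ∂(smoothMA (v j))) atTop (𝓝 (∫ z, f z ∂μ))

section SpaceMA

variable {X : Type*} [TopologicalSpace X]

/-- A holomorphic local coordinate system of dimension `n` on a complex space: a
homeomorphism `ρ` of an open `U₀ ⊆ X` onto an open `Ω₀ ⊆ ℂⁿ` which identifies the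
holomorphic functions on both sides. -/
def IsLocalCoord (S : CSpace X) (n : ℕ) (U₀ : Set X) (ρ : X → Cn n) (Ω₀ : Set (Cn n)) :
    Prop :=
  IsOpen U₀ ∧ IsOpen Ω₀ ∧ ρ '' U₀ = Ω₀ ∧ InjOn ρ U₀ ∧ ContinuousOn ρ U₀ ∧
  (∀ W : Set X, W ⊆ U₀ → IsOpen W → IsOpen (ρ '' W)) ∧
  (∀ j : Fin n, SpaceHolOn S (fun x => ρ x j) U₀) ∧
  ∀ f : X → ℂ, SpaceHolOn S f U₀ →
    ∃ F : Cn n → ℂ, DifferentiableOn ℂ F Ω₀ ∧ ∀ x ∈ U₀, F (ρ x) = f x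

/-- The set of regular points of dimension `n`. -/
def RegLocus (S : CSpace X) (n : ℕ) : Set X :=
  {x | ∃ (U₀ : Set X) (ρ : X → Cn n) (Ω₀ : Set (Cn n)), IsLocalCoord S n U₀ ρ Ω₀ ∧ x ∈ U₀}

/-- The open set `D` has pure dimension `n`: its `n`-dimensional regular points are dense
in it and it has regular points of no other dimension. -/
def PureDimensionIn (S : CSpace X) (D : Set X) (n : ℕ) : Prop :=
  D ⊆ closure (RegLocus S n ∩ D) ∧ ∀ k : ℕ, (RegLocus S k ∩ D).Nonempty → k = n

/-- `μ` is the Monge–Ampère measure `(dd^c u)^n` of `u` on the open subset `D` of a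
complex space: it is carried by the regular part of `D` (i.e. extended by zero through
the singular set) and corresponds, in every local coordinate system, to the
Monge–Ampère measure in `ℂⁿ`. -/
def IsMAOnSpace [MeasurableSpace X] (S : CSpace X) (n : ℕ) (u : X → EReal) (D : Set X)
    (μ : Measure X) : Prop :=
  (∀ A : Set X, MeasurableSet A → Disjoint A D → μ A = 0) ∧
  (∀ A : Set X, MeasurableSet A → A ⊆ D → Disjoint A (RegLocus S n) → μ A = 0) ∧
  ∀ (U₀ : Set X) (ρ : X → Cn n) (Ω₀ : Set (Cn n)), IsLocalCoord S n U₀ ρ Ω₀ → U₀ ⊆ D →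
    ∃ (uu : Cn n → EReal) (ν : Measure (Cn n)),
      (∀ x ∈ U₀, uu (ρ x) = u x) ∧ IsMAOn uu Ω₀ ν ∧
      ∀ A : Set X, MeasurableSet A → A ⊆ U₀ → μ A = ν (ρ '' A)

/-- `log` with values in `[-∞, ∞)`. -/
def elog (t : ℝ) : EReal := if t ≤ 0 then ⊥ else ((Real.log t : ℝ) : EReal)

/-- `g` is a parabolic potential on `D`: a nonnegative continuous plurisubharmonic
exhaustion function of `D` such that `log g` is plurisubharmonic and maximal
(`(dd^c log g)^n = 0`) off the zero set of `g`.  A Stein space possessing such a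
potential is called weakly parabolic. -/
def WeaklyParabolicIn [MeasurableSpace X] (S : CSpace X) (n : ℕ) (g : X → ℝ) (D : Set X) :
    Prop :=
  (∀ x ∈ D, 0 ≤ g x) ∧ ContinuousOn g D ∧
  SpacePSHOn S (fun x => ((g x : ℝ) : EReal)) D ∧
  IsExhaustionOn g D ∧
  SpacePSHOn S (fun x => elog (g x)) D ∧
  IsMAOnSpace S n (fun x => elog (g x)) {x ∈ D | g x ≠ 0} (0 : Measure X)

end SpaceMA

/-! ### Products of complex spaces, generalized crosses -/

section Pi

variable {ι : Type*} [Fintype ι] {Z : ι → Type*} [∀ i, TopologicalSpace (Z i)]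

/-- Holomorphy of a function on an open subset of a finite product of complex spaces,
via products of charts. -/
def PiHolOn (T : ∀ i, CSpace (Z i)) (f : (∀ i, Z i) → ℂ) (Ω : Set (∀ i, Z i)) : Prop :=
  ∀ w ∈ Ω, ∃ c : ∀ i, CChart (Z i), (∀ i, c i ∈ (T i).atlas) ∧ (∀ i, w i ∈ (c i).U) ∧
    ∃ V' : Set (∀ i, (c i).E), IsOpen V' ∧ (fun i => (c i).φ (w i)) ∈ V' ∧
      {y : ∀ i, Z i | (∀ i, y i ∈ (c i).U) ∧ (fun i => (c i).φ (y i)) ∈ V'} ⊆ Ω ∧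
      ∃ F : (∀ i, (c i).E) → ℂ, DifferentiableOn ℂ F V' ∧
        ∀ y : ∀ i, Z i, (∀ i, y i ∈ (c i).U) → ((fun i => (c i).φ (y i)) ∈ V') →
          F (fun i => (c i).φ (y i)) = f y

/-- Plurisubharmonicity on an open subset of a finite product of complex spaces, via
products of charts. -/
def PiPSHOn (T : ∀ i, CSpace (Z i)) (u : (∀ i, Z i) → EReal) (Ω : Set (∀ i, Z i)) : Prop :=
  (∀ z ∈ Ω, u z < ⊤) ∧
  (¬ ∃ U : Set (∀ i, Z i), U ⊆ Ω ∧ IsOpen U ∧ U.Nonempty ∧ ∀ z ∈ U, u z = ⊥) ∧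
  ∀ w ∈ Ω, ∃ c : ∀ i, CChart (Z i), (∀ i, c i ∈ (T i).atlas) ∧ (∀ i, w i ∈ (c i).U) ∧
    ∃ V' : Set (∀ i, (c i).E), IsOpen V' ∧ (fun i => (c i).φ (w i)) ∈ V' ∧
      {y : ∀ i, Z i | (∀ i, y i ∈ (c i).U) ∧ (fun i => (c i).φ (y i)) ∈ V'} ⊆ Ω ∧
      ∃ ψ : (∀ i, (c i).E) → EReal, PSHOnE ψ V' ∧
        ∀ y : ∀ i, Z i, (∀ i, y i ∈ (c i).U) → ((fun i => (c i).φ (y i)) ∈ V') →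
          ψ (fun i => (c i).φ (y i)) = u y

/-- The function `h_{A,D}` on a product of complex spaces. -/
def PiRelExtRaw (T : ∀ i, CSpace (Z i)) (A D : Set (∀ i, Z i)) : (∀ i, Z i) → EReal :=
  fun z =>
    ⨆ u ∈ {u : (∀ i, Z i) → EReal |
      PiPSHOn T u D ∧ (∀ x ∈ D, u x ≤ 1) ∧ ∀ x ∈ A, u x ≤ 0}, u z

/-- The relative extremal function `h*_{A,D}` on a product of complex spaces. -/
def PiRelExt (T : ∀ i, CSpace (Z i)) (A D : Set (∀ i, Z i)) : (∀ i, Z i) → EReal :=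
  fun z => limsup (PiRelExtRaw T A D) (𝓝[D] z)

/-- Pluripolar subsets of a finite product of complex spaces. -/
def PiPluripolar (T : ∀ i, CSpace (Z i)) (P : Set (∀ i, Z i)) : Prop :=
  ∀ w ∈ P, ∃ U : Set (∀ i, Z i), IsOpen U ∧ w ∈ U ∧
    ∃ u : (∀ i, Z i) → EReal, PiPSHOn T u U ∧ ∀ y ∈ P ∩ U, u y = ⊥

end Pi

section Cross

variable {N : ℕ} {X : Fin N → Type*}

/-- The number of `1`-entries of `α`; `α ∈ I(N,k)` iff `idxCard α = k`. -/
def idxCard (α : Fin N → Bool) : ℕ := (Finset.univ.filter fun j => α j = true).card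

/-- `i_{a,α}`: the point of the product whose coordinates are those of `z` where
`α j = 1` and those of `a` where `α j = 0`. -/
def insertCoords (α : Fin N → Bool) (a : ∀ j : {j : Fin N // α j = false}, X j.1)
    (z : ∀ j : {j : Fin N // α j = true}, X j.1) : ∀ j, X j :=
  fun j => if h : α j = true then z ⟨j, h⟩ else a ⟨j, Bool.eq_false_iff.mpr h⟩

/-- The projection `a ↦ a_α^0` onto the coordinates with `α j = 0`. -/
def proj0 (α : Fin N → Bool) (w : ∀ j, X j) : ∀ j : {j : Fin N // α j = false}, X j.1 :=
  fun j => w j.1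

/-- The set `A_α` (the product of the `A_j` with `α_j = 0`). -/
def piASet (A : ∀ j, Set (X j)) (α : Fin N → Bool) :
    Set (∀ j : {j : Fin N // α j = false}, X j.1) :=
  {a | ∀ j, a j ∈ A j.1}

/-- The generalized `(N,k)`-cross `T_{N,k}((A_j, X_j)_j, (Σ_α)_α)` (with `D_j = X_j`). -/
def crossT (A : ∀ j, Set (X j)) (k : ℕ)
    (Sig : ∀ α : Fin N → Bool, Set (∀ j : {j : Fin N // α j = false}, X j.1)) :
    Set (∀ j, X j) :=
  {w | ∃ α : Fin N → Bool, idxCard α = k ∧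
    (∀ j : {j : Fin N // α j = false}, w j.1 ∈ A j.1) ∧ proj0 α w ∉ Sig α}

variable [∀ j, TopologicalSpace (X j)]

/-- `f ∈ 𝒪_s(T_{N,k})`: separate holomorphy on the generalized `(N,k)`-cross. -/
def SepHol (S : ∀ j, CSpace (X j)) (A : ∀ j, Set (X j)) (k : ℕ)
    (Sig : ∀ α : Fin N → Bool, Set (∀ j : {j : Fin N // α j = false}, X j.1))
    (f : (∀ j, X j) → ℂ) : Prop :=
  ∀ α : Fin N → Bool, idxCard α = k →
    ∀ a : ∀ j : {j : Fin N // α j = false}, X j.1, a ∈ piASet A α → a ∉ Sig α →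
      PiHolOn (fun j : {j : Fin N // α j = true} => S j.1)
        (fun z => f (insertCoords α a z)) univ

/-- `f ∈ 𝒪_s^c(T_{N,k})`: separately holomorphic, and continuous on `A_α \ Σ_α` in the
remaining variables. -/
def SepHolC (S : ∀ j, CSpace (X j)) (A : ∀ j, Set (X j)) (k : ℕ)
    (Sig : ∀ α : Fin N → Bool, Set (∀ j : {j : Fin N // α j = false}, X j.1))
    (f : (∀ j, X j) → ℂ) : Prop :=
  SepHol S A k Sig f ∧
  ∀ α : Fin N → Bool, idxCard α = k →
    ∀ b : ∀ j : {j : Fin N // α j = true}, X j.1,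
      ContinuousOn (fun a : ∀ j : {j : Fin N // α j = false}, X j.1 =>
        f (insertCoords α a b)) (piASet A α \ Sig α)

/-- The envelope `X̂_{N,k}` of the `(N,k)`-cross. -/
def crossEnvelope (S : ∀ j, CSpace (X j)) (A : ∀ j, Set (X j))
    (k : ℝ) : Set (∀ j, X j) :=
  {z | (∑ j, relExt (S j) (A j) univ (z j)) < ((k : ℝ) : EReal)}

end Cross

open MeasureTheory
open Complex (I abs_re_le_norm add_im add_re conj_im conj_ofReal conj_re continuous_re imCLM log_re
  mul_conj mul_im mul_re nonneg_iff normSq normSq_add normSq_apply normSq_eq_norm_sq normSq_nonneg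
  norm_exp norm_real ofRealCLM ofReal_pow ofReal_re ofReal_zero one_re pos_iff reCLM re_ofReal_mul
  re_sum sub_im sub_re)
open ContinuousLinearMap (coe_fst' coe_snd' fst proj snd)
open ENNReal (ofReal ofReal_lt_top ofReal_ne_top toReal_ofReal)
open EReal (coe_div coe_le_coe_iff coe_lt_coe_iff coe_lt_top coe_ne_bot coe_nonneg coe_one coe_sub
  coe_toReal coe_zero exists_rat_btwn_of_lt toReal_coe)
open Finset (mul_sum prod_congr prod_mul_distrib sum_add_distrib sum_comm sum_congr sum_div
  sum_eq_single sum_eq_zero sum_le_sum sum_mul sum_neg_distrib sum_nonneg sum_nonpos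
  sum_range_succ)
open Function (Injective comp_def invFunOn uncurry)
open Matrix (PosDef PosSemidef add_mulVec conjTranspose_apply conjTranspose_conjTranspose
  conjTranspose_mul detRowAlternating det_conjTranspose det_mul det_one det_smul dotProduct_mulVec
  mulVec mulVec_mulVec of of_apply one_apply_eq one_mulVec star_eq_conjTranspose star_mulVec
  updateRow_ne vecMul)
open Real (circleAverage circleAverage_fun_add circleAverage_mono continuous_exp exp exp_add
  exp_le_exp exp_log exp_neg exp_pos exp_sum log log_div log_exp log_le_log log_mul log_pow
  norm_eq_abs norm_of_nonneg smoothTransition sq_sqrt sqrt two_pi_pos)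
open Submodule (span)
open intervalIntegral (integral_congr intervalIntegral_eq_integral_uIoc)
open scoped Real ComplexConjugate
open scoped ComplexOrder

/-! ### Subharmonic functions of one complex variable -/

/-- An upper semicontinuous function bounded on a compact set is the pointwise limit of
continuous functions that dominate it there. -/
theorem exists_continuous_approx_of_usc {Y : Type*} [PseudoMetricSpace Y] {K : Set Y} {s : Y → ℝ}
    (hs : UpperSemicontinuousOn s K) {C : ℝ} (hC : ∀ x ∈ K, |s x| ≤ C) :
    ∃ c : ℕ → Y → ℝ, (∀ n, Continuous (c n)) ∧ (∀ n, ∀ x ∈ K, s x ≤ c n x) ∧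
      (∀ n, ∀ x ∈ K, |c n x| ≤ C) ∧
      ∀ x ∈ K, Tendsto (fun n => c n x) atTop (𝓝 (s x)) := by
  rcases K.eq_empty_or_nonempty with rfl | hne
  · exact ⟨fun _ _ => 0, fun _ => continuous_const, by simp, by simp, by simp⟩
  have : Nonempty K := hne.to_subtype
  let c (n : ℕ) (z : Y) : ℝ := ⨆ y : K, (s y - n * dist z y)
  have hsC : ∀ (n : ℕ) (z : Y) (y : K), s y - n * dist z y ≤ C := fun n z y => by
    have : 0 ≤ n * dist z y := by positivity
    grind
  have hbdd : ∀ (n : ℕ) (z : Y), BddAbove (range fun y : K => s y - n * dist z y) := fun n z =>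
    ⟨C, forall_mem_range.2 (hsC n z)⟩
  have hle : ∀ n, ∀ x ∈ K, s x ≤ c n x := fun n x hx => by simpa using le_ciSup (hbdd n x) ⟨x, hx⟩
  refine ⟨c, fun n => ?_, hle, fun n x hx => abs_le.2 ⟨(abs_le.1 (hC x hx)).1.trans (hle n x hx),
    ciSup_le (hsC n x)⟩, fun x hx => tendsto_order.2
      ⟨fun b hb => .of_forall fun n => hb.trans_le (hle n x hx), fun b hb => ?_⟩⟩
  · refine (LipschitzWith.of_le_add_mul (n : NNReal) fun x y => ciSup_le fun k => ?_).continuous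
    have h1 : s k - n * dist y k ≤ c n y := le_ciSup (hbdd n y) k
    have h3 : n * dist y k ≤ n * (dist x y + dist x k) := by
      gcongr; exact dist_comm x y ▸ dist_triangle y x k
    push_cast
    linarith
  · obtain ⟨b', hb1, hb2⟩ := exists_between hb
    obtain ⟨δ, hδ, hδ'⟩ := Metric.eventually_nhds_iff.1 (eventually_nhdsWithin_iff.1 (hs x hx b' hb1))
    filter_upwards [((tendsto_natCast_atTop_atTop (R := ℝ)).atTop_mul_const
      hδ).eventually_ge_atTop (C - b')] with n hn
    refine lt_of_le_of_lt (ciSup_le fun y => ?_) hb2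
    rcases lt_or_ge (dist (y : Y) x) δ with hy | hy
    · have : 0 ≤ n * dist x y := by positivity
      grind
    · have : n * δ ≤ n * dist x y := by rw [dist_comm]; gcongr
      grind

theorem circleIntegrable_of_usc {s : ℂ → ℝ} {a : ℂ} {R C : ℝ}
    (hs : UpperSemicontinuousOn s (sphere a |R|)) (hC : ∀ x ∈ sphere a |R|, |s x| ≤ C) :
    CircleIntegrable s a R := by
  have hm := circleMap_mem_sphere' a R
  have husc : UpperSemicontinuous fun θ => s (circleMap a R θ) := fun θ y hy =>
    (tendsto_nhdsWithin_iff.2 ⟨(continuous_circleMap a R).continuousAt,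
      .of_forall hm⟩).eventually (hs _ (hm θ) y hy)
  exact intervalIntegrable_iff.2 (Measure.integrableOn_of_bounded (M := C) (by simp [uIoc])
    husc.measurable.aestronglyMeasurable (.of_forall fun θ => by simp_all))

theorem sphere_abs_subset {a : ℂ} {r R : ℝ} (hr : 0 ≤ r) (hR : r ≤ R) :
    sphere a |r| ⊆ closedBall a R := by
  rw [abs_of_nonneg hr]; exact sphere_subset_closedBall.trans (closedBall_subset_closedBall hR)

theorem circleAverage_const_mul (k : ℝ) (f : ℂ → ℝ) (z : ℂ) (r : ℝ) :
    circleAverage (fun w => k * f w) z r = k * circleAverage f z r :=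
  Real.circleAverage_fun_smul (a := k)

theorem circleAverage_re {f : ℂ → ℂ} {a : ℂ} {R : ℝ} (hR : 0 < R)
    (hf : DiffContOnCl ℂ f (ball a R)) : circleAverage (fun z => (f z).re) a R = (f a).re := by
  rw [← abs_of_pos hR] at hf
  have hci : CircleIntegrable f a R := (hf.continuousOn.mono (by
    rw [closure_ball a (abs_pos.2 hR.ne').ne']
    exact sphere_subset_closedBall)).circleIntegrable'
  exact (reCLM.circleAverage_comp_comm hci).trans (congrArg Complex.re hf.circleAverage)

theorem HarmonicOnCC.eventually_circleAverage {h : ℂ → ℝ} {Ω : Set ℂ} (hh : HarmonicOnCC h Ω)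
    {z : ℂ} (hz : z ∈ Ω) :
    ∀ᶠ r in 𝓝[>] (0:ℝ), CircleIntegrable h z r ∧ circleAverage h z r = h z := by
  obtain ⟨W, hWo, hzW, hWΩ, f, hf, hhf⟩ := hh z hz
  obtain ⟨δ, hδ, hball⟩ := Metric.isOpen_iff.1 hWo z hzW
  filter_upwards [Ioo_mem_nhdsGT hδ] with r ⟨hr0, hr⟩
  have hcb : closedBall z r ⊆ W := (closedBall_subset_ball hr).trans hball
  have hd : DiffContOnCl ℂ f (ball z r) := DifferentiableOn.diffContOnCl (by
    rw [closure_ball z hr0.ne']; exact hf.mono hcb)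
  have hs : sphere z |r| ⊆ W := (sphere_abs_subset hr0.le le_rfl).trans hcb
  have hcongr : EqOn h (fun w => (f w).re) (sphere z |r|) := fun w hw => hhf w (hs hw)
  exact ⟨((continuous_re.comp_continuousOn (hf.continuousOn.mono hs)).congr
    hcongr).circleIntegrable', by
      rw [Real.circleAverage_congr_sphere hcongr, circleAverage_re hr0 hd, hhf z hzW]⟩

theorem circleAverage_normSq_sub (a z : ℂ) {r : ℝ} (hr : 0 < r) :
    circleAverage (fun w => ‖w - a‖ ^ 2) z r = ‖z - a‖ ^ 2 + r ^ 2 := by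
  have key : ∀ w ∈ sphere z |r|,
      ‖w - a‖ ^ 2 = (‖z - a‖ ^ 2 + r ^ 2) + (2 * (conj (z - a) * (w - z))).re := fun w hw => by
    rw [← sq_abs r, ← mem_sphere_iff_norm.1 hw, ← sub_add_sub_cancel' z a w, ← normSq_eq_norm_sq,
      normSq_add, normSq_eq_norm_sq, normSq_eq_norm_sq]
    simp [mul_re]
    ring
  rw [Real.circleAverage_congr_sphere key, circleAverage_fun_add (circleIntegrable_const _ _ _)
    (by fun_prop), Real.circleAverage_const,
    circleAverage_re (f := fun w => 2 * (conj (z - a) * (w - z))) hr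
      (by apply Differentiable.diffContOnCl; fun_prop)]
  simp

/-- Maximum principle: a weak local sub-mean value inequality implies domination by harmonic
functions. -/
theorem le_harmonic_of_local_submean {s h : ℂ → ℝ} {a : ℂ} {R C : ℝ}
    (hs : UpperSemicontinuousOn s (closedBall a R)) (hC : ∀ x ∈ closedBall a R, |s x| ≤ C)
    (hsub : ∀ z ∈ ball a R, ∀ ε > 0, ∀ᶠ r in 𝓝[>] (0:ℝ), s z ≤ circleAverage s z r + ε * r ^ 2)
    (hh : ContinuousOn h (closedBall a R)) (hharm : HarmonicOnCC h (ball a R))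
    (hle : ∀ z ∈ sphere a R, s z ≤ h z) : ∀ z ∈ closedBall a R, s z ≤ h z := fun z₁ hz₁ => by
  have key : ∀ ε > 0, s z₁ ≤ h z₁ + ε * R ^ 2 := fun ε hε => by
    let y (z : ℂ) : ℝ := s z + (-h z + ε * ‖z - a‖ ^ 2)
    have hcont : ContinuousOn (fun z => -h z + ε * ‖z - a‖ ^ 2) (closedBall a R) :=
      hh.neg.add (by fun_prop)
    obtain ⟨z₀, hz₀, hmax⟩ := (hs.add hcont.upperSemicontinuousOn).exists_isMaxOn ⟨z₁, hz₁⟩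
      (isCompact_closedBall a R)
    have hmax' : ∀ z ∈ closedBall a R, y z ≤ y z₀ := fun z hz => hmax hz
    have hbound : s z₀ + (-h z₀ + ε * ‖z₀ - a‖ ^ 2) ≤ ε * R ^ 2 := by
      by_cases hb : z₀ ∈ ball a R
      · exfalso
        obtain ⟨δ, hδ, hball⟩ := Metric.isOpen_iff.1 isOpen_ball z₀ hb
        obtain ⟨r, ⟨hr0, h1⟩, h2, h3, h4⟩ := (Eventually.and (Ioo_mem_nhdsGT hδ)
          ((hsub z₀ hb (ε / 2) (by positivity)).and (hharm.eventually_circleAverage hb))).exists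
        have hsph : sphere z₀ |r| ⊆ closedBall a R := ((sphere_abs_subset hr0.le le_rfl).trans
          (closedBall_subset_ball h1)).trans (hball.trans ball_subset_closedBall)
        have i1 := circleIntegrable_of_usc (hs.mono hsph) fun x hx => hC x (hsph hx)
        have i2 : CircleIntegrable (fun z => ε * ‖z - a‖ ^ 2) z₀ r := by
          fun_prop
        have e1 : circleAverage y z₀ r =
            circleAverage s z₀ r + (-h z₀ + ε * (‖z₀ - a‖ ^ 2 + r ^ 2)) := by
          rw [circleAverage_fun_add (f₂ := fun z => -h z + ε * ‖z - a‖ ^ 2) i1 (h3.neg.add i2),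
            circleAverage_fun_add (f₁ := fun z => -h z) h3.neg i2, ← circleAverage_normSq_sub a z₀ hr0,
            ← h4]
          congr 2
          · simpa using Real.circleAverage_fun_smul (a := (-1 : ℝ)) (f := h) (c := z₀) (R := r)
          · exact circleAverage_const_mul _ _ _ _
        have e2 : circleAverage y z₀ r ≤ s z₀ + (-h z₀ + ε * ‖z₀ - a‖ ^ 2) :=
          Real.circleAverage_mono_on_of_le_circle (i1.add (h3.neg.add i2)) fun x hx =>
            hmax' x (hsph hx)
        have : 0 < ε * r ^ 2 := by positivity
        linarith
      · have hz₀' : z₀ ∈ sphere a R := le_antisymm hz₀ (not_lt.1 hb)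
        rw [mem_sphere_iff_norm.1 hz₀']
        grind
    have : s z₁ + (-h z₁ + ε * ‖z₁ - a‖ ^ 2) ≤ _ := (hmax' z₁ hz₁).trans hbound
    have : 0 ≤ ε * ‖z₁ - a‖ ^ 2 := by positivity
    linarith
  by_contra! hcon
  have := key ((s z₁ - h z₁) / (2 * (R ^ 2 + 1))) (div_pos (by linarith) (by positivity))
  rw [← sub_le_iff_le_add', div_mul_eq_mul_div, le_div_iff₀ (by positivity)] at this
  nlinarith [sq_nonneg R]

/-- Every continuous function on a circle is uniformly approximated by real parts of entire
functions. -/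
theorem exists_entire_re_approx {c : ℂ → ℝ} (hc : Continuous c) (a : ℂ) {R : ℝ} (hR : 0 < R)
    {ε : ℝ} (hε : 0 < ε) :
    ∃ f : ℂ → ℂ, Differentiable ℂ f ∧ ∀ z ∈ sphere a R, |c z - (f z).re| < ε := by
  have : Fact (0 < 2 * π) := ⟨two_pi_pos⟩
  let g : C(AddCircle (2 * π), ℂ) :=
    ⟨fun t => (c (a + R * (fourier 1 t : ℂ)) : ℂ), by fun_prop⟩
  have hmem : g ∈ closure (span ℂ (range <| @fourier (2 * π)) : Set C(AddCircle (2 * π), ℂ)) := by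
    rw [← Submodule.topologicalClosure_coe, span_fourier_closure_eq_top]; trivial
  obtain ⟨p, hp, hdist⟩ := Metric.mem_closure_iff.1 hmem ε hε
  have hpow : ∀ (m : ℕ) (t : AddCircle (2 * π)), (fourier m t : ℂ) = fourier 1 t ^ m := fun m t => by
    induction m with
    | zero => simp
    | succ m ih => rw [Nat.cast_succ, fourier_add, ih, pow_succ]
  have hrep : ∃ f₁ f₂ : ℂ → ℂ, Differentiable ℂ f₁ ∧ Differentiable ℂ f₂ ∧
      ∀ t, p t = f₁ (fourier 1 t) + conj (f₂ (fourier 1 t)) := by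
    refine Submodule.span_induction ?_ ⟨fun _ => 0, fun _ => 0, by fun_prop, by fun_prop, by simp⟩
      ?_ ?_ hp
    · rintro _ ⟨n, rfl⟩
      obtain ⟨m, rfl | rfl⟩ := n.eq_nat_or_neg
      · exact ⟨fun z => z ^ m, fun _ => 0, by fun_prop, by fun_prop, fun t => by simp [hpow]⟩
      · exact ⟨fun _ => 0, fun z => z ^ m, by fun_prop, by fun_prop, fun t => by
          rw [fourier_neg, hpow, zero_add]⟩
    · rintro x y _ _ ⟨f₁, f₂, h1, h2, h3⟩ ⟨g₁, g₂, k1, k2, k3⟩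
      refine ⟨f₁ + g₁, f₂ + g₂, h1.add k1, h2.add k2, fun t => ?_⟩
      simp only [ContinuousMap.add_apply, h3, k3, Pi.add_apply, map_add]
      ring
    · rintro k x _ ⟨f₁, f₂, h1, h2, h3⟩
      refine ⟨fun z => k * f₁ z, fun z => conj k * f₂ z, by fun_prop, by fun_prop, fun t => ?_⟩
      simp only [ContinuousMap.smul_apply, h3, smul_eq_mul, map_mul, Complex.conj_conj]
      ring
  obtain ⟨f₁, f₂, h1, h2, h3⟩ := hrep
  refine ⟨fun z => f₁ ((z - a) / R) + f₂ ((z - a) / R), by fun_prop, fun z hz => ?_⟩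
  have hR' : (R : ℂ) ≠ 0 := by exact_mod_cast hR.ne'
  obtain ⟨θ, hθ⟩ : ∃ θ : ℝ, z = a + R * Complex.exp (θ * I) := by
    have := Complex.norm_mul_exp_arg_mul_I (z - a)
    rw [mem_sphere_iff_norm.1 hz] at this
    grind
  have hf1 : (fourier 1 (θ : AddCircle (2 * π)) : ℂ) = Complex.exp (θ * I) := by
    rw [fourier_coe_apply]
    push_cast
    field_simp
  have hz' : (z - a) / R = Complex.exp (θ * I) := by grind
  have hg : g (θ : AddCircle (2 * π)) = (c z : ℂ) := by
    change ((c (a + R * (fourier 1 (θ : AddCircle (2 * π)) : ℂ)) : ℝ) : ℂ) = _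
    grind
  have hre : ((g - p) (θ : AddCircle (2 * π))).re = c z - (f₁ ((z - a) / R) + f₂ ((z - a) / R)).re := by
    simp_all
  rw [← hre]
  exact (abs_re_le_norm _).trans_lt (((g - p).norm_coe_le_norm _).trans_lt (dist_eq_norm g p ▸ hdist))

theorem tendsto_circleAverage {f : ℕ → ℂ → ℝ} {g : ℂ → ℝ} {c : ℂ} {r C : ℝ}
    (hf : ∀ j, CircleIntegrable (f j) c r) (hC : ∀ j, ∀ w ∈ sphere c |r|, |f j w| ≤ C)
    (h : ∀ w ∈ sphere c |r|, Tendsto (fun j => f j w) atTop (𝓝 (g w))) :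
    Tendsto (fun j => circleAverage (f j) c r) atTop (𝓝 (circleAverage g c r)) :=
  (intervalIntegral.tendsto_integral_filter_of_dominated_convergence (fun _ => C)
    (.of_forall fun j => (intervalIntegrable_iff.1 (hf j)).aestronglyMeasurable)
    (.of_forall fun j => .of_forall fun θ _ => by simp_all)
    (by simp) (.of_forall fun θ _ => h _ (circleMap_mem_sphere' c r θ))).const_smul _

/-- Monotonicity of circle means of a function dominated by harmonic functions. -/
theorem circleAverage_le_of_dominated {s : ℂ → ℝ} {a : ℂ} {R C : ℝ} (hR : 0 < R)
    (hs : UpperSemicontinuousOn s (closedBall a R)) (hC : ∀ x ∈ closedBall a R, |s x| ≤ C)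
    (hdom : ∀ f : ℂ → ℂ, Differentiable ℂ f → (∀ z ∈ sphere a R, s z ≤ (f z).re) →
      ∀ z ∈ closedBall a R, s z ≤ (f z).re) {r : ℝ} (hr : 0 ≤ r) (hrR : r ≤ R) :
    circleAverage s a r ≤ circleAverage s a R := by
  have hsph : sphere a |R| ⊆ closedBall a R := sphere_abs_subset hR.le le_rfl
  have hsphr : sphere a |r| ⊆ closedBall a R := sphere_abs_subset hr hrR
  have ir := circleIntegrable_of_usc (hs.mono hsphr) fun x hx => hC x (hsphr hx)
  obtain ⟨c, hc1, hc2, hc3, hc4⟩ := exists_continuous_approx_of_usc (hs.mono hsph)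
    (fun x hx => hC x (hsph hx))
  refine ge_of_tendsto' (tendsto_circleAverage (fun n => (hc1 n).continuousOn.circleIntegrable')
    hc3 hc4) fun n => le_of_forall_pos_le_add fun ε hε => ?_
  rw [abs_of_pos hR] at hc2
  obtain ⟨f, hf, hfa⟩ := exists_entire_re_approx (hc1 n) a hR (ε := ε / 2) (by positivity)
  let F (z : ℂ) : ℂ := f z + (ε / 2 : ℝ)
  have hF : Differentiable ℂ F := by fun_prop
  have hre : ∀ z, (F z).re = (f z).re + ε / 2 := fun z => by simp [F]
  have h1 := hdom F hF fun z hz => by grind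
  have hav : ∀ ρ : ℝ, 0 ≤ ρ → circleAverage (fun z => (F z).re) a ρ = (F a).re := fun ρ hρ => by
    rcases hρ.eq_or_lt with rfl | hρ
    · simp
    · exact circleAverage_re hρ hF.diffContOnCl
  have hci : ∀ ρ : ℝ, CircleIntegrable (fun z => (F z).re) a ρ := fun ρ =>
    (continuous_re.comp hF.continuous).continuousOn.circleIntegrable'
  have e1 := circleAverage_mono ir (hci r) fun x hx => h1 x (hsphr hx)
  have e2 : circleAverage (fun z => (F z).re) a R ≤ circleAverage (fun z => c n z + ε) a R := by
    refine circleAverage_mono (hci R) ((hc1 n).add continuous_const).continuousOn.circleIntegrable'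
      fun x hx => ?_
    grind
  rw [circleAverage_fun_add (hc1 n).continuousOn.circleIntegrable'
    (circleIntegrable_const _ _ _), Real.circleAverage_const, hav R hR.le] at e2
  grind

/-! ### Bounded plurisubharmonic functions via a local sub-mean value inequality -/

section LPSH

variable {E : Type*} [NormedAddCommGroup E] [NormedSpace ℂ E]
variable {R : ℝ}

/-- Bounded real-valued plurisubharmonic functions, described by a weak local sub-mean value
inequality along complex lines. -/
def LPSH (u : E → ℝ) (Ω : Set E) : Prop :=
  UpperSemicontinuousOn u Ω ∧ (∃ C, ∀ x ∈ Ω, |u x| ≤ C) ∧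
  ∀ a ∈ Ω, ∀ b : E, ∀ ε > 0, ∀ᶠ r in 𝓝[>] (0:ℝ),
    u a ≤ circleAverage (fun w : ℂ => u (a + w • b)) 0 r + ε * r ^ 2

variable {u v : E → ℝ} {Ω Ω' : Set E}

theorem usc_comp_line (hu : UpperSemicontinuousOn u Ω) (a b : E) :
    UpperSemicontinuousOn (fun w : ℂ => u (a + w • b)) {w | a + w • b ∈ Ω} := fun w hw y hy => by
  have hc : Continuous fun w : ℂ => a + w • b := by fun_prop
  exact (tendsto_nhdsWithin_iff.2 ⟨hc.continuousAt.mono_left nhdsWithin_le_nhds,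
    eventually_mem_nhdsWithin⟩).eventually (hu _ hw y hy)

theorem circleAverage_line_shift (u : E → ℝ) (a b : E) (z : ℂ) (r : ℝ) :
    circleAverage (fun w : ℂ => u (a + w • b)) z r =
      circleAverage (fun w : ℂ => u ((a + z • b) + w • b)) 0 r := by
  unfold circleAverage
  congr 2
  simp [circleMap, add_smul, add_assoc]

theorem LPSH.le_harmonic (hu : LPSH u Ω) (a b : E) {c : ℂ}
    (hR : ∀ w ∈ closedBall c R, a + w • b ∈ Ω) {h : ℂ → ℝ}
    (hh : ContinuousOn h (closedBall c R)) (hharm : HarmonicOnCC h (ball c R))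
    (hle : ∀ z ∈ sphere c R, u (a + z • b) ≤ h z) :
    ∀ z ∈ closedBall c R, u (a + z • b) ≤ h z := by
  obtain ⟨h1, ⟨C, h2⟩, h3⟩ := hu
  refine le_harmonic_of_local_submean (s := fun w => u (a + w • b)) (C := C)
    ((usc_comp_line h1 a b).mono hR) (fun x hx => h2 _ (hR x hx)) 
    (fun z hz ε hε => ?_) hh hharm hle
  simpa only [circleAverage_line_shift u a b z] using
    h3 (a + z • b) (hR z (ball_subset_closedBall hz)) b ε hε

theorem harmonicOnCC_re {f : ℂ → ℂ} (hf : Differentiable ℂ f) {Ω : Set ℂ} (hΩ : IsOpen Ω) :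
    HarmonicOnCC (fun z => (f z).re) Ω :=
  fun z hz => ⟨Ω, hΩ, hz, subset_rfl, f, hf.differentiableOn, fun _ _ => rfl⟩

theorem LPSH.circleMean_mono (hu : LPSH u Ω) (a b : E) (hR0 : 0 < R)
    (hR : ∀ w ∈ closedBall (0:ℂ) R, a + w • b ∈ Ω) {r : ℝ} (hr : 0 ≤ r) (hrR : r ≤ R) :
    circleAverage (fun w : ℂ => u (a + w • b)) 0 r ≤
      circleAverage (fun w : ℂ => u (a + w • b)) 0 R := by
  obtain ⟨C, h2⟩ := hu.2.1
  refine circleAverage_le_of_dominated (C := C) hR0 ((usc_comp_line hu.1 a b).mono hR)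
    (fun x hx => h2 _ (hR x hx)) (fun f hf hle => ?_) hr hrR
  exact hu.le_harmonic a b hR (continuous_re.comp hf.continuous).continuousOn
    (harmonicOnCC_re hf isOpen_ball) hle

/-- The sub-mean value inequality on every disc contained in the domain. -/
theorem LPSH.submean (hu : LPSH u Ω) (a b : E) (hR0 : 0 < R)
    (hR : ∀ w ∈ closedBall (0:ℂ) R, a + w • b ∈ Ω) :
    u a ≤ circleAverage (fun w : ℂ => u (a + w • b)) 0 R := by
  simpa using hu.circleMean_mono a b hR0 hR le_rfl hR0.le

theorem LPSH.circleIntegrable (hu : UpperSemicontinuousOn u Ω) (hb : ∃ C, ∀ x ∈ Ω, |u x| ≤ C)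
    (a b : E) {r : ℝ} (hr : ∀ w ∈ sphere (0:ℂ) |r|, a + w • b ∈ Ω) :
    CircleIntegrable (fun w : ℂ => u (a + w • b)) 0 r := by
  exact circleIntegrable_of_usc ((usc_comp_line hu a b).mono hr) fun x hx =>
    hb.choose_spec _ (hr x hx)

theorem eventually_line_mem (hΩ : IsOpen Ω) {a : E} (ha : a ∈ Ω) (b : E) :
    ∀ᶠ r in 𝓝[>] (0:ℝ), 0 < r ∧ ∀ w ∈ closedBall (0:ℂ) r, a + w • b ∈ Ω := by
  have hopen : IsOpen {w : ℂ | a + w • b ∈ Ω} := hΩ.preimage (by fun_prop)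
  obtain ⟨δ, hδ, hball⟩ := Metric.isOpen_iff.1 hopen 0 (by simp_all)
  filter_upwards [Ioo_mem_nhdsGT hδ] with r hr
  exact ⟨hr.1, fun w hw => hball (closedBall_subset_ball hr.2 hw)⟩

theorem LPSH.mono (hu : LPSH u Ω) (h : Ω' ⊆ Ω) : LPSH u Ω' :=
  ⟨hu.1.mono h, hu.2.1.imp fun _ hC x hx => hC x (h hx), fun a ha => hu.2.2 a (h ha)⟩

/-- Criterion: the sub-mean value inequality on all small circles. -/
theorem LPSH.of_submean (h1 : UpperSemicontinuousOn u Ω) (h2 : ∃ C, ∀ x ∈ Ω, |u x| ≤ C)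
    (h3 : ∀ a ∈ Ω, ∀ b : E, ∀ᶠ r in 𝓝[>] (0:ℝ),
      u a ≤ circleAverage (fun w : ℂ => u (a + w • b)) 0 r) : LPSH u Ω := by
  refine ⟨h1, h2, fun a ha b ε hε => ?_⟩
  filter_upwards [h3 a ha b] with r hr
  have : 0 ≤ ε * r ^ 2 := by positivity
  linarith

theorem LPSH.eventually_submean (hΩ : IsOpen Ω) (hu : LPSH u Ω) {a : E} (ha : a ∈ Ω) (b : E) :
    ∀ᶠ r in 𝓝[>] (0:ℝ), u a ≤ circleAverage (fun w : ℂ => u (a + w • b)) 0 r := by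
  filter_upwards [eventually_line_mem hΩ ha b] with r hr using hu.submean a b hr.1 hr.2

theorem LPSH.congr (hΩ : IsOpen Ω) (hu : LPSH u Ω) (h : EqOn v u Ω) : LPSH v Ω := by
  refine LPSH.of_submean (fun x hx y hy => ?_)
    (hu.2.1.imp fun C hC x hx => by grind) fun a ha b => ?_
  · replace hy : v x < y := hy
    rw [h hx] at hy
    filter_upwards [hu.1 x hx y hy, self_mem_nhdsWithin] with z hz hz'
    rwa [h hz']
  · filter_upwards [hu.eventually_submean hΩ ha b, eventually_line_mem hΩ ha b] with r h1 h2
    rwa [h ha, Real.circleAverage_congr_sphere fun w hw =>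
      h (h2.2 w (sphere_abs_subset h2.1.le le_rfl hw))]

theorem LPSH.const (c : ℝ) : LPSH (fun _ : E => c) Ω :=
  LPSH.of_submean upperSemicontinuousOn_const ⟨|c|, fun _ _ => le_rfl⟩
    fun a _ b => .of_forall fun r => by rw [Real.circleAverage_const]

theorem LPSH.sup (hΩ : IsOpen Ω) (hu : LPSH u Ω) (hv : LPSH v Ω) :
    LPSH (fun x => max (u x) (v x)) Ω := by
  have husc : UpperSemicontinuousOn (fun x => max (u x) (v x)) Ω := fun x hx y hy => by
    filter_upwards [hu.1 x hx y (max_lt_iff.1 hy).1, hv.1 x hx y (max_lt_iff.1 hy).2] with z h1 h2 using max_lt h1 h2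
  obtain ⟨C, hC⟩ := hu.2.1
  obtain ⟨C', hC'⟩ := hv.2.1
  have hb : ∃ C, ∀ x ∈ Ω, |max (u x) (v x)| ≤ C := ⟨max C C', fun x hx =>
    abs_max_le_max_abs_abs.trans (max_le_max (hC x hx) (hC' x hx))⟩
  refine LPSH.of_submean husc hb fun a ha b => ?_
  filter_upwards [hu.eventually_submean hΩ ha b, hv.eventually_submean hΩ ha b,
    eventually_line_mem hΩ ha b] with r h1 h2 h3
  have hs : ∀ w ∈ sphere (0:ℂ) |r|, a + w • b ∈ Ω := fun w hw =>
    h3.2 w (sphere_abs_subset h3.1.le le_rfl hw)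
  have im := LPSH.circleIntegrable husc hb a b hs
  exact max_le (h1.trans (circleAverage_mono (LPSH.circleIntegrable hu.1 hu.2.1 a b hs) im
    fun x _ => le_max_left _ _)) (h2.trans (circleAverage_mono
      (LPSH.circleIntegrable hv.1 hv.2.1 a b hs) im fun x _ => le_max_right _ _))

theorem LPSH.add (hΩ : IsOpen Ω) (hu : LPSH u Ω) (hv : LPSH v Ω) : LPSH (fun x => u x + v x) Ω := by
  obtain ⟨C, hC⟩ := hu.2.1
  obtain ⟨C', hC'⟩ := hv.2.1
  refine LPSH.of_submean (hu.1.add hv.1)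
    ⟨C + C', fun x hx => (abs_add_le _ _).trans (add_le_add (hC x hx) (hC' x hx))⟩ fun a ha b => ?_
  filter_upwards [hu.eventually_submean hΩ ha b, hv.eventually_submean hΩ ha b,
    eventually_line_mem hΩ ha b] with r h1 h2 h3
  have hs : ∀ w ∈ sphere (0:ℂ) |r|, a + w • b ∈ Ω := fun w hw =>
    h3.2 w (sphere_abs_subset h3.1.le le_rfl hw)
  rw [circleAverage_fun_add (LPSH.circleIntegrable hu.1 hu.2.1 a b hs)
    (LPSH.circleIntegrable hv.1 hv.2.1 a b hs)]
  linarith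

theorem LPSH.const_mul (hΩ : IsOpen Ω) (hu : LPSH u Ω) {c : ℝ} (hc : 0 ≤ c) :
    LPSH (fun x => c * u x) Ω := by
  obtain ⟨C, hC⟩ := hu.2.1
  refine LPSH.of_submean ?_ ⟨c * C, fun x hx => ?_⟩ fun a ha b => ?_
  · rcases hc.eq_or_lt with rfl | hc
    · simpa using upperSemicontinuousOn_const
    · intro x hx y hy
      filter_upwards [hu.1 x hx _ ((lt_div_iff₀' hc).2 hy)] with z hz using (lt_div_iff₀' hc).1 hz
  · rw [abs_mul, abs_of_nonneg hc]
    exact mul_le_mul_of_nonneg_left (hC x hx) hc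
  · filter_upwards [hu.eventually_submean hΩ ha b] with r h1
    exact (mul_le_mul_of_nonneg_left h1 hc).trans_eq (circleAverage_const_mul _ _ _ _).symm

theorem LPSH.add_const (hΩ : IsOpen Ω) (hu : LPSH u Ω) (c : ℝ) :
    LPSH (fun x => u x + c) Ω := hu.add hΩ (LPSH.const c)

theorem LPSH.of_locally (hb : ∃ C, ∀ x ∈ Ω, |u x| ≤ C)
    (h : ∀ x ∈ Ω, ∃ U, IsOpen U ∧ x ∈ U ∧ LPSH u U) : LPSH u Ω := by
  refine ⟨fun x hx y hy => ?_, hb, fun x hx => ?_⟩ <;> obtain ⟨U, hU, hxU, hlp⟩ := h x hx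
  · have h2 := hlp.1 x hxU y hy
    rw [hU.nhdsWithin_eq hxU] at h2
    exact h2.filter_mono nhdsWithin_le_nhds
  · exact hlp.2.2 x hxU

/-- A bounded function in the local class is plurisubharmonic. -/
theorem LPSH.pshOnE (hu : LPSH u Ω) : PSHOnE (fun x => (u x : EReal)) Ω := by
  have hco : Monotone Real.toEReal := fun x y hxy => by simp_all
  have hc := continuous_coe_real_ereal
  exact ⟨fun z _ => coe_lt_top _, hc.comp_upperSemicontinuousOn hu.1 hco, fun ⟨U, _, _, ⟨x, hx⟩, h⟩ => coe_ne_bot _ (h x hx),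
    fun a b => ⟨hc.comp_upperSemicontinuousOn (usc_comp_line hu.1 a b) hco, fun c R hR hsub h hh hharm hle z hz =>
      coe_le_coe_iff.2 (hu.le_harmonic a b (fun w hw => hsub hw) hh hharm
        (fun z hz => coe_le_coe_iff.1 (hle z hz)) z hz)⟩⟩

end LPSH

/-! ### Mollification by circled kernels -/

/-- The squared Euclidean norm on `ℂⁿ`. -/
def nsq {n : ℕ} (z : Cn n) : ℝ := ∑ i, normSq (z i)

theorem nsq_nonneg {n : ℕ} (z : Cn n) : 0 ≤ nsq z :=
  sum_nonneg fun _ _ => normSq_nonneg _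

theorem nsq_smul {n : ℕ} (c : ℂ) (z : Cn n) : nsq (c • z) = ‖c‖ ^ 2 * nsq z := by
  simp [nsq, mul_sum, normSq_eq_norm_sq, mul_pow]

theorem normSq_le_nsq {n : ℕ} (z : Cn n) (i : Fin n) : normSq (z i) ≤ nsq z :=
  Finset.single_le_sum (f := fun i => normSq (z i))
    (fun _ _ => normSq_nonneg _) (Finset.mem_univ i)

theorem norm_sq_le_nsq {n : ℕ} (z : Cn n) : ‖z‖ ^ 2 ≤ nsq z := by
  refine (Real.le_sqrt (norm_nonneg z) (nsq_nonneg z)).1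
    ((pi_norm_le_iff_of_nonneg (Real.sqrt_nonneg _)).2 fun i => Real.le_sqrt_of_sq_le ?_)
  rw [← normSq_eq_norm_sq]
  exact normSq_le_nsq z i

theorem nsq_le_norm_sq {n : ℕ} (z : Cn n) : nsq z ≤ n * ‖z‖ ^ 2 := by
  have : nsq z ≤ ∑ _i : Fin n, ‖z‖ ^ 2 := by
    refine sum_le_sum fun i _ => ?_
    rw [normSq_eq_norm_sq]
    gcongr
    exact norm_le_pi_norm z i
  simp_all

theorem contDiff_nsq {n : ℕ} {k : WithTop ℕ∞} : ContDiff ℝ k (nsq : Cn n → ℝ) := by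
  unfold nsq
  have h (i : Fin n) : ContDiff ℝ k fun z : Cn n => z i := contDiff_apply ℝ ℂ i
  exact ContDiff.sum fun i _ => ((Complex.reCLM.contDiff.comp (h i)).mul
    (Complex.reCLM.contDiff.comp (h i))).add
      ((Complex.imCLM.contDiff.comp (h i)).mul (Complex.imCLM.contDiff.comp (h i)))

theorem continuous_nsq {n : ℕ} : Continuous (nsq : Cn n → ℝ) :=
  (contDiff_nsq (k := 0)).continuous

/-- Unnormalised circled bump function. -/
def rhoAux {n : ℕ} (z : Cn n) : ℝ := smoothTransition (1 - nsq z)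

theorem contDiff_rhoAux {n : ℕ} : ContDiff ℝ (⊤ : ℕ∞) (rhoAux : Cn n → ℝ) :=
  Real.smoothTransition.contDiff.comp (contDiff_const.sub contDiff_nsq)

theorem rhoAux_nonneg {n : ℕ} (z : Cn n) : 0 ≤ rhoAux z := Real.smoothTransition.nonneg _

theorem rhoAux_zero {n : ℕ} : rhoAux (0 : Cn n) = 1 := by
  simp [rhoAux, nsq, Real.smoothTransition.one]

theorem norm_le_one_of_rhoAux_ne {n : ℕ} {z : Cn n} (h : rhoAux z ≠ 0) : ‖z‖ ≤ 1 := by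
  by_contra! hcon
  exact h (Real.smoothTransition.zero_of_nonpos (by nlinarith [norm_sq_le_nsq z]))

theorem hasCompactSupport_rhoAux {n : ℕ} : HasCompactSupport (rhoAux : Cn n → ℝ) :=
  HasCompactSupport.of_support_subset_isCompact (isCompact_closedBall 0 1) fun z hz => by
    simpa using norm_le_one_of_rhoAux_ne hz

theorem integrable_rhoAux {n : ℕ} : Integrable (rhoAux : Cn n → ℝ) :=
  contDiff_rhoAux.continuous.integrable_of_hasCompactSupport hasCompactSupport_rhoAux

theorem integral_rhoAux_pos {n : ℕ} : 0 < ∫ z : Cn n, rhoAux z := by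
  refine contDiff_rhoAux.continuous.integral_pos_of_hasCompactSupport_nonneg_nonzero
    hasCompactSupport_rhoAux rhoAux_nonneg (x := 0) ?_
  rw [rhoAux_zero]; simp

/-- A smooth circled probability density supported in the unit ball. -/
def rho {n : ℕ} (z : Cn n) : ℝ := (∫ y : Cn n, rhoAux y)⁻¹ * rhoAux z

theorem contDiff_rho {n : ℕ} : ContDiff ℝ (⊤ : ℕ∞) (rho : Cn n → ℝ) :=
  contDiff_const.mul contDiff_rhoAux

theorem rho_nonneg {n : ℕ} (z : Cn n) : 0 ≤ rho z :=
  mul_nonneg (inv_nonneg.2 integral_rhoAux_pos.le) (rhoAux_nonneg z)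

theorem norm_le_one_of_rho_ne {n : ℕ} {z : Cn n} (h : rho z ≠ 0) : ‖z‖ ≤ 1 :=
  norm_le_one_of_rhoAux_ne fun h0 => h (by simp [rho, h0])

theorem hasCompactSupport_rho {n : ℕ} : HasCompactSupport (rho : Cn n → ℝ) :=
  hasCompactSupport_rhoAux.mul_left

theorem integrable_rho {n : ℕ} : Integrable (rho : Cn n → ℝ) := integrable_rhoAux.const_mul _

theorem integral_rho {n : ℕ} : ∫ z : Cn n, rho z = 1 := by
  unfold rho
  rw [integral_const_mul]
  exact inv_mul_cancel₀ integral_rhoAux_pos.ne'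

theorem integral_const_mul_rho {n : ℕ} (c : ℝ) : ∫ z : Cn n, c * rho z = c := by
  rw [integral_const_mul, integral_rho, mul_one]

theorem rho_smul {n : ℕ} {c : ℂ} (hc : ‖c‖ = 1) (z : Cn n) : rho (c • z) = rho z := by
  simp [rho, rhoAux, nsq_smul, hc]

theorem measurePreserving_smul {n : ℕ} {c : ℂ} (hc : ‖c‖ = 1) :
    MeasurePreserving (fun z : Cn n => c • z) :=
  volume_preserving_pi (fun _ : Fin n =>
    (rotation ⟨c, by simpa [Submonoid.unitSphere] using hc⟩).measurePreserving)

theorem integral_comp_rot {n : ℕ} {G : Type*} [NormedAddCommGroup G] [NormedSpace ℝ G] {c : ℂ}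
    (hc : ‖c‖ = 1) (f : Cn n → G) :
    ∫ z, f (c • z) = ∫ z, f z := by
  have hc0 : c ≠ 0 := by rintro rfl; simp at hc
  exact (measurePreserving_smul hc).integral_comp
    (Homeomorph.smulOfNeZero c hc0).measurableEmbedding f

theorem integral_interval_swap {n : ℕ} {f : ℝ → Cn n → ℝ} (hf : Measurable (uncurry f))
    {g : Cn n → ℝ} (hg : Integrable g) (hle : ∀ θ y, |f θ y| ≤ g y) (a b : ℝ) :
    ∫ θ in a..b, ∫ y, f θ y = ∫ y, ∫ θ in a..b, f θ y := by
  have key : ∀ s : Set ℝ, volume s ≠ ⊤ → ∫ θ in s, ∫ y, f θ y = ∫ y, ∫ θ in s, f θ y := fun s hs => by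
    have : IsFiniteMeasure (volume.restrict s) := ⟨by simpa using hs.lt_top⟩
    exact integral_integral_swap ((hg.comp_snd _).mono' hf.aestronglyMeasurable
      (.of_forall fun p => hle p.1 p.2))
  simp only [intervalIntegral_eq_integral_uIoc]
  rw [key _ (by simp [uIoc]), integral_smul]

/-- Mollification with the circled kernel `rho` at scale `ε`. -/
def mol {n : ℕ} (ε : ℝ) (u : Cn n → ℝ) (x : Cn n) : ℝ := ∫ y, u (x + (ε : ℂ) • y) * rho y

section

variable {n : ℕ} {u v : Cn n → ℝ} {Ω : Set (Cn n)} {C : ℝ}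
variable {x : Cn n} {ε : ℝ}

theorem abs_mul_rho_le {t : ℝ} (ht : |t| ≤ C) (y : Cn n) : |t * rho y| ≤ C * rho y := by
  rw [abs_mul, abs_of_nonneg (rho_nonneg y)]
  exact mul_le_mul_of_nonneg_right ht (rho_nonneg y)

theorem integrable_mul_rho (hu : Measurable u) (hC : ∀ x, |u x| ≤ C) :
    Integrable fun y => u y * rho y :=
  (integrable_rho.const_mul C).mono' (hu.mul contDiff_rho.continuous.measurable).aestronglyMeasurable
    (.of_forall fun y => abs_mul_rho_le (hC y) y)

theorem integrable_mol (hu : Measurable u) (hC : ∀ x, |u x| ≤ C) (x : Cn n) (c : ℂ) :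
    Integrable fun y => u (x + c • y) * rho y :=
  integrable_mul_rho (hu.comp (by fun_prop)) fun y => hC _

theorem circleAverage_mul_const (f : ℂ → ℝ) (k : ℝ) (z : ℂ) (r : ℝ) :
    circleAverage (fun w => f w * k) z r = circleAverage f z r * k := by
  simp [circleAverage, intervalIntegral.integral_mul_const, mul_assoc]

theorem measurable_circleAverage {K : ℂ → Cn n → ℝ} (hK : Measurable (uncurry K)) (r : ℝ) :
    Measurable fun y => circleAverage (fun w => K w y) 0 r := by
  simp only [circleAverage, intervalIntegral_eq_integral_uIoc, smul_eq_mul]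
  have : StronglyMeasurable (uncurry fun y θ => K (circleMap 0 r θ) y) :=
    (hK.comp (((continuous_circleMap 0 r).measurable.comp
      measurable_snd).prodMk measurable_fst)).stronglyMeasurable
  exact (this.integral_prod_right.measurable.const_mul _).const_mul _

theorem circleAverage_integral_rho {K : ℂ → Cn n → ℝ} (hK : Measurable (uncurry K))
    (hC : ∀ w y, |K w y| ≤ C) (r : ℝ) : circleAverage (fun w => ∫ y, K w y * rho y) 0 r =
      ∫ y, circleAverage (fun w => K w y) 0 r * rho y := by
  have h2 := integral_interval_swap (f := fun θ y => K (circleMap 0 r θ) y * rho y)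
    (g := fun y => C * rho y) ((hK.comp (((continuous_circleMap 0 r).measurable.comp
      measurable_fst).prodMk measurable_snd)).mul (contDiff_rho.continuous.measurable.comp
      measurable_snd)) (integrable_rho.const_mul C) (fun θ y => abs_mul_rho_le (hC _ _) y) 0 (2 * π)
  simp only [← circleAverage_mul_const]
  rw [circleAverage, h2, smul_eq_mul, ← integral_const_mul]
  rfl

theorem measurable_line (hu : Measurable u) (x : Cn n) :
    Measurable (uncurry fun (w : ℂ) y => u (x + w • y)) :=
  hu.comp (f := fun p : ℂ × Cn n => x + p.1 • p.2) (by fun_prop)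

theorem mol_eq_circle (hu : Measurable u) (hC : ∀ x, |u x| ≤ C) (ε : ℝ) (x : Cn n) :
    mol ε u x = ∫ y, circleAverage (fun w : ℂ => u (x + w • y)) 0 ε * rho y := by
  rw [← circleAverage_integral_rho (measurable_line hu x) (fun _ _ => hC _), circleAverage]
  have h1 : ∀ θ : ℝ, ∫ y, u (x + circleMap 0 ε θ • y) * rho y = mol ε u x := fun θ => by
    have hc : ‖Complex.exp (θ * I)‖ = 1 := Complex.norm_exp_ofReal_mul_I θ
    rw [mol, ← integral_comp_rot hc (fun y => u (x + (ε : ℂ) • y) * rho y)]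
    simp only [rho_smul hc, circleMap, zero_add, mul_smul]
  simp only [h1, intervalIntegral.integral_const, sub_zero, smul_eq_mul]
  rw [← mul_assoc, inv_mul_cancel₀ two_pi_pos.ne', one_mul]

theorem circleAverage_bound {f : ℂ → ℝ} (hC : ∀ x, |f x| ≤ C) (z : ℂ) (r : ℝ) :
    |circleAverage f z r| ≤ C := by
  rw [circleAverage, smul_eq_mul, abs_mul, abs_of_pos (inv_pos.2 two_pi_pos),
    inv_mul_le_iff₀ two_pi_pos]
  simpa [abs_of_pos Real.pi_pos, mul_comm] using
    intervalIntegral.norm_integral_le_of_norm_le_const (a := 0) (b := 2 * π)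
      (f := fun θ => f (circleMap z r θ)) fun θ _ => hC _

theorem integrable_circle_rho (hu : Measurable u) (hC : ∀ x, |u x| ≤ C) (x : Cn n) (r : ℝ) :
    Integrable fun y => circleAverage (fun w : ℂ => u (x + w • y)) 0 r * rho y :=
  integrable_mul_rho (measurable_circleAverage (measurable_line hu x) r)
    fun _ => circleAverage_bound (fun _ => hC _) _ _

theorem add_smul_mem_of_closedBall (h : closedBall x ε ⊆ Ω) {y : Cn n}
    (hy : ‖y‖ ≤ 1) {w : ℂ} (hw : w ∈ closedBall (0:ℂ) ε) : x + w • y ∈ Ω := by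
  apply h
  rw [mem_closedBall, dist_eq_norm, add_sub_cancel_left, norm_smul]
  exact (mul_le_of_le_one_right (norm_nonneg w) hy).trans (by simp_all)

theorem mul_rho_le {a b : ℝ} {y : Cn n} (h : ‖y‖ ≤ 1 → a ≤ b) : a * rho y ≤ b * rho y := by
  by_cases hy : rho y = 0
  · simp [hy]
  · exact mul_le_mul_of_nonneg_right (h (norm_le_one_of_rho_ne hy)) (rho_nonneg y)

/-- Mollifications decrease with the scale. -/
theorem LPSH.mol_mono (hu : LPSH u Ω) (hm : Measurable u) (hC : ∀ x, |u x| ≤ C)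
    {δ : ℝ} (hδ : 0 < δ) (hδε : δ ≤ ε) (hx : closedBall x ε ⊆ Ω) : mol δ u x ≤ mol ε u x := by
  rw [mol_eq_circle hm hC, mol_eq_circle hm hC]
  refine integral_mono (integrable_circle_rho hm hC x δ) (integrable_circle_rho hm hC x ε)
    fun y => mul_rho_le fun hy => ?_
  exact hu.circleMean_mono x y (hδ.trans_le hδε)
    (fun w hw => add_smul_mem_of_closedBall hx hy hw) hδ.le hδε

theorem LPSH.le_mol (hu : LPSH u Ω) (hm : Measurable u) (hC : ∀ x, |u x| ≤ C)
    (hε : 0 < ε) (hx : closedBall x ε ⊆ Ω) : u x ≤ mol ε u x := by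
  rw [mol_eq_circle hm hC, ← integral_const_mul_rho (n := n) (u x)]
  refine integral_mono (integrable_rho.const_mul _) (integrable_circle_rho hm hC x ε)
    fun y => mul_rho_le fun hy => ?_
  exact hu.submean x y hε (fun w hw => add_smul_mem_of_closedBall hx hy hw)

theorem mol_mono_fun (hu : Measurable u) (hC : ∀ x, |u x| ≤ C) {C' : ℝ} (hv : Measurable v)
    (hC' : ∀ x, |v x| ≤ C') (hε : 0 ≤ ε)
    (h : ∀ y ∈ closedBall x ε, u y ≤ v y) : mol ε u x ≤ mol ε v x := by
  refine integral_mono (integrable_mol hu hC x _) (integrable_mol hv hC' x _)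
    fun y => mul_rho_le fun hy => ?_
  exact h _ (add_smul_mem_of_closedBall subset_rfl hy (by simp [abs_of_nonneg hε]))

theorem mol_le_of_le (hu : Measurable u) (hC : ∀ x, |u x| ≤ C) (hε : 0 ≤ ε)
    {c : ℝ} (h : ∀ y ∈ closedBall x ε, u y ≤ c) : mol ε u x ≤ c := by
  rw [← integral_const_mul_rho (n := n) c]
  exact integral_mono (integrable_mol hu hC x _) (integrable_rho.const_mul _)
    fun y => mul_rho_le fun hy => h _ (add_smul_mem_of_closedBall subset_rfl hy (by simp [abs_of_nonneg hε]))

theorem le_mol_of_le (hu : Measurable u) (hC : ∀ x, |u x| ≤ C) (hε : 0 ≤ ε)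
    {c : ℝ} (h : ∀ y ∈ closedBall x ε, c ≤ u y) : c ≤ mol ε u x := by
  rw [← integral_const_mul_rho (n := n) c]
  exact integral_mono (integrable_rho.const_mul _) (integrable_mol hu hC x _)
    fun y => mul_rho_le fun hy => h _ (add_smul_mem_of_closedBall subset_rfl hy (by simp [abs_of_nonneg hε]))

theorem abs_mol_le (hu : Measurable u) (hC : ∀ x, |u x| ≤ C) (hε : 0 ≤ ε) (x : Cn n) :
    |mol ε u x| ≤ C :=
  abs_le.2 ⟨le_mol_of_le hu hC hε fun y _ => (abs_le.1 (hC y)).1,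
    mol_le_of_le hu hC hε fun y _ => (abs_le.1 (hC y)).2⟩

/-- Mollification is smooth. -/
theorem contDiff_mol (hu : Measurable u) (hC : ∀ x, |u x| ≤ C) (hε : 0 < ε) :
    ContDiff ℝ (⊤ : ℕ∞) (mol ε u) := by
  let k (y : Cn n) : ℝ := (ε ^ Module.finrank ℝ (Cn n))⁻¹ * rho (-(ε⁻¹ • y))
  have hk : ContDiff ℝ (⊤ : ℕ∞) k :=
    contDiff_const.mul (contDiff_rho.comp ((contDiff_id.const_smul (ε⁻¹)).neg))
  have hks : HasCompactSupport k := by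
    refine HasCompactSupport.of_support_subset_isCompact (isCompact_closedBall 0 ε) fun z hz => ?_
    have h2 := norm_le_one_of_rho_ne (z := -(ε⁻¹ • z)) fun h0 => hz (by grind)
    rw [norm_neg, norm_smul, norm_inv, norm_eq_abs, abs_of_pos hε, inv_mul_le_iff₀ hε, mul_one] at h2
    simp_all
  have hloc : LocallyIntegrable u := fun x => ⟨ball x 1, ball_mem_nhds x one_pos,
    Measure.integrableOn_of_bounded (M := C) measure_ball_lt_top.ne hu.aestronglyMeasurable
      (.of_forall hC)⟩
  have heq : mol ε u = convolution u k (ContinuousLinearMap.mul ℝ ℝ) volume := by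
    ext x
    rw [convolution_def, mol]
    simp only [ContinuousLinearMap.mul_apply']
    have e1 : (∫ y, u (x + (ε : ℂ) • y) * rho y) =
        ∫ y, (fun z => u (x + z) * rho (ε⁻¹ • z)) (ε • y) := by
      simp [smul_smul, inv_mul_cancel₀ hε.ne']
    rw [e1, Measure.integral_comp_smul volume (fun z => u (x + z) * rho (ε⁻¹ • z)),
      ← integral_add_left_eq_self (fun t => u t * k (x - t)) x, ← integral_smul,
      abs_of_pos (by positivity)]
    simp [k]
    ring
  rw [heq]
  exact hks.contDiff_convolution_right _ hloc hk

/-- Mollifications of plurisubharmonic functions are plurisubharmonic. -/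
theorem LPSH.mollify (hu : LPSH u Ω) (hm : Measurable u) (hC : ∀ x, |u x| ≤ C) (hε : 0 < ε)
    {Ω' : Set (Cn n)} (hΩ' : IsOpen Ω') (h : ∀ x ∈ Ω', closedBall x ε ⊆ Ω) :
    LPSH (mol ε u) Ω' := by
  refine LPSH.of_submean (contDiff_mol hm hC hε).continuous.continuousOn.upperSemicontinuousOn
    ⟨C, fun x _ => abs_mol_le hm hC hε.le x⟩ fun a ha b => ?_
  filter_upwards [eventually_line_mem hΩ' ha b] with r hr
  have hK : Measurable (uncurry fun (w : ℂ) y => u (a + w • b + (ε : ℂ) • y)) :=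
    hm.comp (f := fun p : ℂ × Cn n => a + p.1 • b + (ε : ℂ) • p.2) (by fun_prop)
  refine le_of_le_of_eq ?_ (circleAverage_integral_rho hK (fun _ _ => hC _) r).symm
  refine integral_mono (integrable_mol hm hC a _) (integrable_mul_rho
    (measurable_circleAverage hK r) fun _ => circleAverage_bound (fun _ => hC _) _ _)
    fun y => mul_rho_le fun hy => ?_
  simp only [add_right_comm a _ ((ε : ℂ) • y)]
  refine hu.submean (a + (ε : ℂ) • y) b hr.1 fun w hw => ?_
  rw [add_right_comm]
  exact add_smul_mem_of_closedBall (h _ (hr.2 w hw)) hy (by simp [abs_of_pos hε])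

/-- Mollifications converge pointwise from above. -/
theorem LPSH.tendsto_mol (hΩ : IsOpen Ω) (hu : LPSH u Ω) (hm : Measurable u) (hC : ∀ x, |u x| ≤ C)
    (hx : x ∈ Ω) : Tendsto (fun ε => mol ε u x) (𝓝[>] 0) (𝓝 (u x)) := by
  obtain ⟨δ, hδ, hball⟩ := Metric.isOpen_iff.1 hΩ x hx
  refine tendsto_order.2 ⟨fun b hb => ?_, fun b hb => ?_⟩
  · filter_upwards [Ioo_mem_nhdsGT hδ] with ε hε
    exact hb.trans_le (hu.le_mol hm hC hε.1 ((closedBall_subset_ball hε.2).trans hball))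
  · obtain ⟨b', hb1, hb2⟩ := exists_between hb
    have := hu.1 x hx b' hb1
    rw [hΩ.nhdsWithin_eq hx] at this
    obtain ⟨δ', hδ', hball'⟩ := Metric.eventually_nhds_iff.1 this
    filter_upwards [Ioo_mem_nhdsGT hδ'] with ε hε
    exact (mol_le_of_le hm hC hε.1.le fun y hy => (hball' (lt_of_le_of_lt hy hε.2)).le).trans_lt hb2

theorem measurable_indicator_of_usc (hΩ : IsOpen Ω) (hu : UpperSemicontinuousOn u Ω) :
    Measurable (Ω.indicator u) := by
  refine measurable_of_Iio fun c => ?_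
  have h1 : IsOpen {x | x ∈ Ω ∧ u x < c} := by
    rw [isOpen_iff_mem_nhds]
    rintro x ⟨hx, hxc⟩
    have := hu x hx c hxc
    rw [hΩ.nhdsWithin_eq hx] at this
    filter_upwards [this, hΩ.mem_nhds hx] with y h2 h3 using ⟨h3, h2⟩
  have h2 : Ω.indicator u ⁻¹' Iio c = {x | x ∈ Ω ∧ u x < c} ∪ (Ωᶜ ∩ {_x | (0:ℝ) < c}) := by
    ext x
    by_cases hx : x ∈ Ω <;> simp [hx]
  rw [h2]
  exact h1.measurableSet.union (hΩ.measurableSet.compl.inter (MeasurableSet.const _))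

theorem LPSH.indicator (hΩ : IsOpen Ω) (hu : LPSH u Ω) : LPSH (Ω.indicator u) Ω :=
  hu.congr hΩ fun _ hx => indicator_of_mem hx u

theorem LPSH.indicator_bound (hu : LPSH u Ω) : ∃ C, ∀ x, |Ω.indicator u x| ≤ C := by
  obtain ⟨C, hC⟩ := hu.2.1
  refine ⟨max C 0, fun x => ?_⟩
  by_cases hx : x ∈ Ω <;> simp [hx, hC]

/-- Every bounded plurisubharmonic function is locally a decreasing limit of smooth ones. -/
theorem LPSH.exists_smooth_approx (hΩ : IsOpen Ω) (hu : LPSH u Ω) {R : ℝ}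
    (hR : 0 < R) (hx : closedBall x R ⊆ Ω) :
    ∃ (v : ℕ → Cn n → ℝ) (R' : ℝ) (C : ℝ), R < R' ∧ (∀ j, ContDiff ℝ (⊤ : ℕ∞) (v j)) ∧
      (∀ j x, |v j x| ≤ C) ∧
      (∀ j, LPSH (v j) (ball x R')) ∧ (∀ y ∈ ball x R', Antitone fun j => v j y) ∧
      ∀ y ∈ ball x R', Tendsto (fun j => v j y) atTop (𝓝 (u y)) := by
  obtain ⟨δ, hδ, hδ'⟩ := (isCompact_closedBall x R).exists_thickening_subset_open hΩ hx
  have hthick : ∀ y ∈ ball x (R + δ / 2), ∀ ε, ε < δ / 2 → closedBall y ε ⊆ Ω :=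
      fun y hy ε hε z hz => hδ' (by
    rw [thickening_closedBall hδ hR.le]
    rw [mem_ball] at hy ⊢
    linarith [dist_triangle z y x, mem_closedBall.1 hz])
  obtain ⟨C, hC⟩ := hu.indicator_bound
  have hm := measurable_indicator_of_usc hΩ hu.1
  let e (j : ℕ) : ℝ := δ / 4 * (1 / (j + 1))
  have he : ∀ j, 0 < e j := fun j => by positivity
  have hanti : Antitone e := fun i j hij => by dsimp only [e]; gcongr
  have he' : ∀ j, e j < δ / 2 := fun j =>
    (hanti j.zero_le).trans_lt (by grind)
  have hlim : Tendsto e atTop (𝓝[>] 0) := tendsto_nhdsWithin_iff.2 ⟨by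
    simpa [e] using (tendsto_one_div_add_atTop_nhds_zero_nat (𝕜 := ℝ)).const_mul (δ / 4), .of_forall he⟩
  refine ⟨fun j => mol (e j) (Ω.indicator u), R + δ / 2, C, by linarith,
    fun j => contDiff_mol hm hC (he j), fun j x => abs_mol_le hm hC (he j).le x,
    fun j => (hu.indicator hΩ).mollify hm hC (he j) isOpen_ball fun y hy => hthick y hy _ (he' j),
    fun y hy i j hij => (hu.indicator hΩ).mol_mono hm hC (he j) (hanti hij) (hthick y hy _ (he' i)),
    fun y hy => ?_⟩
  have hyΩ : y ∈ Ω := hthick y hy 0 (by linarith) (by simp)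
  simpa [hyΩ, comp_def] using ((hu.indicator hΩ).tendsto_mol hΩ hm hC hyΩ).comp hlim

end

/-! ### Limits and holomorphic pull-backs of plurisubharmonic functions -/

section

variable {E : Type*} [NormedAddCommGroup E] [NormedSpace ℂ E]

/-- Bounded pointwise limits of plurisubharmonic functions are plurisubharmonic as soon as they
are upper semicontinuous. -/
theorem LPSH.of_tendsto {Ω : Set E} (hΩ : IsOpen Ω) {u : ℕ → E → ℝ} {v : E → ℝ} {C : ℝ}
    (hu : ∀ j, LPSH (u j) Ω) (hC : ∀ j, ∀ x ∈ Ω, |u j x| ≤ C)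
    (hv : UpperSemicontinuousOn v Ω)
    (h : ∀ x ∈ Ω, Tendsto (fun j => u j x) atTop (𝓝 (v x))) : LPSH v Ω := by
  refine LPSH.of_submean hv ⟨C, fun x hx => le_of_tendsto' (h x hx).abs fun j => hC j x hx⟩
    fun a ha b => ?_
  filter_upwards [eventually_line_mem hΩ ha b] with r hr
  have hs : ∀ w ∈ sphere (0:ℂ) |r|, a + w • b ∈ Ω := fun w hw =>
    hr.2 w (sphere_abs_subset hr.1.le le_rfl hw)
  exact le_of_tendsto_of_tendsto' (h a ha) (tendsto_circleAverage (C := C)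
    (fun j => LPSH.circleIntegrable (hu j).1 (hu j).2.1 a b hs)
    (fun j w hw => hC j _ (hs w hw)) fun w hw => h _ (hs w hw)) fun j =>
      (hu j).submean a b hr.1 hr.2

theorem usc_of_antitone {Y : Type*} [TopologicalSpace Y] {Ω : Set Y} {u : ℕ → Y → ℝ} {v : Y → ℝ}
    (hu : ∀ j, UpperSemicontinuousOn (u j) Ω) (hanti : ∀ x ∈ Ω, Antitone fun j => u j x)
    (h : ∀ x ∈ Ω, Tendsto (fun j => u j x) atTop (𝓝 (v x))) : UpperSemicontinuousOn v Ω := fun x hx y hy => by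
  obtain ⟨j, hj⟩ := ((h x hx).eventually_lt_const hy).exists
  filter_upwards [hu j x hx y hj, self_mem_nhdsWithin] with z hz hz'
  exact ((hanti z hz').le_of_tendsto (h z hz') j).trans_lt hz

theorem circleAverage_clm_sq (L : ℂ →L[ℝ] ℝ) {r : ℝ} (hr : 0 < r) :
    circleAverage (fun w : ℂ => L (w ^ 2)) 0 r = 0 := by
  have h : ∀ z : ℂ, L z = (z * (L 1 - I * L I)).re := fun z => by
    conv_lhs => rw [← Complex.re_add_im z, ← mul_one (z.re : ℂ), ← Complex.real_smul,
      ← Complex.real_smul, map_add, map_smul, map_smul]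
    simp
  rw [funext fun w : ℂ => h (w ^ 2), circleAverage_re (f := fun w : ℂ => w ^ 2 * (L 1 - I * L I)) hr
    (by apply Differentiable.diffContOnCl; fun_prop)]
  simp

/-- Weak sub-mean value inequality of a `C¹` plurisubharmonic function along a holomorphic disc. -/
theorem submean_comp_disc {v : E → ℝ} (hv : ContDiff ℝ 1 v) {γ : ℂ → E} [CompleteSpace E]
    {s : Set ℂ} (hs : s ∈ 𝓝 0) (hγ : DifferentiableOn ℂ γ s)
    (hsub : ∀ b : E, ∀ᶠ r in 𝓝[>] (0:ℝ),
      v (γ 0) ≤ circleAverage (fun w : ℂ => v (γ 0 + w • b)) 0 r) {ε : ℝ} (hε : 0 < ε) :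
    ∀ᶠ r in 𝓝[>] (0:ℝ), v (γ 0) ≤ circleAverage (fun w => v (γ w)) 0 r + ε * r ^ 2 := by
  set p := γ 0 with hp
  set γ1 := dslope γ 0 with hγ1
  set γ2 := dslope γ1 0 with hγ2
  have d1 : DifferentiableOn ℂ γ1 s := (Complex.differentiableOn_dslope hs).2 hγ
  have d2 : DifferentiableOn ℂ γ2 s := (Complex.differentiableOn_dslope hs).2 d1
  set q := γ1 0
  set c := γ2 0
  have e1 : ∀ w, γ w - (p + w • q) = w ^ 2 • γ2 w := fun w => by
    have h1 := sub_smul_dslope γ 0 w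
    have h2 := sub_smul_dslope γ1 0 w
    rw [sub_zero] at h1 h2
    rw [pow_two, mul_smul, h2, smul_sub, ← hγ1] at *
    grind
  have c0 : ContinuousAt γ 0 := (hγ.differentiableAt hs).continuousAt
  have c2 : ContinuousAt γ2 0 := (d2.differentiableAt hs).continuousAt
  set L := fderiv ℝ v p
  have hstrict : HasStrictFDerivAt v L p := hv.contDiffAt.hasStrictFDerivAt one_ne_zero
  have hclaim : ∀ᶠ w in 𝓝 (0:ℂ), |v (γ w) - v (p + w • q) - L (w ^ 2 • c)| ≤ ε * ‖w‖ ^ 2 := by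
    have hcl : Continuous fun w : ℂ => p + w • q := by fun_prop
    have ht : Tendsto (fun w : ℂ => (γ w, p + w • q)) (𝓝 0) (𝓝 (p, p)) :=
      Tendsto.prodMk_nhds c0 (by simpa using hcl.tendsto 0)
    have h1 := (hstrict.isLittleO.comp_tendsto ht).def (c := ε / (2 * (‖c‖ + 1))) (by positivity)
    have h2 : ∀ᶠ w in 𝓝 (0:ℂ), ‖γ2 w‖ < ‖c‖ + 1 :=
      c2.norm.eventually_lt_const (by simp [c])
    have h3 : ∀ᶠ w in 𝓝 (0:ℂ), ‖L‖ * ‖γ2 w - c‖ < ε / 2 := by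
      have : Tendsto (fun w => ‖L‖ * ‖γ2 w - c‖) (𝓝 0) (𝓝 (‖L‖ * ‖c - c‖)) :=
        (c2.sub continuousAt_const).norm.const_mul _
      rw [sub_self, norm_zero, mul_zero] at this
      exact this.eventually_lt_const (by positivity)
    filter_upwards [h1, h2, h3] with w k1 k2 k3
    simp only [Function.comp] at k1
    rw [e1, norm_smul, norm_pow, norm_eq_abs] at k1
    have k5 : |L (w ^ 2 • γ2 w) - L (w ^ 2 • c)| ≤ ‖w‖ ^ 2 * (ε / 2) := by
      rw [← map_sub, ← smul_sub]
      refine (L.le_opNorm _).trans ?_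
      rw [norm_smul, norm_pow]
      calc _ = ‖w‖ ^ 2 * (‖L‖ * ‖γ2 w - c‖) := by ring
        _ ≤ _ := by gcongr
    have k6 : ε / (2 * (‖c‖ + 1)) * (‖w‖ ^ 2 * ‖γ2 w‖) ≤ ‖w‖ ^ 2 * (ε / 2) := by
      calc _ ≤ ε / (2 * (‖c‖ + 1)) * (‖w‖ ^ 2 * (‖c‖ + 1)) := by gcongr
        _ = _ := by field_simp
    grind
  obtain ⟨δ, hδ, hball⟩ := Metric.eventually_nhds_iff.1 (hclaim.and hs)
  filter_upwards [hsub q, Ioo_mem_nhdsGT hδ] with r hr hrδ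
  have hr0 : 0 < r := hrδ.1
  have hsph : ∀ w ∈ sphere (0:ℂ) |r|, dist w 0 < δ := fun w hw =>
    (mem_closedBall.1 (sphere_abs_subset hr0.le le_rfl hw)).trans_lt hrδ.2
  have i1 : CircleIntegrable (fun w => v (γ w)) 0 r :=
    (hv.continuous.comp_continuousOn (hγ.continuousOn.mono fun w hw =>
      (hball (hsph w hw)).2)).circleIntegrable'
  have i2 : CircleIntegrable (fun w : ℂ => v (p + w • q)) 0 r :=
    (hv.continuous.comp (by fun_prop)).continuousOn.circleIntegrable'
  let Lc : ℂ →L[ℝ] ℝ := L.comp ((ContinuousLinearMap.id ℂ ℂ).smulRight c |>.restrictScalars ℝ)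
  have hLc : ∀ z : ℂ, Lc z = L (z • c) := fun z => rfl
  have i3 : CircleIntegrable (fun w : ℂ => Lc (w ^ 2)) 0 r :=
    (Lc.continuous.comp (by fun_prop)).continuousOn.circleIntegrable'
  have hle : circleAverage (fun w => v (p + w • q) + Lc (w ^ 2)) 0 r ≤
      circleAverage (fun w => v (γ w) + ε * r ^ 2) 0 r := by
    refine circleAverage_mono (i2.add i3) (i1.add (circleIntegrable_const _ _ _)) fun w hw => ?_
    have h1 := (hball (hsph w hw)).1
    rw [show ‖w‖ = r by rw [abs_of_pos hr0] at hw; simp_all] at h1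
    simp only [hLc]
    linarith [(abs_le.1 h1).1]
  rw [circleAverage_fun_add i2 i3, circleAverage_clm_sq _ hr0,
    circleAverage_fun_add i1 (circleIntegrable_const _ _ _), Real.circleAverage_const] at hle
  linarith

end

section

variable {E : Type*} [NormedAddCommGroup E] [NormedSpace ℂ E]
variable {n : ℕ} {u v : Cn n → ℝ} {Ω : Set (Cn n)} {C : ℝ}

/-- Plurisubharmonicity is preserved under holomorphic pull-back. -/
theorem LPSH.comp_holomorphic (hΩ : IsOpen Ω) (hu : LPSH u Ω) {G : Set E} (hG : IsOpen G)
    {F : E → Cn n} (hF : DifferentiableOn ℂ F G) (hFG : MapsTo F G Ω) :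
    LPSH (fun x => u (F x)) G := by
  obtain ⟨C, hC⟩ := hu.2.1
  refine LPSH.of_locally ⟨C, fun x hx => hC _ (hFG hx)⟩ fun x hx => ?_
  obtain ⟨R, hR, hRΩ⟩ := Metric.nhds_basis_closedBall.mem_iff.1 (hΩ.mem_nhds (hFG hx))
  obtain ⟨v, R', C', hRR', hv1, hv2, hv3, hv4, hv5⟩ := hu.exists_smooth_approx hΩ hR hRΩ
  have hO : IsOpen (G ∩ F ⁻¹' ball (F x) R') := hF.continuousOn.isOpen_inter_preimage hG isOpen_ball
  refine ⟨G ∩ F ⁻¹' ball (F x) R', hO, ⟨hx, mem_ball_self (hR.trans hRR')⟩, ?_⟩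
  have husc : ∀ j, UpperSemicontinuousOn (fun x => v j (F x)) (G ∩ F ⁻¹' ball (F x) R') :=
    fun j => ((hv1 j).continuous.comp_continuousOn
      (hF.continuousOn.mono inter_subset_left)).upperSemicontinuousOn
  refine LPSH.of_tendsto hO (u := fun j x => v j (F x)) (C := C') (fun j => ?_)
    (fun j x _ => hv2 j _) (usc_of_antitone husc (fun y hy => hv4 _ hy.2) fun y hy => hv5 _ hy.2)
    fun y hy => hv5 _ hy.2
  refine ⟨husc j, ⟨C', fun y _ => hv2 j _⟩, fun a ha b ε hε => ?_⟩
  have hs : (fun w : ℂ => a + w • b) ⁻¹' G ∈ 𝓝 (0:ℂ) :=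
    (hG.preimage (by fun_prop)).mem_nhds (by simp_all)
  have hγ : DifferentiableOn ℂ (fun w : ℂ => F (a + w • b)) ((fun w : ℂ => a + w • b) ⁻¹' G) :=
    hF.comp (by fun_prop) fun w hw => hw
  simpa using submean_comp_disc ((hv1 j).of_le (by simp)) hs hγ (fun b' => by
    simpa using (hv3 j).eventually_submean isOpen_ball ha.2 b') hε

theorem quasiMeasurePreserving_affine (x : Cn n) {ε : ℝ} (hε : ε ≠ 0) :
    Measure.QuasiMeasurePreserving (fun y : Cn n => x + (ε : ℂ) • y) := by
  have h1 : Measure.QuasiMeasurePreserving (fun y : Cn n => ε • y) := ⟨measurable_const_smul ε, by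
    rw [Measure.map_addHaar_smul volume hε]
    exact Measure.smul_absolutelyContinuous⟩
  fun_prop

theorem LPSH.le_of_ae_le (hΩ : IsOpen Ω) (hu : LPSH u Ω) (hv : LPSH v Ω)
    (h : ∀ᵐ x, x ∈ Ω → u x ≤ v x) : ∀ x ∈ Ω, u x ≤ v x := fun x hx => by
  obtain ⟨Cu, hCu⟩ := hu.indicator_bound
  obtain ⟨Cv, hCv⟩ := hv.indicator_bound
  have hmu := measurable_indicator_of_usc hΩ hu.1
  have hmv := measurable_indicator_of_usc hΩ hv.1
  have l1 := (hu.indicator hΩ).tendsto_mol hΩ hmu hCu hx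
  have l2 := (hv.indicator hΩ).tendsto_mol hΩ hmv hCv hx
  rw [indicator_of_mem hx] at l1 l2
  refine le_of_tendsto_of_tendsto l1 l2 ?_
  filter_upwards [self_mem_nhdsWithin] with ε hε
  refine integral_mono_ae (integrable_mol hmu hCu x _) (integrable_mol hmv hCv x _) ?_
  filter_upwards [(quasiMeasurePreserving_affine x (ne_of_gt hε)).ae h] with y hy
  refine mul_le_mul_of_nonneg_right ?_ (rho_nonneg y)
  generalize x + (ε : ℂ) • y = t at hy
  by_cases hm : t ∈ Ω <;> simp [hm, hy]

theorem tendsto_mol_of_tendsto {f : ℕ → Cn n → ℝ} {g : Cn n → ℝ} (hf : ∀ j, Measurable (f j))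
    (hC : ∀ j x, |f j x| ≤ C) (h : ∀ x, Tendsto (fun j => f j x) atTop (𝓝 (g x))) (ε : ℝ)
    (x : Cn n) : Tendsto (fun j => mol ε (f j) x) atTop (𝓝 (mol ε g x)) := by
  exact tendsto_integral_of_dominated_convergence (fun y => C * rho y)
    (fun j => (integrable_mol (hf j) (hC j) x _).aestronglyMeasurable)
    (integrable_rho.const_mul C) (fun j => .of_forall fun y => abs_mul_rho_le (hC j _) y)
    (.of_forall fun y => (h _).mul_const _)

end

/-! ### Regularised suprema -/

section

variable {n : ℕ} {Ω : Set (Cn n)} {C : ℝ}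
variable {u : ℕ → Cn n → ℝ} {U V : Cn n → ℝ}

/-- `V` is the upper semicontinuous regularisation of `U` on `Ω`. -/
def IsUscReg (V U : Cn n → ℝ) (Ω : Set (Cn n)) : Prop :=
  (∀ x ∈ Ω, U x ≤ V x) ∧ UpperSemicontinuousOn V Ω ∧ ∀ x ∈ Ω, ∀ c < V x, ∃ᶠ y in 𝓝 x, c < U y

/-- Data shared by the results on regularised suprema of increasing sequences. -/
theorem LPSH.uscReg_aux (hΩ : IsOpen Ω)
    (hu : ∀ j, LPSH (u j) Ω) (hC : ∀ j, ∀ x ∈ Ω, |u j x| ≤ C)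
    (hU : ∀ x ∈ Ω, Tendsto (fun j => u j x) atTop (𝓝 (U x))) (hV : IsUscReg V U Ω) (hC0 : 0 ≤ C) :
    Measurable (Ω.indicator U) ∧ (∀ x, |Ω.indicator U x| ≤ C) ∧
    (∀ x ∈ Ω, Tendsto (fun ε => mol ε (Ω.indicator U) x) (𝓝[>] 0) (𝓝 (V x))) ∧
    (∀ ε Ω', 0 < ε → IsOpen Ω' → (∀ x ∈ Ω', closedBall x ε ⊆ Ω) →
      LPSH (mol ε (Ω.indicator U)) Ω') := by
  have hm : ∀ j, Measurable (Ω.indicator (u j)) := fun j => measurable_indicator_of_usc hΩ (hu j).1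
  have hCi : ∀ j x, |Ω.indicator (u j) x| ≤ C := fun j x => by
    by_cases hx : x ∈ Ω <;> simp_all
  have hlim : ∀ x, Tendsto (fun j => Ω.indicator (u j) x) atTop (𝓝 (Ω.indicator U x)) := fun x => by
    by_cases hx : x ∈ Ω <;> simp [hx, hU]
  have hUm := measurable_of_tendsto_metrizable hm (tendsto_pi_nhds.2 hlim)
  have hUC : ∀ x, |Ω.indicator U x| ≤ C := fun x => le_of_tendsto' (hlim x).abs fun j => hCi j x
  have hmol := tendsto_mol_of_tendsto hm hCi hlim
  have hle : ∀ x ε, 0 < ε → closedBall x ε ⊆ Ω → U x ≤ mol ε (Ω.indicator U) x := fun x ε hε hx => by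
    have hxΩ := hx (mem_closedBall_self hε.le)
    refine le_of_tendsto_of_tendsto' (hU x hxΩ) (hmol ε x) fun j => ?_
    simpa [hxΩ] using ((hu j).indicator hΩ).le_mol (hm j) (hCi j) hε hx
  have hcont : ∀ ε, 0 < ε → Continuous (mol ε (Ω.indicator U)) := fun ε hε =>
    (contDiff_mol hUm hUC hε).continuous
  have hVle : ∀ x ε, 0 < ε → ball x (2 * ε) ⊆ Ω → V x ≤ mol ε (Ω.indicator U) x :=
      fun x ε hε hx => by
    by_contra! hlt
    obtain ⟨c, hc1, hc2⟩ := exists_between hlt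
    obtain ⟨y, hy1, hy2, hy3⟩ := ((hV.2.2 x (hx (mem_ball_self (by linarith))) c hc2).and_eventually
      (((hcont ε hε).continuousAt.eventually_lt_const hc1).and (ball_mem_nhds x hε))).exists
    have := hle y ε hε fun z hz => hx (by
      rw [mem_ball]; linarith [dist_triangle z y x, mem_closedBall.1 hz, mem_ball.1 hy3])
    linarith
  refine ⟨hUm, hUC, fun x hx => ?_, fun ε Ω' hε hΩ' h => ?_⟩
  · obtain ⟨δ, hδ, hball⟩ := Metric.isOpen_iff.1 hΩ x hx
    refine tendsto_order.2 ⟨fun b hb => ?_, fun b hb => ?_⟩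
    · filter_upwards [Ioo_mem_nhdsGT (half_pos hδ)] with ε hε
      exact hb.trans_le (hVle x ε hε.1 ((ball_subset_ball (by grind)).trans hball))
    · obtain ⟨b', hb1, hb2⟩ := exists_between hb
      have := hV.2.1 x hx b' hb1
      rw [hΩ.nhdsWithin_eq hx] at this
      obtain ⟨δ', hδ', hball'⟩ := Metric.eventually_nhds_iff.1 (this.and (hΩ.mem_nhds hx))
      filter_upwards [Ioo_mem_nhdsGT hδ'] with ε hε
      refine (mol_le_of_le hUm hUC hε.1.le fun y hy => ?_).trans_lt hb2
      have h3 := hball' (lt_of_le_of_lt hy hε.2)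
      rw [indicator_of_mem h3.2]
      exact (hV.1 y h3.2).trans h3.1.le
  · exact LPSH.of_tendsto hΩ' (fun j => ((hu j).indicator hΩ).mollify (hm j) (hCi j) hε hΩ' h)
      (fun j x _ => abs_mol_le (hm j) (hCi j) hε.le x)
      (hcont ε hε).continuousOn.upperSemicontinuousOn fun x _ => hmol ε x

/-- The regularised supremum of an increasing sequence of plurisubharmonic functions is
plurisubharmonic. -/
theorem LPSH.of_uscReg (hΩ : IsOpen Ω)
    (hu : ∀ j, LPSH (u j) Ω) (hC : ∀ j, ∀ x ∈ Ω, |u j x| ≤ C)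
    (hU : ∀ x ∈ Ω, Tendsto (fun j => u j x) atTop (𝓝 (U x)))
    (hV : IsUscReg V U Ω) : LPSH V Ω := by
  rcases Ω.eq_empty_or_nonempty with rfl | ⟨x₀, hx₀⟩
  · exact ⟨hV.2.1, ⟨0, by simp⟩, by simp⟩
  obtain ⟨h1, h2, h4, h5⟩ := LPSH.uscReg_aux hΩ hu hC hU hV ((abs_nonneg _).trans (hC 0 x₀ hx₀))
  refine LPSH.of_locally ⟨C, fun x hx => le_of_tendsto (h4 x hx).abs (by
    filter_upwards [self_mem_nhdsWithin] with ε hε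
    exact abs_mol_le h1 h2 (le_of_lt hε) x)⟩ fun x hx => ?_
  obtain ⟨δ, hδ, hball⟩ := Metric.isOpen_iff.1 hΩ x hx
  have hsub : ∀ y ∈ ball x (δ / 2), ∀ ε, ε ≤ δ / 2 → closedBall y ε ⊆ Ω := fun y hy ε hε z hz =>
    hball (by rw [mem_ball] at hy ⊢; linarith [dist_triangle z y x, mem_closedBall.1 hz])
  have he : ∀ j : ℕ, 0 < δ / 2 * (1 / ((j : ℝ) + 1)) := fun j => by positivity
  have hbΩ : ball x (δ / 2) ⊆ Ω := fun y hy => hsub y hy 0 (by linarith) (by simp)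
  refine ⟨ball x (δ / 2), isOpen_ball, mem_ball_self (by linarith), LPSH.of_tendsto isOpen_ball
    (u := fun j : ℕ => mol (δ / 2 * (1 / ((j : ℝ) + 1))) (Ω.indicator U)) (C := C)
    (fun j => h5 _ _ (he j) isOpen_ball fun y hy => hsub y hy _ (mul_le_of_le_one_right (by linarith)
      (div_le_one_of_le₀ (by simp) (by positivity))))
    (fun j y _ => abs_mol_le h1 h2 (he j).le y) (hV.2.1.mono hbΩ) fun y hy =>
    (h4 y (hbΩ hy)).comp (tendsto_nhdsWithin_iff.2 ⟨?_, .of_forall he⟩)⟩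
  simpa using (tendsto_one_div_add_atTop_nhds_zero_nat (𝕜 := ℝ)).const_mul (δ / 2)

/-- A plurisubharmonic function dominated by the difference of the regularised supremum and the
supremum is nonpositive. -/
theorem LPSH.nonpos_of_add_le_uscReg (hΩ : IsOpen Ω) {w : Cn n → ℝ}
    (hu : ∀ j, LPSH (u j) Ω) (hC : ∀ j, ∀ x ∈ Ω, |u j x| ≤ C)
    (hU : ∀ x ∈ Ω, Tendsto (fun j => u j x) atTop (𝓝 (U x)))
    (hV : IsUscReg V U Ω) (hw : LPSH w Ω) (h : ∀ x ∈ Ω, U x + w x ≤ V x) : ∀ x ∈ Ω, w x ≤ 0 := fun x hx => by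
  obtain ⟨h1, h2, h4, -⟩ := LPSH.uscReg_aux hΩ hu hC hU hV ((abs_nonneg _).trans (hC 0 x hx))
  have hVp := LPSH.of_uscReg hΩ hu hC hU hV
  obtain ⟨Cv, hCv⟩ := hVp.indicator_bound
  obtain ⟨Cw, hCw⟩ := hw.indicator_bound
  have hmv := measurable_indicator_of_usc hΩ hVp.1
  have hmw := measurable_indicator_of_usc hΩ hw.1
  have l1 := (h4 x hx).add ((hw.indicator hΩ).tendsto_mol hΩ hmw hCw hx)
  have l2 := (hVp.indicator hΩ).tendsto_mol hΩ hmv hCv hx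
  rw [indicator_of_mem hx] at l1 l2
  have := le_of_tendsto_of_tendsto' l1 l2 fun ε => by
    have i1 := integrable_mol h1 h2 x ε
    have i2 := integrable_mol hmw hCw x ε
    rw [mol, mol, ← integral_add i1 i2]
    refine integral_mono (i1.add i2) (integrable_mol hmv hCv x ε) fun y => ?_
    simp only [← add_mul]
    refine mul_le_mul_of_nonneg_right ?_ (rho_nonneg y)
    generalize x + (ε : ℂ) • y = t
    by_cases hm : t ∈ Ω <;> simp [hm, h]
  linarith

end

/-! ### Truncation of extended-real-valued plurisubharmonic functions -/

section

variable {E : Type*} [NormedAddCommGroup E] [NormedSpace ℂ E] {Ω : Set E}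
variable {m : ℝ} {t : EReal}

/-- Truncation of an extended-real-valued function from below. -/
def trunc (m : ℝ) (t : EReal) : ℝ := (max t (-m : ℝ)).toReal

theorem coe_trunc (ht : t < ⊤) : (trunc m t : EReal) = max t (-m : ℝ) :=
  coe_toReal (max_lt ht (coe_lt_top _)).ne
    ((EReal.bot_lt_coe _).trans_le (le_max_right _ _)).ne'

theorem neg_le_trunc (ht : t < ⊤) : -m ≤ trunc m t := by
  rw [← coe_le_coe_iff, coe_trunc ht]; simp

theorem le_trunc (ht : t < ⊤) : t ≤ trunc m t := by rw [coe_trunc ht]; simp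

theorem trunc_le {M : ℝ} (ht : t ≤ M) (hm : -m ≤ M) : trunc m t ≤ M := by
  rw [← coe_le_coe_iff, coe_trunc (ht.trans_lt (coe_lt_top _))]
  exact max_le ht (coe_le_coe_iff.2 hm)

theorem trunc_bot : trunc m ⊥ = -m := by rw [trunc, max_eq_right bot_le, toReal_coe]

/-- Truncations of plurisubharmonic functions are plurisubharmonic where bounded above. -/
theorem PSHOnE.lpsh_trunc (hΩ : IsOpen Ω) {φ : E → EReal} (hφ : PSHOnE φ Ω) {M : ℝ}
    (hM : ∀ x ∈ Ω, φ x ≤ M) (m : ℝ) : LPSH (fun x => trunc m (φ x)) Ω := by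
  have husc : UpperSemicontinuousOn (fun x => trunc m (φ x)) Ω := fun x hx y hy => by
    have hy' : max (φ x) ((-m : ℝ) : EReal) < (y : EReal) := by
      rw [← coe_trunc (hφ.1 x hx)]; simp_all
    filter_upwards [hφ.2.1 x hx (y : EReal) (max_lt_iff.1 hy').1, self_mem_nhdsWithin] with z hz hz'
    rw [← coe_lt_coe_iff, coe_trunc (hφ.1 z hz')]
    grind
  have hb : ∀ x ∈ Ω, |trunc m (φ x)| ≤ max |M| |m| := fun x hx => abs_le.2
    ⟨by linarith [neg_le_trunc (m := m) (hφ.1 x hx), le_max_right |M| |m|, le_abs_self m],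
      trunc_le ((hM x hx).trans (coe_le_coe_iff.2 ((le_abs_self M).trans (le_max_left _ _))))
        ((neg_le_abs m).trans (le_max_right _ _))⟩
  refine LPSH.of_submean husc ⟨_, hb⟩ fun a ha b => ?_
  filter_upwards [eventually_line_mem hΩ ha b] with r hr
  have := circleAverage_le_of_dominated (s := fun w : ℂ => trunc m (φ (a + w • b))) (a := 0)
    hr.1 ((usc_comp_line husc a b).mono hr.2) (fun x hx => hb _ (hr.2 x hx)) (fun f hf hle z hz => ?_)
    le_rfl hr.1.le
  · simp_all
  · have hfc := (continuous_re.comp hf.continuous).continuousOn (s := closedBall 0 r)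
    have hT : ∀ z ∈ sphere (0:ℂ) r, φ (a + z • b) < ⊤ := fun z hz =>
      hφ.1 _ (hr.2 z (sphere_subset_closedBall hz))
    exact trunc_le ((hφ.2.2.2 a b).2 0 r hr.1 hr.2 (fun z => (f z).re) hfc
      (harmonicOnCC_re hf isOpen_ball)
      (fun z hz => (le_trunc (hT z hz)).trans (coe_le_coe_iff.2 (hle z hz))) z hz)
      ((LPSH.const (E := ℂ) (Ω := univ) (-m)).le_harmonic 0 1 (fun _ _ => trivial) hfc
        (harmonicOnCC_re hf isOpen_ball)
        (fun z hz => (neg_le_trunc (hT z hz)).trans (hle z hz)) z hz)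

/-- A function all of whose truncations are locally plurisubharmonic is plurisubharmonic. -/
theorem PSHOnE.of_trunc {φ : E → EReal} (htop : ∀ x ∈ Ω, φ x < ⊤)
    (hbot : ¬ ∃ U : Set E, U ⊆ Ω ∧ IsOpen U ∧ U.Nonempty ∧ ∀ z ∈ U, φ z = ⊥)
    (h : ∀ m : ℕ, LPSH (fun x => trunc m (φ x)) Ω) : PSHOnE φ Ω := by
  have husc : UpperSemicontinuousOn φ Ω := fun x hx y hy => by
    obtain ⟨q, hq1, hq2⟩ := exists_rat_btwn_of_lt hy
    obtain ⟨m, hm⟩ := exists_nat_gt (-(q:ℝ))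
    have hlt : trunc m (φ x) < q := by
      rw [← coe_lt_coe_iff, coe_trunc (htop x hx)]
      exact max_lt hq1 (coe_lt_coe_iff.2 (by linarith))
    filter_upwards [(h m).1 x hx _ hlt, self_mem_nhdsWithin] with z hz hz'
    exact (le_trunc (htop z hz')).trans_lt ((coe_lt_coe_iff.2 hz).trans hq2)
  refine ⟨htop, husc, hbot, fun a b => ⟨fun w hw y hy => ?_, fun c R hR hsub k hk hharm hle z hz => ?_⟩⟩
  · have hc : Continuous fun w : ℂ => a + w • b := by fun_prop
    exact (tendsto_nhdsWithin_iff.2 ⟨hc.continuousAt.mono_left nhdsWithin_le_nhds,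
      eventually_mem_nhdsWithin⟩).eventually (husc _ hw y hy)
  · obtain ⟨B, hB⟩ := (isCompact_closedBall c R).exists_bound_of_continuousOn hk
    obtain ⟨m, hm⟩ := exists_nat_gt B
    exact (le_trunc (htop _ (hsub hz))).trans (coe_le_coe_iff.2 ((h m).le_harmonic a b
      (fun w hw => hsub hw) hk hharm (fun z hz => trunc_le (hle z hz)
        (by linarith [(abs_le.1 (hB z (sphere_subset_closedBall hz))).1])) z hz))

end

section

variable {n : ℕ} {Ω : Set (Cn n)}

theorem PSHOnE.mono {E : Type*} [NormedAddCommGroup E] [NormedSpace ℂ E] {ψ : E → EReal}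
    {V V' : Set E} (h : PSHOnE ψ V) (hV : V' ⊆ V) : PSHOnE ψ V' :=
  ⟨fun z hz => h.1 z (hV hz), h.2.1.mono hV, fun ⟨U, hU, h1⟩ => h.2.2.1 ⟨U, hU.trans hV, h1⟩,
    fun a b => ⟨(h.2.2.2 a b).1.mono fun _ hw => hV hw, fun c r hr hc =>
      (h.2.2.2 a b).2 c r hr fun _ hw => hV (hc hw)⟩⟩

/-- Near every point, a function with plurisubharmonic truncations is either `-∞` throughout or
finite almost everywhere. -/
theorem bot_or_null_bot (hΩ : IsOpen Ω) {φ : Cn n → EReal} {K : ℝ} (hK0 : 0 ≤ K)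
    (hK : ∀ y ∈ Ω, φ y ≤ K) (hf : ∀ m : ℕ, LPSH (fun y => trunc m (φ y)) Ω) {x : Cn n}
    (hx : x ∈ Ω) : ∃ δ > 0, ball x δ ⊆ Ω ∧
      ((∀ y ∈ ball x δ, φ y = ⊥) ∨ volume {y ∈ ball x δ | φ y = ⊥} = 0) := by
  obtain ⟨R, hR, hball⟩ := Metric.isOpen_iff.1 hΩ x hx
  have htop : ∀ y ∈ Ω, φ y < ⊤ := fun y hy => (hK y hy).trans_lt (coe_lt_top _)
  obtain ⟨η, hη, hrho⟩ := Metric.isOpen_iff.1 (isOpen_lt continuous_const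
    (contDiff_rho (n := n)).continuous) 0
      (mul_pos (inv_pos.2 integral_rhoAux_pos) (rhoAux_zero ▸ one_pos))
  obtain ⟨ε, hε0, hεR⟩ : ∃ ε > 0, 4 * ε = R := ⟨R / 4, by linarith, by ring⟩
  have hδ1 := min_le_left ε (ε * η / 2)
  have hδ2 := min_le_right ε (ε * η / 2)
  set δ := min ε (ε * η / 2)
  have hsub : ball x δ ⊆ Ω := (ball_subset_ball (by linarith)).trans hball
  refine ⟨δ, lt_min hε0 (by positivity), hsub, or_iff_not_imp_left.2 fun hcon => ?_⟩
  push Not at hcon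
  obtain ⟨x', hx', hne⟩ := hcon
  rw [mem_ball] at hx'
  have hcb : closedBall x' ε ⊆ Ω := fun z hz => hball (by
    rw [mem_ball]; linarith [dist_triangle z x' x, mem_closedBall.1 hz])
  have hx'Ω := hcb (mem_closedBall_self hε0.le)
  let f (m : ℕ) := Ω.indicator fun y => trunc m (φ y)
  have hfm : ∀ m, Measurable (f m) := fun m => measurable_indicator_of_usc hΩ (hf m).1
  have hfK : ∀ m y, f m y ≤ K := fun m y => by
    by_cases hy : y ∈ Ω
    · simp only [f, indicator_of_mem hy]
      exact trunc_le (hK y hy) (by linarith)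
    · simpa only [f, indicator_of_notMem hy]
  let F (m : ℕ) (y : Cn n) := (K - f m (x' + (ε : ℂ) • y)) * rho y
  have hF : ∀ m, Measurable fun y => ofReal (F m y) := fun m => ((measurable_const.sub
    ((hfm m).comp (by fun_prop))).mul contDiff_rho.continuous.measurable).ennreal_ofReal
  have hle : ∀ m, ∫⁻ y, ofReal (F m y) ≤ ofReal (K - (φ x').toReal) := fun m => by
    obtain ⟨Cm, hCm⟩ := (hf m).indicator_bound
    have k1 : trunc m (φ x') ≤ mol ε (f m) x' := by
      simpa [hx'Ω] using ((hf m).indicator hΩ).le_mol (hfm m) hCm hε0 hcb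
    have k2 : (φ x').toReal ≤ trunc m (φ x') := by
      rw [← coe_le_coe_iff, coe_toReal (htop x' hx'Ω).ne hne]
      exact le_trunc (htop x' hx'Ω)
    have i1 := integrable_mol (hfm m) hCm x' (ε : ℂ)
    simp only [F, sub_mul]
    refine (ofReal_integral_eq_lintegral_ofReal ((integrable_rho.const_mul K).sub i1)
      (.of_forall fun y => ?_)).symm.trans_le (ENNReal.ofReal_le_ofReal ?_)
    · simpa using mul_le_mul_of_nonneg_right (hfK m (x' + (ε : ℂ) • y)) (rho_nonneg y)
    rw [integral_sub' (integrable_rho.const_mul K) i1, integral_const_mul, integral_rho]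
    change K * 1 - mol ε (f m) x' ≤ _
    linarith
  have hae := ae_lt_top (Measurable.liminf hF) (((lintegral_liminf_le hF).trans
    (liminf_le_of_frequently_le' (.of_forall hle))).trans_lt ofReal_lt_top).ne
  have hq := quasiMeasurePreserving_affine (-((ε⁻¹ : ℝ) : ℂ) • x') (inv_ne_zero hε0.ne')
  refine measure_mono_null ?_ (hq.ae hae)
  rintro y ⟨hy, hybot⟩ h0
  have hyΩ := hsub hy
  rw [mem_ball] at hy
  set t : Cn n := -((ε⁻¹ : ℝ) : ℂ) • x' + ((ε⁻¹ : ℝ) : ℂ) • y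
  have ht : t = ((ε⁻¹ : ℝ) : ℂ) • (y - x') := by rw [smul_sub, sub_eq_neg_add, ← neg_smul]
  have ht1 : x' + (ε : ℂ) • t = y := by
    rw [ht, smul_smul, ← Complex.ofReal_mul, mul_inv_cancel₀ hε0.ne']
    simp
  have hrt : 0 < rho t := by
    refine hrho (mem_ball_zero_iff.2 ?_)
    rw [ht, norm_smul, norm_real, norm_eq_abs, abs_of_pos (inv_pos.2 hε0),
      inv_mul_lt_iff₀ hε0, ← dist_eq_norm]
    linarith [dist_triangle_right y x' x]
  have hlim : Tendsto (fun m : ℕ => F m t) atTop atTop := by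
    have hFt : ∀ m : ℕ, F m t = (K + m) * rho t := fun m => by
      simp only [F, f, ht1, indicator_of_mem hyΩ, hybot, trunc_bot, sub_neg_eq_add]
    simpa only [hFt] using (tendsto_atTop_add_const_left _ K
      tendsto_natCast_atTop_atTop).atTop_mul_const hrt
  exact h0.ne (ENNReal.tendsto_ofReal_atTop.comp hlim).liminf_eq

end

/-! ### First-order operators, cofactor identities and integration by parts -/

section

variable {n : ℕ}
variable {f g u : Cn n → ℂ} {A : Cn n → Matrix (Fin n) (Fin n) ℂ}

/-- The first-order operator `∂_a + i ∂_b`. -/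
def dop (a b : Cn n) (f : Cn n → ℂ) (x : Cn n) : ℂ :=
  fderiv ℝ f x a + I * fderiv ℝ f x b

/-- Smooth complex-valued functions. -/
abbrev Sm (f : Cn n → ℂ) : Prop := ContDiff ℝ (⊤ : ℕ∞) f

theorem Sm.diff (hf : Sm f) : Differentiable ℝ f :=
  hf.differentiable (by simp)

theorem Sm.fderiv_apply (hf : Sm f) (a : Cn n) : Sm fun x => fderiv ℝ f x a :=
  (hf.fderiv_right (m := (⊤ : ℕ∞)) (by simp)).clm_apply contDiff_const

theorem Sm.dop (hf : Sm f) (a b : Cn n) : Sm (dop a b f) :=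
  (hf.fderiv_apply a).add (contDiff_const.mul (hf.fderiv_apply b))

theorem dop_add (hf : Sm f) (hg : Sm g) (a b : Cn n) :
    dop a b (fun x => f x + g x) = fun x => dop a b f x + dop a b g x := by
  ext x
  have := fderiv_fun_add (hf.diff x) (hg.diff x)
  simp only [dop, this, add_apply]
  ring

theorem dop_mul (hf : Sm f) (hg : Sm g) (a b x : Cn n) :
    dop a b (fun x => f x * g x) x = f x * dop a b g x + dop a b f x * g x := by
  have := fderiv_fun_mul (hf.diff x) (hg.diff x)
  simp only [dop, this, add_apply, smul_apply, smul_eq_mul]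
  ring

theorem fderiv_apply_comm (hf : Sm f) (x a b : Cn n) :
    fderiv ℝ (fun y => fderiv ℝ f y a) x b = fderiv ℝ (fun y => fderiv ℝ f y b) x a := by
  have hd : Differentiable ℝ (fderiv ℝ f) :=
    (hf.fderiv_right (m := (⊤ : ℕ∞)) (by simp)).differentiable (by simp)
  have h : ∀ c d : Cn n, fderiv ℝ (fun y => fderiv ℝ f y c) x d = fderiv ℝ (fderiv ℝ f) x d c := fun c d => by
    simp [fderiv_clm_apply (hd x) (differentiableAt_const c)]
  rw [h, h]
  exact (hf.contDiffAt.isSymmSndFDerivAt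
    (by rw [minSmoothness_of_isRCLikeNormedField]; exact WithTop.coe_le_coe.2 le_top)) b a

theorem dop_comm (hf : Sm f) (a b c d x : Cn n) :
    dop a b (dop c d f) x = dop c d (dop a b f) x := by
  have key : ∀ r s e : Cn n, fderiv ℝ (dop r s f) x e =
      fderiv ℝ (fun y => fderiv ℝ f y r) x e +
        I * fderiv ℝ (fun y => fderiv ℝ f y s) x e := fun r s e => by
    have hs := (hf.fderiv_apply s).diff x
    have h1 := fderiv_fun_add ((hf.fderiv_apply r).diff x) (hs.const_mul I)
    have h2 := fderiv_const_mul hs I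
    unfold dop
    simp_all
  unfold dop at *
  rw [key, key, key, key, fderiv_apply_comm hf x c, fderiv_apply_comm hf x d a,
    fderiv_apply_comm hf x c, fderiv_apply_comm hf x d]
  ring

theorem tsupport_dop_subset (f : Cn n → ℂ) (a b : Cn n) : tsupport (dop a b f) ⊆ tsupport f := by
  refine closure_minimal (fun x hx => ?_) (isClosed_tsupport f)
  by_contra hcon
  have : fderiv ℝ f x = 0 := by_contra fun h0 => hcon (support_fderiv_subset ℝ h0)
  exact hx (by simp [dop, this])

theorem integral_mul_dop (hf : Sm f) (hg : Sm g) (hc : HasCompactSupport f)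
    (a b : Cn n) : ∫ x, f x * dop a b g x = -∫ x, dop a b f x * g x := by
  have hI : ∀ F G : Cn n → ℂ, Sm F → Sm G → HasCompactSupport F → Integrable fun x => F x * G x :=
    fun F G hF hG hc => (hF.continuous.mul hG.continuous).integrable_of_hasCompactSupport hc.mul_right
  have hfd : ∀ v : Cn n, HasCompactSupport fun x => fderiv ℝ f x v := fun v => hc.fderiv_apply ℝ v
  have key : ∀ v : Cn n, ∫ x, f x * fderiv ℝ g x v = -∫ x, fderiv ℝ f x v * g x := fun v =>
    integral_mul_fderiv_eq_neg_fderiv_mul_of_integrable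
      (hI _ _ (hf.fderiv_apply v) hg (hfd v)) (hI _ _ hf (hg.fderiv_apply v) hc) (hI _ _ hf hg hc)
      (fun x _ => hf.diff x) (fun x _ => hg.diff x)
  have e1 : ∀ x, f x * dop a b g x = f x * fderiv ℝ g x a + I * (f x * fderiv ℝ g x b) :=
    fun x => by simp only [dop]; ring
  have e2 : ∀ x, dop a b f x * g x = fderiv ℝ f x a * g x + I * (fderiv ℝ f x b * g x) :=
    fun x => by simp only [dop]; ring
  simp only [e1, e2]
  rw [integral_add (hI _ _ hf (hg.fderiv_apply a) hc) ((hI _ _ hf (hg.fderiv_apply b) hc).const_mul _),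
    integral_add (hI _ _ (hf.fderiv_apply a) hg (hfd a))
      ((hI _ _ (hf.fderiv_apply b) hg (hfd b)).const_mul _),
    integral_const_mul, integral_const_mul, key, key]
  ring

/-- The determinant as a continuous multilinear map of the rows. -/
def detCML (n : ℕ) : ContinuousMultilinearMap ℂ (fun _ : Fin n => Fin n → ℂ) ℂ :=
  { (detRowAlternating (n := Fin n) (R := ℂ)).toMultilinearMap with
    cont := Continuous.matrix_det (A := fun M : Matrix (Fin n) (Fin n) ℂ => M) continuous_id }

theorem hasFDerivAt_det {E : Type*} [NormedAddCommGroup E] [NormedSpace ℝ E]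
    {A : E → Matrix (Fin n) (Fin n) ℂ} {A' : Fin n → Fin n → E →L[ℝ] ℂ} {x : E}
    (hA : ∀ i j, HasFDerivAt (fun y => A y i j) (A' i j) x) :
    HasFDerivAt (fun y => (A y).det)
      (∑ i, ∑ j, (((A x).updateRow i (Pi.single j 1)).det) • A' i j) x := by
  have h1 : HasFDerivAt (fun y => (A y : Fin n → Fin n → ℂ))
      (ContinuousLinearMap.pi fun i => ContinuousLinearMap.pi fun j => A' i j) x :=
    hasFDerivAt_pi.2 fun i => hasFDerivAt_pi.2 fun j => hA i j
  refine ((((detCML n).hasFDerivAt (A x)).restrictScalars ℝ).comp x h1).congr_fderiv ?_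
  ext v
  simp only [sum_apply, smul_apply, smul_eq_mul]
  refine Eq.trans (ContinuousMultilinearMap.linearDeriv_apply (f := detCML n) (x := A x) _) ?_
  refine sum_congr rfl fun i _ => ?_
  change ((A x).updateRow i fun j => A' i j v).det = _
  have hrow : (fun j => A' i j v) = ∑ j, A' i j v • (Pi.single j (1:ℂ) : Fin n → ℂ) := by
    ext k; simp [Finset.sum_apply, Pi.single_apply]
  rw [hrow]
  refine ((detCML n).toMultilinearMap.map_update_sum (t := Finset.univ) i _ _).trans
    (sum_congr rfl fun j _ => ((detCML n).map_update_smul (A x) i _ _).trans ?_)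
  rw [smul_eq_mul, mul_comm]
  rfl

theorem Sm.det (hA : ∀ i j, Sm fun x => A x i j) :
    Sm fun x => (A x).det := by
  simp only [Matrix.det_apply]
  refine ContDiff.sum fun σ _ => ?_
  fun_prop

theorem dop_det (hA : ∀ i j, Sm fun x => A x i j)
    (a b x : Cn n) : dop a b (fun y => (A y).det) x =
      ∑ i, ∑ j, ((A x).updateRow i (Pi.single j 1)).det * dop a b (fun y => A y i j) x := by
  have h := (hasFDerivAt_det (A := A) (x := x) (A' := fun i j => fderiv ℝ (fun y => A y i j) x)
    fun i j => ((hA i j).diff x).hasFDerivAt).fderiv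
  simp only [dop, h, sum_apply, smul_apply, smul_eq_mul, mul_sum, ← sum_add_distrib]
  grind

/-- The cofactors `∂ det / ∂ A_{jk}`. -/
def cof (A : Matrix (Fin n) (Fin n) ℂ) (j k : Fin n) : ℂ := (A.updateRow j (Pi.single k 1)).det

theorem cof_transpose (A : Matrix (Fin n) (Fin n) ℂ) (j k : Fin n) : cof A.transpose k j = cof A j k := by
  unfold cof
  rw [← Matrix.adjugate_apply, ← Matrix.adjugate_apply, ← Matrix.adjugate_transpose,
    Matrix.transpose_apply]

theorem Sm.cof (hA : ∀ i j, Sm fun x => A x i j)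
    (j k : Fin n) : Sm fun x => cof (A x) j k := by
  refine Sm.det fun i l => ?_
  by_cases h : i = j
  · subst h; simpa using contDiff_const
  simp_all

theorem det_updateRow_swap (A : Matrix (Fin n) (Fin n) ℂ) {i j : Fin n} (hij : i ≠ j)
    (v w : Fin n → ℂ) :
    ((A.updateRow j v).updateRow i w).det = -((A.updateRow j w).updateRow i v).det := by
  have := Matrix.det_permute (Equiv.swap i j) ((A.updateRow j w).updateRow i v)
  rw [Equiv.Perm.sign_swap hij] at this
  have h2 : ((A.updateRow j w).updateRow i v).submatrix (Equiv.swap i j) id =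
      (A.updateRow j v).updateRow i w := by
    ext k l
    rw [Matrix.submatrix_apply, id]
    by_cases h1 : k = i
    · subst h1
      rw [Equiv.swap_apply_left, updateRow_ne hij.symm]
      simp
    · by_cases h2 : k = j
      · simp_all
      · rw [Equiv.swap_apply_of_ne_of_ne h1 h2]
        simp_all
  simp_all

/-- The matrix of mixed second derivatives. -/
abbrev mixM (a b c d : Fin n → Cn n) (u : Cn n → ℂ) (x : Cn n) : Matrix (Fin n) (Fin n) ℂ :=
  of fun i l => dop (a i) (b i) (dop (c l) (d l) u) x

/-- Cofactor matrices of mixed second derivatives are divergence free. -/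
theorem sum_dop_cof (hu : Sm u) (a b c d : Fin n → Cn n) (j : Fin n) (x : Cn n) :
    ∑ k, dop (c k) (d k)
      (fun y => cof (mixM a b c d u y) j k) x = 0 := by
  set A := mixM a b c d u
  have hA : ∀ i l, Sm fun y => A y i l := fun i l => (hu.dop _ _).dop _ _
  have hrow : ∀ k i l, Sm fun y => (A y).updateRow j (Pi.single k 1) i l := fun k i l => by
    by_cases h : i = j
    · subst h; simpa using contDiff_const
    simp_all
  have h1 : ∀ k, dop (c k) (d k) (fun y => cof (A y) j k) x =
      ∑ i, ∑ m, (((A x).updateRow j (Pi.single k 1)).updateRow i (Pi.single m 1)).det *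
        dop (c k) (d k) (fun y => (A y).updateRow j (Pi.single k 1) i m) x :=
    fun k => dop_det (hrow k) _ _ _
  refine Eq.trans (sum_congr rfl fun k _ => h1 k) ?_
  rw [sum_comm]
  refine sum_eq_zero fun i _ => ?_
  by_cases hij : i = j
  · subst hij
    refine sum_eq_zero fun k _ => sum_eq_zero fun m _ => ?_
    simp [dop]
  · have h2 : ∀ k m, dop (c k) (d k) (fun y => (A y).updateRow j (Pi.single k 1) i m) x =
        dop (a i) (b i) (dop (c k) (d k) (dop (c m) (d m) u)) x := fun k m => by
      have : (fun y => (A y).updateRow j (Pi.single k 1) i m) = dop (a i) (b i) (dop (c m) (d m) u) := by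
        ext y; simp [updateRow_ne hij, A]
      rw [this, dop_comm (hu.dop _ _)]
    simp only [h2]
    set S : Fin n → Fin n → ℂ := fun k m => dop (a i) (b i) (dop (c k) (d k) (dop (c m) (d m) u)) x
    have hS : ∀ k m, S k m = S m k := fun k m => by
      simp only [S]
      congr 1
      ext y
      exact dop_comm hu _ _ _ _ _
    set P : ℂ := ∑ k, ∑ m, (((A x).updateRow j (Pi.single k 1)).updateRow i (Pi.single m 1)).det * S k m
    have hP : P = -P := by
      calc P = ∑ k, ∑ m, -((((A x).updateRow j (Pi.single m 1)).updateRow i (Pi.single k 1)).det *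
              S m k) := by
            refine sum_congr rfl fun k _ => sum_congr rfl fun m _ => ?_
            rw [det_updateRow_swap _ hij, hS k m]; ring
        _ = -∑ k, ∑ m, ((((A x).updateRow j (Pi.single m 1)).updateRow i (Pi.single k 1)).det *
              S m k) := by simp
        _ = -P := by rw [sum_comm]
    grind

/-- One integration by parts against cofactors. -/
theorem integral_cof_dop (hu : Sm u) (hf : Sm f) (hg : Sm g)
    (hc : HasCompactSupport f) (a b c d : Fin n → Cn n) :
    ∫ x, f x * ∑ j, ∑ k, cof (mixM a b c d u x) j k *
        dop (c k) (d k) (dop (a j) (b j) g) x =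
    -∫ x, ∑ j, ∑ k, cof (mixM a b c d u x) j k *
        (dop (c k) (d k) f x * dop (a j) (b j) g x) := by
  set A := mixM a b c d u
  have hA : ∀ i l, Sm fun y => A y i l := fun i l => (hu.dop _ _).dop _ _
  have hcof := Sm.cof hA
  have hfc : ∀ j k, Sm fun x => f x * cof (A x) j k := fun j k => hf.mul (hcof j k)
  have hcs : ∀ j k, HasCompactSupport fun x => f x * cof (A x) j k := fun j k => hc.mul_right
  have hInt : ∀ F : Cn n → ℂ, Continuous F → tsupport F ⊆ tsupport f → Integrable F :=
    fun F h1 h2 => h1.integrable_of_hasCompactSupport (hc.mono' ((subset_tsupport _).trans h2))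
  have hts : ∀ F G : Cn n → ℂ, tsupport (fun x => F x * G x) ⊆ tsupport F := fun F G =>
    closure_mono fun x hx => by simp_all
  have e1 : ∀ x, f x * ∑ j, ∑ k, cof (A x) j k * dop (c k) (d k) (dop (a j) (b j) g) x =
      ∑ j, ∑ k, (f x * cof (A x) j k) * dop (c k) (d k) (dop (a j) (b j) g) x := fun x => by
    simp only [mul_sum, mul_assoc]
  have i1 : ∀ j k, Integrable fun x => (f x * cof (A x) j k) *
      dop (c k) (d k) (dop (a j) (b j) g) x := fun j k =>
    hInt _ ((hfc j k).continuous.mul ((hg.dop _ _).dop _ _).continuous) ((hts _ _).trans (hts _ _))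
  have i2 : ∀ j k, Integrable fun x => dop (c k) (d k) (fun x => f x * cof (A x) j k) x *
      dop (a j) (b j) g x := fun j k =>
    hInt _ (((hfc j k).dop _ _).continuous.mul (hg.dop _ _).continuous)
      ((hts _ _).trans ((tsupport_dop_subset _ _ _).trans (hts _ _)))
  refine Eq.trans (integral_congr_ae (.of_forall e1)) ?_
  rw [integral_finsetSum _ fun j _ => integrable_finsetSum _ fun k _ => i1 j k]
  simp_rw [fun j => integral_finsetSum Finset.univ (fun k _ => i1 j k)]
  have e2 : ∀ j k, ∫ x, (f x * cof (A x) j k) * dop (c k) (d k) (dop (a j) (b j) g) x =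
      -∫ x, dop (c k) (d k) (fun x => f x * cof (A x) j k) x * dop (a j) (b j) g x := fun j k =>
    integral_mul_dop (hfc j k) (hg.dop _ _) (hcs j k) _ _
  simp only [e2, sum_neg_distrib]
  congr 1
  simp_rw [fun j => (integral_finsetSum Finset.univ (fun k _ => i2 j k)).symm]
  rw [← integral_finsetSum _ fun j _ => integrable_finsetSum _ fun k _ => i2 j k]
  congr 1
  ext x
  refine sum_congr rfl fun j _ => ?_
  have h3 := sum_dop_cof hu a b c d j x
  have h4 : ∀ k, dop (c k) (d k) (fun x => f x * cof (A x) j k) x * dop (a j) (b j) g x =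
      f x * dop (a j) (b j) g x * dop (c k) (d k) (fun x => cof (A x) j k) x +
      cof (A x) j k * (dop (c k) (d k) f x * dop (a j) (b j) g x) := fun k => by
    rw [dop_mul hf (hcof j k)]
    ring
  simp only [h4, sum_add_distrib, ← mul_sum]
  grind

/-- Symmetry of the linearised determinant of mixed second derivatives. -/
theorem integral_cof_symm (hu : Sm u) (hf : Sm f) (hg : Sm g)
    (hcf : HasCompactSupport f) (hcg : HasCompactSupport g) (a b c d : Fin n → Cn n) :
    ∫ x, f x * ∑ j, ∑ k, cof (mixM a b c d u x) j k *
        dop (a j) (b j) (dop (c k) (d k) g) x =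
    ∫ x, g x * ∑ j, ∑ k, cof (mixM a b c d u x) j k *
        dop (a j) (b j) (dop (c k) (d k) f) x := by
  have h1 := integral_cof_dop hu hf hg hcf a b c d
  have h2 := integral_cof_dop hu hg hf hcg c d a b
  have hT : ∀ x, mixM c d a b u x = (mixM a b c d u x).transpose := fun x => by
    ext i l
    exact dop_comm hu _ _ _ _ _
  simp only [hT, cof_transpose] at h2
  simp only [fun j k x => dop_comm hg (c k) (d k) (a j) (b j) x] at h1
  rw [h1]
  have h3 : ∀ x, ∑ j, ∑ k, cof (mixM a b c d u x) k j *
      dop (a k) (b k) (dop (c j) (d j) f) x =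
      ∑ j, ∑ k, cof (mixM a b c d u x) j k *
      dop (a j) (b j) (dop (c k) (d k) f) x := fun x => sum_comm
  simp only [h3] at h2
  rw [h2]
  congr 2
  ext x
  rw [sum_comm]
  grind

end

/-! ### The complex Hessian and the energy functional -/

section

variable {n : ℕ}
variable {a b u v w : Cn n → ℝ}

/-- Smooth real-valued functions. -/
abbrev RSm (u : Cn n → ℝ) : Prop := ContDiff ℝ (⊤ : ℕ∞) u

theorem RSm.ofReal (hu : RSm u) : Sm fun x => (u x : ℂ) :=
  Complex.ofRealCLM.contDiff.comp hu

theorem RSm.diff (hu : RSm u) : Differentiable ℝ u :=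
  hu.differentiable (by simp)

theorem RSm.fderiv_apply (hu : RSm u) (a : Cn n) : RSm fun x => fderiv ℝ u x a :=
  (hu.fderiv_right (m := (⊤ : ℕ∞)) (by simp)).clm_apply contDiff_const

theorem fderiv_ofReal_apply (hu : RSm u) (x a : Cn n) :
    fderiv ℝ (fun y => (u y : ℂ)) x a = ((fderiv ℝ u x a : ℝ) : ℂ) := by
  have : HasFDerivAt (fun y => (u y : ℂ)) (Complex.ofRealCLM.comp (fderiv ℝ u x)) x :=
    Complex.ofRealCLM.hasFDerivAt.comp x (hu.diff x).hasFDerivAt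
  rw [this.fderiv]
  rfl

theorem d2_eq (hu : RSm u) (x v w : Cn n) :
    d2 u x v w = fderiv ℝ (fderiv ℝ u) x w v := by
  have hd : Differentiable ℝ (fderiv ℝ u) :=
    (hu.fderiv_right (m := (⊤ : ℕ∞)) (by simp)).differentiable (by simp)
  simp [d2, fderiv_clm_apply (hd x) (differentiableAt_const v)]

theorem d2_comm (hu : RSm u) (x v w : Cn n) : d2 u x v w = d2 u x w v := by
  rw [d2_eq hu, d2_eq hu]
  exact (hu.contDiffAt.isSymmSndFDerivAt
    (by rw [minSmoothness_of_isRCLikeNormedField]; exact WithTop.coe_le_coe.2 le_top)) w v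

/-- The real and imaginary directions of `∂/∂z_j`. -/
def az (j : Fin n) : Cn n := (1 / 2 : ℝ) • Pi.single j 1
/-- The imaginary direction of `∂/∂z_j`. -/
def bz (j : Fin n) : Cn n := (-(1 / 2) : ℝ) • Pi.single j I
/-- The imaginary direction of `∂/∂z̄_j`. -/
def bzb (j : Fin n) : Cn n := (1 / 2 : ℝ) • Pi.single j I

theorem dop_dop_ofReal (hu : RSm u) (a b c d x : Cn n) :
    dop a b (dop c d fun y => (u y : ℂ)) x =
      ((d2 u x c a - d2 u x d b : ℝ) : ℂ) + I * ((d2 u x d a + d2 u x c b : ℝ) : ℂ) := by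
  have hf : ∀ r s e : Cn n, fderiv ℝ (dop r s fun y => (u y : ℂ)) x e =
      ((d2 u x r e : ℝ) : ℂ) + I * ((d2 u x s e : ℝ) : ℂ) := fun r s e => by
    have h0 : dop r s (fun y => (u y : ℂ)) =
        fun y => ((fderiv ℝ u y r : ℝ) : ℂ) + I * ((fderiv ℝ u y s : ℝ) : ℂ) := by
      ext y; simp only [dop, fderiv_ofReal_apply hu]
    have hs := (hu.fderiv_apply s).ofReal.diff x
    rw [h0, fderiv_fun_add ((hu.fderiv_apply r).ofReal.diff x) (hs.const_mul I),
      fderiv_const_mul hs I]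
    simp only [add_apply, smul_apply, smul_eq_mul, fderiv_ofReal_apply (hu.fderiv_apply r),
      fderiv_ofReal_apply (hu.fderiv_apply s), _root_.d2]
  rw [dop, hf, hf]
  push_cast
  linear_combination ((d2 u x d b : ℝ) : ℂ) * Complex.I_mul_I

theorem d2_smul (hu : RSm u) (x v w : Cn n) (s t : ℝ) :
    d2 u x (s • v) (t • w) = s * t * d2 u x v w := by
  rw [d2_eq hu, d2_eq hu]
  simp only [map_smul, smul_apply, smul_eq_mul]
  ring

theorem cHess_eq_dop (hu : RSm u) (x : Cn n) :
    cHess u x = mixM az bz az bzb (fun y => (u y : ℂ)) x := by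
  ext j k
  simp only [cHess, of_apply, dop_dop_ofReal hu, az, bz, bzb, d2_smul hu]
  rw [d2_comm hu x (Pi.single k 1) (Pi.single j 1),
    d2_comm hu x (Pi.single k I) (Pi.single j I),
    d2_comm hu x (Pi.single k I) (Pi.single j 1),
    d2_comm hu x (Pi.single k 1) (Pi.single j I)]
  push_cast
  ring

theorem sm_cHess (hu : RSm u) (i j : Fin n) : Sm fun x => cHess u x i j := by
  simp only [cHess_eq_dop hu, of_apply]
  exact (hu.ofReal.dop _ _).dop _ _

theorem cHess_add (hu : RSm u) (hv : RSm v) (x : Cn n) :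
    cHess (fun y => u y + v y) x = cHess u x + cHess v x := by
  rw [cHess_eq_dop hu, cHess_eq_dop hv, cHess_eq_dop (hu.add hv)]
  ext i l
  simp only [of_apply, Matrix.add_apply]
  simp only [Complex.ofReal_add]
  rw [dop_add hu.ofReal hv.ofReal, dop_add (hu.ofReal.dop _ _) (hv.ofReal.dop _ _)]

theorem cHess_const_mul (hu : RSm u) (c : ℝ) (x : Cn n) :
    cHess (fun y => c * u y) x = (c : ℂ) • cHess u x := by
  have h : ∀ v w : Cn n, d2 (fun y => c * u y) x v w = c * d2 u x v w := fun v w => by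
    have h1 : (fun y => fderiv ℝ (fun y => c * u y) y v) = fun y => c * fderiv ℝ u y v := by
      ext y
      rw [fderiv_const_mul (hu.diff y)]; rfl
    rw [d2, h1, fderiv_const_mul ((hu.fderiv_apply v).diff x)]
    rfl
  ext i j
  simp only [cHess, of_apply, Matrix.smul_apply, h, smul_eq_mul]
  push_cast
  ring

theorem cHess_isHermitian (hu : RSm u) (x : Cn n) : (cHess u x).IsHermitian := by
  ext j k
  simp only [conjTranspose_apply, cHess, of_apply]
  rw [d2_comm hu x (Pi.single k 1) (Pi.single j 1),
    d2_comm hu x (Pi.single k I) (Pi.single j I),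
    d2_comm hu x (Pi.single k 1) (Pi.single j I),
    d2_comm hu x (Pi.single k I) (Pi.single j 1)]
  simp only [star_div₀, star_add, star_mul', RCLike.star_def, conj_ofReal, Complex.conj_I]
  push_cast
  rw [Complex.conj_ofNat 4]
  ring

/-- The Monge–Ampère density up to a constant factor. -/
def mav (u : Cn n → ℝ) (z : Cn n) : ℝ := (cHess u z).det.re

theorem rsm_mav (hu : RSm u) : RSm (mav u) :=
  Complex.reCLM.contDiff.comp (Sm.det (sm_cHess hu))

theorem RSm.integrable_mul_mav (ha : RSm a) (hc : HasCompactSupport a) (hu : RSm u) :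
    Integrable fun x => a x * mav u x :=
  (ha.continuous.mul (rsm_mav hu).continuous).integrable_of_hasCompactSupport hc.mul_right

/-- The linearisation of `mav`. -/
def lmav (u a : Cn n → ℝ) (z : Cn n) : ℝ :=
  (∑ j, ∑ k, cof (cHess u z) j k * cHess a z j k).re

theorem integral_lmav_symm (hu : RSm u) (ha : RSm a) (hb : RSm b)
    (hca : HasCompactSupport a) (hcb : HasCompactSupport b) :
    ∫ x, a x * lmav u b x = ∫ x, b x * lmav u a x := by
  have hc' : ∀ f : Cn n → ℝ, HasCompactSupport f → HasCompactSupport fun x => (f x : ℂ) :=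
    fun f h => h.comp_left (g := ((↑) : ℝ → ℂ)) ofReal_zero
  have hI : ∀ f g : Cn n → ℝ, RSm f → RSm g → HasCompactSupport f →
      Integrable fun x => (f x : ℂ) * ∑ j, ∑ k, cof (cHess u x) j k * cHess g x j k := fun f g hf hg hc => by
    refine Continuous.integrable_of_hasCompactSupport (hf.ofReal.continuous.mul ?_)
      (hc' f hc).mul_right
    exact continuous_finsetSum _ fun j _ => continuous_finsetSum _ fun k _ => (Sm.cof (sm_cHess hu) j k).continuous.mul (sm_cHess hg j k).continuous
  have hre : ∀ f g : Cn n → ℝ, RSm f → RSm g → HasCompactSupport f → ∫ x, f x * lmav u g x =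
        (∫ x, (f x : ℂ) * ∑ j, ∑ k, cof (cHess u x) j k * cHess g x j k).re := fun f g hf hg hc => by
    refine Eq.trans (integral_congr_ae (.of_forall fun x => ?_)) (integral_re (hI f g hf hg hc))
    simp [lmav]
  rw [hre a b ha hb hca, hre b a hb ha hcb]
  congr 1
  have e : ∀ g : Cn n → ℝ, RSm g → ∀ x, ∑ j, ∑ k, cof (cHess u x) j k * cHess g x j k =
      ∑ j, ∑ k, cof (mixM az bz az bzb (fun y => (u y : ℂ)) x) j k *
        dop (az j) (bz j) (dop (az k) (bzb k) fun y => (g y : ℂ)) x := fun g hg x => by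
    rw [cHess_eq_dop hu, cHess_eq_dop hg]
    rfl
  simp only [e b hb, e a ha]
  exact integral_cof_symm hu.ofReal ha.ofReal hb.ofReal (hc' a hca) (hc' b hcb) az bz az bzb

/-- The two-parameter family `u + s a + t b`. -/
def fam (u a b : Cn n → ℝ) (p : ℝ × ℝ) (x : Cn n) : ℝ := u x + (p.1 * a x + p.2 * b x)

theorem RSm.fam (hu : RSm u) (ha : RSm a) (hb : RSm b) (p : ℝ × ℝ) :
    RSm (fam u a b p) :=
  hu.add ((contDiff_const.mul ha).add (contDiff_const.mul hb))

theorem cHess_fam (hu : RSm u) (ha : RSm a) (hb : RSm b) (p : ℝ × ℝ) (x : Cn n) :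
    cHess (fam u a b p) x = cHess u x + ((p.1 : ℂ) • cHess a x + (p.2 : ℂ) • cHess b x) := by
  have h1 : RSm fun x => p.1 * a x := contDiff_const.mul ha
  have h2 : RSm fun x => p.2 * b x := contDiff_const.mul hb
  rw [← cHess_const_mul ha, ← cHess_const_mul hb, ← cHess_add h1 h2, ← cHess_add hu (h1.add h2)]
  rfl

theorem hasFDerivAt_mav_fam (hu : RSm u) (ha : RSm a) (hb : RSm b)
    (x : Cn n) (p : ℝ × ℝ) :
    HasFDerivAt (fun p => mav (fam u a b p) x)
      (lmav (fam u a b p) a x • fst ℝ ℝ ℝ +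
        lmav (fam u a b p) b x • snd ℝ ℝ ℝ) p := by
  have h1 : ∀ i j, HasFDerivAt (fun p : ℝ × ℝ => cHess (fam u a b p) x i j)
      ((fst ℝ ℝ ℝ).smulRight (cHess a x i j) +
        (snd ℝ ℝ ℝ).smulRight (cHess b x i j)) p := fun i j => by
    have e : (fun p : ℝ × ℝ => cHess (fam u a b p) x i j) = fun p : ℝ × ℝ => cHess u x i j +
        ((fst ℝ ℝ ℝ).smulRight (cHess a x i j) +
        (snd ℝ ℝ ℝ).smulRight (cHess b x i j)) p := by
      ext q
      rw [cHess_fam hu ha hb]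
      simp
    rw [e]
    fun_prop
  refine ((Complex.reCLM.hasFDerivAt (x := (cHess (fam u a b p) x).det)).comp p
    (hasFDerivAt_det h1)).congr_fderiv ?_
  ext <;> simp [lmav, cof]

theorem continuous_fam_entries (hu : RSm u) (ha : RSm a) (hb : RSm b)
    (i j : Fin n) : Continuous fun q : (ℝ × ℝ) × Cn n => cHess (fam u a b q.1) q.2 i j := by
  simp only [cHess_fam hu ha hb, Matrix.add_apply, Matrix.smul_apply, smul_eq_mul]
  have h1 := (sm_cHess hu i j).continuous
  have h2 := (sm_cHess ha i j).continuous
  have h3 := (sm_cHess hb i j).continuous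
  fun_prop

theorem continuous_lmav_fam {c : Cn n → ℝ} (hu : RSm u) (ha : RSm a) (hb : RSm b)
    (hc : RSm c) : Continuous fun q : (ℝ × ℝ) × Cn n => lmav (fam u a b q.1) c q.2 := by
  unfold lmav
  refine continuous_re.comp (continuous_finsetSum _ fun j _ =>
    continuous_finsetSum _ fun k _ => ?_)
  refine Continuous.mul ?_ ((sm_cHess hc j k).continuous.comp continuous_snd)
  exact (Continuous.matrix_updateRow j
    (continuous_matrix (continuous_fam_entries hu ha hb)) continuous_const).matrix_det

/-- Differentiation of the Monge–Ampère pairing. -/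
theorem hasFDerivAt_integral_mav {c : Cn n → ℝ} (hu : RSm u) (ha : RSm a) (hb : RSm b)
    (hc : RSm c) (hcc : HasCompactSupport c) (p : ℝ × ℝ) :
    HasFDerivAt (fun p => ∫ x, c x * mav (fam u a b p) x)
      ((∫ x, c x * lmav (fam u a b p) a x) • fst ℝ ℝ ℝ +
        (∫ x, c x * lmav (fam u a b p) b x) • snd ℝ ℝ ℝ) p := by
  have cl : ∀ d : Cn n → ℝ, RSm d →
      Continuous fun q : (ℝ × ℝ) × Cn n => c q.2 * lmav (fam u a b q.1) d q.2 := fun d hd =>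
    (hc.continuous.comp continuous_snd).mul (continuous_lmav_fam hu ha hb hd)
  let F' : ℝ × ℝ → Cn n → (ℝ × ℝ →L[ℝ] ℝ) := fun p x =>
    (c x * lmav (fam u a b p) a x) • fst ℝ ℝ ℝ +
      (c x * lmav (fam u a b p) b x) • snd ℝ ℝ ℝ
  have hF'c : Continuous (uncurry F') :=
    ((cl a ha).smul continuous_const).add ((cl b hb).smul continuous_const)
  have hF'0 : ∀ p x, x ∉ tsupport c → F' p x = 0 := fun p x hx => by
    simp [F', image_eq_zero_of_notMem_tsupport hx]
  obtain ⟨K, hK⟩ := ((isCompact_closedBall p 1).prod hcc.isCompact).exists_bound_of_continuousOn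
    hF'c.continuousOn
  have hInt : ∀ d : Cn n → ℝ, RSm d → Integrable fun x => c x * lmav (fam u a b p) d x := fun d hd => by
    exact ((cl d hd).comp (Continuous.prodMk_right p)).integrable_of_hasCompactSupport hcc.mul_right
  have key := hasFDerivAt_integral_of_dominated_of_fderiv_le (μ := (volume : Measure (Cn n)))
    (F := fun p x => c x * mav (fam u a b p) x) (F' := F') (x₀ := p)
    (s := closedBall p 1) (bound := (tsupport c).indicator fun _ => K)
    (closedBall_mem_nhds p one_pos) ?_ ?_ ?_ ?_ ?_ ?_
  · refine key.congr_fderiv ?_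
    rw [integral_add ((hInt a ha).smul_const _) ((hInt b hb).smul_const _), integral_smul_const,
      integral_smul_const]
  · exact .of_forall fun q =>
      (hc.continuous.mul (rsm_mav (hu.fam ha hb q)).continuous).aestronglyMeasurable
  · exact hc.integrable_mul_mav hcc (hu.fam ha hb p)
  · exact (hF'c.comp (Continuous.prodMk_right p)).aestronglyMeasurable
  · refine .of_forall fun x q hq => ?_
    by_cases hx : x ∈ tsupport c
    · simp_all
    simp_all
  · rw [integrable_indicator_iff (isClosed_tsupport c).measurableSet]
    exact integrableOn_const hcc.isCompact.measure_lt_top.ne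
  · refine .of_forall fun x q _ => ?_
    refine ((hasFDerivAt_mav_fam hu ha hb x q).const_mul (c x)).congr_fderiv ?_
    simp only [F', smul_add, smul_smul]

/-- The path integral of the Monge–Ampère pairing along the segment from `v` to `w`. -/
def Gam (v w : Cn n → ℝ) : ℝ :=
  ∫ t in (0:ℝ)..1, ∫ x, (w x - v x) * mav (fun y => v y + t * (w y - v y)) x

/-- Path independence. -/
theorem Gam_add (hu : RSm u) (hv : RSm v) (hw : RSm w)
    (h1 : HasCompactSupport fun x => v x - u x) (h2 : HasCompactSupport fun x => w x - v x) :
    Gam u v + Gam v w = Gam u w := by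
  set a : Cn n → ℝ := fun x => v x - u x with ha'
  set b : Cn n → ℝ := fun x => w x - v x with hb'
  have ha : RSm a := hv.sub hu
  have hb : RSm b := hw.sub hv
  let ω : ℝ × ℝ → (ℝ × ℝ →L[ℝ] ℝ) := fun p =>
    (∫ x, a x * mav (fam u a b p) x) • fst ℝ ℝ ℝ +
    (∫ x, b x * mav (fam u a b p) x) • snd ℝ ℝ ℝ
  let dω : ℝ × ℝ → (ℝ × ℝ →L[ℝ] (ℝ × ℝ →L[ℝ] ℝ)) := fun p =>
    ((∫ x, a x * lmav (fam u a b p) a x) • fst ℝ ℝ ℝ +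
        (∫ x, a x * lmav (fam u a b p) b x) • snd ℝ ℝ ℝ).smulRight
        (fst ℝ ℝ ℝ) +
    ((∫ x, b x * lmav (fam u a b p) a x) • fst ℝ ℝ ℝ +
        (∫ x, b x * lmav (fam u a b p) b x) • snd ℝ ℝ ℝ).smulRight
        (snd ℝ ℝ ℝ)
  have hω : ∀ p ∈ (univ : Set (ℝ × ℝ)), HasFDerivWithinAt ω (dω p) univ p := fun p _ =>
    (((hasFDerivAt_integral_mav hu ha hb ha h1 p).smul_const _).add
      ((hasFDerivAt_integral_mav hu ha hb hb h2 p).smul_const _)).hasFDerivWithinAt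
  have hsymm : ∀ p ∈ (univ : Set (ℝ × ℝ)), ∀ x ∈ tangentConeAt ℝ univ p,
      ∀ y ∈ tangentConeAt ℝ univ p, dω p x y = dω p y x := fun p _ x _ y _ => by
    simp only [dω, add_apply, ContinuousLinearMap.smulRight_apply, smul_apply, smul_eq_mul,
      coe_fst', coe_snd']
    rw [integral_lmav_symm (hu.fam ha hb p) ha hb h1 h2]
    ring
  have key := convex_univ.curveIntegral_segment_add_eq_of_hasFDerivWithinAt_symmetric hω hsymm
    (mem_univ (0, 0)) (mem_univ (1, 0)) (mem_univ (1, 1))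
  simp only [curveIntegral_segment] at key
  have e1 : Gam u v = ∫ t in (0:ℝ)..1, ω (AffineMap.lineMap (0, 0) (1, 0) t) ((1, 0) - (0, 0)) := by
    unfold Gam
    congr 1
    ext t
    have hf : fam u a b (t, 0) = fun y => u y + t * (v y - u y) := by ext y; simp [fam, ha']
    simp [AffineMap.lineMap_apply, ω, hf, a]
  have e2 : Gam v w = ∫ t in (0:ℝ)..1, ω (AffineMap.lineMap (1, 0) (1, 1) t) ((1, 1) - (1, 0)) := by
    unfold Gam
    congr 1
    ext t
    have hf : fam u a b (1, t) = fun y => v y + t * (w y - v y) := by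
      ext y; simp only [fam, ha', hb']; ring
    simp [AffineMap.lineMap_apply, ω, hf, b]
  have e3 : Gam u w = ∫ t in (0:ℝ)..1, ω (AffineMap.lineMap (0, 0) (1, 1) t) ((1, 1) - (0, 0)) := by
    unfold Gam
    congr 1
    ext t
    simp only [ω, add_apply, smul_apply, AffineMap.lineMap_apply, coe_fst', coe_snd', smul_eq_mul,
      vsub_eq_sub, Prod.mk_sub_mk, sub_zero, Prod.smul_mk, mul_one, vadd_eq_add, Prod.mk_add_mk,
      add_zero]
    have hf : fam u a b (t, t) = fun y => u y + t * (w y - u y) := by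
      ext y; simp only [fam, ha', hb']; ring
    have hs := hu.fam ha hb (t, t)
    rw [← integral_add (ha.integrable_mul_mav h1 hs) (hb.integrable_mul_mav h2 hs), hf]
    grind
  linarith

/-! ### Monotonicity of the energy -/


theorem one_le_det_one_add {M : Matrix (Fin n) (Fin n) ℂ} (hM : M.PosSemidef) :
    1 ≤ (1 + M).det.re := by
  have hH : (1 + M).IsHermitian := Matrix.isHermitian_one.add hM.isHermitian
  have hev : ∀ i, 1 ≤ hH.eigenvalues i := fun i => by
    rw [hH.eigenvalues_eq, add_mulVec, one_mulVec, dotProduct_add, map_add]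
    have h1 := (RCLike.nonneg_iff.1 (hM.dotProduct_mulVec_nonneg (hH.eigenvectorBasis i).ofLp)).1
    have h2 : RCLike.re (dotProduct (star (hH.eigenvectorBasis i).ofLp)
        (hH.eigenvectorBasis i).ofLp) = 1 := by
      have h3 := inner_self_eq_norm_sq (𝕜 := ℂ) (hH.eigenvectorBasis i)
      rw [(hH.eigenvectorBasis.orthonormal).1 i, EuclideanSpace.inner_eq_star_dotProduct,
        dotProduct_comm] at h3
      linarith
    linarith
  have hc : (1 + M).det = ((∏ i, hH.eigenvalues i : ℝ) : ℂ) := by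
    rw [hH.det_eq_prod_eigenvalues, Complex.ofReal_prod]; rfl
  rw [hc, ofReal_re]
  exact (Finset.prod_const_one (ι := Fin n)).symm.trans_le
    (Finset.prod_le_prod (fun _ _ => zero_le_one) fun i _ => hev i)

open scoped MatrixOrder in
/-- Monotonicity of the determinant on positive semidefinite matrices. -/
theorem det_re_le_det_add {A B : Matrix (Fin n) (Fin n) ℂ} (hA : A.PosSemidef)
    (hB : B.PosSemidef) : A.det.re ≤ (A + B).det.re := by
  by_cases h0 : A.det = 0
  · simpa [h0] using (RCLike.nonneg_iff.1 (hA.add hB).det_nonneg).1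
  · obtain ⟨C, hC⟩ := CStarAlgebra.nonneg_iff_eq_star_mul_self.mp hA.nonneg
    rw [star_eq_conjTranspose] at hC
    have hCd : IsUnit C.det := isUnit_iff_ne_zero.2 fun h => h0 (by simp_all)
    have hM := hB.conjTranspose_mul_mul_same C⁻¹
    have e : A + B = C.conjTranspose * (1 + (C⁻¹).conjTranspose * B * C⁻¹) * C := by
      rw [mul_add, add_mul, mul_one, ← hC]
      congr 1
      have h1 : C⁻¹ * C = 1 := Matrix.nonsing_inv_mul C hCd
      have h2 : C.conjTranspose * (C⁻¹).conjTranspose = 1 := by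
        rw [← conjTranspose_mul, h1, Matrix.conjTranspose_one]
      grind
    have hdA : A.det = ((normSq C.det : ℝ) : ℂ) := by
      rw [hC, det_mul, det_conjTranspose, Complex.normSq_eq_conj_mul_self]
      rfl
    have hd : (A + B).det = ((normSq C.det : ℝ) : ℂ) *
        (1 + (C⁻¹).conjTranspose * B * C⁻¹).det := by
      rw [e, det_mul, det_mul, det_conjTranspose,
        Complex.normSq_eq_conj_mul_self]
      simp only [RCLike.star_def]
      ring
    rw [hd, hdA, re_ofReal_mul, ofReal_re]
    exact le_mul_of_one_le_right (normSq_nonneg _) (one_le_det_one_add hM)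

/-- Smooth plurisubharmonic functions on `ℂⁿ`. -/
def SPSH (u : Cn n → ℝ) : Prop := RSm u ∧ ∀ x, (cHess u x).PosSemidef

theorem SPSH.mav_nonneg (hu : SPSH u) (x : Cn n) : 0 ≤ mav u x :=
  (RCLike.nonneg_iff.1 (hu.2 x).det_nonneg).1

theorem SPSH.add (hu : SPSH u) (hv : SPSH v) : SPSH fun x => u x + v x :=
  ⟨hu.1.add hv.1, fun x => by rw [cHess_add hu.1 hv.1]; exact (hu.2 x).add (hv.2 x)⟩

theorem SPSH.const_mul (hu : SPSH u) {c : ℝ} (hc : 0 ≤ c) : SPSH fun x => c * u x :=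
  ⟨contDiff_const.mul hu.1, fun x => by
    rw [cHess_const_mul hu.1]
    exact (hu.2 x).smul (by positivity : (0:ℂ) ≤ (c : ℂ))⟩

theorem SPSH.mav_segment (hv : SPSH v) (hw : SPSH w) {t : ℝ} (ht0 : 0 ≤ t)
    (ht1 : t ≤ 1) (x : Cn n) :
    (1 - t) ^ n * mav v x ≤ mav (fun y => v y + t * (w y - v y)) x := by
  have h1 := hv.const_mul (sub_nonneg.2 ht1)
  have h2 := hw.const_mul ht0
  have e : (fun y => v y + t * (w y - v y)) = fun y => (1 - t) * v y + t * w y := by ext y; ring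
  have h3 : mav (fun y => (1 - t) * v y) x = (1 - t) ^ n * mav v x := by
    rw [mav, cHess_const_mul hv.1, det_smul, Fintype.card_fin, mav, ← ofReal_pow,
      re_ofReal_mul]
  rw [← h3, e, mav, mav, cHess_add h1.1 h2.1]
  exact det_re_le_det_add (h1.2 x) (h2.2 x)

/-- The energy controls the Monge–Ampère pairing. -/
theorem SPSH.le_Gam (hv : SPSH v) (hw : SPSH w) (hle : ∀ x, v x ≤ w x)
    (hc : HasCompactSupport fun x => w x - v x) :
    (∫ x, (w x - v x) * mav v x) ≤ (n + 1) * Gam v w := by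
  have hwv : RSm fun x => w x - v x := hw.1.sub hv.1
  have hcont : Continuous fun t : ℝ => ∫ x, (w x - v x) * mav (fun y => v y + t * (w y - v y)) x := by
    have h1 : Continuous fun p : ℝ × ℝ =>
        ∫ x, (w x - v x) * mav (fam v (fun y => w y - v y) (fun _ => 0) p) x :=
      continuous_iff_continuousAt.2 fun p =>
        (hasFDerivAt_integral_mav hv.1 hwv contDiff_const hwv hc p).continuousAt
    have hf : ∀ t : ℝ, fam v (fun y => w y - v y) (fun _ => 0) (t, 0) =
        fun y => v y + t * (w y - v y) := fun t => by ext y; simp [fam]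
    simpa only [comp_def, hf] using h1.comp (Continuous.prodMk_left (0:ℝ))
  have hmono : ∫ t in (0:ℝ)..1, (1 - t) ^ n * ∫ x, (w x - v x) * mav v x ≤ Gam v w := by
    refine intervalIntegral.integral_mono_on zero_le_one
      (Continuous.intervalIntegrable (by fun_prop) _ _) (hcont.intervalIntegrable _ _) fun t ht => ?_
    rw [← integral_const_mul]
    refine integral_mono ((hwv.integrable_mul_mav hc hv.1).const_mul _)
      (hwv.integrable_mul_mav hc (hv.1.add (contDiff_const.mul hwv))) fun x => ?_
    have := hv.mav_segment hw ht.1 ht.2 x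
    have h0 := sub_nonneg.2 (hle x)
    nlinarith
  have hpow : ∫ t in (0:ℝ)..1, (1 - t) ^ n = 1 / (n + 1) := by
    rw [intervalIntegral.integral_comp_sub_left (fun t => t ^ n) 1]
    simp
  rw [intervalIntegral.integral_mul_const, hpow] at hmono
  rwa [one_div, inv_mul_le_iff₀ (by positivity)] at hmono

theorem SPSH.Gam_nonneg (hv : SPSH v) (hw : SPSH w) (hle : ∀ x, v x ≤ w x)
    (hc : HasCompactSupport fun x => w x - v x) : 0 ≤ Gam v w := by
  have h2 : 0 ≤ ∫ x, (w x - v x) * mav v x := integral_nonneg fun x =>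
    mul_nonneg (sub_nonneg.2 (hle x)) (hv.mav_nonneg x)
  exact nonneg_of_mul_nonneg_right (h2.trans (hv.le_Gam hw hle hc)) (by positivity)

theorem cHess_eq_zero_of_eventually_const {c : ℝ} {x : Cn n} (h : ∀ᶠ y in 𝓝 x, u y = c) :
    cHess u x = 0 := by
  have hd : ∀ v : Cn n, (fun y => fderiv ℝ u y v) =ᶠ[𝓝 x] fun _ => 0 := fun v => by
    filter_upwards [h.eventually_nhds] with y hy
    simp [EventuallyEq.fderiv_eq (f := fun _ => c) hy]
  ext i j
  simp [cHess, d2, (hd _).fderiv_eq]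

/-- Total Monge–Ampère mass is unchanged under compactly supported perturbations. -/
theorem integral_mav_sub_eq_zero (hu : RSm u) (hv : RSm v)
    (hc : HasCompactSupport fun x => v x - u x) : ∫ x, (mav v x - mav u x) = 0 := by
  set b : Cn n → ℝ := fun x => v x - u x with hb'
  have hb : RSm b := hv.sub hu
  obtain ⟨R, hR⟩ := hc.isCompact.isBounded.subset_closedBall (0 : Cn n)
  let φ : ContDiffBump (0 : Cn n) := ⟨|R| + 1, |R| + 2, by positivity, by linarith⟩
  have hφ : RSm (φ : Cn n → ℝ) := φ.contDiff
  have hφ1 : ∀ x ∈ ball (0 : Cn n) (|R| + 1), φ x = 1 := fun x hx =>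
    φ.one_of_mem_closedBall (ball_subset_closedBall hx)
  have hsupp : tsupport b ⊆ ball 0 (|R| + 1) := hR.trans fun x hx => by
    rw [mem_closedBall] at hx
    exact mem_ball.2 (by grind)
  have h0 : RSm fun _ : Cn n => (0:ℝ) := contDiff_const
  have hHφ : ∀ x ∈ ball (0 : Cn n) (|R| + 1), cHess φ x = 0 := fun x hx => by
    exact cHess_eq_zero_of_eventually_const <| by
      filter_upwards [isOpen_ball.mem_nhds hx] with y hy using hφ1 y hy
  have hlm : ∀ p x, b x * lmav (fam u b (fun _ => 0) p) φ x = 0 := fun p x => by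
    by_cases hx : x ∈ tsupport b
    · simp [lmav, hHφ x (hsupp hx)]
    · rw [image_eq_zero_of_notMem_tsupport hx, zero_mul]
  have hder : ∀ t : ℝ, HasDerivAt (fun t : ℝ => ∫ x, φ x * mav (fam u b (fun _ => 0) (t, 0)) x) 0 t := fun t => by
    have h1 := hasFDerivAt_integral_mav hu hb h0 hφ φ.hasCompactSupport (t, 0)
    have h3 := h1.comp_hasDerivAt t ((hasDerivAt_id t).prodMk (hasDerivAt_const t (0:ℝ)))
    have hs := integral_lmav_symm (hu.fam hb h0 (t, 0)) hφ hb φ.hasCompactSupport hc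
    simp only [hlm, integral_zero] at hs
    simpa [hs, comp_def] using h3
  have hconst := is_const_of_deriv_eq_zero (fun t => (hder t).differentiableAt)
    (fun t => (hder t).deriv) 1 0
  have e1 : fam u b (fun _ => 0) (1, 0) = v := by ext y; simp [fam, hb']
  have e0 : fam u b (fun _ => 0) (0, 0) = u := by ext y; simp [fam]
  simp only [e1, e0] at hconst
  have hI := fun w (hw : RSm w) => hφ.integrable_mul_mav φ.hasCompactSupport hw
  have hsub : ∫ x, (φ x * mav v x - φ x * mav u x) = 0 := by
    rw [integral_sub (hI v hv) (hI u hu), hconst, sub_self]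
  rw [← hsub]
  refine integral_congr_ae (.of_forall fun x => ?_)
  show mav v x - mav u x = φ x * mav v x - φ x * mav u x
  by_cases hx : x ∈ ball (0 : Cn n) (|R| + 1)
  · simp_all
  · have hx' : x ∉ tsupport b := fun h => hx (hsupp h)
    have hHb : cHess b x = 0 := cHess_eq_zero_of_eventually_const <| by
      filter_upwards [(isClosed_tsupport b).isOpen_compl.mem_nhds hx'] with y hy using
        image_eq_zero_of_notMem_tsupport hy
    have hv' : v = fun y => u y + b y := by simp_all
    have : mav v x = mav u x := by rw [mav, hv', cHess_add hu hb, hHb, add_zero, mav]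
    rw [this]; ring

end

/-! ### Second order Taylor expansion and the Levi form -/

section

variable {n : ℕ}
variable {v : Cn n → ℝ} {a : Cn n}

theorem taylor_two (hv : RSm v) {K : Set (Cn n)} (hK : IsCompact K) {ε : ℝ}
    (hε : 0 < ε) : ∃ δ > 0, ∀ a ∈ K, ∀ ζ : Cn n, ‖ζ‖ ≤ δ →
      |v (a + ζ) - v a - fderiv ℝ v a ζ - 1 / 2 * fderiv ℝ (fderiv ℝ v) a ζ ζ| ≤ ε * ‖ζ‖ ^ 2 := by
  have hv1 : ContDiff ℝ (⊤ : ℕ∞) (fderiv ℝ v) := hv.fderiv_right (by simp)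
  have hv2 : ContDiff ℝ (⊤ : ℕ∞) (fderiv ℝ (fderiv ℝ v)) := hv1.fderiv_right (by simp)
  have hd1 : Differentiable ℝ (fderiv ℝ v) := hv1.differentiable (by simp)
  have hu := hK.uniformContinuousAt_of_continuousAt (fderiv ℝ (fderiv ℝ v))
    (fun a _ => hv2.continuous.continuousAt) 
    (dist_mem_uniformity (α := Cn n →L[ℝ] Cn n →L[ℝ] ℝ) hε)
  obtain ⟨δ, hδ, hball⟩ := mem_uniformity_dist.1 hu
  refine ⟨δ / 2, half_pos hδ, fun a ha ζ hζ => ?_⟩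
  have hclose : ∀ x ∈ closedBall a ‖ζ‖,
      ‖fderiv ℝ (fderiv ℝ v) x - fderiv ℝ (fderiv ℝ v) a‖ ≤ ε := fun x hx => by
    have h1 : dist a x < δ := by rw [dist_comm]; rw [mem_closedBall] at hx; linarith
    exact ((dist_eq_norm (E := Cn n →L[ℝ] Cn n →L[ℝ] ℝ) _ _).symm.trans (dist_comm _ _)).trans_le
      (hball h1 ha).le
  have hstep : ∀ x ∈ closedBall a ‖ζ‖,
      ‖fderiv ℝ v x - fderiv ℝ v a - fderiv ℝ (fderiv ℝ v) a (x - a)‖ ≤ ε * ‖ζ‖ := fun x hx => by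
    refine ((convex_closedBall a ‖ζ‖).norm_image_sub_le_of_norm_fderiv_le' (fun y _ => hd1 y)
      hclose (mem_closedBall_self (norm_nonneg _)) hx).trans ?_
    rw [mem_closedBall, dist_eq_norm] at hx
    simp_all
  set A := fderiv ℝ (fderiv ℝ v) a with hA
  have hsymm : ∀ x y, A x y = A y x := hv.contDiffAt.isSymmSndFDerivAt
    (by rw [minSmoothness_of_isRCLikeNormedField]; exact WithTop.coe_le_coe.2 le_top)
  have hR : ∀ x, HasFDerivAt (fun x => v x - fderiv ℝ v a (x - a) - 1 / 2 * A (x - a) (x - a))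
      (fderiv ℝ v x - fderiv ℝ v a - A (x - a)) x := fun x => by
    have h0 : HasFDerivAt (fun x : Cn n => x - a) (ContinuousLinearMap.id ℝ (Cn n)) x :=
      (hasFDerivAt_id x).sub_const a
    have h1 := (hv.diff x).hasFDerivAt.sub ((fderiv ℝ v a).hasFDerivAt.comp x h0)
    have h2 := ((A.hasFDerivAt.comp x h0).clm_apply h0).const_mul (1 / 2 : ℝ)
    refine (h1.sub h2).congr_fderiv ?_
    ext h
    simp only [Function.comp_apply, ContinuousLinearMap.comp_id, sub_apply, smul_apply, add_apply,
      smul_eq_mul, ContinuousLinearMap.flip_apply]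
    rw [hsymm h (x - a)]
    ring
  have hfin := (convex_closedBall a ‖ζ‖).norm_image_sub_le_of_norm_hasFDerivWithin_le
    (fun x _ => (hR x).hasFDerivWithinAt) hstep (mem_closedBall_self (norm_nonneg _))
    (show a + ζ ∈ closedBall a ‖ζ‖ by simp)
  simp only [add_sub_cancel_left, sub_self, map_zero, mul_zero, sub_zero] at hfin
  rw [norm_eq_abs] at hfin
  grind

/-- The Levi form. -/
def levi (v : Cn n → ℝ) (a ζ : Cn n) : ℝ :=
  (∑ j, ∑ k, cHess v a j k * (ζ j * conj (ζ k))).re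

theorem levi_eq_dotProduct (v : Cn n → ℝ) (a ζ : Cn n) :
    levi v a ζ = (dotProduct (star (star ζ)) ((cHess v a).mulVec (star ζ))).re := by
  rw [levi, dotProduct]
  congr 1
  refine sum_congr rfl fun j _ => ?_
  rw [mulVec, dotProduct, mul_sum]
  exact sum_congr rfl fun k _ => by simp; ring

theorem levi_smul (v : Cn n → ℝ) (a ζ : Cn n) (w : ℂ) : levi v a (w • ζ) = ‖w‖ ^ 2 * levi v a ζ := by
  rw [levi, levi, ← re_ofReal_mul, mul_sum]
  congr 1
  refine sum_congr rfl fun j _ => ?_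
  rw [mul_sum]
  refine sum_congr rfl fun k _ => ?_
  simp only [Pi.smul_apply, smul_eq_mul, map_mul]
  have : ((‖w‖ ^ 2 : ℝ) : ℂ) = w * conj w := by rw [mul_conj, normSq_eq_norm_sq]
  grind

theorem Cn.eq_sum (ζ : Cn n) :
    ζ = ∑ j, ((ζ j).re • (Pi.single j 1 : Cn n) + (ζ j).im • (Pi.single j I : Cn n)) := by
  ext i
  simp only [Finset.sum_apply, Pi.add_apply, Pi.smul_apply, Pi.single_apply]
  rw [sum_eq_single i (fun j _ hj => by simp [hj.symm]) (by simp)]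
  simp

/-- Real quadratic forms split into a pluriharmonic part and the Levi form. -/
theorem second_fderiv_eq (hv : RSm v) (a ζ : Cn n) :
    1 / 2 * fderiv ℝ (fderiv ℝ v) a ζ ζ = (∑ j, ∑ k, (((d2 v a (Pi.single j 1) (Pi.single k 1) -
        d2 v a (Pi.single j I) (Pi.single k I) : ℝ) : ℂ) -
      I * ((d2 v a (Pi.single j 1) (Pi.single k I) +
        d2 v a (Pi.single j I) (Pi.single k 1) : ℝ) : ℂ)) / 4 * (ζ j * ζ k)).re
      + levi v a ζ := by
  have h : fderiv ℝ (fderiv ℝ v) a ζ ζ = ∑ j, ∑ k,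
      ((ζ j).re * (ζ k).re * d2 v a (Pi.single j 1) (Pi.single k 1) +
       (ζ j).re * (ζ k).im * d2 v a (Pi.single j 1) (Pi.single k I) +
       (ζ j).im * (ζ k).re * d2 v a (Pi.single j I) (Pi.single k 1) +
       (ζ j).im * (ζ k).im * d2 v a (Pi.single j I) (Pi.single k I)) := by
    conv_lhs => rw [Cn.eq_sum ζ]
    simp only [map_sum, sum_apply]
    simp only [map_add, map_smul, add_apply, smul_apply, smul_eq_mul, d2_eq hv]
    ring
  rw [h, levi, ← add_re, mul_sum, ← sum_add_distrib, re_sum]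
  refine sum_congr rfl fun j _ => ?_
  rw [mul_sum, ← sum_add_distrib, re_sum]
  refine sum_congr rfl fun k _ => ?_
  simp only [cHess, of_apply, add_re, mul_re, Complex.div_ofNat_re, Complex.div_ofNat_im,
    sub_re, sub_im, ofReal_re, Complex.ofReal_im, Complex.I_re,
    Complex.I_im, mul_im, conj_re, conj_im, add_im]
  ring

theorem exists_levi_expansion (hv : RSm v) {K : Set (Cn n)} (hK : IsCompact K)
    {ε : ℝ} (hε : 0 < ε) : ∃ δ > 0, ∀ a ∈ K, ∃ P : Cn n → ℂ, Differentiable ℂ P ∧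
      (P 0).re = v a ∧ ∀ ζ : Cn n, ‖ζ‖ ≤ δ → |v (a + ζ) - (P ζ).re - levi v a ζ| ≤ ε * ‖ζ‖ ^ 2 := by
  obtain ⟨δ, hδ, h⟩ := taylor_two hv hK hε
  refine ⟨δ, hδ, fun a ha => ⟨fun ζ => (v a : ℂ) + ∑ j, ((fderiv ℝ v a (Pi.single j 1) : ℂ) -
      I * (fderiv ℝ v a (Pi.single j I) : ℂ)) * ζ j + ∑ j, ∑ k,
      (((d2 v a (Pi.single j 1) (Pi.single k 1) -
        d2 v a (Pi.single j I) (Pi.single k I) : ℝ) : ℂ) -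
      I * ((d2 v a (Pi.single j 1) (Pi.single k I) +
        d2 v a (Pi.single j I) (Pi.single k 1) : ℝ) : ℂ)) / 4 * (ζ j * ζ k),
      by fun_prop, by simp, fun ζ hζ => ?_⟩⟩
  have h1 := h a ha ζ hζ
  rw [second_fderiv_eq hv] at h1
  have h2 : fderiv ℝ v a ζ = (∑ j, ((fderiv ℝ v a (Pi.single j 1) : ℂ) -
      I * (fderiv ℝ v a (Pi.single j I) : ℂ)) * ζ j).re := by
    conv_lhs => rw [Cn.eq_sum ζ]
    rw [map_sum, re_sum]
    exact sum_congr rfl fun j _ => by simp; ring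
  rw [h2] at h1
  simp only [add_re, ofReal_re] at h1 ⊢
  grind

/-- Smooth functions with the sub-mean value property have nonnegative Levi form. -/
theorem LPSH.cHess_posSemidef {Ω : Set (Cn n)} (hΩ : IsOpen Ω) (hv : RSm v)
    (hl : LPSH v Ω) (ha : a ∈ Ω) : (cHess v a).PosSemidef := by
  have key : ∀ ζ, 0 ≤ levi v a ζ := fun ζ => by
    refine le_of_forall_pos_le_add fun ε hε => ?_
    have hε' : 0 < ε / (‖ζ‖ ^ 2 + 1) := by positivity
    obtain ⟨δ, hδ, hT⟩ := exists_levi_expansion hv (isCompact_singleton (x := a)) hε'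
    obtain ⟨P, hP, hP0, hPe⟩ := hT a rfl
    obtain ⟨r, ⟨⟨hr0, -⟩, hrsub⟩, hrδ⟩ := ((eventually_line_mem hΩ ha ζ).and
      (hl.eventually_submean hΩ ha ζ) |>.and (show ∀ᶠ r in 𝓝[>] (0:ℝ), r * ‖ζ‖ < δ from by
        have : Continuous fun r : ℝ => r * ‖ζ‖ := by fun_prop
        exact nhdsWithin_le_nhds (this.continuousAt.eventually (gt_mem_nhds (by simpa))))).exists
    set c := r ^ 2 * levi v a ζ + ε / (‖ζ‖ ^ 2 + 1) * (r ^ 2 * ‖ζ‖ ^ 2)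
    have hPl : Differentiable ℂ fun w : ℂ => P (w • ζ) :=
      hP.comp (differentiable_id.smul_const ζ)
    have h1 : circleAverage (fun w : ℂ => v (a + w • ζ)) 0 r ≤
        circleAverage (fun w : ℂ => (P (w • ζ)).re + c) 0 r := by
      refine circleAverage_mono (hv.continuous.comp (by fun_prop)).continuousOn.circleIntegrable'
        ((continuous_re.comp hPl.continuous).add continuous_const).continuousOn.circleIntegrable'
        fun w hw => ?_
      have hwn : ‖w‖ = r := by rwa [mem_sphere_zero_iff_norm, abs_of_pos hr0] at hw
      have hn : ‖w • ζ‖ = r * ‖ζ‖ := by rw [norm_smul, hwn]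
      have h2 := (abs_le.1 (hPe (w • ζ) (by linarith))).2
      rw [levi_smul, hwn, hn, mul_pow] at h2
      linarith
    have h2 : circleAverage (fun w : ℂ => (P (w • ζ)).re + c) 0 r = v a + c := by
      have := circleAverage_re hr0 (f := fun w : ℂ => P (w • ζ) + c) (a := 0)
        (hPl.add_const _).diffContOnCl
      simp_all
    have h4 : ε / (‖ζ‖ ^ 2 + 1) * ‖ζ‖ ^ 2 ≤ ε := by
      rw [div_mul_eq_mul_div, div_le_iff₀ (by positivity)]
      nlinarith
    have h5 : 0 ≤ r ^ 2 * (levi v a ζ + ε / (‖ζ‖ ^ 2 + 1) * ‖ζ‖ ^ 2) := by linarith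
    linarith [nonneg_of_mul_nonneg_right h5 (by positivity)]
  refine Matrix.PosSemidef.of_dotProduct_mulVec_nonneg (cHess_isHermitian hv a) fun x => ?_
  exact nonneg_iff.2 ⟨by simpa only [levi_eq_dotProduct, star_star] using key (star x),
    ((cHess_isHermitian hv a).im_star_dotProduct_mulVec_self x).symm⟩

/-! ### Plurisubharmonicity of logarithms and exponentials -/

variable {Ω : Set (Cn n)}

theorem LPSH.re_of_differentiable {f : Cn n → ℂ} (hf : DifferentiableOn ℂ f Ω) (hΩ : IsOpen Ω)
    (hb : ∃ C, ∀ x ∈ Ω, |(f x).re| ≤ C) : LPSH (fun z => (f z).re) Ω := by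
  refine LPSH.of_submean (continuous_re.comp_continuousOn
    hf.continuousOn).upperSemicontinuousOn hb fun a ha b => ?_
  filter_upwards [eventually_line_mem hΩ ha b] with r ⟨hr0, hr⟩
  have hl : DifferentiableOn ℂ (fun w : ℂ => f (a + w • b)) (closedBall 0 r) :=
    hf.comp (by fun_prop) fun w hw => hr w hw
  have := circleAverage_re hr0 (f := fun w : ℂ => f (a + w • b)) (a := 0)
    (DifferentiableOn.diffContOnCl (by rwa [closure_ball _ hr0.ne']))
  simp_all

/-- Bounded above by supporting plurisubharmonic functions. -/
theorem LPSH.of_support {u : Cn n → ℝ} (hu : ContinuousOn u Ω) (hb : ∃ C, ∀ x ∈ Ω, |u x| ≤ C)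
    (h : ∀ a ∈ Ω, ∃ (U : Set (Cn n)) (l : Cn n → ℝ), IsOpen U ∧ a ∈ U ∧ U ⊆ Ω ∧ LPSH l U ∧
      l a = u a ∧ ∀ x ∈ U, l x ≤ u x) : LPSH u Ω := by
  refine LPSH.of_submean hu.upperSemicontinuousOn hb fun a ha b => ?_
  obtain ⟨U, l, hU, haU, hUΩ, hl, hla, hle⟩ := h a ha
  filter_upwards [hl.eventually_submean hU haU b, eventually_line_mem hU haU b] with r h1 ⟨h0, h2⟩
  have h3 : ∀ w ∈ sphere (0:ℂ) |r|, a + w • b ∈ U := fun w hw =>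
    h2 w (sphere_abs_subset h0.le le_rfl hw)
  rw [← hla]
  refine h1.trans (circleAverage_mono (LPSH.circleIntegrable hl.1 hl.2.1 a b h3)
    (LPSH.circleIntegrable (hu.mono hUΩ).upperSemicontinuousOn
      (hb.imp fun C hC x hx => hC x (hUΩ hx)) a b h3) fun w hw => hle _ (h3 w hw))

theorem exists_bounded_nhd {f : Cn n → ℝ} {V : Set (Cn n)} (hV : V ∈ 𝓝 a)
    (hf : ContinuousOn f V) : ∃ U, IsOpen U ∧ a ∈ U ∧ U ⊆ V ∧ ∃ C, ∀ x ∈ U, |f x| ≤ C := by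
  have h1 : ∀ᶠ x in 𝓝 a, |f x| < |f a| + 1 :=
    (hf.continuousAt hV).abs.eventually (gt_mem_nhds (by linarith))
  obtain ⟨U, hUs, hUo, haU⟩ := _root_.mem_nhds_iff.1 (h1.and hV)
  exact ⟨U, hUo, haU, fun x hx => (hUs hx).2, _, fun x hx => (hUs hx).1.le⟩

/-- `log |f|` is locally the real part of a holomorphic function. -/
theorem exists_log_branch {f : Cn n → ℂ} (hΩ : IsOpen Ω) (hf : DifferentiableOn ℂ f Ω)
    (ha : a ∈ Ω) (h0 : f a ≠ 0) :
    ∃ U, IsOpen U ∧ a ∈ U ∧ U ⊆ Ω ∧ (∀ x ∈ U, f x ≠ 0) ∧ LPSH (fun x => log (‖f x‖)) U := by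
  have hc : ContinuousAt (fun x => f x / f a) a :=
    (hf.continuousOn.continuousAt (hΩ.mem_nhds ha)).div_const _
  have h1 : ∀ᶠ x in 𝓝 a, f x / f a ∈ Complex.slitPlane :=
    hc (Complex.isOpen_slitPlane.mem_nhds (by simp [h0]))
  obtain ⟨V, hVs, hVo, haV⟩ := _root_.mem_nhds_iff.1 (h1.and (hΩ.mem_nhds ha))
  have hL : DifferentiableOn ℂ (fun x => Complex.log (f x / f a) + Complex.log (f a)) V :=
    DifferentiableOn.add_const (c := Complex.log (f a)) (DifferentiableOn.clog
      (by simpa only [div_eq_mul_inv] using (hf.mono fun x hx => (hVs hx).2).mul_const (f a)⁻¹) fun x hx => (hVs hx).1)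
  obtain ⟨U, hUo, haU, hUV, hUb⟩ := exists_bounded_nhd (hVo.mem_nhds haV)
    (continuous_re.comp_continuousOn hL.continuousOn)
  have hne : ∀ x ∈ U, f x ≠ 0 := fun x hx h => Complex.slitPlane_ne_zero (hVs (hUV hx)).1
    (by grind)
  refine ⟨U, hUo, haU, fun x hx => (hVs (hUV hx)).2, hne, ?_⟩
  refine (LPSH.re_of_differentiable (hL.mono hUV) hUo hUb).congr hUo fun x hx => ?_
  simp only [add_re, log_re, norm_div]
  rw [log_div (norm_ne_zero_iff.2 (hne x hx)) (norm_ne_zero_iff.2 h0)]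
  ring

theorem LPSH.log_sum {ι : Type*} [Fintype ι] {p : ι → Cn n → ℂ} (hΩ : IsOpen Ω)
    (hp : ∀ i, DifferentiableOn ℂ (p i) Ω) (hpos : ∀ x ∈ Ω, 0 < ∑ i, ‖p i x‖ ^ 2)
    (hb : ∃ C, ∀ x ∈ Ω, |log (∑ i, ‖p i x‖ ^ 2)| ≤ C) :
    LPSH (fun x => log (∑ i, ‖p i x‖ ^ 2)) Ω := by
  have hcont : ContinuousOn (fun x => ∑ i, ‖p i x‖ ^ 2) Ω :=
    continuousOn_finsetSum _ fun i _ => (hp i).continuousOn.norm.pow 2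
  refine LPSH.of_support (hcont.log fun x hx => (hpos x hx).ne') hb fun a ha => ?_
  set S := ∑ i, ‖p i a‖ ^ 2 with hS
  have hSp : 0 < S := hpos a ha
  let f : Cn n → ℂ := fun x => ∑ i, conj (p i a) * p i x
  have hf : DifferentiableOn ℂ f Ω := by fun_prop
  have hfa : f a = (S : ℂ) := by
    simp only [f, hS, Complex.ofReal_sum]
    refine sum_congr rfl fun i _ => ?_
    rw [mul_comm, mul_conj, normSq_eq_norm_sq]
  obtain ⟨U, hU, haU, hUΩ, hne, hl⟩ := exists_log_branch hΩ hf ha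
    (by rw [hfa]; positivity)
  refine ⟨U, fun x => 2 * log ‖f x‖ + (- log S), hU, haU, hUΩ,
    (hl.const_mul hU zero_le_two).add_const hU _, ?_, fun x hx => ?_⟩
  · show 2 * log ‖f a‖ + -log S = log S
    rw [hfa, norm_real, norm_of_nonneg hSp.le]; ring
  · have hcs : ‖f x‖ ^ 2 ≤ S * ∑ i, ‖p i x‖ ^ 2 := by
      have h1 : ‖f x‖ ≤ ∑ i, ‖p i a‖ * ‖p i x‖ := by exact (norm_sum_le _ _).trans (by simp)
      exact (pow_le_pow_left₀ (norm_nonneg _) h1 2).trans (Finset.sum_mul_sq_le_sq_mul_sq _ _ _)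
    have h2 := norm_pos_iff.2 (hne x hx)
    have h3 := log_le_log (by positivity) hcs
    rw [log_pow, log_mul hSp.ne' (hpos x (hUΩ hx)).ne'] at h3
    grind

theorem LPSH.norm_sq_mul_exp {F : Cn n → ℂ} {ψ : Cn n → ℝ} (hΩ : IsOpen Ω)
    (hF : DifferentiableOn ℂ F Ω) (hψ : LPSH ψ Ω) (hψc : ContinuousOn ψ Ω)
    (hb : ∃ C, ∀ x ∈ Ω, |‖F x‖ ^ 2 * exp (ψ x)| ≤ C) :
    LPSH (fun x => ‖F x‖ ^ 2 * exp (ψ x)) Ω := by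
  refine LPSH.of_support ((hF.continuousOn.norm.pow 2).mul hψc.rexp) hb fun a ha => ?_
  by_cases h0 : F a = 0
  · exact ⟨Ω, fun _ => 0, hΩ, ha, Subset.rfl, LPSH.const 0, by simp [h0], fun x _ => by positivity⟩
  · obtain ⟨U, hU, haU, hUΩ, hne, hl⟩ := exists_log_branch hΩ hF ha h0
    set c := ‖F a‖ ^ 2 * exp (ψ a) with hc
    set t := 2 * log ‖F a‖ + ψ a with ht
    have hlog : ∀ x ∈ U, ‖F x‖ ^ 2 * exp (ψ x) = exp (2 * log ‖F x‖ + ψ x) := fun x hx => by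
      have h2 : 0 < ‖F x‖ := norm_pos_iff.2 (hne x hx)
      rw [exp_add, ← Nat.cast_ofNat (R := ℝ) (n := 2), ← log_pow,
        exp_log (by positivity)]
    refine ⟨U, fun x => c * (2 * log ‖F x‖ + ψ x + (1 - t)), hU, haU, hUΩ,
      (((hl.const_mul hU zero_le_two).add hU (hψ.mono hUΩ)).add_const hU _).const_mul hU
        (by positivity), ?_, fun x hx => ?_⟩
    · linarith
    · rw [hlog x hx, hc, hlog a haU, ← ht]
      have h1 := mul_le_mul_of_nonneg_left (Real.add_one_le_exp (2 * log ‖F x‖ + ψ x - t))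
        (exp_pos t).le
      rw [← exp_add, add_sub_cancel] at h1
      linarith

/-! ### A regularised maximum -/

/-- A smooth convex approximation of `t ↦ max t 0`. -/
def smt (t : ℝ) : ℝ := ∫ s in (-(1 / 2) : ℝ)..t, smoothTransition (s + 1 / 2)

theorem continuous_smt_aux : Continuous fun s : ℝ => smoothTransition (s + 1 / 2) :=
  Real.smoothTransition.continuous.comp (by fun_prop)

theorem hasDerivAt_smt (t : ℝ) : HasDerivAt smt (smoothTransition (t + 1 / 2)) t :=
  continuous_smt_aux.integral_hasStrictDerivAt _ t |>.hasDerivAt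

theorem deriv_smt : deriv smt = fun t => smoothTransition (t + 1 / 2) :=
  funext fun t => (hasDerivAt_smt t).deriv

theorem contDiff_smt : ContDiff ℝ (⊤ : ℕ∞) smt := by
  rw [contDiff_infty_iff_deriv, deriv_smt]
  exact ⟨fun t => (hasDerivAt_smt t).differentiableAt, by fun_prop⟩

theorem smt_support (t₀ t : ℝ) :
    smt t₀ + smoothTransition (t₀ + 1 / 2) * (t - t₀) ≤ smt t := by
  have hm : MonotoneOn (deriv smt) univ := by
    rw [deriv_smt]
    exact fun a _ b _ hab => Real.smoothTransition.monotone (by linarith)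
  have hc : ConvexOn ℝ univ smt := MonotoneOn.convexOn_of_deriv convex_univ
    (contDiff_smt.continuous.continuousOn)
    (contDiff_smt.differentiable (by simp)).differentiableOn (by simp_all)
  rcases lt_trichotomy t₀ t with h | h | h
  · have := hc.le_slope_of_hasDerivAt (mem_univ t₀) (mem_univ t) h (hasDerivAt_smt t₀)
    rw [slope_def_field, le_div_iff₀ (sub_pos.2 h)] at this
    linarith
  · grind
  · have := hc.slope_le_of_hasDerivAt (mem_univ t) (mem_univ t₀) h (hasDerivAt_smt t₀)
    rw [slope_def_field, div_le_iff₀ (sub_pos.2 h)] at this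
    linarith

theorem smt_of_le {t : ℝ} (ht : t ≤ -(1 / 2)) : smt t = 0 := by
  rw [smt, intervalIntegral.integral_symm, neg_eq_zero]
  refine (integral_congr (g := fun _ => 0) fun s hs => ?_).trans (by simp)
  rw [uIcc_of_le ht] at hs
  exact Real.smoothTransition.zero_of_nonpos (by grind)

theorem smoothTransition_symm (s : ℝ) :
    smoothTransition s + smoothTransition (1 - s) = 1 := by
  have h := (Real.smoothTransition.pos_denom s).ne'
  rw [smoothTransition, smoothTransition, sub_sub_cancel,
    add_comm (expNegInvGlue (1 - s)), ← add_div, div_self h]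

theorem smt_of_ge {t : ℝ} (ht : 1 / 2 ≤ t) : smt t = t := by
  have hI : ∀ a b : ℝ, IntervalIntegrable (fun s : ℝ => smoothTransition (s + 1 / 2))
    volume a b := fun a b => continuous_smt_aux.intervalIntegrable a b
  have h1 : ∫ s in (-(1 / 2) : ℝ)..(1 / 2), smoothTransition (s + 1 / 2) = 1 / 2 := by
    have e1 := intervalIntegral.integral_comp_neg (a := -(1 / 2)) (b := 1 / 2)
      fun s : ℝ => smoothTransition (s + 1 / 2)
    have e2 : (∫ s in (-(1 / 2) : ℝ)..(1 / 2), smoothTransition (s + 1 / 2)) +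
        ∫ s in (-(1 / 2) : ℝ)..(1 / 2), smoothTransition (-s + 1 / 2) = 1 := by
      have hc : Continuous fun s : ℝ => smoothTransition (-s + 1 / 2) :=
        Real.smoothTransition.continuous.comp (by fun_prop)
      rw [← intervalIntegral.integral_add (hI _ _) (hc.intervalIntegrable _ _)]
      have : ∀ s : ℝ, smoothTransition (s + 1 / 2) + smoothTransition (-s + 1 / 2) = 1 := fun s => by
        grind [smoothTransition_symm (s + 1 / 2)]
      simp only [this]
      norm_num
    linarith
  have h2 : ∫ s in (1 / 2 : ℝ)..t, smoothTransition (s + 1 / 2) = t - 1 / 2 := by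
    refine (integral_congr (g := fun _ => 1) fun s hs => ?_).trans (by simp)
    rw [uIcc_of_le ht] at hs
    exact Real.smoothTransition.one_of_one_le (by grind)
  rw [smt, ← intervalIntegral.integral_add_adjacent_intervals (hI _ (1 / 2)) (hI _ _), h1, h2]
  ring

/-- A smooth maximum: equal to the maximum when the arguments differ by at least `1 / 2`. -/
def smax (a b : ℝ) : ℝ := b + smt (a - b)

theorem smax_of_ge {a b : ℝ} (h : b + 1 / 2 ≤ a) : smax a b = a := by
  rw [smax, smt_of_ge (by linarith)]; ring

theorem smax_of_le {a b : ℝ} (h : a + 1 / 2 ≤ b) : smax a b = b := by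
  rw [smax, smt_of_le (by linarith), add_zero]

theorem smax_mono_left {a a' : ℝ} (b : ℝ) (h : a ≤ a') : smax a b ≤ smax a' b := by
  rw [smax, smax]
  nlinarith [smt_support (a - b) (a' - b), Real.smoothTransition.nonneg (a - b + 1 / 2)]

theorem LPSH.smax {u : Cn n → ℝ} (hΩ : IsOpen Ω) (hu : LPSH u Ω) (hv : LPSH v Ω)
    (huc : ContinuousOn u Ω) (hvc : ContinuousOn v Ω)
    (hb : ∃ C, ∀ x ∈ Ω, |smax (u x) (v x)| ≤ C) : LPSH (fun x => smax (u x) (v x)) Ω := by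
  refine LPSH.of_support (hvc.add (contDiff_smt.continuous.comp_continuousOn (huc.sub hvc))) hb
    fun a ha => ?_
  set m := smoothTransition (u a - v a + 1 / 2) with hm
  have h0 : 0 ≤ m := Real.smoothTransition.nonneg _
  have h1 : m ≤ 1 := Real.smoothTransition.le_one _
  refine ⟨Ω, fun x => m * u x + (1 - m) * v x + (smt (u a - v a) - m * (u a - v a)), hΩ, ha,
    Subset.rfl, ((hu.const_mul hΩ h0).add hΩ (hv.const_mul hΩ (sub_nonneg.2 h1))).add_const hΩ _,
    ?_, fun x _ => ?_⟩
  · simp only [_root_.smax]; ring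
  · simp only [_root_.smax]
    linarith [smt_support (u a - v a) (u x - v x)]

end

/-! ### Gram matrices and Bergman kernels -/

section

variable {n : ℕ} {ι : Type} [Fintype ι] [DecidableEq ι]

set_option linter.unusedSectionVars false

open scoped MatrixOrder in
/-- Simultaneous diagonalisation of two positive definite forms. -/
theorem exists_simultaneous_diag {A B : Matrix ι ι ℂ} (hA : A.PosDef) (hB : B.PosDef) :
    ∃ (T : Matrix ι ι ℂ) (l : ι → ℝ), (∀ i, 0 < l i) ∧ T * A * T.conjTranspose = 1 ∧
      T * B * T.conjTranspose = Matrix.diagonal fun i => (l i : ℂ) := by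
  obtain ⟨C, hC⟩ := CStarAlgebra.nonneg_iff_eq_star_mul_self.mp hA.posSemidef.nonneg
  rw [star_eq_conjTranspose] at hC
  have hCd : IsUnit C.det := isUnit_iff_ne_zero.2 fun h => hA.det_pos.ne' (by simp_all)
  have h1 : C * C⁻¹ = 1 := Matrix.mul_nonsing_inv C hCd
  have h2 : (C⁻¹).conjTranspose * C.conjTranspose = 1 := by
    rw [← conjTranspose_mul, h1, Matrix.conjTranspose_one]
  set T0 := (C⁻¹).conjTranspose with hT0
  have hinj : Injective T0.conjTranspose.mulVec := by
    rw [hT0, conjTranspose_conjTranspose]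
    exact Function.LeftInverse.injective (g := C.mulVec) fun x => by simp_all
  have hB' : (T0 * B * T0.conjTranspose).PosDef := by
    have := hB.conjTranspose_mul_mul_same hinj
    simp_all
  have h3 : T0.conjTranspose = C⁻¹ := by simp_all
  clear_value T0
  obtain ⟨U, l, hl, hUU, hd⟩ : ∃ (U : Matrix ι ι ℂ) (l : ι → ℝ), (∀ i, 0 < l i) ∧
      U.conjTranspose * U = 1 ∧ U.conjTranspose * (T0 * B * T0.conjTranspose) * U =
      Matrix.diagonal fun i => (l i : ℂ) := by
    refine ⟨hB'.isHermitian.eigenvectorUnitary, hB'.isHermitian.eigenvalues,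
      fun i => hB'.eigenvalues_pos i, ?_, ?_⟩
    · simp [← star_eq_conjTranspose]
    · simpa [star_eq_conjTranspose, comp_def] using
        hB'.isHermitian.conjStarAlgAut_star_eigenvectorUnitary
  refine ⟨U.conjTranspose * T0, l, hl, ?_, ?_⟩ <;>
    rw [conjTranspose_mul, conjTranspose_conjTranspose] <;> grind

/-- The Gram matrix of the functions `e i` for the weight `ω` on the compact set `B`. -/
def gram (B : Set (Cn n)) (e : ι → Cn n → ℂ) (ω : Cn n → ℝ) : Matrix ι ι ℂ :=
  of fun i j => ∫ z in B, e i z * conj (e j z) * (ω z : ℂ)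

/-- The Bergman kernel on the diagonal. -/
def berg (B : Set (Cn n)) (e : ι → Cn n → ℂ) (ω : Cn n → ℝ) (z : Cn n) : ℝ :=
  (dotProduct (star fun i => e i z) ((gram B e ω)⁻¹.mulVec fun i => e i z)).re

variable {B : Set (Cn n)} {e : ι → Cn n → ℂ} {ω ω' φ : Cn n → ℝ}

theorem gram_conj (hB : IsCompact B) (he : ∀ i, Continuous (e i)) (hω : Continuous ω)
    (T : Matrix ι ι ℂ) (i j : ι) :
    (T * gram B e ω * T.conjTranspose) i j =
      ∫ z in B, (T.mulVec fun l => e l z) i * conj ((T.mulVec fun l => e l z) j) *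
        (ω z : ℂ) := by
  have hI : ∀ p q : ι, Integrable (fun z => T i p * (e p z * conj (e q z) * (ω z : ℂ)) *
      conj (T j q)) (volume.restrict B) := fun p q =>
    ContinuousOn.integrableOn_compact hB (by fun_prop)
  have e1 : ∀ z, (T.mulVec fun l => e l z) i * conj ((T.mulVec fun l => e l z) j) *
      (ω z : ℂ) = ∑ q, ∑ p, T i p * (e p z * conj (e q z) * (ω z : ℂ)) *
      conj (T j q) := fun z => by
    simp only [mulVec, dotProduct, map_sum, map_mul, sum_mul, mul_sum]
    grind
  simp only [e1]
  rw [integral_finsetSum _ fun q _ => integrable_finsetSum _ fun p _ => hI p q, Matrix.mul_apply]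
  refine sum_congr rfl fun q _ => ?_
  rw [integral_finsetSum _ fun p _ => hI p q, Matrix.mul_apply, sum_mul]
  refine sum_congr rfl fun p _ => ?_
  simp [integral_mul_const, integral_const_mul, gram]

theorem ofReal_integral_norm_sq (f : Cn n → ℂ) : ∫ z in B, f z * conj (f z) * (ω z : ℂ) =
      ((∫ z in B, ‖f z‖ ^ 2 * ω z : ℝ) : ℂ) := by
  refine Eq.trans (integral_congr_ae (.of_forall fun z => ?_)) integral_ofReal
  simp only [mul_conj, normSq_eq_norm_sq]
  simp

theorem integrableOn_norm_mulVec (hB : IsCompact B) (he : ∀ i, Continuous (e i)) {w : Cn n → ℝ}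
    (T : Matrix ι ι ℂ) (i : ι) (hw : Continuous w) :
    IntegrableOn (fun z => ‖(T.mulVec fun j => e j z) i‖ ^ 2 * w z) B :=
  ContinuousOn.integrableOn_compact hB (by fun_prop)

/-- Positivity of the Gram matrix. -/
theorem gram_posDef (hB : IsCompact B) (he : ∀ i, Continuous (e i)) (hω : Continuous ω)
    (hpos : ∀ z, 0 < ω z)
    (hLI : ∀ c : ι → ℂ, (∀ z ∈ interior B, ∑ i, c i * e i z = 0) → c = 0) :
    (gram B e ω).PosDef := by
  have hform : ∀ x : ι → ℂ, dotProduct (star x) ((gram B e ω).mulVec x) =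
      ((∫ z in B, ‖∑ i, conj (x i) * e i z‖ ^ 2 * ω z : ℝ) : ℂ) := fun x => by
    have hI : ∀ p q : ι, Integrable (fun z => conj (x p) *
        (e p z * conj (e q z) * (ω z : ℂ)) * x q) (volume.restrict B) := fun p q =>
      ContinuousOn.integrableOn_compact hB (by fun_prop)
    rw [← ofReal_integral_norm_sq]
    have e1 : ∀ z, (∑ i, conj (x i) * e i z) *
        conj (∑ i, conj (x i) * e i z) * (ω z : ℂ) = ∑ p, ∑ q,
        conj (x p) * (e p z * conj (e q z) * (ω z : ℂ)) * x q := fun z => by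
      simp only [map_sum, map_mul, sum_mul, mul_sum, starRingEnd_self_apply]
      rw [sum_comm]
      grind
    simp only [e1]
    rw [integral_finsetSum _ fun q _ => integrable_finsetSum _ fun p _ => hI q p, dotProduct]
    refine sum_congr rfl fun p _ => ?_
    rw [integral_finsetSum _ fun q _ => hI p q, mulVec, dotProduct, mul_sum]
    refine sum_congr rfl fun q _ => ?_
    rw [integral_mul_const, integral_const_mul, gram, of_apply]
    simp only [Pi.star_apply, RCLike.star_def, mul_assoc]
  refine Matrix.PosDef.of_dotProduct_mulVec_pos ?_ fun x hx => ?_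
  · ext i j
    simp only [gram, conjTranspose_apply, of_apply, RCLike.star_def]
    rw [← integral_conj]
    refine integral_congr_ae (.of_forall fun z => ?_)
    simp only [map_mul, starRingEnd_self_apply, conj_ofReal]
    ring
  · rw [hform]
    have hc2 : Continuous fun z => ‖∑ i, conj (x i) * e i z‖ ^ 2 * ω z := by fun_prop
    have h0 : 0 ≤ ∫ z in B, ‖∑ i, conj (x i) * e i z‖ ^ 2 * ω z :=
      integral_nonneg fun z => mul_nonneg (by positivity) (hpos z).le
    refine Complex.zero_lt_real.2 (lt_of_le_of_ne h0 fun h => hx ?_)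
    have h1 := (setIntegral_eq_zero_iff_of_nonneg_ae (.of_forall fun z =>
      mul_nonneg (by positivity) (hpos z).le) (hc2.continuousOn.integrableOn_compact hB)).1 h.symm
    have h3 := Measure.eqOn_open_of_ae_eq (ae_restrict_of_ae_restrict_of_subset interior_subset h1)
      isOpen_interior hc2.continuousOn continuousOn_const
    have h4 := hLI (fun i => conj (x i)) fun z hz => by simpa [(hpos z).ne'] using h3 hz
    ext i
    simpa using congrFun h4 i

theorem berg_eq {T : Matrix ι ι ℂ} (hT : T * gram B e ω * T.conjTranspose = 1) (z : Cn n) :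
    berg B e ω z = ∑ i, ‖(T.mulVec fun l => e l z) i‖ ^ 2 := by
  have h1 : (gram B e ω)⁻¹ = T.conjTranspose * T := by
    refine Matrix.inv_eq_right_inv ?_
    rw [← mul_assoc]
    exact mul_eq_one_comm.1 (by grind)
  rw [berg, h1, ← mulVec_mulVec, dotProduct_mulVec, ← star_mulVec,
    dotProduct, re_sum]
  refine sum_congr rfl fun i _ => ?_
  rw [Pi.star_apply, RCLike.star_def, mul_comm, mul_conj, ofReal_re,
    normSq_eq_norm_sq]

/-- A weight adapted pair of bases: orthonormal for `ω`, orthogonal for `ω'`. -/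
theorem exists_bases (hB : IsCompact B) (he : ∀ i, Continuous (e i)) (hω : Continuous ω)
    (hω' : Continuous ω') (hP : (gram B e ω).PosDef) (hP' : (gram B e ω').PosDef) :
    ∃ (T : Matrix ι ι ℂ) (l : ι → ℝ), T * gram B e ω * T.conjTranspose = 1 ∧ (∀ i, 0 < l i) ∧
      (∀ i, ∫ z in B, ‖(T.mulVec fun j => e j z) i‖ ^ 2 * ω z = 1) ∧
      (∀ i, ∫ z in B, ‖(T.mulVec fun j => e j z) i‖ ^ 2 * ω' z = l i) ∧
      log (gram B e ω').det.re - log (gram B e ω).det.re = ∑ i, log (l i) := by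
  obtain ⟨T, l, hl, h1, h2⟩ := exists_simultaneous_diag hP hP'
  refine ⟨T, l, h1, hl, fun i => ?_, fun i => ?_, ?_⟩
  · have := congrFun (congrFun h1 i) i
    rw [gram_conj hB he hω, ofReal_integral_norm_sq, one_apply_eq] at this
    simp_all
  · have := congrFun (congrFun h2 i) i
    rw [gram_conj hB he hω', ofReal_integral_norm_sq, Matrix.diagonal_apply_eq] at this
    simp_all
  · have hdet : ∀ G : Matrix ι ι ℂ, (T * G * T.conjTranspose).det.re =
        normSq T.det * G.det.re := fun G => by
      rw [det_mul, det_mul, det_conjTranspose, RCLike.star_def,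
        mul_right_comm, mul_conj, re_ofReal_mul]
    have d1 := hdet (gram B e ω)
    have d2 := hdet (gram B e ω')
    rw [h1, det_one, one_re] at d1
    rw [h2, Matrix.det_diagonal, ← Complex.ofReal_prod, ofReal_re] at d2
    have p1 : 0 < (gram B e ω).det.re := (pos_iff.1 hP.det_pos).1
    have p2 : 0 < (gram B e ω').det.re := (pos_iff.1 hP'.det_pos).1
    have hne : normSq T.det ≠ 0 := by grind
    rw [← Real.log_prod (fun i _ => (hl i).ne'), d2, log_mul hne p2.ne']
    have d3 := congrArg log d1
    rw [Real.log_one, log_mul hne p1.ne'] at d3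
    linarith

theorem exists_orthonormal (hB : IsCompact B) (he : ∀ i, Continuous (e i)) (hω : Continuous ω) (hP : (gram B e ω).PosDef) : ∃ T : Matrix ι ι ℂ, T * gram B e ω * T.conjTranspose = 1 := by
  obtain ⟨T, -, h, -⟩ := exists_bases hB he hω hω hP hP
  grind

theorem continuous_berg (hB : IsCompact B) (he : ∀ i, Continuous (e i)) (hω : Continuous ω) (hP : (gram B e ω).PosDef) : Continuous (berg B e ω) := by
  obtain ⟨T, hT⟩ := exists_orthonormal hB he hω hP
  rw [funext (berg_eq hT)]
  fun_prop

theorem logdet_le (hB : IsCompact B) (he : ∀ i, Continuous (e i)) (hω : Continuous ω) (hω' : Continuous ω') (hP : (gram B e ω).PosDef) (hP' : (gram B e ω').PosDef) : log (gram B e ω').det.re - log (gram B e ω).det.re ≤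
    ∫ z in B, berg B e ω z * (ω' z - ω z) := by
  obtain ⟨T, l, hT, hl, h1, h2, h3⟩ := exists_bases hB he hω hω' hP hP'
  have hI := fun w i => integrableOn_norm_mulVec (w := w) hB he T i
  simp only [berg_eq hT, sum_mul]
  rw [h3, integral_finsetSum _ fun i _ => hI (fun z => ω' z - ω z) i (hω'.sub hω)]
  refine sum_le_sum fun i _ => ?_
  simp only [mul_sub]
  rw [integral_sub (hI _ i hω') (hI _ i hω), h1, h2]
  exact Real.log_le_sub_one_of_pos (hl i)

theorem le_logdet (hB : IsCompact B) (he : ∀ i, Continuous (e i)) (hω : Continuous ω) (hω' : Continuous ω') (hP : (gram B e ω).PosDef) (hP' : (gram B e ω').PosDef) (hpos : ∀ z, 0 < ω z) (hpos' : ∀ z, 0 < ω' z) :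
    ∫ z in B, berg B e ω z * ω z * (log (ω' z) - log (ω z)) ≤
    log (gram B e ω').det.re - log (gram B e ω).det.re := by
  obtain ⟨T, l, hT, hl, h1, h2, h3⟩ := exists_bases hB he hω hω' hP hP'
  have hI := fun w i => integrableOn_norm_mulVec (w := w) hB he T i
  have hlc : Continuous fun z => ω z * (log (ω' z) - log (ω z)) :=
    hω.mul ((hω'.log fun z => (hpos' z).ne').sub (hω.log fun z => (hpos z).ne'))
  simp only [berg_eq hT, sum_mul, mul_assoc]
  rw [h3, integral_finsetSum _ fun i _ => hI _ i hlc]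
  refine sum_le_sum fun i _ => ?_
  have hle : ∫ z in B, ‖(T.mulVec fun j => e j z) i‖ ^ 2 *
      (ω z * (log (ω' z) - log (ω z))) ≤
      ∫ z in B, ((log (l i) - 1) * (‖(T.mulVec fun j => e j z) i‖ ^ 2 * ω z) +
        (l i)⁻¹ * (‖(T.mulVec fun j => e j z) i‖ ^ 2 * ω' z)) := by
    refine integral_mono (hI _ i hlc) (((hI _ i hω).const_mul _).add ((hI _ i hω').const_mul _))
      fun z => ?_
    have hx := Real.log_le_sub_one_of_pos (div_pos (div_pos (hpos' z) (hpos z)) (hl i))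
    rw [log_div (div_pos (hpos' z) (hpos z)).ne' (hl i).ne',
      log_div (hpos' z).ne' (hpos z).ne'] at hx
    have h4 : ω z * (ω' z / ω z / l i) = (l i)⁻¹ * ω' z := by grind
    have h5 : ω z * (log (ω' z) - log (ω z)) ≤
        (log (l i) - 1) * ω z + (l i)⁻¹ * ω' z := by nlinarith [hpos z]
    have h6 : 0 ≤ ‖(T.mulVec fun j => e j z) i‖ ^ 2 := by positivity
    nlinarith [mul_le_mul_of_nonneg_left h5 h6]
  rw [integral_add ((hI _ i hω).const_mul _) ((hI _ i hω').const_mul _), integral_const_mul,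
    integral_const_mul, h1, h2, inv_mul_cancel₀ (hl i).ne'] at hle
  linarith

theorem norm_sq_le_berg (hB : IsCompact B) (he : ∀ i, Continuous (e i)) (hω : Continuous ω) (hP : (gram B e ω).PosDef) (c : ι → ℂ) (a : Cn n) :
    ‖∑ i, c i * e i a‖ ^ 2 ≤ berg B e ω a * ∫ z in B, ‖∑ i, c i * e i z‖ ^ 2 * ω z := by
  obtain ⟨T, hT⟩ := exists_orthonormal hB he hω hP
  have hTu : IsUnit T.det := isUnit_iff_ne_zero.2 fun h => by simpa [h] using congrArg Matrix.det hT
  set d := vecMul c T⁻¹ with hd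
  have hexp : ∀ z, ∑ i, c i * e i z = ∑ i, d i * (T.mulVec fun l => e l z) i := fun z => by
    change dotProduct c _ = dotProduct d _
    rw [hd, ← dotProduct_mulVec, mulVec_mulVec, Matrix.nonsing_inv_mul T hTu, one_mulVec]
  have hInt : ∫ z in B, ‖∑ i, c i * e i z‖ ^ 2 * ω z = ∑ i, ‖d i‖ ^ 2 := by
    have h1 : ((∫ z in B, ‖∑ i, c i * e i z‖ ^ 2 * ω z : ℝ) : ℂ) = ((∑ i, ‖d i‖ ^ 2 : ℝ) : ℂ) := by
      have hI : ∀ p q : ι, Integrable (fun z => d q * ((T.mulVec fun l => e l z) q *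
          conj ((T.mulVec fun l => e l z) p) * (ω z : ℂ)) * conj (d p))
          (volume.restrict B) := fun p q =>
        ContinuousOn.integrableOn_compact hB (by fun_prop)
      rw [← ofReal_integral_norm_sq]
      have e1 : ∀ z, (∑ i, c i * e i z) * conj (∑ i, c i * e i z) * (ω z : ℂ) =
          ∑ q, ∑ p, d q * ((T.mulVec fun l => e l z) q *
          conj ((T.mulVec fun l => e l z) p) * (ω z : ℂ)) * conj (d p) := fun z => by
        simp only [hexp, map_sum, map_mul, sum_mul, mul_sum]
        rw [sum_comm]
        grind
      simp only [e1]
      rw [integral_finsetSum _ fun q _ => integrable_finsetSum _ fun p _ => hI p q]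
      push_cast
      refine sum_congr rfl fun q _ => ?_
      rw [integral_finsetSum _ fun p _ => hI p q, sum_eq_single q]
      · rw [integral_mul_const, integral_const_mul, ← gram_conj hB he hω, hT, one_apply_eq,
          mul_one, mul_conj, normSq_eq_norm_sq]
        simp
      · intro p _ hp
        rw [integral_mul_const, integral_const_mul, ← gram_conj hB he hω, hT,
          Matrix.one_apply_ne hp.symm, mul_zero, zero_mul]
      · simp
    exact_mod_cast h1
  rw [hInt, berg_eq hT, hexp, mul_comm]
  have h1 : ‖∑ i, d i * (T.mulVec fun l => e l a) i‖ ≤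
      ∑ i, ‖d i‖ * ‖(T.mulVec fun l => e l a) i‖ := (norm_sum_le _ _).trans (by simp)
  exact (pow_le_pow_left₀ (norm_nonneg _) h1 2).trans (Finset.sum_mul_sq_le_sq_mul_sq _ _ _)

theorem berg_nonneg (hB : IsCompact B) (he : ∀ i, Continuous (e i)) (hω : Continuous ω) (hP : (gram B e ω).PosDef) (a : Cn n) : 0 ≤ berg B e ω a := by
  obtain ⟨T, hT⟩ := exists_orthonormal hB he hω hP
  rw [berg_eq hT]
  positivity

/-- Extremal characterisation of the Bergman kernel. -/
theorem berg_le (hB : IsCompact B) (he : ∀ i, Continuous (e i)) (hω : Continuous ω) (hP : (gram B e ω).PosDef) {C : ℝ} {a : Cn n} (hC : 0 ≤ C)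
    (h : ∀ c : ι → ℂ, ‖∑ i, c i * e i a‖ ^ 2 ≤ C * ∫ z in B, ‖∑ i, c i * e i z‖ ^ 2 * ω z) :
    berg B e ω a ≤ C := by
  set x : ι → ℂ := fun i => e i a
  set G := gram B e ω with hG
  obtain ⟨T, hT⟩ := exists_orthonormal hB he hω hP
  set K := berg B e ω a with hK
  have hK0 : 0 ≤ K := berg_nonneg hB he hω hP a
  set d : ι → ℂ := star (T.mulVec x) with hd
  set c := vecMul d T with hc
  have hexp : ∀ z, ∑ i, c i * e i z = ∑ i, d i * (T.mulVec fun l => e l z) i := fun z => by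
    exact (dotProduct_mulVec d T _).symm
  have hval : ‖∑ i, c i * e i a‖ = K := by
    rw [hexp, hK, berg_eq hT]
    have : ∑ i, d i * (T.mulVec fun l => e l a) i =
        ((∑ i, ‖(T.mulVec fun l => e l a) i‖ ^ 2 : ℝ) : ℂ) := by
      push_cast
      refine sum_congr rfl fun i _ => ?_
      rw [hd, Pi.star_apply, RCLike.star_def, mul_comm, mul_conj, normSq_eq_norm_sq]
      simp
    rw [this, norm_real, norm_of_nonneg (by positivity)]
  have hInt : ((∫ z in B, ‖∑ i, c i * e i z‖ ^ 2 * ω z : ℝ) : ℂ) = (K : ℂ) := by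
    rw [← ofReal_integral_norm_sq]
    have h1 := gram_conj hB he hω (of fun _ : ι => c)
    have hc0 : ∀ z (i : ι), ((of fun _ : ι => c).mulVec fun l => e l z) i =
        ∑ l, c l * e l z := fun z i => rfl
    rcases isEmpty_or_nonempty ι with hι | ⟨⟨i⟩⟩
    · simp [hK, berg]
    have h2 := h1 i i
    simp only [hc0] at h2
    rw [← h2]
    rw [show (of fun _ : ι => c) = (of fun _ : ι => d) * T from rfl, conjTranspose_mul]
    have h4 : (of fun _ : ι => d) * T * G * (T.conjTranspose *
        (of fun _ : ι => d).conjTranspose) = (of fun _ : ι => d) *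
        (T * G * T.conjTranspose) * (of fun _ : ι => d).conjTranspose := by grind
    rw [h4, hT, mul_one, Matrix.mul_apply, hK, berg_eq hT]
    push_cast
    refine sum_congr rfl fun l _ => ?_
    rw [conjTranspose_apply, of_apply, RCLike.star_def, mul_conj,
      normSq_eq_norm_sq, hd, Pi.star_apply, RCLike.star_def, RCLike.norm_conj]
    push_cast
    rfl
  have h1 := h c
  rw [hval, show ∫ z in B, ‖∑ i, c i * e i z‖ ^ 2 * ω z = K by simp_all] at h1
  rcases hK0.eq_or_lt with h0 | h0 <;> nlinarith

/-- The comparison inequality between Bergman kernels of two weights. -/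
theorem berg_comparison (hB : IsCompact B) (he : ∀ i, Continuous (e i)) (hω : Continuous ω)
    (hφ : Continuous φ) (hpos : ∀ z, 0 < φ z) (hle : ∀ z, φ z ≤ ω z)
    (hLI : ∀ c : ι → ℂ, (∀ z ∈ interior B, ∑ i, c i * e i z = 0) → c = 0)
    (hK : ∀ z, 0 < berg B e ω z) :
    ∫ z in B, berg B e φ z * φ z * max 0 (- log (berg B e ω z) - log (φ z)) ≤
      volume.real B + ∫ z in B, berg B e ω z * ω z * (log (ω z) - log (φ z)) := by
  have hposω : ∀ z, 0 < ω z := fun z => (hpos z).trans_le (hle z)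
  have hP := gram_posDef hB he hω hposω hLI
  have hPφ := gram_posDef hB he hφ hpos hLI
  have hKc := continuous_berg hB he hω hP
  set ψ : Cn n → ℝ := fun z => max (φ z) (berg B e ω z)⁻¹ with hψ'
  have hψ : Continuous ψ := hφ.max (hKc.inv₀ fun z => (hK z).ne')
  have hψpos : ∀ z, 0 < ψ z := fun z => (hpos z).trans_le (le_max_left _ _)
  have hPψ := gram_posDef hB he hψ hψpos hLI
  have j1 := le_logdet hB he hφ hψ hPφ hPψ hpos hψpos
  have j2 := le_logdet hB he hω hφ hP hPφ hposω hpos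
  have t := logdet_le hB he hω hψ hP hPψ
  have t2 : ∫ z in B, berg B e ω z * (ψ z - ω z) ≤ ∫ z in B, (1:ℝ) := by
    refine integral_mono ((hKc.mul (hψ.sub hω)).continuousOn.integrableOn_compact hB)
      (continuousOn_const.integrableOn_compact hB) fun z => ?_
    show berg B e ω z * (max (φ z) (berg B e ω z)⁻¹ - ω z) ≤ 1
    rcases max_cases (φ z) (berg B e ω z)⁻¹ with ⟨h, -⟩ | ⟨h, -⟩
    · nlinarith [hK z, hle z]
    · rw [h, mul_sub, mul_inv_cancel₀ (hK z).ne']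
      nlinarith [hK z, hposω z, mul_pos (hK z) (hposω z)]
  rw [setIntegral_const, smul_eq_mul, mul_one] at t2
  have e1 : ∫ z in B, berg B e φ z * φ z * max 0 (- log (berg B e ω z) - log (φ z)) =
      ∫ z in B, berg B e φ z * φ z * (log (ψ z) - log (φ z)) := by
    refine integral_congr_ae (.of_forall fun z => ?_)
    show _ * max 0 (- log (berg B e ω z) - log (φ z)) =
      _ * (log (max (φ z) (berg B e ω z)⁻¹) - log (φ z))
    have h1 : log (max (φ z) (berg B e ω z)⁻¹) =
        max (log (φ z)) (- log (berg B e ω z)) := by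
      rw [← Real.log_inv]
      exact (Real.strictMonoOn_log.monotoneOn).map_max (mem_Ioi.2 (hpos z))
        (mem_Ioi.2 (inv_pos.2 (hK z)))
    grind
  have e2 : ∫ z in B, berg B e ω z * ω z * (log (ω z) - log (φ z)) =
      - ∫ z in B, berg B e ω z * ω z * (log (φ z) - log (ω z)) := by
    rw [← integral_neg]
    grind
  linarith

end

/-! ### The reference weight and peak polynomials -/

section

variable {n : ℕ}

theorem d2_nsq (x v w : Cn n) :
    d2 nsq x v w = ∑ j, (2 * (v j).re * (w j).re + 2 * (v j).im * (w j).im) := by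
  let re (j : Fin n) : Cn n →L[ℝ] ℝ := Complex.reCLM.comp (proj j)
  let im (j : Fin n) : Cn n →L[ℝ] ℝ := Complex.imCLM.comp (proj j)
  have h : ∀ x : Cn n, HasFDerivAt nsq
      (∑ j, ((2 * (x j).re) • re j + (2 * (x j).im) • im j)) x := fun x => by
    have h1 : HasFDerivAt (fun z : Cn n => ∑ j, (re j z ^ 2 + im j z ^ 2))
        (∑ j, ((2 * (x j).re) • re j + (2 * (x j).im) • im j)) x := by
      refine HasFDerivAt.fun_sum fun j _ => ?_
      convert ((re j).hasFDerivAt (x := x)).pow 2 |>.add (((im j).hasFDerivAt (x := x)).pow 2)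
        using 2 <;> simp [re, im]
    refine h1.congr_of_eventuallyEq (.of_forall fun z => ?_)
    simp only [nsq, normSq_apply, re, im]
    simp [sq]
  have h2 : (fun x => fderiv ℝ nsq x v) =
      ⇑(∑ j, ((2 * (v j).re) • re j + (2 * (v j).im) • im j)) := by
    ext x
    rw [(h x).fderiv, sum_apply, sum_apply]
    refine sum_congr rfl fun j _ => ?_
    simp [re, im]
    ring
  rw [d2, h2, ContinuousLinearMap.fderiv, sum_apply]
  simp [re, im]

theorem cHess_nsq (x : Cn n) : cHess nsq x = 1 := by
  have hs : ∀ (i j : Fin n) (c : ℂ), (Pi.single i c : Cn n) j = if j = i then c else 0 :=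
    fun i j c => Pi.single_apply i c j
  ext i j
  simp only [cHess, of_apply, d2_nsq, hs, Matrix.one_apply]
  by_cases h : i = j
  · subst h
    have e1 : ∀ c d : ℂ, ∑ l : Fin n, (2 * (if l = i then c else 0).re * (if l = i then d else 0).re +
        2 * (if l = i then c else 0).im * (if l = i then d else 0).im) =
        2 * c.re * d.re + 2 * c.im * d.im := fun c d => by
      rw [sum_eq_single i (fun l _ hl => by simp [hl]) (by simp)]
      simp
    simp only [e1]
    norm_num
  · have e1 : ∀ c d : ℂ, ∑ l : Fin n, (2 * (if l = i then c else 0).re * (if l = j then d else 0).re +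
        2 * (if l = i then c else 0).im * (if l = j then d else 0).im) = 0 := fun c d => by
      refine sum_eq_zero fun l _ => ?_
      by_cases hl : l = i
      · simp_all
      · simp [hl]
    simp_all

theorem spsh_nsq : SPSH (nsq : Cn n → ℝ) :=
  ⟨contDiff_nsq, fun x => by rw [cHess_nsq]; exact Matrix.PosSemidef.one⟩

theorem bounded_on_ball {f : Cn n → ℝ} (hf : Continuous f) (a : Cn n) (R : ℝ) :
    ∃ C, ∀ x ∈ ball a R, |f x| ≤ C := by
  obtain ⟨C, hC⟩ := (isCompact_closedBall a R).exists_bound_of_continuousOn hf.continuousOn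
  exact ⟨C, fun x hx => hC x (ball_subset_closedBall hx)⟩

theorem lpsh_nsq (R : ℝ) : LPSH (nsq : Cn n → ℝ) (ball 0 R) := by
  refine LPSH.of_submean continuous_nsq.continuousOn.upperSemicontinuousOn
    (bounded_on_ball continuous_nsq 0 R) fun a ha b => ?_
  filter_upwards [self_mem_nhdsWithin] with r hr
  have e : ∀ w : ℂ, nsq a + (2 * ∑ j, conj (a j) * (w * b j)).re ≤ nsq (a + w • b) := fun w => by
    have : nsq (a + w • b) = nsq a + (2 * ∑ j, conj (a j) * (w * b j)).re +
        nsq (w • b) := by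
      simp only [nsq, mul_sum, re_sum, ← sum_add_distrib, Pi.add_apply,
        Pi.smul_apply, smul_eq_mul]
      refine sum_congr rfl fun j _ => ?_
      rw [normSq_add, ← conj_re (a j * _)]
      simp
      ring
    linarith [nsq_nonneg (w • b)]
  have hd : Differentiable ℂ fun w : ℂ => (nsq a : ℂ) + 2 * ∑ j, conj (a j) * (w * b j) :=
    by fun_prop
  have h1 := circleAverage_re hr hd.diffContOnCl (a := 0)
  have h2 : nsq a = circleAverage
      (fun w : ℂ => nsq a + (2 * ∑ j, conj (a j) * (w * b j)).re) 0 r := by simp_all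
  rw [h2]
  refine circleAverage_mono ?_ ?_ fun w _ => e w
  · fun_prop
  · exact (continuous_nsq.comp (by fun_prop)).continuousOn.circleIntegrable'

/-- The reference weight. -/
def phi0 (z : Cn n) : ℝ := ∑ j, 1 / 2 * log (1 + normSq (z j))

theorem rsm_phi0 : RSm (phi0 : Cn n → ℝ) := by
  have : ContDiff ℝ (⊤ : ℕ∞) fun z : ℂ => normSq z := by
    have h1 : ContDiff ℝ (⊤ : ℕ∞) Complex.re := Complex.reCLM.contDiff
    have h2 : ContDiff ℝ (⊤ : ℕ∞) Complex.im := Complex.imCLM.contDiff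
    exact (h1.mul h1).add (h2.mul h2)
  refine ContDiff.sum fun j _ => contDiff_const.mul (ContDiff.log (contDiff_const.add
    (this.comp (contDiff_apply ℝ ℂ j))) fun z => ?_)
  have := normSq_nonneg (z j)
  positivity

theorem phi0_nonneg (z : Cn n) : 0 ≤ phi0 z := sum_nonneg fun j _ =>
  mul_nonneg (by norm_num) (Real.log_nonneg (by linarith [normSq_nonneg (z j)]))

theorem LPSH.sum {ι : Type*} {Ω : Set (Cn n)} (hΩ : IsOpen Ω) (s : Finset ι)
    {u : ι → Cn n → ℝ} (h : ∀ i ∈ s, LPSH (u i) Ω) : LPSH (fun z => ∑ i ∈ s, u i z) Ω := by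
  classical
  induction s using Finset.induction_on with
  | empty => simpa using LPSH.const 0
  | insert i s hi ih =>
    simp only [Finset.sum_insert hi]
    exact (h i (Finset.mem_insert_self i s)).add hΩ
      (ih fun j hj => h j (Finset.mem_insert_of_mem hj))

theorem lpsh_phi0 (R : ℝ) : LPSH (phi0 : Cn n → ℝ) (ball 0 R) := by
  refine LPSH.sum isOpen_ball _ fun j _ => LPSH.const_mul isOpen_ball ?_ (by norm_num)
  have e : ∀ z : Cn n, 1 + normSq (z j) = ∑ i : Fin 2, ‖(![fun _ => 1, fun z : Cn n => z j] :
      Fin 2 → Cn n → ℂ) i z‖ ^ 2 := by simp [Fin.sum_univ_two, normSq_eq_norm_sq]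
  have hpos : ∀ z : Cn n, 0 < 1 + normSq (z j) := fun z => by linarith [normSq_nonneg (z j)]
  have hc : Continuous fun z : Cn n => log (1 + normSq (z j)) :=
    Continuous.log (continuous_const.add (Complex.continuous_normSq.comp (continuous_apply j)))
      fun z => (hpos z).ne'
  have hb := bounded_on_ball hc 0 R
  simp only [e] at hpos hb ⊢
  refine LPSH.log_sum isOpen_ball (fun i => ?_) (fun z _ => hpos z) hb
  fin_cases i
  · simp
  · exact (differentiable_apply j).differentiableOn

theorem SPSH.of_lpsh {f : Cn n → ℝ} (hf : RSm f) (h : ∀ R, LPSH f (ball 0 R)) : SPSH f :=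
  ⟨hf, fun x => (h (‖x‖ + 1)).cHess_posSemidef isOpen_ball hf (by simp)⟩

/-- Monomials of degree at most `k` in each variable. -/
def mono (k : ℕ) (α : Fin n → Fin (k + 1)) (z : Cn n) : ℂ := ∏ j, z j ^ (α j : ℕ)

theorem differentiable_mono (k : ℕ) (α : Fin n → Fin (k + 1)) : Differentiable ℂ (mono k α) := by
  unfold mono
  fun_prop

theorem mono_linearIndependent (k : ℕ) (c : (Fin n → Fin (k + 1)) → ℂ)
    (h : ∀ z ∈ interior (closedBall (0 : Cn n) 4), ∑ α, c α * mono k α z = 0) : c = 0 := by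
  let s (α : Fin n → Fin (k + 1)) : Fin n →₀ ℕ := Finsupp.equivFunOnFinite.symm fun j => (α j : ℕ)
  have hs : Injective s := fun α β hαβ => by
    have := Finsupp.equivFunOnFinite.symm.injective hαβ
    ext j
    exact congrFun this j
  let p : MvPolynomial (Fin n) ℂ := ∑ α, MvPolynomial.monomial (s α) (c α)
  have hp : p = 0 := by
    refine MvPolynomial.funext_set (fun _ => ball (0:ℂ) 4) (fun _ => ?_) fun z hz => ?_
    · exact infinite_of_mem_nhds 0 (ball_mem_nhds _ (by norm_num))
    · rw [map_zero, ← h z]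
      · simp only [p, map_sum, MvPolynomial.eval_monomial]
        refine sum_congr rfl fun α _ => ?_
        rw [Finsupp.prod_fintype _ _ (by simp)]
        rfl
      · refine interior_mono ball_subset_closedBall ?_
        rw [isOpen_ball.interior_eq, mem_ball_zero_iff, pi_norm_lt_iff (by norm_num)]
        simp_all
  ext α
  have := congrArg (MvPolynomial.coeff (s α)) hp
  simp only [p, MvPolynomial.coeff_sum, MvPolynomial.coeff_monomial, MvPolynomial.coeff_zero,
    hs.eq_iff] at this
  simp_all

theorem exists_peak (k : ℕ) (b : Cn n) : ∃ c : (Fin n → Fin (k + 1)) → ℂ,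
    ∀ z, ∑ α, c α * mono k α z = ∏ j, (z j * b j + 1) ^ k := by
  refine ⟨fun α => ∏ j, (b j ^ (α j : ℕ) * (k.choose (α j) : ℂ)), fun z => ?_⟩
  have e : ∀ j, (z j * b j + 1) ^ k =
      ∑ m : Fin (k + 1), b j ^ (m : ℕ) * (k.choose m : ℂ) * z j ^ (m : ℕ) := fun j => by
    rw [add_pow, Finset.sum_range]
    refine sum_congr rfl fun m _ => ?_
    ring
  simp only [e]
  rw [Finset.prod_univ_sum, Fintype.piFinset_univ]
  refine sum_congr rfl fun α _ => ?_
  rw [mono, ← prod_mul_distrib]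

theorem integrable_gauss : Integrable fun z : Cn n => exp (-(nsq z / 289)) := by
  have h1 : Integrable fun z : ℂ => exp (-(normSq z / 289)) := by
    have := (GaussianFourier.integrable_cexp_neg_mul_sq_norm_add (V := ℂ) (b := (1 / 289 : ℝ))
      (by norm_num) 0 0).norm
    refine this.congr (.of_forall fun z => ?_)
    simp only [norm_exp]
    congr 1
    rw [normSq_eq_norm_sq]
    simp [← ofReal_pow]
    linarith
  have h2 := Integrable.fintype_prod (μ := fun _ : Fin n => (volume : Measure ℂ)) fun _ => h1
  refine h2.congr (.of_forall fun z => ?_)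
  simp only [nsq]
  rw [← exp_sum, sum_neg_distrib, sum_div]

/-- The Gaussian constant. -/
def gauss (n : ℕ) : ℝ := ∫ z : Cn n, exp (-(nsq z / 289))

theorem gauss_pos : 0 < gauss n := by exact integral_exp_pos integrable_gauss

theorem integral_gauss_scale {k : ℕ} (hk : 0 < k) (a : Cn n) :
    Integrable (fun z : Cn n => exp (-(k * nsq (z - a) / 289))) ∧
    ∫ z : Cn n, exp (-(k * nsq (z - a) / 289)) = gauss n / (k : ℝ) ^ n := by
  have hk' : (0:ℝ) < k := by positivity
  have e : ∀ z : Cn n, exp (-(k * nsq z / 289)) =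
      exp (-(nsq (sqrt k • z) / 289)) := fun z => by
    have : sqrt k • z = (sqrt k : ℂ) • z := by ext; simp
    rw [this, nsq_smul, norm_real, norm_of_nonneg (Real.sqrt_nonneg _),
      sq_sqrt hk'.le]
  constructor
  · refine Integrable.comp_sub_right (f := fun z : Cn n => exp (-(k * nsq z / 289))) ?_ a
    simp only [e]
    exact (integrable_comp_smul_iff volume (fun z : Cn n => exp (-(nsq z / 289)))
      (Real.sqrt_pos.2 hk').ne').2 integrable_gauss
  · rw [integral_sub_right_eq_self (fun z : Cn n => exp (-(k * nsq z / 289))) a]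
    simp only [e]
    rw [Measure.integral_comp_smul volume (fun z : Cn n => exp (-(nsq z / 289)))]
    have hfr : Module.finrank ℝ (Cn n) = 2 * n := by
      rw [Module.finrank_pi_fintype]
      simp [mul_comm]
    rw [hfr, pow_mul, sq_sqrt hk'.le, abs_of_pos (by positivity), smul_eq_mul, gauss]
    ring

theorem exp_phi0 (k : ℕ) (z : Cn n) :
    exp (2 * k * phi0 z) = ∏ j, (1 + normSq (z j)) ^ k := by
  rw [phi0, mul_sum, exp_sum]
  refine prod_congr rfl fun j _ => ?_
  have : 0 < 1 + normSq (z j) := by linarith [normSq_nonneg (z j)]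
  rw [show 2 * (k:ℝ) * (1 / 2 * log (1 + normSq (z j))) =
    k * log (1 + normSq (z j)) by ring, ← log_pow, exp_log (by positivity)]

/-- The Bergman kernel of the reference weight is bounded below. -/
theorem le_berg_phi0 {k : ℕ} (hk : 0 < k) {a : Cn n} (ha : ‖a‖ ≤ 4) : (k : ℝ) ^ n / gauss n ≤
      berg (closedBall 0 4) (mono k) (fun z => exp (-(2 * k * phi0 z))) a *
        exp (-(2 * k * phi0 a)) := by
  have hB := isCompact_closedBall (0 : Cn n) 4
  have hω : Continuous fun z : Cn n => exp (-(2 * k * phi0 z)) :=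
    continuous_exp.comp (continuous_const.mul rsm_phi0.continuous).neg
  have he : ∀ α, Continuous (mono (n := n) k α) := fun α => (differentiable_mono k α).continuous
  have hP := gram_posDef hB he hω (fun z => exp_pos _) (mono_linearIndependent k)
  obtain ⟨c, hc⟩ := exists_peak k fun j => conj (a j)
  have h1 := norm_sq_le_berg hB he hω hP c a
  simp only [hc] at h1
  set K := berg (closedBall 0 4) (mono k) (fun z => exp (-(2 * k * phi0 z))) a
  have hK0 : 0 ≤ K := berg_nonneg hB he hω hP a
  have hva : ‖∏ j, (a j * conj (a j) + 1) ^ k‖ = exp (2 * k * phi0 a) := by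
    rw [exp_phi0, norm_prod]
    refine prod_congr rfl fun j _ => ?_
    have : a j * conj (a j) + 1 = ((1 + normSq (a j) : ℝ) : ℂ) := by rw [mul_conj]; push_cast; ring
    rw [norm_pow, this, norm_real, norm_of_nonneg
      (by linarith [normSq_nonneg (a j)])]
  have hpt : ∀ z ∈ closedBall (0 : Cn n) 4, ‖∏ j, (z j * conj (a j) + 1) ^ k‖ ^ 2 *
      exp (-(2 * k * phi0 z)) ≤
      exp (2 * k * phi0 a) * exp (-(k * nsq (z - a) / 289)) := fun z hz => by
    have hz' : ‖z‖ ≤ 4 := by simp_all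
    have e1 : exp (-(k * nsq (z - a) / 289)) =
        ∏ j, exp (-(normSq (z j - a j) / 289)) ^ k := by
      simp only [← Real.exp_nat_mul]
      rw [← exp_sum]
      congr 1
      simp only [nsq, Pi.sub_apply, mul_sum, sum_div, ← sum_neg_distrib]
      grind
    rw [exp_neg (2 * k * phi0 z), exp_phi0, exp_phi0, e1, norm_prod, ← Finset.prod_pow,
      ← Finset.prod_inv_distrib, ← prod_mul_distrib, ← prod_mul_distrib]
    refine Finset.prod_le_prod (fun j _ => ?_) fun j _ => ?_
    · have := normSq_nonneg (z j)
      positivity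
    · rw [norm_pow, ← pow_mul, mul_comm k 2, pow_mul, ← inv_pow, ← mul_pow, ← mul_pow]
      have hzj := normSq_nonneg (z j)
      have haj := normSq_nonneg (a j)
      have hz1 : normSq (z j) ≤ 16 := by
        rw [normSq_eq_norm_sq]
        nlinarith [norm_le_pi_norm z j, norm_nonneg (z j)]
      have ha1 : normSq (a j) ≤ 16 := by
        rw [normSq_eq_norm_sq]
        nlinarith [norm_le_pi_norm a j, norm_nonneg (a j)]
      refine pow_le_pow_left₀ (by positivity) ?_ k
      have hid : ‖z j * conj (a j) + 1‖ ^ 2 =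
          (1 + normSq (z j)) * (1 + normSq (a j)) - normSq (z j - a j) := by
        rw [← normSq_eq_norm_sq]
        simp only [normSq_apply, add_re, mul_re, conj_re,
          conj_im, one_re, add_im, mul_im, Complex.one_im,
          sub_re, sub_im]
        ring
      rw [hid]
      have hd := normSq_nonneg (z j - a j)
      set x := normSq (z j)
      set y := normSq (a j)
      set d := normSq (z j - a j)
      have hexp := Real.add_one_le_exp (-(d / 289))
      rw [← div_eq_mul_inv, div_le_iff₀ (by positivity)]
      have h289 : (1 + x) * (1 + y) ≤ 289 := by nlinarith
      have h0 : 0 < (1 + y) * (1 + x) := by positivity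
      calc (1 + x) * (1 + y) - d ≤ (1 + y) * (1 + x) * (-(d / 289) + 1) := by nlinarith
        _ ≤ (1 + y) * (1 + x) * exp (-(d / 289)) := mul_le_mul_of_nonneg_left hexp h0.le
        _ = _ := by ring
  have hInt : ∫ z in closedBall (0 : Cn n) 4, ‖∏ j, (z j * conj (a j) + 1) ^ k‖ ^ 2 *
      exp (-(2 * k * phi0 z)) ≤ exp (2 * k * phi0 a) * (gauss n / (k : ℝ) ^ n) := by
    obtain ⟨hI, hG⟩ := integral_gauss_scale hk a
    rw [← hG, ← integral_const_mul]
    have hJ := hI.const_mul (exp (2 * k * phi0 a))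
    refine (setIntegral_mono_on ?_ hJ.integrableOn measurableSet_closedBall hpt).trans
      (setIntegral_le_integral hJ (.of_forall fun z => by positivity))
    refine ContinuousOn.integrableOn_compact hB (Continuous.continuousOn ?_)
    fun_prop
  rw [hva] at h1
  have h2 := h1.trans (mul_le_mul_of_nonneg_left hInt hK0)
  set E := exp (2 * k * phi0 a) with hE
  have hE0 : 0 < E := exp_pos _
  have hk' : (0:ℝ) < (k:ℝ) ^ n := by positivity
  rw [exp_neg, div_le_iff₀ gauss_pos]
  have h3 : E ≤ K * (gauss n / (k : ℝ) ^ n) := by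
    refine le_of_mul_le_mul_left ?_ hE0
    linarith
  have h4 : E * (k : ℝ) ^ n ≤ K * gauss n := by
    calc E * (k : ℝ) ^ n ≤ K * (gauss n / (k : ℝ) ^ n) * (k : ℝ) ^ n :=
          mul_le_mul_of_nonneg_right h3 hk'.le
      _ = _ := by field_simp
  calc (k : ℝ) ^ n = E⁻¹ * (E * (k : ℝ) ^ n) := by field_simp
    _ ≤ E⁻¹ * (K * gauss n) := mul_le_mul_of_nonneg_left h4 (inv_pos.2 hE0).le
    _ = _ := by ring

end

/-! ### Upper bounds for Bergman kernels -/

section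

variable {n : ℕ}

theorem dotProduct_star_self (x : Cn n) : (dotProduct (star x) x).re = nsq x := by
  rw [dotProduct, re_sum, nsq]
  refine sum_congr rfl fun j _ => ?_
  rw [Pi.star_apply, RCLike.star_def, mul_comm, mul_conj, ofReal_re]

theorem nsq_star (x : Cn n) : nsq (star x) = nsq x := by simp [nsq]

open scoped MatrixOrder in
/-- A linear change of variables normalising the Levi form. -/
theorem exists_levi_normalization {U : Cn n → ℝ} {a : Cn n}
    (hP : (cHess U a).PosDef) : ∃ N : Cn n →ₗ[ℂ] Cn n,
      (∀ y, levi U a (N y) = nsq y) ∧ normSq (LinearMap.det N) * mav U a = 1 := by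
  obtain ⟨C, hC⟩ := CStarAlgebra.nonneg_iff_eq_star_mul_self.mp hP.posSemidef.nonneg
  rw [star_eq_conjTranspose] at hC
  have hCd : C.det ≠ 0 := fun h => hP.det_pos.ne' (by simp_all)
  have h1 : C * C⁻¹ = 1 := Matrix.mul_nonsing_inv C (isUnit_iff_ne_zero.2 hCd)
  set D : Matrix (Fin n) (Fin n) ℂ := C⁻¹.map conj with hD
  have hstar : ∀ y : Cn n, star (D.mulVec y) = C⁻¹.mulVec (star y) := fun y => by
    ext i
    simp [hD, mulVec, dotProduct]
  refine ⟨Matrix.toLin' D, fun y => ?_, ?_⟩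
  · rw [levi_eq_dotProduct, Matrix.toLin'_apply, hstar, hC, ← mulVec_mulVec,
      dotProduct_mulVec, ← star_mulVec, mulVec_mulVec, h1, one_mulVec,
      dotProduct_star_self, nsq_star]
  · have h2 : mav U a = normSq C.det := by
      have : (cHess U a).det = ((normSq C.det : ℝ) : ℂ) := by
        rw [hC, det_mul, det_conjTranspose, Complex.normSq_eq_conj_mul_self]
        rfl
      rw [mav, this, ofReal_re]
    have h3 : D.det = conj (C⁻¹.det) := ((starRingEnd ℂ).map_det C⁻¹).symm
    simp_all

theorem setIntegral_comp_linear_le {L : Cn n →ₗ[ℂ] Cn n} (hL : LinearMap.det L ≠ 0) {a : Cn n}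
    {B : Set (Cn n)} (hB : IsCompact B) (hmem : ∀ y ∈ closedBall (0 : Cn n) 1, a + L y ∈ B)
    {h : Cn n → ℝ} (hc : Continuous h) (h0 : ∀ z, 0 ≤ h z) :
    ∫ y in closedBall (0 : Cn n) 1, h (a + L y) ≤
      (normSq (LinearMap.det L))⁻¹ * ∫ z in B, h z := by
  set Lr := L.restrictScalars ℝ with hLr
  have hdet : LinearMap.det Lr = normSq (LinearMap.det L) := by
    rw [hLr, LinearMap.det_restrictScalars, Algebra.norm_complex_apply]
  have hdet0 : LinearMap.det Lr ≠ 0 := by simp_all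
  have hLc : Continuous fun y => Lr y := LinearMap.continuous_of_finiteDimensional Lr
  have hH : StronglyMeasurable (B.indicator h) :=
    hc.stronglyMeasurable.indicator hB.measurableSet
  have hHi : Integrable (B.indicator h) :=
    (integrable_indicator_iff hB.measurableSet).2 (hc.continuousOn.integrableOn_compact hB)
  have hmap := Measure.map_linearMap_addHaar_eq_smul_addHaar (volume : Measure (Cn n)) hdet0
  have hmeas : AEStronglyMeasurable (fun x => B.indicator h (a + x)) (Measure.map Lr volume) :=
    (hH.comp_measurable (measurable_const_add a)).aestronglyMeasurable
  have h1 : ∫ y, B.indicator h (a + Lr y) =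
      (normSq (LinearMap.det L))⁻¹ * ∫ z in B, h z := by
    rw [← integral_map hLc.aemeasurable hmeas, hmap, integral_smul_measure, integral_add_left_eq_self (B.indicator h) a,
      integral_indicator hB.measurableSet, hdet, abs_of_nonneg
      (inv_nonneg.2 (normSq_nonneg _)), toReal_ofReal
      (inv_nonneg.2 (normSq_nonneg _)), smul_eq_mul]
  have hInt : Integrable fun y => B.indicator h (a + Lr y) := by
    refine (integrable_map_measure hmeas hLc.aemeasurable).1 ?_
    rw [hmap]
    exact (hHi.comp_add_left a).smul_measure ofReal_ne_top
  rw [← h1]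
  refine le_trans (le_of_eq (setIntegral_congr_fun measurableSet_closedBall fun y hy => ?_))
    (setIntegral_le_integral hInt (.of_forall fun y =>
      indicator_nonneg (fun z _ => h0 z) _))
  simp_all

/-- The strictly plurisubharmonic function attached to `f`. -/
def upot (M : ℝ) (f : Cn n → ℝ) (z : Cn n) : ℝ := phi0 z + M * f z + nsq z

theorem spsh_phi0 : SPSH (phi0 : Cn n → ℝ) := SPSH.of_lpsh rsm_phi0 lpsh_phi0

theorem SPSH.upot {f : Cn n → ℝ} (hf : SPSH f) {M : ℝ} (hM : 0 ≤ M) : SPSH (upot M f) :=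
  (spsh_phi0.add (hf.const_mul hM)).add spsh_nsq

theorem cHess_upot {f : Cn n → ℝ} (hf : SPSH f) {M : ℝ} (hM : 0 ≤ M) (a : Cn n) :
    (cHess (upot M f) a).PosDef ∧ ∀ ζ, nsq ζ ≤ levi (upot M f) a ζ := by
  have hq := spsh_phi0.add (hf.const_mul hM)
  have e : cHess (_root_.upot M f) a = 1 + cHess (fun z => phi0 z + M * f z) a := by
    rw [add_comm, ← cHess_nsq a, ← cHess_add hq.1 contDiff_nsq]
    rfl
  rw [e]
  refine ⟨Matrix.PosDef.one.add_posSemidef (hq.2 a), fun ζ => ?_⟩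
  have h1 := (nonneg_iff.1 ((hq.2 a).dotProduct_mulVec_nonneg (star ζ))).1
  rw [levi_eq_dotProduct, e, add_mulVec, one_mulVec, dotProduct_add, add_re,
    dotProduct_star_self, nsq_star]
  linarith

/-- The sub-mean value estimate on ellipsoids adapted to the Levi form. -/
theorem exists_pointwise_bound (n : ℕ) : ∃ C > 0, ∀ (f g : Cn n → ℝ) (M : ℝ), 0 ≤ M → SPSH f →
    RSm g → LPSH g (ball 0 5) → ∃ k₀ : ℕ, ∀ k ≥ k₀, ∀ a : Cn n, ‖a‖ ≤ 3 → ∀ p : Cn n → ℂ,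
      Differentiable ℂ p → ‖p a‖ ^ 2 * exp (-(2 * k * (phi0 a + M * (f a - g a)))) ≤
        C * (k : ℝ) ^ n * mav (upot M f) a * ∫ z in closedBall 0 4, ‖p z‖ ^ 2 *
          exp (-(2 * k * (phi0 z + M * (f z - g z)))) := by
  obtain ⟨Cr, hCr⟩ := (hasCompactSupport_rho (n := n)).exists_bound_of_continuous
    contDiff_rho.continuous
  have hCr0 : 0 ≤ Cr := (norm_nonneg _).trans (hCr 0)
  refine ⟨(Cr + 1) * exp 2 * (n + 1) ^ n, by positivity, fun f g M hM hf hg hgl => ?_⟩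
  obtain ⟨δ, hδ, hT⟩ := exists_levi_expansion (hf.upot hM).1 (isCompact_closedBall (0 : Cn n) 3)
    one_pos
  obtain ⟨k₁, hk₁⟩ := exists_nat_gt (1 / δ ^ 2)
  refine ⟨max k₁ 4, fun k hk a ha p hp => ?_⟩
  have hk4 : (4:ℝ) ≤ k := by simp_all
  have hk0 : (0:ℝ) < k := by linarith
  have hkδ : 1 / (k:ℝ) ≤ δ ^ 2 := by
    have h1 : 1 / δ ^ 2 ≤ k := hk₁.le.trans (by simp_all)
    rw [div_le_iff₀ (by positivity)] at h1 ⊢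
    linarith
  obtain ⟨P, hP, hP0, hPe⟩ := hT a (by simp_all)
  obtain ⟨hpd, hlev⟩ := cHess_upot hf hM a
  obtain ⟨N, hN, hNd⟩ := exists_levi_normalization hpd
  set s : ℝ := sqrt (1 / (k * (n + 1))) with hs
  have hs2 : s ^ 2 = 1 / (k * (n + 1)) := sq_sqrt (by positivity)
  set L : Cn n →ₗ[ℂ] Cn n := (s : ℂ) • N with hL
  have hLy : ∀ y, levi (upot M f) a (L y) ≤ ‖y‖ ^ 2 / k := fun y => by
    rw [hL, LinearMap.smul_apply, levi_smul, hN, norm_real, norm_eq_abs, sq_abs, hs2]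
    have h1 := nsq_le_norm_sq y
    have h2 : 1 / ((k:ℝ) * (n + 1)) * nsq y ≤ 1 / ((k:ℝ) * (n + 1)) * ((n + 1) * ‖y‖ ^ 2) :=
      mul_le_mul_of_nonneg_left (by nlinarith [sq_nonneg ‖y‖]) (by positivity)
    refine h2.trans (le_of_eq ?_)
    field_simp
  have hLn : ∀ y, ‖L y‖ ^ 2 ≤ ‖y‖ ^ 2 / k := fun y =>
    (norm_sq_le_nsq _).trans ((hlev _).trans (hLy y))
  have hdet : normSq (LinearMap.det L) * ((k * (n + 1)) ^ n * mav (upot M f) a) = 1 := by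
    have h1 : LinearMap.det L = (s : ℂ) ^ n * LinearMap.det N := by simp [hL]
    rw [h1, map_mul, map_pow, Complex.normSq_ofReal, ← sq, hs2, div_pow, one_pow,
      one_div, mul_mul_mul_comm, inv_mul_cancel₀ (by positivity), one_mul, hNd]
  have hdne : LinearMap.det L ≠ 0 := fun h => by simp [h] at hdet
  -- the holomorphic polynomial normalising the weight at `a`
  set P' : Cn n → ℂ := fun ζ => P ζ - nsq a - 2 * ∑ j, conj (a j) * ζ j with hP'
  have hP'd : Differentiable ℂ P' := by fun_prop
  have hns : ∀ ζ : Cn n, nsq (a + ζ) = nsq a + (2 * ∑ j, conj (a j) * ζ j).re + nsq ζ := fun ζ => by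
    simp only [nsq, mul_sum, re_sum, ← sum_add_distrib, Pi.add_apply]
    refine sum_congr rfl fun j _ => ?_
    rw [normSq_add, ← conj_re (a j * _)]
    simp
    ring
  have hP'e : ∀ ζ : Cn n, ‖ζ‖ ≤ δ →
      phi0 (a + ζ) + M * f (a + ζ) ≤ (P' ζ).re + levi (upot M f) a ζ := fun ζ hζ => by
    have h1 := (abs_le.1 (hPe ζ hζ)).2
    simp only [_root_.upot, hns] at h1
    simp only [hP', sub_re, ofReal_re]
    linarith [norm_sq_le_nsq ζ]
  have hP'0 : (P' 0).re = phi0 a + M * f a := by simp [hP', hP0, _root_.upot]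
  -- the plurisubharmonic function to which the sub-mean value inequality is applied
  have hLd : Differentiable ℂ fun y => L y :=
    (LinearMap.toContinuousLinearMap L).differentiable
  have haff : Differentiable ℂ fun y => a + L y := hLd.const_add a
  set Φ : Cn n → ℝ := fun y => ‖p (a + L y) * Complex.exp (-(k * P' (L y)))‖ ^ 2 *
    exp (2 * k * (M * g (a + L y))) with hΦ
  have hΦc : Continuous Φ := by
    have h1 := hp.continuous.comp haff.continuous
    have h2 := hP'd.continuous.comp hLd.continuous
    have h3 := hg.continuous.comp haff.continuous
    exact ((h1.mul (Complex.continuous_exp.comp (continuous_const.mul h2).neg)).norm.pow 2).mul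
      (continuous_exp.comp (continuous_const.mul (continuous_const.mul h3)))
  have hmem : ∀ y : Cn n, ‖y‖ ≤ 2 → ‖a + L y‖ ≤ 4 := fun y hy => by
    have h2 : ‖y‖ ^ 2 / k ≤ 1 := by rw [div_le_iff₀ hk0]; nlinarith [norm_nonneg y]
    have h3 : ‖L y‖ ≤ 1 := by nlinarith [norm_nonneg (L y), hLn y]
    linarith [norm_add_le a (L y)]
  have hmem2 : ∀ y ∈ ball (0 : Cn n) 2, a + L y ∈ ball (0 : Cn n) 5 := fun y hy => by
    rw [mem_ball_zero_iff] at hy ⊢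
    linarith [hmem y hy.le]
  have hΦl : LPSH Φ (ball 0 2) := by
    exact LPSH.norm_sq_mul_exp isOpen_ball
      ((hp.comp haff).mul ((hP'd.comp hLd).const_mul (k:ℂ)).neg.cexp).differentiableOn
      (((hgl.comp_holomorphic isOpen_ball isOpen_ball haff.differentiableOn
        hmem2).const_mul isOpen_ball hM).const_mul isOpen_ball (by positivity))
      (((hg.continuous.comp haff.continuous).const_mul _).const_mul _).continuousOn
      (bounded_on_ball hΦc 0 2)
  have hsub : Φ 0 ≤ (Cr + 1) * ∫ y in closedBall (0 : Cn n) 1, Φ y := by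
    obtain ⟨C', hC'⟩ := hΦl.indicator_bound
    have h1 := (hΦl.indicator isOpen_ball).le_mol (measurable_indicator_of_usc isOpen_ball hΦl.1)
      hC' one_pos (x := 0) (closedBall_subset_ball (by norm_num))
    rw [indicator_of_mem (by simp)] at h1
    refine h1.trans ?_
    rw [mol, ← integral_const_mul, ← integral_indicator measurableSet_closedBall]
    refine integral_mono (integrable_mol (measurable_indicator_of_usc isOpen_ball hΦl.1) hC' 0 _)
      ((integrable_indicator_iff measurableSet_closedBall).2
        ((hΦc.const_mul _).continuousOn.integrableOn_compact (isCompact_closedBall _ _)))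
      fun y => ?_
    simp only [Complex.ofReal_one, one_smul, zero_add]
    have hΦ0 : ∀ y, 0 ≤ Φ y := fun y => by positivity
    by_cases hy : ‖y‖ ≤ 1
    · rw [indicator_of_mem (show y ∈ ball (0 : Cn n) 2 by
        rw [mem_ball_zero_iff]; linarith), indicator_of_mem (by simpa using hy), mul_comm]
      refine mul_le_mul_of_nonneg_right ?_ (hΦ0 y)
      linarith [(le_abs_self _).trans (hCr y)]
    · rw [show rho y = 0 from by_contra fun h => hy (norm_le_one_of_rho_ne h), mul_zero]
      exact indicator_nonneg (fun z _ => mul_nonneg (by positivity) (hΦ0 z)) y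
  set W : Cn n → ℝ := fun z => ‖p z‖ ^ 2 * exp (-(2 * k * (phi0 z + M * (f z - g z)))) with hW
  have hWc : Continuous W := by
    have h1 := hp.continuous
    have h2 := (rsm_phi0 (n := n)).continuous
    have h3 := hf.1.continuous
    fun_prop
  have hnorm : ∀ y, Φ y = ‖p (a + L y)‖ ^ 2 *
      exp (2 * k * (M * g (a + L y)) - 2 * k * (P' (L y)).re) := fun y => by
    simp only [hΦ]
    rw [norm_mul, mul_pow, norm_exp, ← Real.exp_nat_mul, mul_assoc, ← exp_add]
    congr 2
    simp
    ring
  have hΦW : ∀ y ∈ closedBall (0 : Cn n) 1, Φ y ≤ exp 2 * W (a + L y) := fun y hy => by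
    have hy1 : ‖y‖ ≤ 1 := by simpa using hy
    have h1 : ‖y‖ ^ 2 / k ≤ 1 / k :=
      div_le_div_of_nonneg_right (by nlinarith [norm_nonneg y]) hk0.le
    have h3 := hP'e (L y) (by nlinarith [hLn y, norm_nonneg (L y)])
    rw [hnorm, hW]
    simp only
    rw [mul_left_comm (exp 2), ← exp_add]
    refine mul_le_mul_of_nonneg_left (exp_le_exp.2 ?_) (by positivity)
    have h7 := mul_le_mul_of_nonneg_left ((hLy y).trans h1) hk0.le
    rw [mul_one_div_cancel hk0.ne'] at h7
    nlinarith
  have hfin := setIntegral_comp_linear_le hdne (isCompact_closedBall (0 : Cn n) 4) (a := a)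
    (fun y hy => ?_) hWc (fun z => by positivity)
  · have hΦ0 : Φ 0 = W a := by rw [hnorm, map_zero, add_zero, hP'0, hW]; ring
    have h1 : ∫ y in closedBall (0 : Cn n) 1, Φ y ≤
        exp 2 * ∫ y in closedBall (0 : Cn n) 1, W (a + L y) := by
      rw [← integral_const_mul]
      refine setIntegral_mono_on (hΦc.continuousOn.integrableOn_compact (isCompact_closedBall _ _))
        ?_ measurableSet_closedBall hΦW
      exact ((hWc.comp haff.continuous).const_mul _).continuousOn.integrableOn_compact
        (isCompact_closedBall _ _)
    rw [inv_eq_of_mul_eq_one_right hdet] at hfin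
    calc ‖p a‖ ^ 2 * exp (-(2 * k * (phi0 a + M * (f a - g a)))) = Φ 0 := hΦ0.symm
      _ ≤ (Cr + 1) * (exp 2 * ((k * (n + 1)) ^ n * mav (upot M f) a *
          ∫ z in closedBall 0 4, W z)) :=
        hsub.trans (mul_le_mul_of_nonneg_left (h1.trans
          (mul_le_mul_of_nonneg_left hfin (exp_pos _).le)) (by positivity))
      _ = _ := by rw [mul_pow]; ring
  · rw [mem_closedBall_zero_iff] at hy ⊢
    exact hmem y (by linarith)

/-! ### Plurisubharmonic functions that are very negative on small sets -/

/-- Smooth plurisubharmonic functions on `ℂⁿ` with prescribed values outside a ball. -/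
def Adm (f : Cn n → ℝ) : Prop :=
  RSm f ∧ (∀ R, LPSH f (ball 0 R)) ∧ ∀ z, 4 ≤ nsq z → f z = nsq z - 2

theorem Adm.sub_eq_zero {f g : Cn n → ℝ} (hf : Adm f) (hg : Adm g) (z : Cn n) (h : ¬‖z‖ ≤ 2) :
    g z - f z = 0 := by
  have h4 : 4 ≤ nsq z := by nlinarith [norm_sq_le_nsq z]
  rw [hg.2.2 z h4, hf.2.2 z h4, sub_self]

theorem Adm.hasCompactSupport_sub {f g : Cn n → ℝ} (hf : Adm f) (hg : Adm g) :
    HasCompactSupport fun z => g z - f z :=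
  HasCompactSupport.of_support_subset_isCompact (isCompact_closedBall (0 : Cn n) 2)
    fun z hz => by_contra fun h => hz (hf.sub_eq_zero hg z (by simpa using h))

theorem exists_small_psh (n : ℕ) : ∃ C > 0, ∀ f g : Cn n → ℝ, Adm f → Adm g → (∀ z, f z ≤ g z) →
    ∀ M > 0, ∀ δ > 0, ∃ χ : Cn n → ℝ, Continuous χ ∧ LPSH χ (ball 0 2) ∧
      (∀ z ∈ ball (0 : Cn n) 2, χ z ≤ 0) ∧ (∀ z ∈ ball (0 : Cn n) 2, f z < g z - δ → χ z ≤ -1) ∧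
      ∫ z in ball (0 : Cn n) 2, |χ z| ≤ C / (M * δ) + C / δ * ∫ z, (g z - f z) * mav (upot M f) z := by
  obtain ⟨C₀, hC₀, hub⟩ := exists_pointwise_bound n
  obtain ⟨c₁, hc₁⟩ := (isCompact_closedBall (0 : Cn n) 2).exists_bound_of_continuousOn
    (rsm_phi0 (n := n)).continuous.continuousOn
  set V : ℝ := volume.real (closedBall (0 : Cn n) 4) with hV
  set V2 : ℝ := volume.real (ball (0 : Cn n) 2) with hV2
  have hV0 : 0 ≤ V := measureReal_nonneg
  have hV20 : 0 ≤ V2 := measureReal_nonneg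
  have hG := gauss_pos (n := n)
  have hc₁0 : 0 ≤ c₁ := (norm_nonneg _).trans (hc₁ 0 (by simp))
  refine ⟨(c₁ + 1) * V2 + gauss n * V + gauss n * C₀, by positivity,
    fun f g hf hg hfg M hM δ hδ => ?_⟩
  have hfs := SPSH.of_lpsh hf.1 hf.2.1
  obtain ⟨k₀, hk₀⟩ := hub f g M hM.le hfs hg.1 (hg.2.1 5)
  obtain ⟨S, hS⟩ := (isCompact_closedBall (0 : Cn n) 3).exists_bound_of_continuousOn
    (rsm_mav (hfs.upot hM.le).1).continuous.continuousOn
  have hS0 : 0 ≤ S := (norm_nonneg _).trans (hS 0 (by simp))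
  obtain ⟨k, hkS, hkk, hk1⟩ : ∃ k : ℕ, C₀ * (k:ℝ) ^ n * S ≤ exp (2 * k) ∧ k₀ ≤ k ∧ 0 < k := by
    have h1 : Tendsto (fun k : ℕ => (k:ℝ) ^ n * exp (-(k:ℝ))) atTop (𝓝 0) :=
      (Real.tendsto_pow_mul_exp_neg_atTop_nhds_zero n).comp tendsto_natCast_atTop_atTop
    have h2 : ∀ᶠ k : ℕ in atTop, (k:ℝ) ^ n * exp (-(k:ℝ)) < 1 / (C₀ * S + 1) :=
      h1.eventually (gt_mem_nhds (by positivity))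
    obtain ⟨k, ⟨h3, h4⟩, h5⟩ := (h2.and (eventually_ge_atTop k₀) |>.and (eventually_gt_atTop 0)).exists
    refine ⟨k, ?_, h4, h5⟩
    rw [exp_neg, ← div_eq_mul_inv, div_lt_div_iff₀ (exp_pos _) (by positivity)] at h3
    have h6 : exp k ≤ exp (2 * k) := exp_le_exp.2 (by linarith)
    nlinarith [show 0 ≤ (k:ℝ) ^ n by positivity]
  have hk0 : (0:ℝ) < k := by positivity
  set w : Cn n → ℝ := fun z => phi0 z + M * (f z - g z) with hw
  have hwc : Continuous w := rsm_phi0.continuous.add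
    (continuous_const.mul (hf.1.continuous.sub hg.1.continuous))
  set ω : Cn n → ℝ := fun z => exp (-(2 * k * w z)) with hω'
  set φ : Cn n → ℝ := fun z => exp (-(2 * k * phi0 z)) with hφ'
  have hω : Continuous ω := continuous_exp.comp (continuous_const.mul hwc).neg
  have hφ : Continuous φ := continuous_exp.comp (continuous_const.mul rsm_phi0.continuous).neg
  set B := closedBall (0 : Cn n) 4 with hBdef
  have hB : IsCompact B := isCompact_closedBall _ _
  have he : ∀ α, Continuous (mono (n := n) k α) := fun α => (differentiable_mono k α).continuous
  have hLI := mono_linearIndependent (n := n) k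
  have hP := gram_posDef hB he hω (fun z => exp_pos _) hLI
  have hPφ := gram_posDef hB he hφ (fun z => exp_pos _) hLI
  set K := berg B (mono k) ω with hKdef
  have hKc : Continuous K := continuous_berg hB he hω hP
  have hK : ∀ z, 0 < K z := fun z => by
    refine lt_of_le_of_ne (berg_nonneg hB he hω hP z) fun h => ?_
    obtain ⟨c, hc⟩ := exists_peak k (0 : Cn n)
    have h1 := norm_sq_le_berg hB he hω hP c z
    simp [← hKdef, ← h, hc] at h1
    linarith
  have hKle : ∀ z, ‖z‖ ≤ 3 → K z * ω z ≤ C₀ * (k:ℝ) ^ n * mav (upot M f) z := fun z hz => by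
    have hm := (hfs.upot hM.le).mav_nonneg z
    have h1 : K z ≤ C₀ * (k:ℝ) ^ n * mav (upot M f) z * (ω z)⁻¹ := by
      refine berg_le hB he hω hP (by positivity) fun c => ?_
      rw [mul_right_comm, ← div_eq_mul_inv, le_div_iff₀ (exp_pos _)]
      exact hk₀ k hkk z hz (fun y => ∑ i, c i * mono k i y)
        (by have := differentiable_mono (n := n) k; fun_prop)
    rwa [← div_eq_mul_inv, le_div_iff₀ (exp_pos _)] at h1
  set w' : Cn n → ℝ := fun z => 1 / (2 * k) * log (K z) with hw'
  have hw'c : Continuous w' := continuous_const.mul (hKc.log fun z => (hK z).ne')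
  have hw'le : ∀ z, ‖z‖ ≤ 3 → w' z ≤ w z + 1 := fun z hz => by
    have h1 : K z * ω z ≤ exp (2 * k) := by
      exact (hKle z hz).trans ((mul_le_mul_of_nonneg_left ((le_abs_self _).trans
        (hS z (by simpa using hz))) (by positivity)).trans hkS)
    have h2 := log_le_log (mul_pos (hK z) (exp_pos _)) h1
    rw [log_mul (hK z).ne' (exp_pos _).ne', log_exp, log_exp] at h2
    rw [hw', one_div, inv_mul_le_iff₀ (by positivity)]
    linarith
  have hw'l : LPSH w' (ball 0 2) := by
    refine LPSH.const_mul isOpen_ball ?_ (by positivity)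
    obtain ⟨T, hT⟩ := exists_orthonormal hB he hω hP
    have hb := bounded_on_ball (hKc.log fun z => (hK z).ne') (0 : Cn n) 2
    have hK' := hK
    have eK : K = fun z => ∑ i, ‖(T.mulVec fun l => mono k l z) i‖ ^ 2 := funext (berg_eq hT)
    simp only [eK] at hb hK' ⊢
    refine LPSH.log_sum isOpen_ball (fun i => Differentiable.differentiableOn ?_)
      (fun z _ => hK' z) hb
    simp only [mulVec, dotProduct]
    have := differentiable_mono (n := n) k
    fun_prop
  set gap := ∫ z, (g z - f z) * mav (upot M f) z with hgap
  have hgi := RSm.integrable_mul_mav (hg.1.sub hf.1) (hf.hasCompactSupport_sub hg)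
    (hfs.upot hM.le).1
  have hcmp := berg_comparison hB he hω hφ (fun z => exp_pos _) (fun z => by
    refine exp_le_exp.2 (neg_le_neg (mul_le_mul_of_nonneg_left ?_ (by positivity)))
    nlinarith [hfg z]) hLI hK
  have hc0 : Continuous fun z => max 0 (phi0 z - w' z) :=
    continuous_const.max (rsm_phi0.continuous.sub hw'c)
  have hmain : ∫ z in B, max 0 (phi0 z - w' z) ≤ gauss n * V + gauss n * C₀ * M * gap := by
    have h1 : ∫ z in B, (k:ℝ) ^ n / gauss n * (2 * k) * max 0 (phi0 z - w' z) ≤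
        ∫ z in B, berg B (mono k) φ z * φ z * max 0 (-log (K z) - log (φ z)) := by
      refine setIntegral_mono_on ((hc0.const_mul _).continuousOn.integrableOn_compact hB) ?_
        hB.measurableSet fun z hz => ?_
      · exact (((continuous_berg hB he hφ hPφ).mul hφ).mul (continuous_const.max
          ((hKc.log fun z => (hK z).ne').neg.sub
          (hφ.log fun z => (exp_pos _).ne')))).continuousOn.integrableOn_compact hB
      · have h2 := le_berg_phi0 hk1 (a := z) (by simpa [hBdef] using hz)
        have h3 : max 0 (-log (K z) - log (φ z)) = 2 * k * max 0 (phi0 z - w' z) := by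
          rw [mul_max_of_nonneg _ _ (by positivity), mul_zero, hφ', log_exp]
          simp only [hw']
          field_simp
          ring
        rw [h3, mul_assoc]
        exact mul_le_mul_of_nonneg_right h2 (by positivity)
    have h2 : ∫ z in B, K z * ω z * (log (ω z) - log (φ z)) ≤
        2 * k * M * (C₀ * (k:ℝ) ^ n) * gap := by
      rw [hgap, ← integral_const_mul, ← integral_indicator hB.measurableSet]
      refine integral_mono ((integrable_indicator_iff hB.measurableSet).2
        (((hKc.mul hω).mul ((hω.log fun z => (exp_pos _).ne').sub
          (hφ.log fun z => (exp_pos _).ne'))).continuousOn.integrableOn_compact hB))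
        (hgi.const_mul _) fun z => ?_
      have hm := (hfs.upot hM.le).mav_nonneg z
      have h5 := sub_nonneg.2 (hfg z)
      by_cases hz : ‖z‖ ≤ 3
      · rw [indicator_of_mem (by rw [hBdef, mem_closedBall_zero_iff]; linarith)]
        have e1 : log (ω z) - log (φ z) = 2 * k * M * (g z - f z) := by
          rw [hω', hφ', log_exp, log_exp]
          linarith
        rw [e1]
        linarith [mul_le_mul_of_nonneg_right (hKle z hz)
          (by positivity : 0 ≤ 2 * k * M * (g z - f z))]
      · have e0 := hf.sub_eq_zero hg z fun h => hz (h.trans (by norm_num))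
        have e1 : log (ω z) - log (φ z) = 0 := by
          rw [hω', hφ', log_exp, log_exp]
          linear_combination (2 * (k:ℝ) * M) * e0
        rw [e0, zero_mul, mul_zero]
        exact le_of_eq (indicator_apply_eq_zero.2 fun _ => by rw [e1, mul_zero])
    rw [integral_const_mul] at h1
    have h3 := h1.trans (hcmp.trans (add_le_add_right h2 _))
    set I := ∫ z in B, max 0 (phi0 z - w' z)
    have hkn : (1:ℝ) ≤ (k:ℝ) ^ n := one_le_pow₀ (by exact_mod_cast hk1)
    have hk1' : (1:ℝ) ≤ k := by exact_mod_cast hk1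
    have h4 : (k:ℝ) ^ n / gauss n * (2 * k) * I ≤
        (k:ℝ) ^ n / gauss n * (2 * k) * (gauss n * V + gauss n * C₀ * M * gap) := by
      refine h3.trans ?_
      have e2 : (k:ℝ) ^ n / gauss n * (2 * k) * (gauss n * V + gauss n * C₀ * M * gap) =
          (k:ℝ) ^ n * (2 * k) * V + 2 * k * M * (C₀ * (k:ℝ) ^ n) * gap := by field_simp
      linarith [le_mul_of_one_le_left hV0 (show 1 ≤ (k:ℝ) ^ n * (2 * k) by nlinarith)]
    exact le_of_mul_le_mul_left h4 (by positivity)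
  have hφle : ∀ z ∈ ball (0 : Cn n) 2, phi0 z ≤ c₁ := fun z hz =>
    (le_abs_self _).trans (hc₁ z (ball_subset_closedBall hz))
  have hn2 : ∀ z ∈ ball (0 : Cn n) 2, ‖z‖ ≤ 3 := fun z hz => by
    rw [mem_ball_zero_iff] at hz; linarith
  have hMδ : 0 < M * δ := by positivity
  have hχc : Continuous fun z => 1 / (M * δ) * (w' z - (c₁ + 1)) :=
    continuous_const.mul (hw'c.sub continuous_const)
  have hneg : ∀ z ∈ ball (0 : Cn n) 2, w' z - (c₁ + 1) ≤ 0 := fun z hz => by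
    have h3 : w z ≤ phi0 z := by nlinarith [hfg z]
    linarith [hw'le z (hn2 z hz), hφle z hz]
  refine ⟨fun z => 1 / (M * δ) * (w' z - (c₁ + 1)), hχc,
    (hw'l.add_const isOpen_ball (-(c₁ + 1))).const_mul isOpen_ball (by positivity), ?_, ?_, ?_⟩
  · exact fun z hz => mul_nonpos_of_nonneg_of_nonpos (by positivity) (hneg z hz)
  · intro z hz hlt
    have h3 : w z ≤ phi0 z - M * δ := by nlinarith
    rw [one_div, inv_mul_le_iff₀ hMδ]
    linarith [hw'le z (hn2 z hz), hφle z hz]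
  · have hI : ∀ q : Cn n → ℝ, Continuous q → IntegrableOn q (ball (0 : Cn n) 2) := fun q hq =>
      (hq.continuousOn.integrableOn_compact (isCompact_closedBall 0 2)).mono_set
        ball_subset_closedBall
    have h1 : ∫ z in ball (0 : Cn n) 2, |1 / (M * δ) * (w' z - (c₁ + 1))| ≤
        ∫ z in ball (0 : Cn n) 2, 1 / (M * δ) * (c₁ + 1 + max 0 (phi0 z - w' z)) := by
      refine setIntegral_mono_on (hI _ hχc.abs) (hI _ (continuous_const.mul
        (continuous_const.add hc0))) measurableSet_ball fun z hz => ?_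
      rw [abs_mul, abs_of_pos (by positivity : 0 < 1 / (M * δ)), abs_of_nonpos (hneg z hz)]
      refine mul_le_mul_of_nonneg_left ?_ (by positivity)
      linarith [phi0_nonneg z, le_max_right 0 (phi0 z - w' z)]
    refine h1.trans ?_
    rw [integral_const_mul, integral_add (hI _ continuous_const) (hI _ hc0), setIntegral_const,
      smul_eq_mul]
    have h2 : ∫ z in ball (0 : Cn n) 2, max 0 (phi0 z - w' z) ≤ ∫ z in B, max 0 (phi0 z - w' z) :=
      setIntegral_mono_set (hc0.continuousOn.integrableOn_compact hB)
        (.of_forall fun z => le_max_left _ _)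
        ((ball_subset_ball (by norm_num)).trans ball_subset_closedBall).eventuallyLE
    have hgap0 : 0 ≤ gap := integral_nonneg fun z =>
      mul_nonneg (sub_nonneg.2 (hfg z)) ((hfs.upot hM.le).mav_nonneg z)
    rw [show volume.real (ball (0 : Cn n) 2) = V2 from rfl]
    calc 1 / (M * δ) * (V2 * (c₁ + 1) + ∫ z in ball (0 : Cn n) 2, max 0 (phi0 z - w' z))
        ≤ 1 / (M * δ) * (V2 * (c₁ + 1) + (gauss n * V + gauss n * C₀ * M * gap)) :=
          mul_le_mul_of_nonneg_left (by linarith) (by positivity)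
      _ = ((c₁ + 1) * V2 + gauss n * V) / (M * δ) + gauss n * C₀ / δ * gap := by
          field_simp
          ring
      _ ≤ _ := add_le_add
          (div_le_div_of_nonneg_right (le_add_of_nonneg_right (by positivity)) hMδ.le)
          (mul_le_mul_of_nonneg_right (div_le_div_of_nonneg_right
            (le_add_of_nonneg_left (by positivity)) hδ.le) hgap0)

end

/-! ### Small sets -/

section

variable {n : ℕ}
variable {E : Set (Cn n)} {c δ η : ℝ} {z : Cn n}

theorem LPSH.integrableOn {u : Cn n → ℝ} {a : Cn n} {R : ℝ} (hu : LPSH u (ball a R)) :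
    IntegrableOn u (ball a R) := by
  obtain ⟨C, hC⟩ := hu.indicator_bound
  rw [← integrable_indicator_iff measurableSet_ball]
  have hm := measurable_indicator_of_usc isOpen_ball hu.1
  refine Integrable.mono' (g := (ball a R).indicator fun _ => C)
    ((integrable_indicator_iff measurableSet_ball).2 (integrableOn_const measure_ball_lt_top.ne))
    hm.aestronglyMeasurable (.of_forall fun x => ?_)
  by_cases hx : x ∈ ball a R
  · rw [indicator_of_mem hx (fun _ => C)]; exact hC x
  · simp [hx]

/-- A potential of size `η` on the ball of radius `2`. -/
def Pot (χ : Cn n → ℝ) (η : ℝ) : Prop :=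
  LPSH χ (ball 0 2) ∧ (∀ z ∈ ball (0 : Cn n) 2, -1 ≤ χ z ∧ χ z ≤ 0) ∧
    ∫ z in ball (0 : Cn n) 2, -χ z ≤ η

/-- Sets on which a potential of size `η` equals `-1`. -/
def SmallSet (E : Set (Cn n)) (η : ℝ) : Prop :=
  ∃ χ : Cn n → ℝ, Pot χ η ∧ ∀ z ∈ E ∩ ball 0 2, χ z ≤ -1

theorem SmallSet.mono {E' : Set (Cn n)} (h : SmallSet E η) (hE : E' ⊆ E) : SmallSet E' η := by
  obtain ⟨χ, h1, h2⟩ := h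
  exact ⟨χ, h1, fun z hz => h2 z ⟨hE hz.1, hz.2⟩⟩

/-- Truncated sums of potentials. -/
theorem lpsh_trunc_sum {χ : ℕ → Cn n → ℝ} {η : ℕ → ℝ} (h : ∀ j, Pot (χ j) (η j)) {m : ℝ} (hm : 0 ≤ m)
    {V : Cn n → ℝ} (hV : ∀ z ∈ ball (0 : Cn n) 2, Tendsto
      (fun N => max (∑ j ∈ Finset.range N, χ j z) (-m)) atTop (𝓝 (V z))) : LPSH V (ball 0 2) := by
  have hl : ∀ N, LPSH (fun z => max (∑ j ∈ Finset.range N, χ j z) (-m)) (ball 0 2) := fun N =>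
    (LPSH.sum isOpen_ball _ fun j _ => (h j).1).sup isOpen_ball (LPSH.const _)
  have hneg : ∀ N, ∀ z ∈ ball (0 : Cn n) 2, ∑ j ∈ Finset.range N, χ j z ≤ 0 := fun N z hz =>
    sum_nonpos fun j _ => ((h j).2.1 z hz).2
  refine LPSH.of_tendsto isOpen_ball hl (C := m) (fun N z hz => ?_)
    (usc_of_antitone (fun N => (hl N).1) (fun z hz => antitone_nat_of_succ_le fun N => ?_) hV) hV
  · grind
  · rw [sum_range_succ]
    exact max_le_max_right _ (by linarith [((h N).2.1 z hz).2])

theorem SmallSet.iUnion {E : ℕ → Set (Cn n)} {η : ℕ → ℝ} (h : ∀ j, SmallSet (E j) (η j))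
    (hη : ∀ N, ∑ j ∈ Finset.range N, η j ≤ c) : SmallSet (⋃ j, E j) c := by
  choose χ h1 h2 using h
  let S (N : ℕ) (z : Cn n) : ℝ := max (∑ j ∈ Finset.range N, χ j z) (-1)
  have hanti : ∀ z ∈ ball (0 : Cn n) 2, Antitone fun N => S N z := fun z hz =>
    antitone_nat_of_succ_le fun N => by
      simp only [S, sum_range_succ]
      exact max_le_max_right _ (by linarith [((h1 N).2.1 z hz).2])
  have hbd : ∀ z, BddBelow (range fun N => S N z) := fun z =>
    ⟨-1, by rintro _ ⟨N, rfl⟩; grind⟩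
  have hlim : ∀ z ∈ ball (0 : Cn n) 2, Tendsto (fun N => S N z) atTop (𝓝 (⨅ N, S N z)) :=
    fun z hz => tendsto_atTop_ciInf (hanti z hz) (hbd z)
  have hneg : ∀ N, ∀ z ∈ ball (0 : Cn n) 2, S N z ≤ 0 := fun N z hz =>
    max_le (sum_nonpos fun j _ => ((h1 j).2.1 z hz).2) (by norm_num)
  have hl : ∀ N, LPSH (S N) (ball 0 2) := fun N =>
    (LPSH.sum isOpen_ball _ fun j _ => (h1 j).1).sup isOpen_ball (LPSH.const _)
  refine ⟨fun z => ⨅ N, S N z, ⟨lpsh_trunc_sum h1 zero_le_one hlim, fun z hz =>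
    ⟨le_ciInf fun N => le_max_right _ _, (ciInf_le (hbd z) 0).trans (hneg 0 z hz)⟩, ?_⟩,
    fun z hz => ?_⟩
  · have hconv : Tendsto (fun N => ∫ z in ball (0 : Cn n) 2, -S N z) atTop
        (𝓝 (∫ z in ball (0 : Cn n) 2, -⨅ N, S N z)) := by
      refine tendsto_integral_of_dominated_convergence (fun _ => 1)
        (fun N => (hl N).integrableOn.neg.aestronglyMeasurable)
        (integrableOn_const measure_ball_lt_top.ne) (fun N => ?_) ?_
      · filter_upwards [ae_restrict_mem measurableSet_ball] with z hz
        rw [norm_neg, norm_eq_abs]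
        grind
      · filter_upwards [ae_restrict_mem measurableSet_ball] with z hz using (hlim z hz).neg
    refine le_of_tendsto' hconv fun N => le_trans ?_ (hη N)
    calc ∫ z in ball (0 : Cn n) 2, -S N z
        ≤ ∫ z in ball (0 : Cn n) 2, ∑ j ∈ Finset.range N, -χ j z := by
          refine setIntegral_mono (hl N).integrableOn.neg
            (integrable_finsetSum _ fun j _ => (h1 j).1.integrableOn.neg) fun z => ?_
          rw [sum_neg_distrib]
          grind
      _ = ∑ j ∈ Finset.range N, ∫ z in ball (0 : Cn n) 2, -χ j z :=
          integral_finsetSum _ fun j _ => (h1 j).1.integrableOn.neg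
      _ ≤ _ := sum_le_sum fun j _ => (h1 j).2.2
  · obtain ⟨j, hj⟩ := mem_iUnion.1 hz.1
    refine (ciInf_le (hbd z) (j + 1)).trans (max_le ?_ le_rfl)
    rw [sum_range_succ]
    grind

theorem SmallSet.iUnion_geom {E : ℕ → Set (Cn n)} (hc : 0 < c)
    (h : ∀ j, SmallSet (E j) (c * (1 / 2) ^ (j + 1))) : SmallSet (⋃ j, E j) c := by
  refine SmallSet.iUnion h fun N => ?_
  have : ∀ N : ℕ, ∑ j ∈ Finset.range N, c * (1 / 2 : ℝ) ^ (j + 1) = c - c * (1 / 2) ^ N := fun N => by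
    induction N with
    | zero => simp
    | succ N ih => rw [sum_range_succ, ih]; ring
  simp_all

theorem SmallSet.nonneg {a : ℝ} (h : SmallSet E a) : 0 ≤ a := by
  obtain ⟨χ, h, -⟩ := h
  exact (setIntegral_nonneg measurableSet_ball fun z hz => by linarith [h.2.1 z hz]).trans h.2.2

theorem SmallSet.union {E' : Set (Cn n)} {a b : ℝ} (h : SmallSet E a) (h' : SmallSet E' b) :
    SmallSet (E ∪ E') (a + b) := by
  refine (SmallSet.iUnion (E := fun m => if m = 0 then E else if m = 1 then E' else ∅)
    (η := fun m => if m = 0 then a else if m = 1 then b else 0)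
    (fun m => ?_) fun N => ?_).mono ?_
  · split_ifs
    · exact h
    · exact h'
    · exact ⟨fun _ => 0, ⟨LPSH.const 0, fun _ _ => by norm_num, by simp⟩, fun z hz => hz.1.elim⟩
  · have := h.nonneg
    have := h'.nonneg
    rcases N with _ | _ | N
    · simp; linarith
    · simp_all
    · rw [Finset.sum_range_succ', Finset.sum_range_succ', sum_eq_zero (by simp)]
      grind
  · rintro z (hz | hz)
    exacts [mem_iUnion.2 ⟨0, by grind⟩, mem_iUnion.2 ⟨1, by grind⟩]

/-- A sum of potentials of summable size is plurisubharmonic. -/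
theorem exists_sum_psh {χ : ℕ → Cn n → ℝ} (h : ∀ j, Pot (χ j) ((1 / 2) ^ j)) :
    ∃ ψ : Cn n → EReal, PSHOnE ψ (ball 0 2) ∧
      ∀ z ∈ ball (0 : Cn n) 2, ψ z = ⊥ ↔ ¬ Summable fun j => χ j z := by
  classical
  let ψ (z : Cn n) : EReal := if Summable fun j => χ j z then ((∑' j, χ j z : ℝ) : EReal) else ⊥
  have hbot : ∀ z, ψ z = ⊥ ↔ ¬ Summable fun j => χ j z := fun z => by simp [ψ]
  refine ⟨ψ, PSHOnE.of_trunc (fun z _ => ?_) ?_ fun m => ?_, fun z _ => hbot z⟩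
  · simp only [ψ]
    split_ifs <;> simp
  · rintro ⟨U, hU, hUo, ⟨x, hx⟩, hUb⟩
    have hae : ∀ᵐ z ∂(volume.restrict (ball (0 : Cn n) 2)), Summable fun j => ‖χ j z‖ := by
      have hlt : ∑' j, ∫⁻ z in ball (0 : Cn n) 2, ‖χ j z‖ₑ ≠ ⊤ := by
        have hle : ∀ j, ∫⁻ z in ball (0 : Cn n) 2, ‖χ j z‖ₑ ≤ ofReal ((1 / 2) ^ j) := fun j => by
          rw [← ofReal_integral_norm_eq_lintegral_enorm (h j).1.integrableOn]
          exact ENNReal.ofReal_le_ofReal ((setIntegral_congr_fun measurableSet_ball fun z hz =>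
            abs_of_nonpos ((h j).2.1 z hz).2).trans_le (h j).2.2)
        refine ne_top_of_le_ne_top ?_ (ENNReal.tsum_le_tsum hle)
        rw [← ENNReal.ofReal_tsum_of_nonneg (fun j => by positivity) (summable_geometric_two)]
        simp
      rw [← lintegral_tsum fun j => (h j).1.integrableOn.aestronglyMeasurable.enorm] at hlt
      filter_upwards [ae_lt_top' (AEMeasurable.tsum fun j =>
        (h j).1.integrableOn.aestronglyMeasurable.enorm) hlt] with z hz
      exact summable_norm_iff.2 (Summable.of_enorm hz.ne)
    have h0 : volume U = 0 := by
      rw [ae_restrict_iff' measurableSet_ball] at hae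
      refine measure_mono_null (fun z hz => ?_) (ae_iff.1 hae)
      exact fun hs => (hbot z).1 (hUb z hz) (hs (hU hz)).of_norm
    exact (hUo.measure_pos volume ⟨x, hx⟩).ne' h0
  · refine lpsh_trunc_sum h (Nat.cast_nonneg m) fun z hz => ?_
    by_cases hs : Summable fun j => χ j z
    · have e : trunc m (ψ z) = max (∑' j, χ j z) (-m) := by
        have : (trunc m (ψ z) : EReal) = ((max (∑' j, χ j z) (-m) : ℝ) : EReal) := by
          simp only [ψ, if_pos hs]
          exact (EReal.coe_strictMono.monotone.map_max).symm
        simp_all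
      rw [e]
      exact hs.hasSum.tendsto_sum_nat.max tendsto_const_nhds
    · rw [(hbot z).2 hs, trunc_bot]
      have hs' : ¬ Summable fun j => -χ j z := fun h' => hs (by simpa using h'.neg)
      have h1 := (not_summable_iff_tendsto_nat_atTop_of_nonneg fun j =>
        neg_nonneg.2 ((h j).2.1 z hz).2).1 hs'
      refine tendsto_const_nhds.congr' ?_
      filter_upwards [h1.eventually_ge_atTop (m:ℝ)] with N hN
      rw [sum_neg_distrib] at hN
      grind

/-! ### Quasi-continuity -/

/-- Plurisubharmonic functions on the ball of radius `3` with values in `[0, 1]`. -/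
def UPsh (u : Cn n → ℝ) : Prop :=
  LPSH u (ball 0 3) ∧ ∀ z ∈ ball (0 : Cn n) 3, 0 ≤ u z ∧ u z ≤ 1

/-- Mollification at scale `1 / (i + 2)`. -/
def mo (u : Cn n → ℝ) (i : ℕ) : Cn n → ℝ := mol (1 / ((i : ℝ) + 2)) ((ball 0 3).indicator u)

/-- The admissible function obtained from a mollification. -/
def ad (u : Cn n → ℝ) (i : ℕ) (z : Cn n) : ℝ := smax (mo u i z) (nsq z - 2)

variable {u v : Cn n → ℝ}

theorem UPsh.ind (hu : UPsh u) : Measurable ((ball 0 3).indicator u) ∧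
    (∀ x, |(ball (0 : Cn n) 3).indicator u x| ≤ 1) ∧
    ∀ x, 0 ≤ (ball (0 : Cn n) 3).indicator u x ∧ (ball (0 : Cn n) 3).indicator u x ≤ 1 := by
  have h : ∀ x, 0 ≤ (ball (0 : Cn n) 3).indicator u x ∧ (ball (0 : Cn n) 3).indicator u x ≤ 1 := fun x => by
    by_cases hx : x ∈ ball (0 : Cn n) 3
    · simpa [hx] using hu.2 x hx
    simp_all
  exact ⟨measurable_indicator_of_usc isOpen_ball hu.1.1,
    fun x => abs_le.2 ⟨by grind, (h x).2⟩, h⟩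

theorem scale_pos (i : ℕ) : 0 < 1 / ((i : ℝ) + 2) ∧ 1 / ((i : ℝ) + 2) ≤ 1 / 2 :=
  ⟨by positivity, one_div_le_one_div_of_le two_pos (by simp)⟩

theorem UPsh.mo_mem (hu : UPsh u) (i : ℕ) (z : Cn n) : 0 ≤ mo u i z ∧ mo u i z ≤ 1 :=
  ⟨le_mol_of_le hu.ind.1 hu.ind.2.1 (scale_pos i).1.le fun y _ => (hu.ind.2.2 y).1,
    mol_le_of_le hu.ind.1 hu.ind.2.1 (scale_pos i).1.le fun y _ => (hu.ind.2.2 y).2⟩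

theorem UPsh.rsm_mo (hu : UPsh u) (i : ℕ) : RSm (mo u i) :=
  contDiff_mol hu.ind.1 hu.ind.2.1 (scale_pos i).1

theorem closedBall_subset_three (hz : ‖z‖ < 5 / 2) {t : ℝ} (ht : t ≤ 1 / 2) :
    closedBall z t ⊆ ball 0 3 := fun y hy => by
  rw [mem_closedBall, dist_eq_norm] at hy
  rw [mem_ball_zero_iff]
  linarith [norm_le_norm_add_norm_sub' y z]

theorem UPsh.ad_of_four_le (hu : UPsh u) (i : ℕ) (hz : 4 ≤ nsq z) :
    ad u i z = nsq z - 2 :=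
  smax_of_le (by linarith [(hu.mo_mem i z).2])

theorem UPsh.ad_eq (hu : UPsh u) (i : ℕ) (hz : nsq z < 1) : ad u i z = mo u i z :=
  smax_of_ge (by linarith [(hu.mo_mem i z).1])

theorem UPsh.adm (hu : UPsh u) (i : ℕ) : Adm (ad u i) := by
  have hs : RSm (ad u i) := (contDiff_nsq.sub contDiff_const).add
    (contDiff_smt.comp ((hu.rsm_mo i).sub (contDiff_nsq.sub contDiff_const)))
  refine ⟨hs, fun R => LPSH.of_locally (bounded_on_ball hs.continuous 0 R) fun x _ => ?_,
    fun z hz => hu.ad_of_four_le i hz⟩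
  have hq : ∀ R, LPSH (fun z : Cn n => nsq z - 2) (ball 0 R) := fun R =>
    (lpsh_nsq R).add_const isOpen_ball (-2)
  by_cases hx : ‖x‖ < 5 / 2
  · refine ⟨ball 0 (5 / 2), isOpen_ball, by simp_all, LPSH.smax isOpen_ball ?_ (hq _)
      (hu.rsm_mo i).continuous.continuousOn (continuous_nsq.sub continuous_const).continuousOn
      (bounded_on_ball hs.continuous 0 _)⟩
    exact (hu.1.indicator isOpen_ball).mollify hu.ind.1 hu.ind.2.1 (scale_pos i).1 isOpen_ball
      fun y hy => closedBall_subset_three (by simp_all) (scale_pos i).2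
  · have ho : IsOpen ({z : Cn n | 4 < nsq z} ∩ ball 0 (‖x‖ + 1)) :=
      (isOpen_lt continuous_const continuous_nsq).inter isOpen_ball
    refine ⟨_, ho, ⟨?_, by simp⟩, ((hq (‖x‖ + 1)).mono inter_subset_right).congr ho
      fun z hz => hu.ad_of_four_le i (le_of_lt hz.1)⟩
    show 4 < nsq x
    nlinarith [norm_sq_le_nsq x]

theorem UPsh.ad_mono (hu : UPsh u) (hv : UPsh v) (h : ∀ z ∈ ball (0 : Cn n) 3, u z ≤ v z) (i : ℕ)
    (z : Cn n) : ad u i z ≤ ad v i z := by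
  refine smax_mono_left _ (mol_mono_fun hu.ind.1 hu.ind.2.1 hv.ind.1 hv.ind.2.1 (scale_pos i).1.le
    fun y _ => ?_)
  by_cases hy : y ∈ ball (0 : Cn n) 3 <;> simp_all

theorem UPsh.ad_anti (hu : UPsh u) {i j : ℕ} (hij : i ≤ j) (z : Cn n) : ad u j z ≤ ad u i z := by
  by_cases hz : ‖z‖ < 5 / 2
  · refine smax_mono_left _ ((hu.1.indicator isOpen_ball).mol_mono hu.ind.1 hu.ind.2.1
      (scale_pos j).1 ?_ (closedBall_subset_three hz (scale_pos i).2))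
    exact one_div_le_one_div_of_le (by positivity) (by gcongr)
  · have h4 : 4 ≤ nsq z := by nlinarith [norm_sq_le_nsq z]
    rw [hu.ad_of_four_le _ h4, hu.ad_of_four_le _ h4]

theorem UPsh.const (h0 : 0 ≤ c) (h1 : c ≤ 1) : UPsh fun _ : Cn n => c :=
  ⟨LPSH.const c, fun _ _ => ⟨h0, h1⟩⟩

theorem Adm.sub_compact {f g : Cn n → ℝ} (hf : Adm f) (hg : Adm g) (M : ℝ) :
    HasCompactSupport fun z => upot M g z - upot M f z := by
  have e : (fun z => upot M g z - upot M f z) = fun z => M * (g z - f z) := by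
    ext z; simp only [upot]; ring
  exact e ▸ (hf.hasCompactSupport_sub hg).mul_left

/-- The energy of an admissible function. -/
def en (M : ℝ) (f : Cn n → ℝ) : ℝ := Gam (upot M (ad (fun _ => 0) 0)) (upot M f)

theorem Adm.en_sub {f g : Cn n → ℝ} (hf : Adm f) (hg : Adm g) {M : ℝ} (hM : 0 < M)
    (hfg : ∀ z, f z ≤ g z) : 0 ≤ en M g - en M f ∧
      ∫ z, (g z - f z) * mav (upot M f) z ≤ (n + 1) / M * (en M g - en M f) := by
  have hU : ∀ {f : Cn n → ℝ}, Adm f → SPSH (upot M f) := fun h =>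
    (SPSH.of_lpsh h.1 h.2.1).upot hM.le
  have h0 := (UPsh.const (n := n) le_rfl zero_le_one).adm 0
  have e : en M g - en M f = Gam (upot M f) (upot M g) := by
    have := Gam_add (hU h0).1 (hU hf).1 (hU hg).1 (h0.sub_compact hf M) (hf.sub_compact hg M)
    rw [en, en, ← this]; ring
  have hle : ∀ z, upot M f z ≤ upot M g z := fun z => by simp_all [upot]
  rw [e]
  refine ⟨(hU hf).Gam_nonneg (hU hg) hle (hf.sub_compact hg M), ?_⟩
  have h1 := (hU hf).le_Gam (hU hg) hle (hf.sub_compact hg M)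
  have e2 : ∀ z, (upot M g z - upot M f z) * mav (upot M f) z =
      M * ((g z - f z) * mav (upot M f) z) := fun z => by simp only [upot]; ring
  simp only [e2, integral_const_mul] at h1
  rw [div_mul_eq_mul_div, le_div_iff₀ hM]
  linarith

theorem exists_small_of_en (hδ : 0 < δ) (hη : 0 < η) : ∃ M > 0, ∃ κ > 0,
    ∀ f g : Cn n → ℝ, Adm f → Adm g → (∀ z, f z ≤ g z) → en M g - en M f < κ →
      SmallSet {z | f z < g z - δ} η := by
  obtain ⟨C, hC, h⟩ := exists_small_psh n
  refine ⟨2 * C / (η * δ), by positivity, η * δ / (2 * C) * (2 * C / (η * δ)) / (n + 1),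
    by positivity, fun f g hf hg hfg hen => ?_⟩
  set M := 2 * C / (η * δ) with hMd
  have hM : 0 < M := by positivity
  obtain ⟨χ, hχc, hχ, hχ0, hχ1, hχi⟩ := h f g hf hg hfg M hM δ hδ
  have h1 := (hf.en_sub hg hM hfg).2
  have hl := hχ.sup isOpen_ball (LPSH.const (-1))
  refine ⟨_, ⟨hl, fun z hz => ⟨le_max_right _ _, max_le (hχ0 z hz) (by norm_num)⟩, ?_⟩,
    fun z hz => max_le (hχ1 z hz.2 hz.1) le_rfl⟩
  calc ∫ z in ball (0 : Cn n) 2, -max (χ z) (-1) ≤ ∫ z in ball (0 : Cn n) 2, |χ z| :=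
        setIntegral_mono hl.integrableOn.neg hχ.integrableOn.abs fun z =>
          (neg_le_neg (le_max_left _ _)).trans (neg_le_abs _)
    _ ≤ C / (M * δ) + C / δ * ((n + 1) / M * (η * δ / (2 * C) * M / (n + 1))) :=
        hχi.trans (add_le_add_right (mul_le_mul_of_nonneg_left (h1.trans
          (mul_le_mul_of_nonneg_left hen.le (by positivity))) (by positivity)) _)
    _ = η := by
        have e1 : C / (M * δ) = η / 2 := by rw [hMd]; field_simp
        have e2 : C / δ * ((n + 1) / M * (η * δ / (2 * C) * M / (n + 1))) = η / 2 := by field_simp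
        linarith

theorem UPsh.en_mem (hu : UPsh u) (i : ℕ) {M : ℝ} (hM : 0 < M) :
    0 ≤ en M (ad u i) ∧ en M (ad u i) ≤ en M (ad (fun _ : Cn n => 1) 0) := by
  have h0 := UPsh.const (n := n) le_rfl zero_le_one
  have h1 := UPsh.const (n := n) zero_le_one le_rfl
  have e0 : en M (ad (fun _ : Cn n => 0) 0) = 0 := by simp [en, Gam]
  have e1 : ∀ z, ad (fun _ : Cn n => 0) 0 z ≤ ad (fun _ : Cn n => 0) i z := fun z => by
    refine smax_mono_left _ ?_
    have h2 : ∀ j, mo (fun _ : Cn n => 0) j z = 0 := fun j => by simp [mo, mol]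
    rw [h2, h2]
  have a := ((h0.adm 0).en_sub (hu.adm i) hM fun z =>
    (e1 z).trans (h0.ad_mono hu (fun y hy => (hu.2 y hy).1) i z)).1
  have b := ((hu.adm i).en_sub (h1.adm 0) hM fun z =>
    (hu.ad_mono h1 (fun y hy => (hu.2 y hy).2) i z).trans (h1.ad_anti (Nat.zero_le i) z)).1
  grind

/-- From Cauchy estimates outside small sets to quasi-uniform convergence. -/
theorem quasi_limit {G : Set (Cn n)} {f : ℕ → Cn n → ℝ} {F : Cn n → ℝ}
    (hF : ∀ z ∈ G, Tendsto (fun j => f j z) atTop (𝓝 (F z)))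
    (hc : ∀ δ > 0, ∀ η > 0, ∃ J, ∀ j ≥ J, ∀ k ≥ j, SmallSet {z ∈ G | δ < |f j z - f k z|} η)
    (hδ : 0 < δ) (hη : 0 < η) :
    ∃ J, ∀ j ≥ J, SmallSet {z ∈ G | δ < |f j z - F z|} η := by
  choose J hJ using fun m : ℕ => hc (δ * (1 / 2) ^ (m + 1)) (by positivity)
    (η * (1 / 2) ^ (m + 1)) (by positivity)
  refine ⟨J 0, fun j hj => ?_⟩
  let s : ℕ → ℕ := fun m => Nat.rec j (fun m t => max (t + 1) (J (m + 1))) m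
  have hs : ∀ m, s m ≤ s (m + 1) := fun m => (Nat.le_succ _).trans (le_max_left _ _)
  have hsJ : ∀ m, J m ≤ s m := by
    rintro (_ | m)
    · exact hj
    grind
  have hst : Tendsto s atTop atTop := by
    refine tendsto_atTop_mono (fun m => ?_) tendsto_id
    induction m with
    | zero => simp
    | succ m ih => grind
  refine (SmallSet.iUnion_geom hη fun m => hJ m (s m) (hsJ m) (s (m + 1)) (hs m)).mono ?_
  rintro z ⟨hz, hlt⟩
  by_contra hcon
  have hb : ∀ m, |f (s m) z - f (s (m + 1)) z| ≤ δ * (1 / 2) ^ (m + 1) := fun m =>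
    not_lt.1 fun hh => hcon (mem_iUnion.2 ⟨m, hz, hh⟩)
  have hsum : ∀ m, |f j z - f (s m) z| ≤ δ - δ * (1 / 2) ^ m := fun m => by
    induction m with
    | zero => simp [s]
    | succ m ih =>
      refine (abs_sub_le _ (f (s m) z) _).trans ((add_le_add ih (hb m)).trans (le_of_eq ?_))
      ring
  have hlim : |f j z - F z| ≤ δ := by
    refine le_of_tendsto' ((tendsto_const_nhds.sub ((hF z hz).comp hst)).abs) fun m =>
      (hsum m).trans ?_
    linarith [show 0 ≤ δ * (1 / 2 : ℝ) ^ m by positivity]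
  linarith

theorem UPsh.tendsto_mo (hu : UPsh u) (hz : z ∈ ball (0 : Cn n) 3) :
    Tendsto (fun i => mo u i z) atTop (𝓝 (u z)) := by
  have h := (hu.1.indicator isOpen_ball).tendsto_mol isOpen_ball hu.ind.1 hu.ind.2.1 hz
  rw [indicator_of_mem hz] at h
  refine h.comp (tendsto_nhdsWithin_iff.2 ⟨?_, .of_forall fun i => (scale_pos i).1⟩)
  exact tendsto_const_nhds.div_atTop (tendsto_atTop_add_const_right _ _ tendsto_natCast_atTop_atTop)

/-- The neighbourhood of the origin on which the local results hold. -/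
abbrev Gb (n : ℕ) : Set (Cn n) := {z | nsq z < 1}

theorem isOpen_Gb : IsOpen (Gb n) := isOpen_lt continuous_nsq continuous_const

theorem norm_lt_one_of_mem_Gb (hz : z ∈ Gb n) : ‖z‖ < 1 := by
  have h : nsq z < 1 := hz
  nlinarith [norm_sq_le_nsq z, norm_nonneg z]

theorem Gb_subset_ball {R : ℝ} (hR : 1 ≤ R) : Gb n ⊆ ball 0 R := fun _ hz =>
  mem_ball_zero_iff.2 ((norm_lt_one_of_mem_Gb hz).trans_le hR)

theorem UPsh.le_mo (hu : UPsh u) (i : ℕ) (hz : z ∈ Gb n) : u z ≤ mo u i z := by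
  have := (hu.1.indicator isOpen_ball).le_mol hu.ind.1 hu.ind.2.1
    (scale_pos i).1 (closedBall_subset_three (z := z) (by
      linarith [norm_lt_one_of_mem_Gb hz]) (scale_pos i).2)
  rwa [indicator_of_mem (Gb_subset_ball (by norm_num) hz)] at this

theorem UPsh.quasi_cont (hu : UPsh u) (hδ : 0 < δ) (hη : 0 < η) :
    ∃ I, ∀ i ≥ I, SmallSet {z ∈ Gb n | δ < |mo u i z - u z|} η := by
  refine quasi_limit (fun z hz => hu.tendsto_mo (Gb_subset_ball (by norm_num) hz))
    (fun δ hδ η hη => ?_) hδ hη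
  obtain ⟨M, hM, κ, hκ, h⟩ := exists_small_of_en (n := n) hδ hη
  have hbd : BddBelow (range fun i => en M (ad u i)) :=
    ⟨0, by rintro _ ⟨i, rfl⟩; exact (hu.en_mem i hM).1⟩
  obtain ⟨J, hJ⟩ := exists_lt_of_ciInf_lt (show ⨅ i, en M (ad u i) < (⨅ i, en M (ad u i)) + κ by
    linarith)
  refine ⟨J, fun j hj k hk => (h (ad u k) (ad u j) (hu.adm k) (hu.adm j) (hu.ad_anti hk) ?_).mono ?_⟩
  · have h1 := ciInf_le hbd k
    have h2 := ((hu.adm j).en_sub (hu.adm J) hM (hu.ad_anti hj)).1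
    linarith
  · rintro z ⟨hz, hlt⟩
    have h1 := hu.ad_anti hk z
    rw [mem_ofPred_eq]
    rw [hu.ad_eq k hz, hu.ad_eq j hz] at *
    grind

theorem quasi_increasing {u : ℕ → Cn n → ℝ} {U : Cn n → ℝ} (hu : ∀ j, UPsh (u j))
    (hmono : ∀ z ∈ ball (0 : Cn n) 3, Monotone fun j => u j z)
    (hU : ∀ z ∈ Gb n, Tendsto (fun j => u j z) atTop (𝓝 (U z))) (hδ : 0 < δ)
    (hη : 0 < η) : ∃ J, ∀ j ≥ J, SmallSet {z ∈ Gb n | δ < |u j z - U z|} η := by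
  refine quasi_limit hU (fun δ hδ η hη => ?_) hδ hη
  obtain ⟨M, hM, κ, hκ, h⟩ := exists_small_of_en (n := n) (half_pos hδ) (half_pos hη)
  let a (j : ℕ) : ℝ := ⨅ i, en M (ad (u j) i)
  have hbd : ∀ j, BddBelow (range fun i => en M (ad (u j) i)) := fun j =>
    ⟨0, by rintro _ ⟨i, rfl⟩; exact ((hu j).en_mem i hM).1⟩
  have hbu : BddAbove (range a) := ⟨en M (ad (fun _ : Cn n => 1) 0), by
    rintro _ ⟨j, rfl⟩; exact (ciInf_le (hbd j) 0).trans ((hu j).en_mem 0 hM).2⟩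
  obtain ⟨J, hJ⟩ := exists_lt_of_lt_ciSup (show (⨆ j, a j) - κ / 2 < ⨆ j, a j by linarith)
  have hem : ∀ i {j k}, j ≤ k → en M (ad (u j) i) ≤ en M (ad (u k) i) := fun i j k hjk => by
    have := (((hu j).adm i).en_sub ((hu k).adm i) hM ((hu j).ad_mono (hu k)
      (fun z hz => hmono z hz hjk) i)).1
    linarith
  refine ⟨J, fun j hj k hk => ?_⟩
  obtain ⟨i₀, hi₀⟩ := exists_lt_of_ciInf_lt (show a k < a k + κ / 2 by linarith)
  have hq := fun c (hc : 0 < c) => (hu j).quasi_cont (half_pos hδ) hc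
  obtain ⟨I, hI⟩ := hq (η / 2) (half_pos hη)
  have hs := h (ad (u j) (max i₀ I)) (ad (u k) (max i₀ I)) ((hu j).adm _) ((hu k).adm _)
    ((hu j).ad_mono (hu k) (fun z hz => hmono z hz hk) _) (by
      have h1 := (((hu k).adm _).en_sub ((hu k).adm i₀) hM ((hu k).ad_anti (le_max_left i₀ I))).1
      have h2 := ciInf_le (hbd j) (max i₀ I)
      have h3 : a J ≤ a j := ciInf_mono (hbd J) fun i => hem i hj
      have h4 := le_ciSup hbu k
      linarith)
  refine ((add_halves η) ▸ (hI _ (le_max_right i₀ I)).union hs).mono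
    (E' := {z ∈ Gb n | δ < |u j z - u k z|}) ?_
  · rintro z ⟨hz, hlt⟩
    have hz3 := Gb_subset_ball (R := 3) (by norm_num) hz
    by_contra hcon
    have h1 : |mo (u j) (max i₀ I) z - u j z| ≤ δ / 2 := by grind
    have h2 : ad (u k) (max i₀ I) z - δ / 2 ≤ ad (u j) (max i₀ I) z := by grind
    rw [(hu j).ad_eq _ hz, (hu k).ad_eq _ hz] at h2
    have h3 := (hu k).le_mo (max i₀ I) hz
    rw [abs_sub_comm, abs_of_nonneg (by linarith [hmono z hz3 hk])] at hlt
    linarith [(abs_le.1 h1).2]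

end

section Negligible

variable {n : ℕ} {h W U : Cn n → ℝ} {u : ℕ → Cn n → ℝ}

theorem smallSet_lt_sub_uscReg (hu : ∀ j, UPsh (u j))
    (hmono : ∀ z ∈ ball (0 : Cn n) 3, Monotone fun j => u j z)
    (hU : ∀ z ∈ ball (0 : Cn n) 3, Tendsto (fun j => u j z) atTop (𝓝 (U z)))
    (hV : IsUscReg h U (ball 0 3)) (hh : UPsh h) {δ η : ℝ} (hδ : 0 < δ) (hη : 0 < η) :
    SmallSet {z ∈ Gb n | U z < h z - 8 * δ} η := by
  have hG := Gb_subset_ball (n := n) (R := 3) (by norm_num)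
  obtain ⟨j, hj⟩ := quasi_increasing hu hmono (fun z hz => hU z (hG hz)) hδ
    (show 0 < η / 3 by linarith)
  obtain ⟨i, hi⟩ := (hu j).quasi_cont hδ (show 0 < η / 3 by linarith)
  obtain ⟨l, hl⟩ := hh.quasi_cont hδ (show 0 < η / 3 by linarith)
  obtain ⟨χ, hχ, hχ'⟩ := ((hj j le_rfl).union (hi i le_rfl)).union (hl l le_rfl)
  have hout : ∀ z ∈ Gb n, -1 < χ z → |u j z - U z| ≤ δ ∧ |mo (u j) i z - u j z| ≤ δ ∧
      |mo h l z - h z| ≤ δ := fun z hz h1 => by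
    have h2 : z ∉ _ := fun hc => (hχ' z ⟨hc, Gb_subset_ball (by norm_num) hz⟩).not_gt h1
    grind
  have hO : IsOpen {z ∈ Gb n | 5 * δ < mo h l z - mo (u j) i z} :=
    isOpen_Gb.inter (isOpen_lt continuous_const
      ((hh.rsm_mo l).continuous.sub ((hu j).rsm_mo i).continuous))
  have hOG : {z ∈ Gb n | 5 * δ < mo h l z - mo (u j) i z} ⊆ ball 0 3 := fun z hz => hG hz.1
  have hle := LPSH.nonpos_of_add_le_uscReg (C := 1) hO (fun j => (hu j).1.mono hOG)
    (fun j z hz => by have := (hu j).2 z (hOG hz); rw [abs_le]; grind)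
    (fun z hz => hU z (hOG hz)) ⟨fun z hz => hV.1 z (hOG hz), hV.2.1.mono hOG,
      fun z hz => hV.2.2 z (hOG hz)⟩
    ((((hχ.1.mono fun z hz => Gb_subset_ball (by norm_num) hz.1).add_const hO 1).sup hO
      (LPSH.const 0)).const_mul hO hδ.le) fun z hz => by
    rcases le_or_gt (χ z) (-1) with hc | hc
    · rw [max_eq_right (by linarith)]
      linarith [hV.1 z (hOG hz)]
    · obtain ⟨h1, h2, h3⟩ := hout z hz.1 hc
      rw [abs_le] at h1 h2 h3
      have := hχ.2.1 z (Gb_subset_ball (by norm_num) hz.1)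
      nlinarith [hz.2, max_le (show χ z + 1 ≤ 1 by linarith) zero_le_one]
  refine ⟨χ, ⟨hχ.1, hχ.2.1, hχ.2.2.trans (by linarith)⟩, fun z hz => ?_⟩
  by_contra hc
  obtain ⟨h1, h2, h3⟩ := hout z hz.1.1 (not_le.1 hc)
  rw [abs_le] at h1 h2 h3
  nlinarith [hle z ⟨hz.1.1, by grind⟩, le_max_left (χ z + 1) 0]

/-- Negligible sets are pluripolar. -/
theorem exists_psh_bot_of_lt_uscReg (hu : ∀ j, UPsh (u j))
    (hmono : ∀ z ∈ ball (0 : Cn n) 3, Monotone fun j => u j z)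
    (hU : ∀ z ∈ ball (0 : Cn n) 3, Tendsto (fun j => u j z) atTop (𝓝 (U z)))
    (hV : IsUscReg h U (ball 0 3)) (hh : UPsh h) :
    ∃ ψ : Cn n → EReal, PSHOnE ψ (ball 0 2) ∧ ∀ z ∈ Gb n, U z < h z → ψ z = ⊥ := by
  have hs : ∀ j : ℕ, SmallSet {z ∈ Gb n | U z < h z} ((1 / 2) ^ j) := fun j => by
    refine (SmallSet.iUnion_geom (c := (1 / 2) ^ j) (by positivity)
      (E := fun m : ℕ => {z ∈ Gb n | U z < h z - 8 * (1 / ((m : ℝ) + 1))}) fun m =>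
        smallSet_lt_sub_uscReg hu hmono hU hV hh (by positivity) (by positivity)).mono ?_
    rintro z ⟨hz, hlt⟩
    obtain ⟨m, hm⟩ := exists_nat_one_div_lt (show 0 < (h z - U z) / 8 by linarith)
    exact mem_iUnion.2 ⟨m, hz, by linarith⟩
  choose χ hχ hχ' using hs
  obtain ⟨ψ, hψ, hψ'⟩ := exists_sum_psh hχ
  refine ⟨ψ, hψ, fun z hz hlt => ?_⟩
  have hz2 := Gb_subset_ball (R := 2) (by norm_num) hz
  rw [hψ' z hz2]
  intro hsum
  exact absurd (ge_of_tendsto' (hsum.tendsto_atTop_zero.neg) (b := 1) fun j => by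
    grind) (by norm_num)

/-- Gluing along a finely open set, up to a pluripolar exceptional set. -/
theorem exists_glue_psh (hh : UPsh h) (hW : UPsh W) (hle : ∀ z ∈ Gb n, h z ≤ W z) {r : ℝ}
    (hr : ∀ z ∈ Gb n, h z < r → W z ≤ r) :
    ∃ ψ : Cn n → EReal, PSHOnE ψ (ball 0 2) ∧ ∃ F : ℕ → Cn n → ℝ, (∀ j, LPSH (F j) (Gb n)) ∧
      (∀ j, ∀ z ∈ Gb n, 0 ≤ F j z ∧ F j z ≤ 1) ∧ ∀ z ∈ Gb n, ψ z ≠ ⊥ →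
        Tendsto (fun j => F j z) atTop (𝓝 (if h z < r then h z else W z)) := by
  have hG3 := Gb_subset_ball (n := n) (R := 3) (by norm_num)
  have hG2 := Gb_subset_ball (n := n) (R := 2) (by norm_num)
  have hδ : ∀ j : ℕ, (0 : ℝ) < (1 / 2) ^ j := fun j => by positivity
  have hI := fun j : ℕ => hh.quasi_cont (hδ j) (hδ j)
  choose I hI using hI
  have hI' := fun j => hI j (I j) le_rfl
  choose χ hχ hχ' using hI'
  obtain ⟨ψ, hψ, hψ'⟩ := exists_sum_psh hχ
  let k (j : ℕ) := mo h (I j)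
  let F (j : ℕ) (z : Cn n) : ℝ := if r - (1 / 2) ^ j < k j z then
    max (h z) (W z - 2 * (1 / 2) ^ j + χ j z) else h z
  have hF : ∀ j, ∀ z ∈ Gb n, h z < r → F j z = h z := fun j z hz hzr => by
    by_cases hk : r - (1 / 2) ^ j < k j z
    · simp only [F, if_pos hk]
      refine max_eq_left ?_
      by_cases hc : χ j z ≤ -1
      · linarith [(hW.2 z (hG3 hz)).2, (hh.2 z (hG3 hz)).1, hδ j]
      · have : |mo h (I j) z - h z| ≤ (1 / 2) ^ j := by
          grind
        linarith [(abs_le.1 this).2, hr z hz hzr, ((hχ j).2.1 z (hG2 hz)).2]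
    grind
  have hb : ∀ j, ∀ z ∈ Gb n, 0 ≤ F j z ∧ F j z ≤ 1 := fun j z hz => by
    have h1 := hh.2 z (hG3 hz)
    have h2 := hW.2 z (hG3 hz)
    have h3 := (hχ j).2.1 z (hG2 hz)
    have := hδ j
    simp only [F]
    split_ifs
    · exact ⟨h1.1.trans (le_max_left _ _), max_le h1.2 (by linarith)⟩
    · exact h1
  refine ⟨ψ, hψ, F, fun j => ?_, hb, fun z hz hb => ?_⟩
  · refine LPSH.of_locally ⟨1, fun z hz => ?_⟩ fun z hz => ?_
    · rw [abs_le]; grind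
    by_cases hzr : h z < r
    · obtain ⟨O, hO, hO'⟩ := upperSemicontinuousOn_iff_preimage_Iio.1 hh.1.1 r
      have hmem : ∀ y ∈ Gb n ∩ O, h y < r := fun y hy =>
        (hO'.symm.subset ⟨hG3 hy.1, hy.2⟩).2
      refine ⟨Gb n ∩ O, isOpen_Gb.inter hO, ⟨hz, (hO'.subset ⟨hG3 hz, hzr⟩).2⟩, ?_⟩
      exact (hh.1.mono (inter_subset_left.trans hG3)).congr (isOpen_Gb.inter hO) fun y hy =>
        hF j y hy.1 (hmem y hy)
    · have hk : IsOpen {y ∈ Gb n | r - (1 / 2) ^ j < k j y} := isOpen_Gb.inter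
        (isOpen_lt continuous_const (hh.rsm_mo _).continuous)
      refine ⟨_, hk, ⟨hz, ?_⟩, ?_⟩
      · have := hh.le_mo (I j) hz
        grind
      · refine (LPSH.sup hk (hh.1.mono fun y hy => hG3 hy.1)
          (((hW.1.mono fun y hy => hG3 hy.1).add_const hk (-(2 * (1 / 2) ^ j))).add hk
            ((hχ j).1.mono fun y hy => hG2 hy.1))).congr hk fun y hy => ?_
        grind
  · have hs : Summable fun j => χ j z := by
      by_contra hc
      exact hb ((hψ' z (hG2 hz)).2 hc)
    split_ifs with hzr
    · simp only [hF _ z hz hzr, tendsto_const_nhds]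
    · have h0 : Tendsto (fun j : ℕ => (1 / 2 : ℝ) ^ j) atTop (𝓝 0) :=
        tendsto_pow_atTop_nhds_zero_of_lt_one (by norm_num) (by norm_num)
      have h1 : Tendsto (fun j => max (h z) (W z - 2 * (1 / 2) ^ j + χ j z)) atTop (𝓝 (W z)) := by
        have := (tendsto_const_nhds (x := h z)).max (((tendsto_const_nhds (x := W z)).sub
          (h0.const_mul 2)).add hs.tendsto_atTop_zero)
        rwa [mul_zero, sub_zero, add_zero, max_eq_right (hle z hz)] at this
      refine h1.congr fun j => ?_
      have := hh.le_mo (I j) hz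
      have := hδ j
      simp only [F, k]
      rw [if_pos (by linarith)]

end Negligible

section HolomorphicSmooth

variable {n : ℕ} {f : Cn n → ℂ} {Ω : Set (Cn n)}

theorem exists_rsm_eq_re (hf : DifferentiableOn ℂ f Ω) {a : Cn n} {R : ℝ} (hR : 0 < R)
    (h : closedBall a (2 * R) ⊆ Ω) : ∃ p, RSm p ∧ ∀ z ∈ ball a R, p z = (f z).re := by
  have hsub : ball a (2 * R) ⊆ Ω := ball_subset_closedBall.trans h
  obtain ⟨C, hC⟩ := (isCompact_closedBall a (2 * R)).exists_bound_of_continuousOn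
    (hf.continuousOn.mono h)
  have hb : ∀ x ∈ ball a (2 * R), |(f x).re| ≤ C := fun x hx =>
    (abs_re_le_norm _).trans (hC x (ball_subset_closedBall hx))
  have h1 : LPSH (fun z => (f z).re) (ball a (2 * R)) :=
    LPSH.re_of_differentiable (hf.mono hsub) isOpen_ball ⟨C, hb⟩
  have h2 : LPSH (fun z => (-f z).re) (ball a (2 * R)) :=
    LPSH.re_of_differentiable (hf.mono hsub).neg isOpen_ball ⟨C, fun x hx => by simp_all⟩
  obtain ⟨C₁, hC₁⟩ := h1.indicator_bound
  obtain ⟨C₂, hC₂⟩ := h2.indicator_bound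
  have m1 := measurable_indicator_of_usc isOpen_ball h1.1
  refine ⟨_, contDiff_mol m1 hC₁ hR, fun z hz => ?_⟩
  have hz2 : closedBall z R ⊆ ball a (2 * R) := closedBall_subset_ball' (by
    have := mem_ball.1 hz; linarith)
  have hz' := hz2 (mem_closedBall_self hR.le)
  have e1 := (h1.indicator isOpen_ball).le_mol m1 hC₁ hR hz2
  have e2 := (h2.indicator isOpen_ball).le_mol (measurable_indicator_of_usc isOpen_ball h2.1)
    hC₂ hR hz2
  have e3 : (ball a (2 * R)).indicator (fun z => (-f z).re) =
      fun z => -(ball a (2 * R)).indicator (fun z => (f z).re) z := by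
    ext z; by_cases hz : z ∈ ball a (2 * R) <;> simp [hz]
  rw [e3] at e2
  simp only [mol, neg_mul, integral_neg, indicator_of_mem hz'] at e1 e2 ⊢
  linarith

theorem contDiffAt_of_differentiableOn (hΩ : IsOpen Ω) (hf : DifferentiableOn ℂ f Ω) {a : Cn n}
    (ha : a ∈ Ω) : ContDiffAt ℝ 2 f a := by
  obtain ⟨R, hR, h⟩ := Metric.nhds_basis_closedBall.mem_iff.1 (hΩ.mem_nhds ha)
  have h' : closedBall a (2 * (R / 2)) ⊆ Ω := by grind
  obtain ⟨p, hp, hp'⟩ := exists_rsm_eq_re hf (half_pos hR) h'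
  obtain ⟨q, hq, hq'⟩ := exists_rsm_eq_re (f := fun z => -I * f z)
    (hf.const_mul _) (half_pos hR) h'
  refine (((Complex.ofRealCLM.contDiff.comp (contDiff_infty.1 hp 2)).add
    ((Complex.ofRealCLM.contDiff.comp (contDiff_infty.1 hq 2)).mul contDiff_const)).contDiffAt
      (f := fun z => ((p z : ℝ) : ℂ) + ((q z : ℝ) : ℂ) * I)).congr_of_eventuallyEq ?_
  filter_upwards [ball_mem_nhds a (half_pos hR)] with z hz
  simp_all

theorem DifferentiableOn.fderiv_apply_Cn (hΩ : IsOpen Ω) (hf : DifferentiableOn ℂ f Ω) (v : Cn n) :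
    DifferentiableOn ℂ (fun x => fderiv ℂ f x v) Ω := fun a ha => by
  have hc := contDiffAt_of_differentiableOn hΩ hf ha
  have hr : ∀ᶠ x in 𝓝 a, ∀ u, fderiv ℝ f x u = fderiv ℂ f x u := by
    filter_upwards [hΩ.mem_nhds ha] with x hx u
    rw [(hf.differentiableAt (hΩ.mem_nhds hx)).fderiv_restrictScalars ℝ]; rfl
  have hd : DifferentiableAt ℝ (fderiv ℝ f) a :=
    (hc.fderiv_right (m := 1) (by norm_num)).differentiableAt one_ne_zero
  have hs : IsSymmSndFDerivAt ℝ f a := hc.isSymmSndFDerivAt (by simp)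
  have hda : ∀ u, HasFDerivAt (fun x => fderiv ℂ f x u)
      ((ContinuousLinearMap.apply ℝ ℂ u).comp (fderiv ℝ (fderiv ℝ f) a)) a := fun u =>
    ((ContinuousLinearMap.apply ℝ ℂ u).hasFDerivAt.comp a hd.hasFDerivAt).congr_of_eventuallyEq (by
      filter_upwards [hr] with x hx
      simp [hx])
  refine ((differentiableAt_iff_restrictScalars ℝ (hda v).differentiableAt).2
    ⟨{ toFun := fun u => fderiv ℝ (fderiv ℝ f) a u v, map_add' := by simp,
       map_smul' := fun c u => ?_, cont := by fun_prop }, ?_⟩).differentiableWithinAt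
  · have h1 := (hda (c • u)).unique (((hda u).const_smul c).congr_of_eventuallyEq
      (.of_forall fun x => by simp))
    have := congrArg (· v) h1
    simp only [ContinuousLinearMap.comp_apply, ContinuousLinearMap.apply_apply, smul_apply] at this
    rw [hs (c • u) v, this, hs v u]; rfl
  · rw [(hda v).fderiv]; ext u; rfl

/-- Directional derivatives of holomorphic functions are holomorphic. -/
theorem DifferentiableOn.fderiv_apply_const {E : Type*} [NormedAddCommGroup E] [NormedSpace ℂ E]
    [FiniteDimensional ℂ E] {f : E → ℂ} {Ω : Set E} (hΩ : IsOpen Ω) (hf : DifferentiableOn ℂ f Ω)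
    (v : E) : DifferentiableOn ℂ (fun x => fderiv ℂ f x v) Ω := by
  let e : E ≃L[ℂ] Cn (Module.finrank ℂ E) := ContinuousLinearEquiv.ofFinrankEq (by simp)
  have h := DifferentiableOn.fderiv_apply_Cn (f := f ∘ e.symm) (hΩ.preimage e.symm.continuous)
    (hf.comp e.symm.differentiable.differentiableOn fun x hx => hx) (e v)
  refine (h.comp (e.differentiable.differentiableOn (s := Ω)) fun x hx => by simp_all).congr
    fun x hx => ?_
  simp [e.symm.comp_right_fderiv]

end HolomorphicSmooth

section LowerBound

variable {n : ℕ}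

theorem cHess_congr {u v : Cn n → ℝ} {z : Cn n} (h : u =ᶠ[𝓝 z] v) : cHess u z = cHess v z := by
  have hd : ∀ a b, d2 u z a b = d2 v z a b := fun a b => by
    refine congrArg (fun L : Cn n →L[ℝ] ℝ => L b) (Filter.EventuallyEq.fderiv_eq ?_)
    filter_upwards [h.eventuallyEq_nhds] with y hy
    rw [hy.fderiv_eq]
  simp only [cHess, hd]

theorem mav_nonneg_of_lpsh {v : Cn n → ℝ} {Ω : Set (Cn n)} (hΩ : IsOpen Ω) (hv : RSm v)
    (hl : LPSH v Ω) {a : Cn n} (ha : a ∈ Ω) : 0 ≤ mav v a :=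
  (RCLike.nonneg_iff.1 (hl.cHess_posSemidef hΩ hv ha).det_nonneg).1

open scoped MatrixOrder in
theorem cHess_eq_zero {p : Cn n → ℝ} {Ω : Set (Cn n)} (hΩ : IsOpen Ω) (hp : RSm p) (h1 : LPSH p Ω)
    (h2 : LPSH (fun z => (-1) * p z) Ω) {a : Cn n} (ha : a ∈ Ω) : cHess p a = 0 := by
  have e1 := h1.cHess_posSemidef hΩ hp ha
  have e2 := h2.cHess_posSemidef hΩ (contDiff_const.mul hp) ha
  rw [cHess_const_mul hp] at e2
  exact le_antisymm (by simpa using Matrix.nonneg_iff_posSemidef.2 e2) e1.nonneg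

theorem lt_of_nsq_lt {z : Cn n} (hz : nsq z < 9 / 8) : ‖z‖ < 5 / 4 := by
  nlinarith [norm_sq_le_nsq z, norm_nonneg z]

/-- A strictly plurisubharmonic minorant touching `u` from below forces a definite amount of
Monge–Ampère mass for all smooth plurisubharmonic functions uniformly close to `u`. -/
theorem exists_lower_bound_smoothMA {u : Cn n → ℝ} {H : Cn n → ℂ} (hu : ContinuousAt u 0)
    (hH : DifferentiableOn ℂ H (ball 0 3)) (hH0 : (H 0).re = 0) {ε : ℝ} (hε : 0 < ε)
    (h : ∀ z ∈ ball (0 : Cn n) 3, u 0 + (H z).re + ε * nsq z ≤ u z) :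
    ∃ f : Cn n → ℝ, Continuous f ∧ HasCompactSupport f ∧ tsupport f ⊆ ball 0 2 ∧ ∃ c > 0, ∃ τ > 0,
      ∀ v : Cn n → ℝ, RSm v → LPSH v (ball 0 2) →
        (∀ z ∈ closedBall (0 : Cn n) (3 / 2), |v z - u z| ≤ τ) → c ≤ ∫ z, f z ∂smoothMA v := by
  have hB : IsOpen (ball (0 : Cn n) (5 / 4)) := isOpen_ball
  have hBH := hH.mono (ball_subset_ball (show (5 / 4 : ℝ) ≤ 3 by norm_num))
  obtain ⟨p, hp, hpH⟩ := exists_rsm_eq_re hH (a := 0) (R := 5 / 4) (by norm_num)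
    (closedBall_subset_ball (by norm_num))
  have hp0 : p 0 = 0 := by simp_all
  obtain ⟨C, hC⟩ := bounded_on_ball hp.continuous 0 (5 / 4)
  have lp : LPSH p (ball 0 (5 / 4)) := (LPSH.re_of_differentiable hBH hB
    ⟨C, fun x hx => by grind⟩).congr hB hpH
  have lp' : LPSH (fun z => (-1) * p z) (ball 0 (5 / 4)) := (LPSH.re_of_differentiable hBH.neg hB
    ⟨C, fun x hx => by simp_all⟩).congr hB fun z hz => by simp_all
  have hev : ∀ᶠ z in 𝓝 (0 : Cn n), u z - u 0 - p z < ε / 40 ∧ nsq z < 1 := by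
    have hc : ContinuousAt (fun z => u z - u 0 - p z) 0 :=
      (hu.sub continuousAt_const).sub hp.continuous.continuousAt
    exact (hc.eventually (gt_mem_nhds (by linarith))).and
      (continuous_nsq.continuousAt.eventually (gt_mem_nhds (by simp [nsq])))
  obtain ⟨δ, hδ, hδ'⟩ := Metric.eventually_nhds_iff_ball.1 hev
  let f : Cn n → ℝ := fun z => max 0 (min 1 (9 - 8 * nsq z))
  have hf0 : ∀ z, 9 / 8 ≤ nsq z → f z = 0 := fun z hz =>
    max_eq_left ((min_le_right _ _).trans (by linarith))
  have hf1 : ∀ z, nsq z ≤ 1 → f z = 1 := fun z hz => by grind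
  have hfc : Continuous f := continuous_const.max (continuous_const.min
    (continuous_const.sub (continuous_const.mul continuous_nsq)))
  have hts : tsupport f ⊆ closedBall 0 (5 / 4) := closure_minimal (fun z hz => by
    by_contra hc
    exact hz (hf0 z (not_lt.1 fun h => hc (by simpa using (lt_of_nsq_lt h).le)))) isClosed_closedBall
  have hfs : HasCompactSupport f := (isCompact_closedBall _ _).of_isClosed_subset
    (isClosed_tsupport f) hts
  refine ⟨f, hfc, hfs, hts.trans (closedBall_subset_ball (by norm_num)),
    4 ^ n * n.factorial * ((ε / 4) ^ n * (2 ^ n * volume.real (ball (0 : Cn n) δ))), ?_, ε / 40,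
    by positivity, fun v hv lv hvu => ?_⟩
  · have : 0 < volume.real (ball (0 : Cn n) δ) :=
      ENNReal.toReal_pos (measure_ball_pos _ _ hδ).ne' measure_ball_lt_top.ne
    positivity
  let a : Cn n → ℝ := fun z => 4 / ε * (v z + ((-1) * p z + -u 0))
  let ζ : Cn n → ℝ := fun z => 2 * nsq z + 1
  have hq : RSm fun z => (-1) * p z + -u 0 := (contDiff_const.mul hp).add contDiff_const
  have ha : RSm a := contDiff_const.mul (hv.add hq)
  have hζ : RSm ζ := (contDiff_const.mul contDiff_nsq).add contDiff_const
  have lv' := lv.mono (ball_subset_ball (show (5 / 4 : ℝ) ≤ 2 by norm_num))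
  have la : LPSH a (ball 0 (5 / 4)) :=
    (lv'.add hB (lp'.add_const hB _)).const_mul hB (by positivity)
  have hvu' : ∀ z, nsq z < 9 / 8 → |v z - u z| ≤ ε / 40 := fun z hz =>
    hvu z (by simpa using (lt_of_nsq_lt hz).le.trans (by norm_num))
  have e1 : ∀ z, 1 ≤ nsq z → nsq z < 9 / 8 → ζ z + 1 / 2 ≤ a z := fun z hz hz' => by
    have h1 := h z (by simpa using (lt_of_nsq_lt hz').trans (by norm_num))
    rw [← hpH z (by simpa using lt_of_nsq_lt hz')] at h1
    have h2 := (abs_le.1 (hvu' z hz')).1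
    have h3 : ε * nsq z - ε / 40 ≤ v z + ((-1) * p z + -u 0) := by linarith
    have h4 := mul_le_mul_of_nonneg_left h3 (show 0 ≤ 4 / ε by positivity)
    have h5 : 4 / ε * (ε * nsq z - ε / 40) = 4 * nsq z - 1 / 10 := by field_simp; ring
    linarith
  have e2 : ∀ z ∈ ball (0 : Cn n) δ, a z + 1 / 2 ≤ ζ z := fun z hz => by
    obtain ⟨h1, hz'⟩ := hδ' z hz
    have h2 := (abs_le.1 (hvu' z (by linarith))).2
    have h3 : v z + ((-1) * p z + -u 0) ≤ ε / 20 := by linarith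
    have h4 := mul_le_mul_of_nonneg_left h3 (show 0 ≤ 4 / ε by positivity)
    have h5 : 4 / ε * (ε / 20) = 1 / 5 := by field_simp; norm_num
    linarith [nsq_nonneg z]
  let w : Cn n → ℝ := fun z => if nsq z < 9 / 8 then smax (ζ z) (a z) else a z
  have hG : IsOpen {z : Cn n | nsq z < 9 / 8} := isOpen_lt continuous_nsq continuous_const
  have hGB : {z : Cn n | nsq z < 9 / 8} ⊆ ball 0 (5 / 4) := fun z hz => by
    simpa using lt_of_nsq_lt hz
  have w1 : ∀ z, 1 < nsq z → w =ᶠ[𝓝 z] a := fun z hz => by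
    filter_upwards [(isOpen_lt continuous_const continuous_nsq).mem_nhds hz] with y hy
    by_cases h : nsq y < 9 / 8
    · simp only [w, if_pos h]; exact smax_of_le (e1 y (le_of_lt hy) h)
    grind
  have w2 : ∀ z, nsq z < 9 / 8 → w =ᶠ[𝓝 z] fun z => smax (ζ z) (a z) := fun z hz => by
    filter_upwards [hG.mem_nhds hz] with y hy using if_pos hy
  have hs : RSm fun z => smax (ζ z) (a z) := ha.add (contDiff_smt.comp (hζ.sub ha))
  have hw : RSm w := contDiff_iff_contDiffAt.2 fun z => by
    by_cases hz : nsq z < 9 / 8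
    · exact hs.contDiffAt.congr_of_eventuallyEq (w2 z hz)
    · exact ha.contDiffAt.congr_of_eventuallyEq (w1 z (by linarith))
  have lw : LPSH w {z | nsq z < 9 / 8} := by
    have lz : LPSH ζ {z | nsq z < 9 / 8} :=
      ((((lpsh_nsq (5 / 4)).const_mul hB two_pos.le).add_const hB 1).mono hGB)
    refine (LPSH.smax hG lz (la.mono hGB) hζ.continuous.continuousOn ha.continuous.continuousOn
      ?_).congr hG fun z hz => if_pos hz
    obtain ⟨C, hC⟩ := bounded_on_ball hs.continuous 0 (5 / 4)
    exact ⟨C, fun x hx => hC x (hGB hx)⟩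
  have hInt : ∀ {g : Cn n → ℝ}, RSm g → Integrable fun z => f z * mav g z := fun hg =>
    (hfc.mul (rsm_mav hg).continuous).integrable_of_hasCompactSupport hfs.mul_right
  have key : ∫ z, f z * mav w z = ∫ z, f z * mav a z := by
    rw [← sub_eq_zero, ← integral_sub (hInt hw) (hInt ha), ← integral_mav_sub_eq_zero ha hw]
    · refine integral_congr_ae (.of_forall fun z => ?_)
      rcases le_or_gt (nsq z) 1 with hz | hz
      · simp only [hf1 z hz, one_mul]
      · simp only [mav, cHess_congr (w1 z hz), sub_self]
    · refine HasCompactSupport.intro (isCompact_closedBall 0 (5 / 4)) fun z hz => ?_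
      have : ¬ nsq z < 9 / 8 := fun h => hz (by simpa using (lt_of_nsq_lt h).le)
      simp only [w, if_neg this, sub_self]
  have hav : ∀ z, f z * mav a z = (4 / ε) ^ n * (f z * mav v z) := fun z => by
    by_cases hz : nsq z < 9 / 8
    · have h0 : cHess (fun z => (-1) * p z + -u 0) z = 0 := by
        refine cHess_eq_zero hB hq (lp'.add_const hB _) ?_ (hGB hz)
        exact (lp.add_const hB (u 0)).congr hB fun z _ => by ring
      have : cHess a z = ((4 / ε : ℝ) : ℂ) • cHess v z := by
        rw [cHess_const_mul (hv.add hq), cHess_add hv hq, h0, add_zero]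
      rw [mav, mav, this, det_smul, ← ofReal_pow, re_ofReal_mul]
      simp; ring
    · simp [hf0 z (not_lt.1 hz)]
  have hfn : ∀ z, 0 ≤ f z := fun z => le_max_left _ _
  have hnn : ∀ {g : Cn n → ℝ}, RSm g → LPSH g {z | nsq z < 9 / 8} → ∀ z, 0 ≤ f z * mav g z :=
    fun hg lg z => by
      by_cases hz : nsq z < 9 / 8
      · exact mul_nonneg (hfn z) (mav_nonneg_of_lpsh hG hg lg hz)
      · simp [hf0 z (not_lt.1 hz)]
  have hlow : 2 ^ n * volume.real (ball (0 : Cn n) δ) ≤ ∫ z, f z * mav w z := by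
    refine le_trans (le_of_eq ?_) (setIntegral_le_integral (s := ball 0 δ) (hInt hw)
      (.of_forall (hnn hw lw)))
    rw [setIntegral_congr_fun (g := fun _ => (2 : ℝ) ^ n) measurableSet_ball fun z hz => ?_]
    · simp [mul_comm]
    · have hz1 := (hδ' z hz).2
      have : w =ᶠ[𝓝 z] ζ := (w2 z (by linarith)).trans (by
        filter_upwards [isOpen_ball.mem_nhds hz] with y hy using smax_of_ge (e2 y hy))
      have h1 : cHess ζ z = (2 : ℂ) • (1 : Matrix (Fin n) (Fin n) ℂ) := by
        rw [cHess_add (u := fun z => 2 * nsq z) (v := fun _ => 1) (contDiff_const.mul contDiff_nsq)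
          contDiff_const, cHess_const_mul contDiff_nsq, cHess_nsq,
          cHess_eq_zero_of_eventually_const (.of_forall fun _ => rfl)]
        simp
      simp only [hf1 z hz1.le, mav, cHess_congr this, h1, det_smul]
      have : ((2 : ℂ) ^ n).re = 2 ^ n := by exact_mod_cast ofReal_re (2 ^ n : ℝ)
      simp [this]
  have hMA : ∫ z, f z ∂smoothMA v = 4 ^ n * n.factorial * ∫ z, f z * mav v z := by
    have hm : Measurable (maDensity v) := ((rsm_mav hv).continuous.measurable).const_mul _
    rw [smoothMA, integral_withDensity_eq_integral_toReal_smul₀ hm.ennreal_ofReal.aemeasurable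
      (.of_forall fun _ => ofReal_lt_top), ← integral_const_mul]
    refine integral_congr_ae (.of_forall fun z => ?_)
    by_cases hz : nsq z < 9 / 8
    · have : 0 ≤ maDensity v z :=
        mul_nonneg (by positivity) (mav_nonneg_of_lpsh hB hv lv' (hGB hz))
      simp only [toReal_ofReal this]
      simp only [smul_eq_mul, maDensity, mav]; ring
    · simp [hf0 z (not_lt.1 hz)]
  rw [hMA]
  refine mul_le_mul_of_nonneg_left ?_ (by positivity)
  rw [key, integral_congr_ae (.of_forall hav), integral_const_mul] at hlow
  have h1 : (ε / 4) ^ n * (4 / ε) ^ n = 1 := by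
    rw [← mul_pow, show ε / 4 * (4 / ε) = 1 by field_simp, one_pow]
  calc _ ≤ (ε / 4) ^ n * ((4 / ε) ^ n * ∫ z, f z * mav v z) :=
        mul_le_mul_of_nonneg_left hlow (by positivity)
    _ = _ := by rw [← mul_assoc, h1, one_mul]

end LowerBound

section RegularPoints

variable {E : Type*} [NormedAddCommGroup E] [NormedSpace ℂ E] [FiniteDimensional ℂ E]

theorem differentiableOn_det {r : ℕ} {W : Set E} {A : E → Matrix (Fin r) (Fin r) ℂ}
    (h : ∀ i j, DifferentiableOn ℂ (fun x => A x i j) W) :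
    DifferentiableOn ℂ (fun x => (A x).det) W := by
  simp only [Matrix.det_apply']
  have hp : Differentiable ℂ fun p : Fin r → ℂ => ∏ i, p i :=
    (contDiff_prod (n := 1) fun i _ => contDiff_apply ℂ ℂ i).differentiable one_ne_zero
  fun_prop

/-- Holomorphic functions on `W` vanishing on `Z`. -/
def VanOn (W Z : Set E) (f : E → ℂ) : Prop := DifferentiableOn ℂ f W ∧ ∀ x ∈ Z, f x = 0

theorem analyticOrderAt_eq_top_of_recursion {κ : ℕ → ℂ → ℂ} {m : ℂ → ℂ} {s : Set ℂ} (hs : s ∈ 𝓝 0)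
    (hκ : ∀ j, DifferentiableOn ℂ (κ j) s) (hm : DifferentiableOn ℂ m s) (hm0 : m 0 ≠ 0)
    (h0 : ∀ j, κ j 0 = 0) (h : ∀ j, ∀ t ∈ s, κ (j + 1) t = m t * deriv (κ j) t) :
    analyticOrderAt (κ 0) 0 = ⊤ := by
  have ha : ∀ j, AnalyticAt ℂ (κ j) 0 := fun j => (hκ j).analyticAt hs
  have hle : ∀ (N : ℕ) j, (N : ℕ∞) ≤ analyticOrderAt (κ j) 0 := fun N => by
    induction N with
    | zero => simp
    | succ N ih =>
      intro j
      rw [Nat.cast_add, Nat.cast_one, ← analyticOrderAt_deriv_ge_iff (ha j) (h0 j)]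
      refine (ih (j + 1)).trans_eq ?_
      rw [analyticOrderAt_congr (g := m * deriv (κ j)) (by filter_upwards [hs] with t ht using h j t ht),
        analyticOrderAt_mul (hm.analyticAt hs) (ha j).deriv,
        (hm.analyticAt hs).analyticOrderAt_eq_zero.2 hm0, zero_add]
  exact ENat.eq_top_iff_forall_ge.2 fun N => hle N 0

/-- The regular points of the zero set of a space of holomorphic functions contain the complement
of the zero set of one holomorphic function. -/
theorem exists_regular_locus {W Z : Set E} (hW : IsOpen W) (hZW : Z ⊆ W) (hZ : Z.Nonempty) :
    ∃ (k : ℕ) (l : E →L[ℂ] Cn k) (M : E → ℂ), DifferentiableOn ℂ M W ∧ (∃ q ∈ Z, M q ≠ 0) ∧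
      ∀ q ∈ Z, M q ≠ 0 → ∃ (y : Cn k → E) (ρ : ℝ), 0 < ρ ∧ DifferentiableOn ℂ y (ball 0 ρ) ∧
        y 0 = q ∧ (∀ z ∈ ball (0 : Cn k) ρ, y z ∈ W ∧ l (y z) = l q + z ∧
          ∀ f, VanOn W Z f → f (y z) = 0) ∧ ∀ᶠ x in 𝓝 q, x ∈ Z → x = y (l x - l q) := by
  classical
  have hfd : ∀ {f : E → ℂ}, VanOn W Z f → ∀ x ∈ W, DifferentiableAt ℂ f x := fun hf x hx =>
    hf.1.differentiableAt (hW.mem_nhds hx)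
  let Q (r : ℕ) : Prop := ∃ (h : Fin r → E → ℂ) (q : E), (∀ i, VanOn W Z (h i)) ∧ q ∈ Z ∧
    Function.Surjective fun v i => fderiv ℂ (h i) q v
  have hQb : ∀ r, Q r → r ≤ Module.finrank ℂ E := by
    rintro r ⟨h, q, -, -, hs⟩
    simpa using LinearMap.finrank_le_finrank_of_surjective
      (f := LinearMap.pi fun i => (fderiv ℂ (h i) q : E →ₗ[ℂ] ℂ)) hs
  have hQ0 : Q 0 := ⟨fun i => i.elim0, hZ.some, fun i => i.elim0, hZ.some_mem, fun y => ⟨0,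
    Subsingleton.elim _ _⟩⟩
  obtain ⟨r, hQr, hmax⟩ : ∃ r, Q r ∧ ¬ Q (r + 1) :=
    ⟨_, Nat.findGreatest_spec (P := Q) (Nat.zero_le _) hQ0, fun hc =>
      (Nat.lt_succ_self _).not_ge (Nat.le_findGreatest (hQb _ hc) hc)⟩
  obtain ⟨h, q₀, hI, hq₀, hsurj⟩ := hQr
  let L : E →ₗ[ℂ] Cn r := LinearMap.pi fun i => (fderiv ℂ (h i) q₀ : E →ₗ[ℂ] ℂ)
  obtain ⟨g, hg⟩ := LinearMap.exists_leftInverse_of_injective (LinearMap.ker L).subtype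
    (Submodule.ker_subtype _)
  set k := Module.finrank ℂ (LinearMap.ker L)
  let b : LinearMap.ker L ≃ₗ[ℂ] Cn k := LinearEquiv.ofFinrankEq _ _ (by simp [k])
  have hinj : Injective (L.prod (b.toLinearMap ∘ₗ g)) := by
    rw [← LinearMap.ker_eq_bot, LinearMap.ker_eq_bot']
    intro v hv
    obtain ⟨h1, h2⟩ := Prod.ext_iff.1 hv
    have h3 := LinearMap.congr_fun hg ⟨v, h1⟩
    have h4 : g v = 0 := by simpa using h2
    simpa [h4, eq_comm] using congrArg Subtype.val h3
  have hdim : Module.finrank ℂ E = Module.finrank ℂ (Cn r × Cn k) := by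
    have := L.finrank_range_add_finrank_ker
    rw [LinearMap.range_eq_top.2 hsurj, finrank_top] at this
    simpa [Module.finrank_prod, k] using this.symm
  let e : E ≃L[ℂ] Cn r × Cn k :=
    (LinearMap.linearEquivOfInjective _ hinj hdim).toContinuousLinearEquiv
  have he1 : ∀ v i, (e v).1 i = fderiv ℂ (h i) q₀ v := fun v i => rfl
  let w (j : Fin r) : E := e.symm (Pi.single j 1, 0)
  let J (x : E) : Matrix (Fin r) (Fin r) ℂ := of fun i j => fderiv ℂ (h i) x (w j)
  let M (x : E) : ℂ := (J x).det
  have hJ : ∀ i j, DifferentiableOn ℂ (fun x => J x i j) W := fun i j =>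
    DifferentiableOn.fderiv_apply_const hW (hI i).1 (w j)
  have hM : DifferentiableOn ℂ M W := differentiableOn_det hJ
  let ξ (z : Cn k) (x : E) : E := M x • e.symm (0, z) -
    ∑ j, (J x).cramer (fun i => fderiv ℂ (h i) x (e.symm (0, z))) j • w j
  have hξh : ∀ z x i, fderiv ℂ (h i) x (ξ z x) = 0 := fun z x i => by
    have := congrFun (Matrix.mulVec_cramer (J x) fun i => fderiv ℂ (h i) x (e.symm (0, z))) i
    simp only [mulVec, dotProduct, Pi.smul_apply, smul_eq_mul] at this
    simp only [ξ, map_sub, map_smul, map_sum, smul_eq_mul, sub_eq_zero]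
    rw [← this]
    exact sum_congr rfl fun j _ => mul_comm _ _
  have hξe : ∀ z x, (e (ξ z x)).2 = M x • z := fun z x => by simp [ξ, w, Prod.snd_sum]
  let D (z : Cn k) (f : E → ℂ) (x : E) : ℂ := M x * fderiv ℂ f x (ξ z x)
  have hinjx : ∀ x, M x ≠ 0 → ∀ v, (∀ i, fderiv ℂ (h i) x v = 0) → (e v).2 = 0 → v = 0 := fun x hx v h1 h2 => by
    have hv : v = ∑ j, (e v).1 j • w j := by
      apply e.injective
      refine Prod.ext ?_ ?_
      · ext i; simp [w, Prod.fst_sum, Pi.single_apply]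
      · simp [w, Prod.snd_sum, h2]
    have h3 : (e v).1 = 0 := Matrix.eq_zero_of_mulVec_eq_zero hx (by
      ext i
      have := h1 i
      rw [hv, map_sum] at this
      simpa [mulVec, dotProduct, J, mul_comm] using this)
    exact e.injective (Prod.ext (by simpa using h3) (by simpa using h2))
  have hequiv : ∀ x, M x ≠ 0 → ∃ T : E ≃L[ℂ] Cn r × Cn k, ∀ v,
      T v = (fun i => fderiv ℂ (h i) x v, (e v).2) := fun x hx =>
    ⟨(LinearMap.linearEquivOfInjective ((LinearMap.pi fun i => (fderiv ℂ (h i) x : E →ₗ[ℂ] ℂ)).prod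
      ((LinearMap.snd ℂ _ _) ∘ₗ e.toLinearMap)) (by
        rw [← LinearMap.ker_eq_bot, LinearMap.ker_eq_bot']
        intro v hv
        obtain ⟨h1, h2⟩ := Prod.ext_iff.1 hv
        exact hinjx x hx v (fun i => congrFun h1 i) h2) hdim).toContinuousLinearEquiv, fun v => rfl⟩
  have hD : ∀ z f, VanOn W Z f → VanOn W Z (D z f) := by
    refine fun z f hf => ⟨hM.mul ?_, fun x hx => ?_⟩
    · have hc : ∀ j, DifferentiableOn ℂ (fun x => (J x).cramer
          (fun i => fderiv ℂ (h i) x (e.symm (0, z))) j) W := fun j => by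
        simp only [Matrix.cramer_apply]
        refine differentiableOn_det fun i j' => ?_
        by_cases hj : j' = j
        · simpa [hj, Matrix.updateCol_apply] using
            DifferentiableOn.fderiv_apply_const hW (hI i).1 (e.symm (0, z))
        · simpa [hj, Matrix.updateCol_apply] using hJ i j'
      simp only [ξ, map_sub, map_smul, map_sum, smul_eq_mul]
      exact (hM.mul (DifferentiableOn.fderiv_apply_const hW hf.1 _)).sub (DifferentiableOn.fun_sum
        fun j _ => (hc j).mul (DifferentiableOn.fderiv_apply_const hW hf.1 _))
    · by_cases hMx : M x = 0
      · simp [D, hMx]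
      by_contra hne
      have hne' : fderiv ℂ f x (ξ z x) ≠ 0 := fun h0 => hne (by simp [D, h0])
      obtain ⟨T, hT⟩ := hequiv x hMx
      refine hmax ⟨Fin.cons f h, x, fun i => Fin.cases (by simpa using hf) (by simpa using hI) i, hx,
        fun y => ?_⟩
      let v := T.symm (fun i => y i.succ, 0)
      have hv : ∀ i, fderiv ℂ (h i) x v = y i.succ := fun i => by
        have := hT v
        simp only [v, T.apply_symm_apply] at this
        exact (congrFun (congrArg Prod.fst this) i).symm
      refine ⟨v + ((y 0 - fderiv ℂ f x v) / fderiv ℂ f x (ξ z x)) • ξ z x, funext fun i =>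
        Fin.cases ?_ (fun i => ?_) i⟩
      · simp [hne']
      · simp [hv, hξh]
  refine ⟨k, (snd ℂ _ _).comp (e : E →L[ℂ] Cn r × Cn k), M, hM, ⟨q₀, hq₀, ?_⟩,
    fun q hq hMq => ?_⟩
  · have : J q₀ = 1 := by
      ext i j
      simp only [J, of_apply, ← he1, w, e.apply_symm_apply, Matrix.one_apply, Pi.single_apply]
    simp [M, this]
  let Φ (x : E) : Cn r × Cn k := (fun i => h i x, (e x).2 - (e q).2)
  have hΦ : ∀ x ∈ W, ∀ T : E ≃L[ℂ] Cn r × Cn k, (∀ v, T v = (fun i => fderiv ℂ (h i) x v, (e v).2)) →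
      HasStrictFDerivAt Φ (T : E →L[ℂ] Cn r × Cn k) x := fun x hx T hT => by
    have h1 : HasStrictFDerivAt (fun x i => h i x) (ContinuousLinearMap.pi fun i =>
        fderiv ℂ (h i) x) x := hasStrictFDerivAt_pi.2 fun i =>
      hasStrictFDerivAt_of_hasFDerivAt_of_continuousAt (by
        filter_upwards [hW.mem_nhds hx] with y hy using (hfd (hI i) y hy).hasFDerivAt)
        ((continuousOn_clm_apply.2 fun v => (DifferentiableOn.fderiv_apply_const hW (hI i).1
          v).continuousOn).continuousAt (hW.mem_nhds hx))
    have h2 : HasStrictFDerivAt (fun x => (e x).2 - (e q).2)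
        ((snd ℂ _ _).comp (e : E →L[ℂ] Cn r × Cn k)) x :=
      ((snd ℂ _ _).comp (e : E →L[ℂ] Cn r × Cn k)).hasStrictFDerivAt.sub_const _
    convert h1.prodMk h2 using 1
    ext v : 1
    exact hT v
  have hqW := hZW hq
  obtain ⟨T, hT⟩ := hequiv q hMq
  have hst := hΦ q hqW T hT
  let Ψ := hst.toOpenPartialHomeomorph Φ
  have hΨc : (Ψ : E → Cn r × Cn k) = Φ := hst.toOpenPartialHomeomorph_coe
  have hqs : q ∈ Ψ.source := hst.mem_toOpenPartialHomeomorph_source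
  have hΦq : Φ q = 0 := Prod.ext (funext fun i => (hI i).2 q hq) (by simp [Φ])
  have h0t : (0 : Cn r × Cn k) ∈ Ψ.target := by
    have := Ψ.map_source hqs
    rwa [hΨc, hΦq] at this
  have hs0 : Ψ.symm 0 = q := by rw [← hΦq, ← hΨc, Ψ.left_inv hqs]
  have hs0' : Ψ.symm (0, 0) = q := hs0
  have hWM : IsOpen {x ∈ W | M x ≠ 0} := hM.continuousOn.isOpen_inter_preimage hW isOpen_ne
  have hev : ∀ᶠ z : Cn k in 𝓝 0, ((0, z) : Cn r × Cn k) ∈ Ψ.target ∧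
      Ψ.symm (0, z) ∈ {x ∈ W | M x ≠ 0} := by
    have hc : ContinuousAt (fun z : Cn k => ((0, z) : Cn r × Cn k)) 0 := by fun_prop
    refine (hc.eventually (Ψ.open_target.mem_nhds h0t)).and (hc.eventually
      ((Ψ.continuousAt_symm h0t).eventually (hWM.mem_nhds ?_)))
    exact hs0.symm ▸ ⟨hqW, hMq⟩
  obtain ⟨ρ, hρ, hball⟩ := Metric.eventually_nhds_iff_ball.1 hev
  let y (z : Cn k) : E := Ψ.symm (0, z)
  have hΦy : ∀ z ∈ ball (0 : Cn k) ρ, Φ (y z) = (0, z) := fun z hz => by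
    exact Ψ.right_inv (hball z hz).1
  have hyd : ∀ z ∈ ball (0 : Cn k) ρ, ∃ y' : Cn k →L[ℂ] E, HasFDerivAt y y' z ∧
      ∀ b, M (y z) • y' b = ξ b (y z) := fun z hz => by
    obtain ⟨ht, hyW, hyM⟩ := hball z hz
    obtain ⟨T, hT⟩ := hequiv (y z) hyM
    have h1 := Ψ.hasFDerivAt_symm (f' := T) ht (by rw [hΨc]; fun_prop)
    refine ⟨_, h1.comp z (hasFDerivAt_prodMk_right 0 z), fun b => T.injective ?_⟩
    rw [map_smul, hT (ξ b (y z)), hξe]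
    simp only [hξh]
    simp [Prod.ext_iff, funext_iff]
  have hydiff : DifferentiableOn ℂ y (ball 0 ρ) := fun z hz =>
    (hyd z hz).choose_spec.1.differentiableAt.differentiableWithinAt
  refine ⟨y, ρ, hρ, hydiff, hs0, fun z hz => ⟨(hball z hz).2.1, ?_, fun f hf => ?_⟩, ?_⟩
  · have := congrArg Prod.snd (hΦy z hz)
    simp only [Φ, sub_eq_iff_eq_add'] at this
    exact this
  · let s : Set ℂ := {t | t • z ∈ ball (0 : Cn k) ρ}
    have hso : IsOpen s := isOpen_ball.preimage (by fun_prop)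
    have h0s : (0 : ℂ) ∈ s := by simpa [s] using hρ
    have hcv : Convex ℝ s := (convex_ball (0 : Cn k) ρ).is_linear_preimage
      (f := fun t : ℂ => t • z) ⟨fun a b => add_smul a b z, fun c a => smul_assoc c a z⟩
    let κ (j : ℕ) (t : ℂ) : ℂ := (D z)^[j] f (y (t • z))
    have hIj : ∀ j, VanOn W Z ((D z)^[j] f) := fun j => by
      induction j with
      | zero => exact hf
      | succ j ih => rw [Function.iterate_succ_apply']; exact hD z _ ih
    have hys : DifferentiableOn ℂ (fun t : ℂ => y (t • z)) s :=
      hydiff.comp (by fun_prop) fun t ht => ht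
    have hmaps : MapsTo (fun t : ℂ => y (t • z)) s W := fun t ht => (hball _ ht).2.1
    have hκ : ∀ j, DifferentiableOn ℂ (κ j) s := fun j => (hIj j).1.comp hys hmaps
    have htop := analyticOrderAt_eq_top_of_recursion (hso.mem_nhds h0s) hκ
      (m := fun t => M (y (t • z)) ^ 2) ((hM.comp hys hmaps).pow 2)
      (by simpa [y, hs0'] using hMq)
      (fun j => by
        have := (hIj j).2 q hq
        simpa [κ, y, hs0'] using this)
      (fun j t ht => by
        obtain ⟨y', h1, h2⟩ := hyd _ ht
        have h3 : HasDerivAt (fun t : ℂ => t • z) z t := by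
          simpa using (hasDerivAt_id t).smul_const z
        have h4 := (hfd (hIj j) _ (hmaps ht)).hasFDerivAt.comp_hasDerivAt t
          (h1.comp_hasDerivAt t h3)
        have h5 : deriv (κ j) t = fderiv ℂ ((D z)^[j] f) (y (t • z)) (y' z) := h4.deriv
        simp only [κ, Function.iterate_succ_apply', D]
        rw [← h2, map_smul, smul_eq_mul, ← mul_assoc, ← sq]
        exact congrArg _ h5.symm)
    have := AnalyticOnNhd.eqOn_zero_of_preconnected_of_eventuallyEq_zero
      ((hκ 0).analyticOnNhd hso) hcv.isPreconnected h0s (analyticOrderAt_eq_top.1 htop)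
    simpa [κ] using this (show (1 : ℂ) ∈ s by simpa [s] using hz)
  · filter_upwards [Ψ.open_source.mem_nhds hqs] with x hx hxZ
    have h1 : Φ x = (0, (e x).2 - (e q).2) := Prod.ext (funext fun i => (hI i).2 x hxZ) rfl
    have h2 := Ψ.left_inv hx
    rw [hΨc, h1] at h2
    exact h2.symm

end RegularPoints

section Charts

variable {X : Type*} [TopologicalSpace X] {S : CSpace X} {m : ℕ}
variable {γ : Cn m → X} {Ω : Set (Cn m)} {D : Set X}

theorem CChart.exists_nhd (c : CChart X) {x : X} (hx : x ∈ c.U) {O : Set X} (hO : IsOpen O)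
    (hxO : x ∈ O) : ∃ W : Set c.E, IsOpen W ∧ W ⊆ c.V ∧ c.φ x ∈ W ∧
      ∀ y ∈ c.U, c.φ y ∈ W → y ∈ O := by
  obtain ⟨V, hV, hVe⟩ := c.open_image (c.U ∩ O) inter_subset_left (c.openU.inter hO)
  refine ⟨V ∩ c.V, hV.inter c.subvariety.1, inter_subset_right,
    ⟨(hVe.subset ⟨x, ⟨hx, hxO⟩, rfl⟩).2, c.subvariety.2.1 (c.mapsToB x hx)⟩, fun y hy hyV => ?_⟩
  obtain ⟨y', hy', he⟩ := hVe.symm.subset ⟨c.mapsToB y hy, hyV.1⟩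
  exact c.injOn hy'.1 hy he ▸ hy'.2

theorem CSpace.exists_transition {c d : CChart X} (hc : c ∈ S.atlas) (hd : d ∈ S.atlas) {x : X}
    (hxc : x ∈ c.U) (hxd : x ∈ d.U) {V : Set d.E} (hV : IsOpen V) (hxV : d.φ x ∈ V) :
    ∃ (W : Set c.E) (F : c.E → d.E), IsOpen W ∧ W ⊆ c.V ∧ c.φ x ∈ W ∧ DifferentiableOn ℂ F W ∧
      MapsTo F W V ∧ ∀ y ∈ c.U, c.φ y ∈ W → y ∈ d.U ∧ F (c.φ y) = d.φ y := by
  obtain ⟨W₀, hW₀, hx₀, F, hF, hFe⟩ := S.compat c hc d hd x ⟨hxc, hxd⟩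
  obtain ⟨W₁, hW₁, hWV, hx₁, hW₁d⟩ := c.exists_nhd hxc d.openU hxd
  refine ⟨(W₀ ∩ F ⁻¹' V) ∩ W₁, F, (hF.continuousOn.isOpen_inter_preimage hW₀ hV).inter hW₁,
    fun w hw => hWV hw.2, ⟨⟨hx₀, ?_⟩, hx₁⟩, hF.mono fun w hw => hw.1.1, fun w hw => hw.1.2,
    fun y hy hyW => ⟨hW₁d y hy hyW.2, hFe y ⟨hy, hW₁d y hy hyW.2⟩ hyW.1.1⟩⟩
  grind

/-- Holomorphic maps from subsets of `ℂᵐ` to a complex space. -/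
def HolParam (S : CSpace X) (γ : Cn m → X) (Ω : Set (Cn m)) : Prop :=
  ∀ z ∈ Ω, ∃ c ∈ S.atlas, ∃ N, IsOpen N ∧ z ∈ N ∧ N ⊆ Ω ∧ MapsTo γ N c.U ∧
    DifferentiableOn ℂ (fun z => c.φ (γ z)) N

theorem HolParam.chart (h : HolParam S γ Ω) {z : Cn m} (hz : z ∈ Ω)
    {d : CChart X} (hd : d ∈ S.atlas) (hzd : γ z ∈ d.U) {V : Set d.E} (hV : IsOpen V)
    (hzV : d.φ (γ z) ∈ V) : ∃ N, IsOpen N ∧ z ∈ N ∧ N ⊆ Ω ∧ MapsTo γ N d.U ∧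
      MapsTo (fun z => d.φ (γ z)) N V ∧ DifferentiableOn ℂ (fun z => d.φ (γ z)) N := by
  obtain ⟨c, hc, N, hN, hzN, hNΩ, hNc, hdiff⟩ := h z hz
  obtain ⟨W, F, hW, -, hzW, hF, hFV, hFe⟩ := S.exists_transition hc hd (hNc hzN) hzd hV hzV
  have hsub : ∀ w ∈ N ∩ (fun z => c.φ (γ z)) ⁻¹' W, γ w ∈ d.U ∧ F (c.φ (γ w)) = d.φ (γ w) :=
    fun w hw => hFe _ (hNc hw.1) hw.2
  refine ⟨N ∩ (fun z => c.φ (γ z)) ⁻¹' W, hdiff.continuousOn.isOpen_inter_preimage hN hW,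
    ⟨hzN, hzW⟩, fun w hw => hNΩ hw.1, fun w hw => (hsub w hw).1, fun w hw => ?_, ?_⟩
  · simp only [← (hsub w hw).2]; exact hFV hw.2
  · exact (hF.comp (hdiff.mono inter_subset_left) fun w hw => hw.2).congr fun w hw =>
      (hsub w hw).2.symm

theorem HolParam.continuousOn (h : HolParam S γ Ω) :
    ContinuousOn γ Ω := fun z hz => by
  refine ContinuousAt.continuousWithinAt fun O hO => ?_
  obtain ⟨O', hO', hO'o, hzO⟩ := _root_.mem_nhds_iff.1 hO
  obtain ⟨c, hc, hzc⟩ := S.chart_cover (γ z)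
  obtain ⟨W, hW, -, hzW, hWO⟩ := c.exists_nhd hzc hO'o hzO
  obtain ⟨N, hN, hzN, -, h1, h2, -⟩ := h.chart hz hc hzc hW hzW
  exact mem_map.2 (mem_of_superset (hN.mem_nhds hzN) fun w hw => hO' (hWO _ (h1 hw) (h2 hw)))

theorem HolParam.differentiableOn (h : HolParam S γ Ω) {f : X → ℂ}
    (hf : SpaceHolOn S f D) (hD : MapsTo γ Ω D) :
    DifferentiableOn ℂ (fun z => f (γ z)) Ω := fun z hz => by
  obtain ⟨c, hc, hzc, V, hV, -, hzV, -, F, hF, hFe⟩ := hf _ (hD hz)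
  obtain ⟨N, hN, hzN, -, h1, h2, h3⟩ := h.chart hz hc hzc hV hzV
  exact ((((hF.comp h3 h2).congr fun w hw => (hFe _ (h1 hw) (h2 hw)).symm) z hzN).differentiableAt
    (hN.mem_nhds hzN)).differentiableWithinAt

theorem SpaceHolOn.continuousOn {f : X → ℂ} (hf : SpaceHolOn S f D) :
    ContinuousOn f D := fun x hx => by
  obtain ⟨c, hc, hxc, V, hV, -, hxV, -, F, hF, hFe⟩ := hf x hx
  have h1 := (hF.continuousOn.continuousAt (hV.mem_nhds hxV)).comp
    (c.contOn.continuousAt (c.openU.mem_nhds hxc))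
  refine (h1.congr ?_).continuousWithinAt
  filter_upwards [(c.contOn.isOpen_inter_preimage c.openU hV).mem_nhds ⟨hxc, hxV⟩] with y hy
    using hFe y hy.1 hy.2

theorem LPSH.comp_clm {E E' : Type*} [NormedAddCommGroup E] [NormedSpace ℂ E]
    [NormedAddCommGroup E'] [NormedSpace ℂ E'] {u : E → ℝ} {V : Set E} (hu : LPSH u V)
    (e : E' →L[ℂ] E) : LPSH (fun z => u (e z)) (e ⁻¹' V) := by
  refine ⟨fun x hx c hc => ?_, ?_, fun a ha b ε hε => ?_⟩
  · exact (e.continuous.continuousWithinAt.tendsto_nhdsWithin (fun y hy => hy)).eventually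
      (hu.1 (e x) hx c hc)
  · obtain ⟨C, hC⟩ := hu.2.1
    exact ⟨C, fun x hx => hC _ hx⟩
  · simpa using hu.2.2 (e a) ha (e b) ε hε

theorem HolParam.lpsh_trunc (h : HolParam S γ Ω) {u : X → EReal}
    (hu : SpacePSHOn S u D) (hD : MapsTo γ Ω D) {C t : ℝ} (hC : ∀ z ∈ Ω, u (γ z) ≤ C)
    (ht : -t ≤ C) : LPSH (fun z => trunc t (u (γ z))) Ω := by
  refine LPSH.of_locally ⟨max t C, fun z hz => ?_⟩ fun z hz => ?_
  · have h1 := neg_le_trunc (m := t) (hu.1 _ (hD hz))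
    rw [abs_le]
    exact ⟨by grind, (trunc_le (hC z hz) ht).trans (le_max_right _ _)⟩
  obtain ⟨c, hc, hzc, V, hV, -, hzV, hVD, ψ, hψ, hψe⟩ := hu.2.2 _ (hD hz)
  have hlt : ψ (c.φ (γ z)) < (C + 1 : ℝ) := by
    rw [hψe _ hzc hzV]
    exact (hC z hz).trans_lt (coe_lt_coe_iff.2 (lt_add_one C))
  obtain ⟨O, hO, hOe⟩ := upperSemicontinuousOn_iff_preimage_Iio.1 hψ.2.1 ((C + 1 : ℝ) : EReal)
  have hVO := hV.inter hO
  obtain ⟨N, hN, hzN, -, h1, h2, h3⟩ := h.chart hz hc hzc hVO ⟨hzV, (hOe.subset ⟨hzV, hlt⟩).2⟩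
  let e : c.E ≃L[ℂ] Cn (Module.finrank ℂ c.E) := ContinuousLinearEquiv.ofFinrankEq (by simp)
  have hl := ((hψ.mono inter_subset_left).lpsh_trunc hVO (M := C + 1)
    (fun x hx => (hOe.symm.subset hx).2.le) t).comp_clm e.symm.toContinuousLinearMap
  refine ⟨N, hN, hzN, ((hl.comp_holomorphic (hVO.preimage e.symm.continuous) hN
    (e.differentiable.comp_differentiableOn h3) fun w hw => by simpa using h2 hw).congr hN
      fun w hw => ?_)⟩
  simp [hψe _ (h1 hw) (h2 hw).1]

end Charts

section Peak

variable {X : Type*} [TopologicalSpace X] {S : CSpace X}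

/-- The real part of a holomorphic function attached to a finite family and a point. -/
def peak (s : Finset (X → ℂ)) (b x : X) : ℝ :=
  (∑ f ∈ s, 2 * conj (f b) * (f x - f b)).re

theorem peak_eq (s : Finset (X → ℂ)) (b x : X) :
    peak s b x = ∑ f ∈ s, ‖f x‖ ^ 2 - ∑ f ∈ s, ‖f b‖ ^ 2 - ∑ f ∈ s, ‖f x - f b‖ ^ 2 := by
  simp only [peak, re_sum, ← Finset.sum_sub_distrib, ← normSq_eq_norm_sq]
  refine sum_congr rfl fun f _ => ?_
  simp [normSq_apply]
  ring

theorem exists_peak_set [T2Space X] [SecondCountableTopology X] {K : Set X} (hK : IsCompact K)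
    (hne : K.Nonempty) {𝒪 : Set (Set X)} (h𝒪 : ∀ O ∈ 𝒪, IsOpen O) (hcov : ∀ x ∈ K, ∃ O ∈ 𝒪, x ∈ O)
    (hsep : ∀ x ∈ K, ∀ y ∈ K, x ≠ y → ∃ f : X → ℂ, SpaceHolOn S f univ ∧ f x ≠ f y) :
    ∃ O ∈ 𝒪, ∃ s : Finset (X → ℂ), (∀ f ∈ s, SpaceHolOn S f univ) ∧ ∃ b ∈ K, ∃ ε > 0,
      ∀ x ∈ K, peak s b x ≤ 0 ∧ (x ∉ O → peak s b x ≤ -ε) := by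
  classical
  have := isCompact_iff_compactSpace.1 hK
  let _ : MetricSpace K := TopologicalSpace.metrizableSpaceMetric K
  obtain ⟨δ, hδ, hL⟩ := lebesgue_number_lemma_of_metric (s := (univ : Set K)) (ι := 𝒪)
    (c := fun O => Subtype.val ⁻¹' O.1) isCompact_univ
    (fun O => (h𝒪 O.1 O.2).preimage continuous_subtype_val) fun x _ => by simp_all
  have hcl : IsCompact {p : K × K | δ ≤ dist p.1 p.2} :=
    (isClosed_le continuous_const (continuous_fst.dist continuous_snd)).isCompact
  have hsep' : ∀ p ∈ {p : K × K | δ ≤ dist p.1 p.2}, ∃ f : X → ℂ, SpaceHolOn S f univ ∧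
      f p.1 ≠ f p.2 := fun p hp => hsep _ p.1.2 _ p.2.2 fun h =>
    (hδ.trans_le hp).ne' (by rw [Subtype.ext h, dist_self])
  choose! F hF hFne using hsep'
  have hFc : ∀ p ∈ {p : K × K | δ ≤ dist p.1 p.2}, Continuous (F p) := fun p hp =>
    continuousOn_univ.1 (hF p hp).continuousOn
  obtain ⟨t, htK, htc⟩ := hcl.elim_nhds_subcover (fun p => {p' : K × K | F p p'.1 ≠ F p p'.2})
    fun p hp => (isOpen_ne_fun ((hFc p hp).comp (continuous_subtype_val.comp continuous_fst))
      ((hFc p hp).comp (continuous_subtype_val.comp continuous_snd))).mem_nhds (hFne p hp)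
  have hcont : ∀ b, Continuous (peak (t.image F) b) := fun b => continuous_re.comp
    (continuous_finsetSum _ fun f hf => by
      obtain ⟨p, hp, rfl⟩ := Finset.mem_image.1 hf
      exact continuous_const.mul ((hFc p (htK p hp)).sub continuous_const))
  obtain ⟨b, hb, hmax⟩ := hK.exists_isMaxOn hne (f := fun x => ∑ f ∈ t.image F, ‖f x‖ ^ 2)
    (continuous_finsetSum _ fun f hf => by
      obtain ⟨p, hp, rfl⟩ := Finset.mem_image.1 hf
      exact (hFc p (htK p hp)).norm.pow 2).continuousOn
  have hle : ∀ x ∈ K, peak (t.image F) b x ≤ -∑ f ∈ t.image F, ‖f x - f b‖ ^ 2 := fun x hx => by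
    rw [peak_eq]
    linarith [isMaxOn_iff.1 hmax x hx]
  obtain ⟨⟨O, hO⟩, hbO⟩ := hL ⟨b, hb⟩ (mem_univ _)
  have hneg : ∀ x ∈ K \ O, peak (t.image F) b x < 0 := fun x hx => by
    refine (hle x hx.1).trans_lt (neg_lt_zero.2 ?_)
    have hd : δ ≤ dist (⟨x, hx.1⟩ : K) ⟨b, hb⟩ := not_lt.1 fun h => hx.2 (hbO (mem_ball.2 h))
    obtain ⟨p, hp, hpt⟩ := mem_iUnion₂.1 (htc (show (⟨x, hx.1⟩, ⟨b, hb⟩) ∈ _ from hd))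
    exact Finset.sum_pos' (fun _ _ => by positivity) ⟨F p, Finset.mem_image_of_mem _ hp,
      pow_pos (norm_pos_iff.2 (sub_ne_zero.2 hpt)) 2⟩
  refine ⟨O, hO, t.image F, fun f hf => by grind, b, hb, ?_⟩
  have hle0 : ∀ x ∈ K, peak (t.image F) b x ≤ 0 := fun x hx => (hle x hx).trans
    (neg_nonpos.2 (sum_nonneg fun _ _ => by positivity))
  rcases (K \ O).eq_empty_or_nonempty with h | h
  · grind
  · obtain ⟨x₀, hx₀, hm⟩ := (hK.diff (h𝒪 O hO)).exists_isMaxOn h (hcont b).continuousOn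
    exact ⟨-peak (t.image F) b x₀, neg_pos.2 (hneg x₀ hx₀), fun x hx => ⟨hle0 x hx, fun hxO => by
      simpa using isMaxOn_iff.1 hm x ⟨hx, hxO⟩⟩⟩

theorem HolParam.of_chart {m : ℕ} {c : CChart X} (hc : c ∈ S.atlas) {γ : Cn m → X} {Ω : Set (Cn m)}
    (hΩ : IsOpen Ω) (h1 : MapsTo γ Ω c.U) (h2 : DifferentiableOn ℂ (fun z => c.φ (γ z)) Ω) :
    HolParam S γ Ω := fun _ hz => ⟨c, hc, Ω, hΩ, hz, le_rfl, h1, h2⟩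

/-- Local coordinates on a complex space from a parametrization of its image in a chart. -/
theorem exists_localCoord {c : CChart X} (hc : c ∈ S.atlas) {W : Set c.E} {p : ℕ}
    {F : Fin p → c.E → ℂ} (hF : ∀ i, DifferentiableOn ℂ (F i) W)
    (hB : c.B ∩ W = {w ∈ W | ∀ i, F i w = 0}) {Q : Set X} (hQ : IsOpen Q)
    (hQU : ∀ x ∈ Q, x ∈ c.U ∧ c.φ x ∈ W) {k : ℕ} {l : c.E →L[ℂ] Cn k} {q : X} (hq : q ∈ Q)
    {y : Cn k → c.E} {ρ : ℝ} (hρ : 0 < ρ) (hy : DifferentiableOn ℂ y (ball 0 ρ)) (hy0 : y 0 = c.φ q)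
    (hyz : ∀ z ∈ ball (0 : Cn k) ρ, y z ∈ W ∧ l (y z) = l (c.φ q) + z ∧
      ∀ f, VanOn W (c.φ '' Q) f → f (y z) = 0)
    (hev : ∀ᶠ x in 𝓝 (c.φ q), x ∈ c.φ '' Q → x = y (l x - l (c.φ q))) {O : Set X} (hO : IsOpen O)
    (hqO : q ∈ O) : ∃ (t : ℝ) (γ : Cn k → X) (R : X → Cn k), 0 < t ∧ γ 0 = q ∧
      HolParam S γ (ball 0 3) ∧ DifferentiableOn ℂ (fun z => c.φ (γ z)) (ball 0 3) ∧
      (∀ z ∈ ball (0 : Cn k) 3, γ z ∈ O ∩ Q ∧ l (c.φ (γ z)) = l (c.φ q) + (t : ℂ) • z ∧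
        R (γ z) = z) ∧ IsLocalCoord S k (γ '' ball 0 2) R (ball 0 2) := by
  obtain ⟨hqU, hqW⟩ := hQU q hq
  obtain ⟨W', hW', hW'V, hqW', hW'O⟩ := c.exists_nhd hqU (hO.inter hQ) ⟨hqO, hq⟩
  obtain ⟨N, hN, hNo, hqN⟩ := _root_.mem_nhds_iff.1 hev
  have hyc : ContinuousAt y 0 := hy.continuousOn.continuousAt (ball_mem_nhds _ hρ)
  obtain ⟨ρ₁, hρ₁, hball⟩ := Metric.eventually_nhds_iff_ball.1
    (((hyc.eventually ((hW'.inter hNo).mem_nhds (by grind)))).and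
      (ball_mem_nhds (0 : Cn k) hρ))
  set t := ρ₁ / 3
  have ht : 0 < t := by positivity
  have htb : ∀ z ∈ ball (0 : Cn k) 3, (t : ℂ) • z ∈ ball (0 : Cn k) ρ₁ := fun z hz => by
    rw [mem_ball_zero_iff] at hz ⊢
    rw [norm_smul, norm_real, norm_of_nonneg ht.le]
    simp only [t] at *
    nlinarith
  have hyB : ∀ z ∈ ball (0 : Cn k) 3, ∃ x ∈ c.U, c.φ x = y ((t : ℂ) • z) := fun z hz => by
    obtain ⟨h1, -, h3⟩ := hyz _ (hball _ (htb z hz)).2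
    have : y ((t : ℂ) • z) ∈ c.B ∩ W := hB.symm.subset ⟨h1, fun i => h3 _ ⟨hF i, by
      rintro _ ⟨x, hx, rfl⟩
      exact (hB.subset ⟨c.mapsToB x (hQU x hx).1, (hQU x hx).2⟩).2 i⟩⟩
    rw [← c.image_eq] at this
    exact this.1
  have : Nonempty X := ⟨q⟩
  choose! γ hγU hγ using hyB
  let R (x : X) : Cn k := (t⁻¹ : ℂ) • (l (c.φ x) - l (c.φ q))
  have htc : (t : ℂ) ≠ 0 := by positivity
  have hlγ : ∀ z ∈ ball (0 : Cn k) 3, l (c.φ (γ z)) = l (c.φ q) + (t : ℂ) • z := fun z hz => by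
    rw [hγ z hz]; exact (hyz _ (hball _ (htb z hz)).2).2.1
  have hRγ : ∀ z ∈ ball (0 : Cn k) 3, R (γ z) = z := fun z hz => by
    simp only [R]; rw [hlγ z hz, add_sub_cancel_left, inv_smul_smul₀ htc]
  have hγR : ∀ x ∈ c.U, c.φ x ∈ W' ∩ N → R x ∈ ball (0 : Cn k) 3 → γ (R x) = x := fun x hx hxW hR => by
    refine c.injOn (hγU _ hR) hx ?_
    rw [hγ _ hR, hN hxW.2 ⟨x, (hW'O x hx hxW.1).2, rfl⟩]
    rw [smul_inv_smul₀ htc]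
  have h23 : ball (0 : Cn k) 2 ⊆ ball 0 3 := ball_subset_ball (by norm_num)
  have hφγ : DifferentiableOn ℂ (fun z => c.φ (γ z)) (ball 0 3) :=
    (hy.comp ((differentiable_id.const_smul (t : ℂ)).differentiableOn) fun z hz =>
      (hball _ (htb z hz)).2).congr hγ
  have hpar : HolParam S γ (ball 0 3) := HolParam.of_chart hc isOpen_ball hγU hφγ
  have hpar2 : HolParam S γ (ball 0 2) := HolParam.of_chart hc isOpen_ball
    (fun z hz => hγU z (h23 hz)) (hφγ.mono h23)
  let V : Set c.E := (W' ∩ N) ∩ {w | (t⁻¹ : ℂ) • (l w - l (c.φ q)) ∈ ball (0 : Cn k) 2}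
  have hV : IsOpen V := (hW'.inter hNo).inter (isOpen_ball.preimage (by fun_prop))
  have hU₀ : γ '' ball 0 2 = c.U ∩ c.φ ⁻¹' V := by
    ext x
    constructor
    · rintro ⟨z, hz, rfl⟩
      refine ⟨hγU z (h23 hz), ?_, ?_⟩
      · rw [hγ z (h23 hz)]; exact (hball _ (htb z (h23 hz))).1
      · have := hRγ z (h23 hz)
        simp only [R] at this
        rw [mem_ofPred_eq, this]; exact hz
    · rintro ⟨hx, hxV⟩
      exact ⟨R x, hxV.2, hγR x hx hxV.1 (h23 hxV.2)⟩
  have hγq : γ 0 = q := by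
    have h0 : (0 : Cn k) ∈ ball (0 : Cn k) 3 := by simp
    refine c.injOn (hγU 0 h0) hqU ?_
    rw [hγ 0 h0, smul_zero, hy0]
  refine ⟨t, γ, R, ht, hγq, hpar, hφγ, fun z hz => ⟨hW'O _ (hγU z hz) ?_, hlγ z hz, hRγ z hz⟩,
    ?_, isOpen_ball, ?_, ?_, ?_, fun W₀ hW₀ hW₀o => ?_, fun j => ?_, fun f hf => ?_⟩
  · rw [hγ z hz]; exact (hball _ (htb z hz)).1.1
  · rw [hU₀]; exact c.contOn.isOpen_inter_preimage c.openU hV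
  · rw [image_image, image_congr fun z hz => hRγ z (h23 hz), image_id']
  · rintro _ ⟨z, hz, rfl⟩ _ ⟨z', hz', rfl⟩ h
    rw [hRγ z (h23 hz), hRγ z' (h23 hz')] at h
    rw [h]
  · exact (Continuous.comp_continuousOn (g := fun w => (t⁻¹ : ℂ) • (l w - l (c.φ q))) (by fun_prop)
      c.contOn).mono (hU₀.subset.trans inter_subset_left)
  · have : R '' W₀ = ball 0 2 ∩ γ ⁻¹' W₀ := by
      ext z
      constructor
      · rintro ⟨x, hx, rfl⟩
        obtain ⟨z, hz, rfl⟩ := hW₀ hx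
        rw [hRγ z (h23 hz)]
        exact ⟨hz, hx⟩
      · rintro ⟨hz, hzW⟩
        exact ⟨γ z, hzW, hRγ z (h23 hz)⟩
    rw [this]
    exact hpar2.continuousOn.isOpen_inter_preimage isOpen_ball hW₀o
  · rw [hU₀]
    refine fun x hx => ⟨c, hc, hx.1, V, hV, fun w hw => hW'V hw.1.1, hx.2, fun y hy => hy,
      fun w => ((t⁻¹ : ℂ) • (l w - l (c.φ q))) j, ?_, fun _ _ _ => rfl⟩
    fun_prop
  · exact ⟨fun z => f (γ z), hpar2.differentiableOn hf fun z hz => ⟨z, hz, rfl⟩, by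
      rintro _ ⟨z, hz, rfl⟩
      simp only [hRγ z (h23 hz)]⟩

end Peak

section Parabolic

variable {X : Type*} [TopologicalSpace X] [T2Space X] {S : CSpace X} {n : ℕ}

theorem false_of_potential {D : Set X} (hD : IsOpen D) (hpure : PureDimensionIn S D n)
    {c : CChart X} (hc : c ∈ S.atlas) {w₀ : c.E} {ρ₀ : ℝ} (hρ₀ : 0 < ρ₀) {p : ℕ}
    {F : Fin p → c.E → ℂ} (hF : ∀ i, DifferentiableOn ℂ (F i) (ball w₀ (2 * ρ₀)))
    (hB : c.B ∩ ball w₀ (2 * ρ₀) = {w ∈ ball w₀ (2 * ρ₀) | ∀ i, F i w = 0})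
    {s : Finset (X → ℂ)} (hs : ∀ f ∈ s, SpaceHolOn S f univ) {b : X} {ε : ℝ}
    {Q : Set X} (hQ : Q = {x ∈ D | -ε < peak s b x}) (hne : Q.Nonempty)
    (hpk : ∀ x ∈ Q, peak s b x ≤ 0) (hQU : ∀ x ∈ Q, x ∈ c.U ∧ c.φ x ∈ closedBall w₀ ρ₀)
    {G : X → ℝ} (hG : ContinuousOn G D) (hG0 : ∀ x ∈ Q, 0 ≤ G x)
    (hGK : ∀ R : ℝ, ∃ K, IsCompact K ∧ K ⊆ D ∧ ∀ x ∈ Q, G x ≤ R → x ∈ K)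
    (hMA : ∀ (γ : Cn n → X) (R : X → Cn n), HolParam S γ (ball 0 3) → MapsTo γ (ball 0 3) Q →
      (∀ z ∈ ball (0 : Cn n) 3, |G (γ z) - G (γ 0)| ≤ 1) →
      IsLocalCoord S n (γ '' ball 0 2) R (ball 0 2) → (∀ z ∈ ball (0 : Cn n) 2, R (γ z) = z) →
      ∀ f : Cn n → ℝ, Continuous f → HasCompactSupport f → tsupport f ⊆ ball 0 2 → ∀ κ > 0,
        ∀ τ > 0, ∃ v : Cn n → ℝ, RSm v ∧ LPSH v (ball 0 2) ∧
          (∀ z ∈ closedBall (0 : Cn n) (3 / 2), |v z - G (γ z)| ≤ τ) ∧ ∫ z, f z ∂smoothMA v < κ) :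
    False := by
  have hpc : Continuous (peak s b) := continuous_re.comp (continuous_finsetSum _
    fun f hf => continuous_const.mul ((continuousOn_univ.1 (hs f hf).continuousOn).sub
      continuous_const))
  have hQo : IsOpen Q := hQ ▸ hD.inter (isOpen_lt continuous_const hpc)
  have hQD : Q ⊆ D := fun x hx => (hQ.subset hx).1
  have hb2 : closedBall w₀ ρ₀ ⊆ ball w₀ (2 * ρ₀) := closedBall_subset_ball (by linarith)
  have hQU' : ∀ x ∈ Q, x ∈ c.U ∧ c.φ x ∈ ball w₀ (2 * ρ₀) := fun x hx =>
    ⟨(hQU x hx).1, hb2 (hQU x hx).2⟩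
  obtain ⟨k, l, M, hM, ⟨_, ⟨q₀, hq₀, rfl⟩, hMq₀⟩, hreg⟩ := exists_regular_locus
    (isOpen_ball (x := w₀) (ε := 2 * ρ₀)) (Z := c.φ '' Q)
    (by rintro _ ⟨x, hx, rfl⟩; exact (hQU' x hx).2) (hne.image _)
  obtain ⟨B₁, hB₁⟩ := (isCompact_closedBall w₀ ρ₀).exists_bound_of_continuousOn
    (hM.continuousOn.mono hb2)
  obtain ⟨B₀, hB₀⟩ := (isCompact_closedBall w₀ ρ₀).exists_bound_of_continuousOn
    ((continuous_nsq.comp l.continuous).continuousOn)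
  have hN : ∀ x ∈ Q, nsq (l (c.φ x)) ≤ B₀ := fun x hx => (le_abs_self _).trans (hB₀ _ (hQU x hx).2)
  have hL : ∀ x ∈ Q, M (c.φ x) ≠ 0 → log ‖M (c.φ x)‖ ≤ log B₁ := fun x hx h =>
    log_le_log (norm_pos_iff.2 h) (hB₁ _ (hQU x hx).2)
  have hκ : 0 < peak s b q₀ + ε := by linarith [(hQ.subset hq₀).2]
  obtain ⟨η, hη, hη'⟩ : ∃ η > 0, η * (B₀ + log B₁ + 1 + G q₀ -
      log ‖M (c.φ q₀)‖ - nsq (l (c.φ q₀))) < peak s b q₀ + ε := by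
    set A := B₀ + log B₁ + 1 + G q₀ - log ‖M (c.φ q₀)‖ - nsq (l (c.φ q₀))
    refine ⟨(peak s b q₀ + ε) / (|A| + 1), by positivity, ?_⟩
    rw [div_mul_eq_mul_div, div_lt_iff₀ (by positivity)]
    nlinarith [le_abs_self A]
  let Θ (x : X) : ℝ := peak s b x + η * (nsq (l (c.φ x)) + log ‖M (c.φ x)‖ - G x)
  have hΘ0 : -ε + η * (B₀ + log B₁ + 1) < Θ q₀ := by linarith
  have hlo : ∀ x ∈ Q, M (c.φ x) ≠ 0 → Θ q₀ ≤ Θ x → -ε + η ≤ peak s b x ∧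
      Θ q₀ / η - B₀ ≤ log ‖M (c.φ x)‖ ∧ G x ≤ B₀ + log B₁ - Θ q₀ / η := fun x hx hMx hle => by
    have h1 := hN x hx
    have h2 := hL x hx hMx
    have h3 := hG0 x hx
    have h4 := hpk x hx
    have h5 : η * (nsq (l (c.φ x)) + log ‖M (c.φ x)‖ - G x) ≤ η * (B₀ + log B₁) :=
      mul_le_mul_of_nonneg_left (by linarith) hη.le
    have h6 : Θ q₀ / η ≤ nsq (l (c.φ x)) + log ‖M (c.φ x)‖ - G x := by
      rw [div_le_iff₀ hη]
      linarith
    refine ⟨?_, by linarith, by linarith⟩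
    linarith
  obtain ⟨K, hK, hKD, hKG⟩ := hGK (B₀ + log B₁ - Θ q₀ / η)
  have hK₁ : IsCompact (K ∩ {x | -ε + η ≤ peak s b x}) :=
    hK.inter_right (isClosed_le continuous_const hpc)
  have hK₁Q : K ∩ {x | -ε + η ≤ peak s b x} ⊆ Q := fun x hx => hQ.symm.subset
    ⟨hKD hx.1, by have : -ε + η ≤ peak s b x := hx.2; linarith⟩
  have hMc : ContinuousOn (fun x => ‖M (c.φ x)‖) Q := (hM.continuousOn.comp
    (c.contOn.mono fun x hx => (hQU x hx).1) fun x hx => (hQU' x hx).2).norm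
  have hK₂ : IsCompact ((K ∩ {x | -ε + η ≤ peak s b x}) ∩
      (fun x => ‖M (c.φ x)‖) ⁻¹' Ici (exp (Θ q₀ / η - B₀))) :=
    hK₁.of_isClosed_subset ((hMc.mono hK₁Q).preimage_isClosed_of_isClosed hK₁.isClosed isClosed_Ici)
      inter_subset_left
  set K₂ := (K ∩ {x | -ε + η ≤ peak s b x}) ∩
      (fun x => ‖M (c.φ x)‖) ⁻¹' Ici (exp (Θ q₀ / η - B₀))
  have hmem : ∀ x ∈ Q, M (c.φ x) ≠ 0 → Θ q₀ ≤ Θ x → x ∈ K₂ := fun x hx hMx hle => by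
    obtain ⟨h1, h2, h3⟩ := hlo x hx hMx hle
    exact ⟨⟨hKG x hx h3, h1⟩, (Real.le_log_iff_exp_le (norm_pos_iff.2 hMx)).1 h2⟩
  have hM0 : ∀ x ∈ K₂, M (c.φ x) ≠ 0 := fun x hx =>
    norm_pos_iff.1 ((exp_pos _).trans_le hx.2)
  have hΘc : ContinuousOn Θ K₂ := by
    have h2 : K₂ ⊆ Q := fun x hx => hK₁Q hx.1
    exact hpc.continuousOn.add (continuousOn_const.mul ((((continuous_nsq.comp
      l.continuous).comp_continuousOn (c.contOn.mono fun x hx => (hQU x (h2 hx)).1)).add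
        ((hMc.mono h2).log fun x hx => norm_ne_zero_iff.2 (hM0 x hx))).sub
          (hG.mono (h2.trans hQD))))
  obtain ⟨q, hqK, hmax⟩ := hK₂.exists_isMaxOn ⟨q₀, hmem q₀ hq₀ hMq₀ le_rfl⟩ hΘc
  have hqQ : q ∈ Q := hK₁Q hqK.1
  have hqmax : ∀ x ∈ Q, M (c.φ x) ≠ 0 → Θ x ≤ Θ q := fun x hx hMx => by
    by_cases h : Θ q₀ ≤ Θ x
    · exact isMaxOn_iff.1 hmax x (hmem x hx hMx h)
    · exact (not_le.1 h).le.trans (isMaxOn_iff.1 hmax q₀ (hmem q₀ hq₀ hMq₀ le_rfl))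
  have hMq := hM0 q hqK
  obtain ⟨y, ρ, hρ, hy, hy0, hyz, hyev⟩ := hreg (c.φ q) ⟨q, hqQ, rfl⟩ hMq
  let O : Set X := {x ∈ Q | ‖M (c.φ x) / M (c.φ q) - 1‖ < 1 ∧ |G x - G q| < 1}
  have hO : IsOpen O := by
    have h1 : ContinuousOn (fun x => (‖M (c.φ x) / M (c.φ q) - 1‖, |G x - G q|)) Q :=
      (((hM.continuousOn.comp (c.contOn.mono fun x hx => (hQU x hx).1) fun x hx =>
        (hQU' x hx).2).div_const _).sub continuousOn_const).norm.prodMk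
        ((hG.mono hQD).sub continuousOn_const).abs
    exact h1.isOpen_inter_preimage hQo (isOpen_Iio.prod isOpen_Iio)
  obtain ⟨t, γ, R, ht, hγ0, hpar, hφγ, hγ, hcoord⟩ := exists_localCoord hc hF hB hQo hQU' hqQ hρ hy
    hy0 hyz hyev hO ⟨hqQ, by simp [hMq], by simp⟩
  obtain rfl : k = n := hpure.2 k ⟨q, ⟨_, R, _, hcoord, 0, by simp, hγ0⟩, hQD hqQ⟩
  have hMγ : ∀ z ∈ ball (0 : Cn k) 3, M (c.φ (γ z)) ≠ 0 := fun z hz h => by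
    have := (hγ z hz).1.1.2.1
    simp [h] at this
  have hMd : DifferentiableOn ℂ (fun z => M (c.φ (γ z)) / M (c.φ q)) (ball 0 3) :=
    (hM.comp hφγ fun z hz => (hQU' _ (hγ z hz).1.2).2).mul_const _
  let H (z : Cn k) : ℂ := (η⁻¹ : ℂ) * ∑ f ∈ s, 2 * conj (f b) * (f (γ z) - f q) +
    (2 * t * ∑ j, conj (l (c.φ q) j) * z j + Complex.log (M (c.φ (γ z)) / M (c.φ q)))
  have hHd : DifferentiableOn ℂ H (ball 0 3) := by
    refine (DifferentiableOn.const_mul (DifferentiableOn.fun_sum fun f hf =>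
      ((hpar.differentiableOn (hs f hf) fun _ _ => mem_univ _).sub_const _).const_mul _) _).add
      (DifferentiableOn.add (by fun_prop) (hMd.clog fun z hz => ?_))
    simpa using Complex.mem_slitPlane_of_norm_lt_one (hγ z hz).1.1.2.1
  have hHre : ∀ z ∈ ball (0 : Cn k) 3, G q + (H z).re + t ^ 2 * nsq z ≤ G (γ z) := fun z hz => by
    have h1 := hqmax (γ z) (hγ z hz).1.2 (hMγ z hz)
    have h2 : (Complex.log (M (c.φ (γ z)) / M (c.φ q))).re =
        log ‖M (c.φ (γ z))‖ - log ‖M (c.φ q)‖ := by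
      rw [log_re, norm_div, log_div (norm_ne_zero_iff.2 (hMγ z hz))
        (norm_ne_zero_iff.2 hMq)]
    have h3 : nsq (l (c.φ (γ z))) = nsq (l (c.φ q)) + t ^ 2 * nsq z +
        2 * t * (∑ j, conj (l (c.φ q) j) * z j).re := by
      rw [(hγ z hz).2.1]
      simp only [nsq, re_sum, mul_sum, ← sum_add_distrib]
      refine sum_congr rfl fun j _ => ?_
      simp [normSq_apply]
      ring
    have h4 : peak s b (γ z) - peak s b q =
        (∑ f ∈ s, 2 * conj (f b) * (f (γ z) - f q)).re := by
      simp only [peak, ← sub_re, ← Finset.sum_sub_distrib]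
      congr 1
      exact sum_congr rfl fun f _ => by ring
    have h5 : (H z).re = η⁻¹ * (peak s b (γ z) - peak s b q) + (2 * t *
        (∑ j, conj (l (c.φ q) j) * z j).re +
          (log ‖M (c.φ (γ z))‖ - log ‖M (c.φ q)‖)) := by
      rw [h4, ← h2]
      have e1 : (η⁻¹ : ℂ) = ((η⁻¹ : ℝ) : ℂ) := by simp
      have e2 : (2 * t : ℂ) = ((2 * t : ℝ) : ℂ) := by simp
      simp only [H, add_re, e1, e2, re_ofReal_mul]
    have h6 : η * (η⁻¹ * (peak s b (γ z) - peak s b q)) = peak s b (γ z) - peak s b q :=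
      mul_inv_cancel_left₀ hη.ne' _
    refine le_of_mul_le_mul_left (a := η) ?_ hη
    simp only [Θ, h3] at h1
    rw [h5]
    linarith
  have h03 : (0 : Cn k) ∈ ball 0 3 := by simp
  have hGγ : ContinuousAt (fun z => G (γ z)) 0 := (hG.comp hpar.continuousOn fun z hz =>
    hQD (hγ z hz).1.2).continuousAt (isOpen_ball.mem_nhds h03)
  obtain ⟨f, hf1, hf2, hf3, κ, hκ0, τ, hτ, hf⟩ := exists_lower_bound_smoothMA hGγ hHd
    (by simp [H, hγ0, hMq]) (pow_pos ht 2) (by simpa only [hγ0] using hHre)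
  obtain ⟨v, hv1, hv2, hv3, hv4⟩ := hMA γ R hpar (fun z hz => (hγ z hz).1.2)
    (fun z hz => by rw [hγ0]; exact (hγ z hz).1.1.2.2.le) hcoord
    (fun z hz => (hγ z (ball_subset_ball (by norm_num) hz)).2.2) f hf1 hf2 hf3 κ hκ0 τ hτ
  exact (hf v hv1 hv2 hv3).not_gt hv4

end Parabolic

section Parabolic

variable {X : Type*} [TopologicalSpace X] {S : CSpace X} {n : ℕ}
variable {D : Set X}

theorem exists_approx_of_isMAOn_zero {u : Cn n → ℝ} {uu : Cn n → EReal} {ν : Measure (Cn n)}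
    (hu : LPSH u (ball 0 3)) (hc : ContinuousOn u (ball 0 3))
    (huu : ∀ z ∈ ball (0 : Cn n) 2, uu z = u z) (hν : IsMAOn uu (ball 0 2) ν)
    (h0 : ν (ball 0 2) = 0) {f : Cn n → ℝ} (hf : Continuous f) (hfc : HasCompactSupport f)
    (hfs : tsupport f ⊆ ball 0 2) {κ τ : ℝ} (hκ : 0 < κ) (hτ : 0 < τ) :
    ∃ v : Cn n → ℝ, RSm v ∧ LPSH v (ball 0 2) ∧
      (∀ z ∈ closedBall (0 : Cn n) (3 / 2), |v z - u z| ≤ τ) ∧ ∫ z, f z ∂smoothMA v < κ := by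
  obtain ⟨v, R', C, hR', hv1, -, hv3, hv4, hv5⟩ := hu.exists_smooth_approx isOpen_ball (x := 0)
    two_pos (closedBall_subset_ball (by norm_num))
  have hsub : ball (0 : Cn n) 2 ⊆ ball 0 R' := ball_subset_ball hR'.le
  have hcb : closedBall (0 : Cn n) (3 / 2) ⊆ ball 0 2 := closedBall_subset_ball (by norm_num)
  have hν0 : ν = 0 := by
    refine Measure.measure_univ_eq_zero.1 (le_antisymm ?_ bot_le)
    rw [← union_compl_self (ball (0 : Cn n) 2)]
    refine (measure_union_le _ _).trans ?_
    rw [h0, hν.1 _ measurableSet_ball.compl disjoint_compl_left, add_zero]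
  have h1 := hν.2 v hv1 (fun j => ((hv3 j).mono hsub).pshOnE) (fun z hz => hv4 z (hsub hz))
    (fun z hz => by
      rw [huu z hz]
      exact (continuous_coe_real_ereal.tendsto _).comp (hv5 z (hsub hz))) f hf hfc hfs
  rw [hν0, integral_zero_measure] at h1
  have h2 : TendstoUniformlyOn v u atTop (closedBall (0 : Cn n) (3 / 2)) :=
    Antitone.tendstoUniformlyOn_of_forall_tendsto (isCompact_closedBall _ _)
      (fun j => (hv1 j).continuous.continuousOn) (fun z hz => hv4 z (hsub (hcb hz)))
      (hc.mono (closedBall_subset_ball (by norm_num))) fun z hz => hv5 z (hsub (hcb hz))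
  obtain ⟨j, hj1, hj2⟩ := ((h1.eventually_lt_const hκ).and
    (Metric.tendstoUniformlyOn_iff.1 h2 τ hτ)).exists
  refine ⟨v j, hv1 j, (hv3 j).mono hsub, fun z hz => ?_, hj1⟩
  rw [abs_sub_comm, ← Real.dist_eq]
  exact (hj2 z hz).le

theorem false_of_weaklyParabolic [T2Space X] [SecondCountableTopology X] [MeasurableSpace X] [BorelSpace X]
    (hD : IsOpen D) (hDc : IsCompact (closure D)) (hne : D.Nonempty)
    (hn : n ≠ 0) (hpure : PureDimensionIn S D n) {g : X → ℝ} (hg : WeaklyParabolicIn S n g D)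
    (hX : IsSteinIn S univ) : False := by
  obtain ⟨hg0, hgc, -, hgex, hlog, hma⟩ := hg
  let 𝒪 : Set (Set X) := {O | IsOpen O ∧ (∃ c ∈ S.atlas, ∃ (w₀ : c.E) (ρ₀ : ℝ) (p : ℕ)
    (F : Fin p → c.E → ℂ), 0 < ρ₀ ∧ (∀ i, DifferentiableOn ℂ (F i) (ball w₀ (2 * ρ₀))) ∧
      c.B ∩ ball w₀ (2 * ρ₀) = {w ∈ ball w₀ (2 * ρ₀) | ∀ i, F i w = 0} ∧
      ∀ x ∈ O, x ∈ c.U ∧ c.φ x ∈ closedBall w₀ ρ₀) ∧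
    ((∃ K, IsCompact K ∧ K ⊆ D ∧ O ⊆ K) ∨ ∀ x ∈ O, x ∈ D → 1 ≤ g x)}
  have hcov : ∀ x ∈ closure D, ∃ O ∈ 𝒪, x ∈ O := fun x _ => by
    obtain ⟨c, hc, hxc⟩ := S.chart_cover x
    obtain ⟨W, hW, hxW, -, p, F, hF, hB⟩ := c.subvariety.2.2 _ (c.subvariety.2.1 (c.mapsToB x hxc))
    obtain ⟨ρ, hρ, hρW⟩ := Metric.isOpen_iff.1 hW _ hxW
    have e : 2 * (ρ / 2) = ρ := by ring
    have key : ∀ O : Set X, IsOpen O → x ∈ O →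
        ((∃ K, IsCompact K ∧ K ⊆ D ∧ O ⊆ K) ∨ ∀ x ∈ O, x ∈ D → 1 ≤ g x) →
        ∃ O ∈ 𝒪, x ∈ O := fun O hO hxO h => by
      refine ⟨O ∩ (c.U ∩ c.φ ⁻¹' ball (c.φ x) (ρ / 2)),
        ⟨hO.inter (c.contOn.isOpen_inter_preimage c.openU isOpen_ball), ⟨c, hc, c.φ x, ρ / 2, p, F,
          half_pos hρ, fun i => (hF i).mono (by rwa [e]), ?_,
          fun y hy => ⟨hy.2.1, ball_subset_closedBall hy.2.2⟩⟩, ?_⟩,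
        hxO, hxc, mem_ball_self (half_pos hρ)⟩
      · rw [e]
        ext w
        have := Set.ext_iff.1 hB w
        grind
      grind
    by_cases hxD : x ∈ D
    · exact key {y ∈ D | g y < g x + 1} (hgc.isOpen_inter_preimage hD isOpen_Iio) ⟨hxD, by simp⟩
        (.inl ⟨_, (hgex _).1, (hgex _).2, subset_closure⟩)
    · refine key (closure {y ∈ D | g y < 1})ᶜ isClosed_closure.isOpen_compl
        (fun h => hxD ((hgex 1).2 h)) (.inr fun y hy hyD => not_lt.1 fun h =>
          hy (subset_closure ⟨hyD, h⟩))
  obtain ⟨O, ⟨hO, ⟨c, hc, w₀, ρ₀, p, F, hρ₀, hF, hB, hOU⟩, htype⟩, s, hs, b, hb, ε, hε, hpk⟩ :=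
    exists_peak_set hDc hne.closure (fun O h => h.1) hcov
      fun x _ y _ h => hX.2 x (mem_univ x) y (mem_univ y) h
  have hpc : Continuous (peak s b) := continuous_re.comp (continuous_finsetSum _
    fun f hf => continuous_const.mul ((continuousOn_univ.1 (hs f hf).continuousOn).sub
      continuous_const))
  set Q : Set X := {x ∈ D | -ε < peak s b x} with hQ
  have hQO : ∀ x ∈ Q, x ∈ O := fun x hx => by
    by_contra h
    exact ((hpk x (subset_closure hx.1)).2 h).not_gt hx.2
  have hQne : Q.Nonempty := by
    obtain ⟨x, hx1, hx2⟩ := mem_closure_iff.1 hb _ (isOpen_lt continuous_const hpc)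
      (show -ε < peak s b b by simpa [peak] using hε)
    exact ⟨x, hx2, hx1⟩
  have hQD : Q ⊆ D := fun x hx => hx.1
  rcases htype with ⟨K, hK, hKD, hOK⟩ | hge
  · refine false_of_potential (G := fun _ => 0) hD hpure hc hρ₀ hF hB hs hQ hQne
      (fun x hx => (hpk x (subset_closure hx.1)).1) (fun x hx => hOU x (hQO x hx))
      continuousOn_const (fun _ _ => le_rfl) (fun R => ⟨K, hK, hKD, fun x hx _ => hOK (hQO x hx)⟩)
      fun γ R _ _ _ _ _ f hf hfc hfs κ hκ τ hτ => ⟨fun _ => 0, contDiff_const, LPSH.const 0,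
        fun z _ => by simpa using hτ.le, ?_⟩
    have hH : ∀ z : Cn n, maDensity (fun _ => (0 : ℝ)) z = 0 := fun z => by
      have : Nonempty (Fin n) := ⟨⟨0, Nat.pos_of_ne_zero hn⟩⟩
      have : cHess (fun _ => (0 : ℝ)) z = 0 := by ext; simp [cHess, d2]
      simp [maDensity, this]
    simpa [smoothMA, hH] using hκ
  · let G (x : X) : ℝ := log (max (g x) 1)
    have hgQ : ∀ x ∈ Q, max (g x) 1 = g x := fun x hx => max_eq_left (hge x (hQO x hx) hx.1)
    have hel : ∀ x ∈ Q, elog (g x) = (G x : EReal) := fun x hx => by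
      have := hge x (hQO x hx) hx.1
      simp only [elog, G, hgQ x hx, if_neg (by linarith : ¬ g x ≤ 0)]
    have hG0 : ∀ x, 0 ≤ G x := fun x => Real.log_nonneg (le_max_right _ _)
    have hGc : ContinuousOn G D := (ContinuousOn.sup hgc continuousOn_const).log fun x _ =>
      (zero_lt_one.trans_le (le_max_right _ _)).ne'
    refine false_of_potential (G := G) hD hpure hc hρ₀ hF hB hs hQ hQne
      (fun x hx => (hpk x (subset_closure hx.1)).1) (fun x hx => hOU x (hQO x hx)) hGc
      (fun x _ => hG0 x) (fun R => ⟨_, (hgex (exp R + 1)).1, (hgex _).2, fun x hx hR =>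
        subset_closure ⟨hx.1, ?_⟩⟩) fun γ R hγ hγQ hγ1 hco hR f hf hfc hfs κ hκ τ hτ => ?_
    · have := (Real.log_le_iff_le_exp (zero_lt_one.trans_le (le_max_right (g x) 1))).1 hR
      grind
    have h23 : ball (0 : Cn n) 2 ⊆ ball 0 3 := ball_subset_ball (by norm_num)
    obtain ⟨uu, ν, huu, hν, hνA⟩ := hma.2.2 _ R _ hco (by
      rintro _ ⟨z, hz, rfl⟩
      have := hge _ (hQO _ (hγQ (h23 hz))) (hQD (hγQ (h23 hz)))
      exact ⟨hQD (hγQ (h23 hz)), by linarith⟩)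
    have hup : LPSH (fun z => G (γ z)) (ball 0 3) := by
      refine (hγ.lpsh_trunc hlog (fun z hz => hQD (hγQ hz)) (C := G (γ 0) + 1) (t := 0)
        (fun z hz => ?_) (by linarith [hG0 (γ 0)])).congr isOpen_ball fun z hz => ?_
      · rw [hel _ (hγQ hz), coe_le_coe_iff]
        linarith [(abs_le.1 (hγ1 z hz)).2]
      · simp only [hel _ (hγQ hz), trunc]
        rw [max_eq_left (by simpa using hG0 (γ z)), toReal_coe]
    refine exists_approx_of_isMAOn_zero hup (hGc.comp hγ.continuousOn fun z hz => hQD (hγQ hz))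
      (fun z hz => ?_) hν ?_ hf hfc hfs hκ hτ
    · have := huu _ (mem_image_of_mem γ hz)
      rw [hR z hz] at this
      exact this.trans (hel _ (hγQ (h23 hz)))
    · have := hνA _ hco.1.measurableSet subset_rfl
      rw [hco.2.2.1] at this
      simpa using this.symm

theorem IsAnalyticIn.of_isOpen_diff {C : Set X} (hCD : C ⊆ D) (hC : IsOpen C)
    (hC' : IsOpen (D \ C)) : IsAnalyticIn S C D := by
  refine ⟨hCD, fun x hx => ?_⟩
  obtain ⟨c, hc, hxc⟩ := S.chart_cover x
  by_cases h : x ∈ C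
  · obtain ⟨W, h1, h2, h3, h4⟩ := c.exists_nhd hxc hC h
    exact ⟨c, hc, hxc, W, h1, h2, h3, 0, fun _ _ => 0, fun _ => differentiableOn_const _,
      fun y hy hyW _ => iff_of_true (h4 y hy hyW) fun i => i.elim0⟩
  · obtain ⟨W, h1, h2, h3, h4⟩ := c.exists_nhd hxc hC' ⟨hx, h⟩
    exact ⟨c, hc, hxc, W, h1, h2, h3, 1, fun _ _ => 1, fun _ => differentiableOn_const _,
      fun y hy hyW _ => iff_of_false (h4 y hy hyW).2 fun h => one_ne_zero (h 0)⟩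

theorem IsIrreducibleIn.exists_eq_singleton [T2Space X] (hD : IsOpen D) (h : IsIrreducibleIn S D)
    (hpure : PureDimensionIn S D 0) : ∃ x, D = {x} := by
  obtain ⟨x, ⟨U, ρ, Ω, hU, hxU⟩, hxD⟩ := closure_nonempty_iff.1 (h.1.mono hpure.1)
  have hx : U = {x} := eq_singleton_iff_unique_mem.2 ⟨hxU, fun y hy =>
    hU.2.2.2.1 hy hxU (Subsingleton.elim _ _)⟩
  have h1 : IsOpen ({x} : Set X) := hx ▸ hU.1
  have h2 : IsOpen (D \ {x}) := hD.sdiff isClosed_singleton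
  have hsub : {x} ⊆ D := singleton_subset_iff.2 hxD
  rcases h.2 {x} (D \ {x}) (.of_isOpen_diff hsub h1 h2) (.of_isOpen_diff sdiff_subset h2
    (by simp_all)) (union_sdiff_cancel hsub) with h | h
  · grind
  grind

theorem SpacePSHOn.const (hD : IsOpen D) (a : ℝ) :
    SpacePSHOn S (fun _ => (a : EReal)) D := by
  refine ⟨fun _ _ => coe_lt_top a, fun C hC => ?_, fun x hx => ?_⟩
  · obtain ⟨y, hy⟩ := hC.1.2.1
    exact ⟨y, hy, coe_ne_bot a⟩
  · obtain ⟨c, hc, hxc⟩ := S.chart_cover x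
    obtain ⟨W, h1, h2, h3, h4⟩ := c.exists_nhd hxc hD hx
    exact ⟨c, hc, hxc, W, h1, h2, h3, fun y hy => h4 y hy.1 hy.2, _, (LPSH.const a).pshOnE,
      fun _ _ _ => rfl⟩

theorem relExt_self (hD : IsOpen D) {x : X} (hx : x ∈ D) : relExt S D D x = 0 := by
  have h : ∀ y ∈ D, relExtRaw S D D y = 0 := fun y hy => le_antisymm
    (iSup₂_le fun u hu => hu.2.2 y hy)
    (le_iSup₂ (f := fun (u : X → EReal) (_ : u ∈ {u | SpacePSHOn S u D ∧ (∀ x ∈ D, u x ≤ 1) ∧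
      ∀ x ∈ D, u x ≤ 0}) => u y) (fun _ => ((0 : ℝ) : EReal)) ⟨.const hD 0, by simp, by simp⟩)
  have : (𝓝[D] x).NeBot := mem_closure_iff_nhdsWithin_neBot.1 (subset_closure hx)
  rw [relExt, limsup_congr (eventually_mem_nhdsWithin.mono h), limsup_const]

theorem relExt_annulus_of_singleton {x : X} (hx : IsOpen ({x} : Set X)) {A : Set X} (hA : A ⊆ {x})
    (hA' : ¬ IsPluripolarIn S A {x}) {r s : ℝ} (hr : 0 < r) (hrs : r < s) :
    ∀ z ∈ {z ∈ ({x} : Set X) | relExt S A {x} z < ((s : ℝ) : EReal)},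
      relExt S {z ∈ ({x} : Set X) | relExt S A {x} z < ((r : ℝ) : EReal)}
          {z ∈ ({x} : Set X) | relExt S A {x} z < ((s : ℝ) : EReal)} z =
        max 0 ((relExt S A {x} z - ((r : ℝ) : EReal)) / (((s - r : ℝ) : EReal))) := by
  obtain rfl : A = {x} := (subset_singleton_iff_eq.1 hA).resolve_left fun h =>
    hA' fun y hy => absurd (h.subset hy) (notMem_empty y)
  have h : ∀ t : ℝ, 0 < t → {z ∈ ({x} : Set X) | relExt S {x} {x} z < (t : EReal)} = {x} :=
    fun t ht => sep_eq_self_iff_mem_true.2 fun y hy => by rw [relExt_self hx hy]; positivity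
  rintro z ⟨hz, -⟩
  rw [h r hr, h s (hr.trans hrs), relExt_self hx hz, max_eq_left]
  rw [← coe_zero, ← coe_sub, ← coe_div, coe_le_coe_iff]
  exact div_nonpos_of_nonpos_of_nonneg (by linarith) (by linarith)

end Parabolic

section Manifold

variable {X : Type*} [TopologicalSpace X] {S : CSpace X} {m : ℕ}
variable {G : Set (Cn m)}

/-- `γ` is the inverse of a manifold chart, up to an affine change of coordinates. -/
def IsCoord (S : CSpace X) (γ : Cn m → X) : Prop :=
  ∃ c ∈ S.atlas, ∃ (p : c.E) (e : Cn m ≃L[ℂ] c.E), ∀ z ∈ ball (0 : Cn m) 3,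
    γ z ∈ c.U ∧ c.φ (γ z) = p + e z

theorem exists_isCoord {M : Set X} (hM : IsManifoldIn S M) {x : X} (hx : x ∈ M) {O : Set X}
    (hO : IsOpen O) (hxO : x ∈ O) : ∃ (m : ℕ) (γ : Cn m → X), IsCoord S γ ∧ γ 0 = x ∧
      MapsTo γ (ball 0 3) O := by
  obtain ⟨c, hc, hxc, hBV⟩ := hM x hx
  obtain ⟨W, hW, hWV, hxW, hWO⟩ := c.exists_nhd hxc hO hxO
  let e₀ : Cn (Module.finrank ℂ c.E) ≃L[ℂ] c.E := ContinuousLinearEquiv.ofFinrankEq (by simp)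
  have hc0 : Tendsto (fun z => c.φ x + e₀ z) (𝓝 0) (𝓝 (c.φ x)) :=
    Continuous.tendsto' (by fun_prop) _ _ (by simp)
  obtain ⟨ρ, hρ, hρW⟩ := Metric.mem_nhds_iff.1 (hc0 (hW.mem_nhds hxW))
  let t : ℂ := ((ρ / 3 : ℝ) : ℂ)
  have ht : t ≠ 0 := by simp [t, hρ.ne']
  let e := (LinearEquiv.smulOfNeZero ℂ (Cn (Module.finrank ℂ c.E)) t
    ht).toContinuousLinearEquiv.trans e₀
  have he : ∀ z ∈ ball (0 : Cn _) 3, c.φ x + e z ∈ W := fun z hz => by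
    refine hρW (show t • z ∈ ball 0 ρ from ?_)
    rw [mem_ball_zero_iff] at hz ⊢
    rw [norm_smul, norm_real, norm_of_nonneg (by positivity)]
    nlinarith
  have hsurj : ∀ z ∈ ball (0 : Cn _) 3, ∃ y ∈ c.U, c.φ y = c.φ x + e z := fun z hz => by
    have := hWV (he z hz)
    rwa [← hBV, ← c.image_eq] at this
  have : Nonempty X := ⟨x⟩
  choose! γ hγU hγ using hsurj
  exact ⟨_, γ, ⟨c, hc, c.φ x, e, fun z hz => ⟨hγU z hz, hγ z hz⟩⟩,
    c.injOn (hγU 0 (by simp)) hxc (by simp_all),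
    fun z hz => hWO _ (hγU z hz) (by simp_all)⟩

namespace IsCoord

variable {γ : Cn m → X}

theorem holParam (h : IsCoord S γ) : HolParam S γ (ball 0 3) := by
  obtain ⟨c, hc, p, e, h⟩ := h
  exact .of_chart hc isOpen_ball (fun z hz => (h z hz).1) (DifferentiableOn.congr
    (f := fun z => p + e z) (by fun_prop) fun z hz => (h z hz).2)

theorem injOn (h : IsCoord S γ) : InjOn γ (ball 0 3) := by
  obtain ⟨c, -, p, e, h⟩ := h
  intro z hz w hw hzw
  have h1 := (h z hz).2
  simp_all

theorem image_eq (h : IsCoord S γ) (hG : G ⊆ ball 0 3) : ∃ c ∈ S.atlas,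
    ∃ (p : c.E) (e : Cn m ≃L[ℂ] c.E), γ '' G = c.U ∩ c.φ ⁻¹' {w | e.symm (w - p) ∈ G} ∧
      {w | e.symm (w - p) ∈ G} ⊆ c.V ∧ ∀ y ∈ γ '' G, γ (e.symm (c.φ y - p)) = y := by
  obtain ⟨c, hc, p, e, h⟩ := h
  have h1 : ∀ z ∈ G, e.symm (c.φ (γ z) - p) = z := fun z hz => by simp [(h z (hG hz)).2]
  refine ⟨c, hc, p, e, subset_antisymm ?_ ?_, fun w hw => ?_, ?_⟩
  · rintro _ ⟨z, hz, rfl⟩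
    grind
  · rintro y ⟨hy, hyG⟩
    exact ⟨_, hyG, c.injOn (h _ (hG hyG)).1 hy (by rw [(h _ (hG hyG)).2]; simp)⟩
  · have := c.subvariety.2.1 (c.mapsToB _ (h _ (hG hw)).1)
    rw [(h _ (hG hw)).2] at this
    simp_all
  grind

theorem isOpen_image (h : IsCoord S γ) (hG : G ⊆ ball 0 3) (hGo : IsOpen G) :
    IsOpen (γ '' G) := by
  obtain ⟨c, -, p, e, h1, -⟩ := h.image_eq hG
  rw [h1]
  exact c.contOn.isOpen_inter_preimage c.openU
    (hGo.preimage (e.symm.continuous.comp (continuous_id.sub continuous_const)))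

theorem pshOnE (h : IsCoord S γ) (hG : G ⊆ ball 0 3) (hGo : IsOpen G)
    {u : X → EReal} {ψ : Cn m → EReal} (hu : PSHOnE ψ G) (hψ : ∀ z ∈ G, ψ z = u (γ z)) {x : X}
    (hx : x ∈ γ '' G) :
    ∃ c ∈ S.atlas, x ∈ c.U ∧ ∃ V' : Set c.E, IsOpen V' ∧ V' ⊆ c.V ∧ c.φ x ∈ V' ∧
      {y ∈ c.U | c.φ y ∈ V'} ⊆ γ '' G ∧
      ∃ ψ : c.E → EReal, PSHOnE ψ V' ∧ ∀ y ∈ c.U, c.φ y ∈ V' → ψ (c.φ y) = u y := by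
  obtain ⟨c, hc, p, e, h1, h2, h3⟩ := h.image_eq hG
  have hcont : Continuous fun w => e.symm (w - p) :=
    e.symm.continuous.comp (continuous_id.sub continuous_const)
  have hx' := h1.subset hx
  refine ⟨c, hc, hx'.1, {w | e.symm (w - p) ∈ G}, hGo.preimage hcont, h2, hx'.2, h1.symm.subset,
    fun w => ψ (e.symm (w - p)), ⟨fun w hw => hu.1 _ hw, ?_, ?_, fun a b => ?_⟩,
    fun y hy hyG => (hψ _ hyG).trans <| congrArg u (h3 y (h1.symm.subset ⟨hy, hyG⟩))⟩
  · intro w hw c hc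
    exact (hcont.continuousWithinAt.tendsto_nhdsWithin (s := {w | e.symm (w - p) ∈ G})
      (t := G) fun _ h => h).eventually (hu.2.1 _ hw c hc)
  · rintro ⟨N, hN, hNo, ⟨w, hw⟩, hbot⟩
    have hco : Continuous fun z => p + e z := continuous_const.add e.continuous
    exact hu.2.2.1 ⟨(fun z => p + e z) ⁻¹' N, fun z hz => by simpa using hN hz, hNo.preimage hco,
      ⟨e.symm (w - p), by simp_all⟩, fun z hz => by simpa using hbot _ hz⟩
  · have := hu.2.2.2 (e.symm (a - p)) (e.symm b)
    have e1 : ∀ w : ℂ, e.symm (a + w • b - p) = e.symm (a - p) + w • e.symm b := fun w => by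
      rw [← map_smul, ← map_add]; abel
    grind

end IsCoord

/-- Real-valued functions that are plurisubharmonic in local coordinates are plurisubharmonic. -/
theorem SpacePSHOn.of_isCoord {D : Set X} {u : X → ℝ} (h : ∀ x ∈ D, ∃ (m : ℕ) (γ : Cn m → X)
    (G : Set (Cn m)), IsCoord S γ ∧ G ⊆ ball 0 3 ∧ IsOpen G ∧ x ∈ γ '' G ∧ γ '' G ⊆ D ∧
      LPSH (fun z => u (γ z)) G) : SpacePSHOn S (fun x => (u x : EReal)) D := by
  refine ⟨fun _ _ => coe_lt_top _, fun C hC => ?_, fun x hx => ?_⟩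
  · obtain ⟨y, hy⟩ := hC.1.2.1
    exact ⟨y, hy, coe_ne_bot _⟩
  · obtain ⟨m, γ, G, hγ, hG, hGo, hxG, hGD, hu⟩ := h x hx
    obtain ⟨c, hc, hxc, V, h1, h2, h3, h4, h5⟩ :=
      hγ.pshOnE hG hGo (u := fun x => (u x : EReal)) hu.pshOnE (fun _ _ => rfl) hxG
    grind

/-- The identity theorem on balls. -/
theorem eq_zero_of_eqOn_open {E : Type*} [NormedAddCommGroup E] [NormedSpace ℂ E] {F : E → ℂ}
    {W N : Set E} (hW : IsOpen W) (hWc : Convex ℝ W) (hF : DifferentiableOn ℂ F W) (hN : IsOpen N)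
    (hNW : (N ∩ W).Nonempty) (h0 : ∀ w ∈ N ∩ W, F w = 0) : ∀ w ∈ W, F w = 0 := by
  obtain ⟨a, haN, haW⟩ := hNW
  intro w hw
  let ℓ (t : ℂ) : E := a + t • (w - a)
  have hℓ : Differentiable ℂ ℓ := by fun_prop
  have hs : IsOpen (ℓ ⁻¹' W) := hW.preimage hℓ.continuous
  have hcv : Convex ℝ (ℓ ⁻¹' W) := fun x hx y hy α β hα hβ hαβ => by
    have : ℓ (α • x + β • y) = α • ℓ x + β • ℓ y := by
      simp only [ℓ, smul_add, add_smul, smul_assoc]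
      rw [add_add_add_comm, ← add_smul, hαβ, one_smul]
    show ℓ _ ∈ W
    rw [this]
    exact hWc hx hy hα hβ hαβ
  have h0s : (0 : ℂ) ∈ ℓ ⁻¹' W := by simpa [ℓ] using haW
  have := AnalyticOnNhd.eqOn_zero_of_preconnected_of_eventuallyEq_zero
    ((hF.comp hℓ.differentiableOn fun _ h => h).analyticOnNhd hs) hcv.isPreconnected h0s
    (by filter_upwards [(hs.inter (hN.preimage hℓ.continuous)).mem_nhds
          ⟨h0s, by simpa [ℓ] using haN⟩] with t ht using h0 _ ⟨ht.2, ht.1⟩)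
  simpa [ℓ] using this (show (1 : ℂ) ∈ ℓ ⁻¹' W by simpa [ℓ] using hw)

end Manifold

section Manifold

variable {X : Type*} [TopologicalSpace X] {S : CSpace X} {m : ℕ}
variable {γ : Cn m → X} {u : X → EReal}

theorem IsAnalyticIn.subset_of_isPreconnected {M A U : Set X} (hM : IsManifoldIn S M)
    (hMo : IsOpen M) (hMc : IsPreconnected M) (hMU : M ⊆ U) (hA : IsAnalyticIn S A U)
    (hne : (M ∩ interior A).Nonempty) : M ⊆ A := by
  refine (hMc.subset_of_closure_inter_subset isOpen_interior hne ?_).trans interior_subset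
  rintro y ⟨hyA, hyM⟩
  obtain ⟨c, hc, hyc, V, hV, -, hyV, p, F, hF, hAF⟩ := hA.2 y (hMU hyM)
  obtain ⟨m, γ, hγ, hγ0, hγM⟩ := exists_isCoord hM hyM hMo hyM
  subst hγ0
  obtain ⟨N, hN, hzN, hN3, h1, h2, h3⟩ := hγ.holParam.chart (mem_ball_self three_pos) hc hyc hV hyV
  obtain ⟨δ, hδ, hδN⟩ := Metric.isOpen_iff.1 hN 0 hzN
  have hδ3 := hδN.trans hN3
  have hop := hγ.isOpen_image hδ3 isOpen_ball
  obtain ⟨_, ⟨z, hz, rfl⟩, hzA⟩ := mem_closure_iff.1 hyA _ hop ⟨0, mem_ball_self hδ, rfl⟩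
  refine mem_interior.2 ⟨_, ?_, hop, 0, mem_ball_self hδ, rfl⟩
  rintro _ ⟨w, hw, rfl⟩
  refine (hAF _ (h1 (hδN hw)) (h2 (hδN hw)) (hMU (hγM (hδ3 hw)))).2 fun i => ?_
  refine eq_zero_of_eqOn_open isOpen_ball (convex_ball 0 δ)
    (((hF i).comp h3 h2).mono hδN) (hγ.holParam.continuousOn.isOpen_inter_preimage isOpen_ball
      isOpen_interior) ⟨z, ⟨hδ3 hz, hzA⟩, hz⟩ (fun v hv => ?_) w hw
  exact (hAF _ (h1 (hδN hv.2)) (h2 (hδN hv.2)) (hMU (hγM (hδ3 hv.2)))).1 (interior_subset hv.1.2) i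

theorem IsIrreducibleAnalyticIn.of_isPreconnected {M U : Set X} (hM : IsManifoldIn S M)
    (hMo : IsOpen M) (hMc : IsPreconnected M) (hne : M.Nonempty) (hMU : M ⊆ U)
    (hUM : IsOpen (U \ M)) : IsIrreducibleAnalyticIn S M U := by
  refine ⟨.of_isOpen_diff hMU hMo hUM, hne, fun A₁ A₂ h₁ h₂ h => or_iff_not_imp_left.2 fun hn => ?_⟩
  obtain ⟨y, hyM, hyA⟩ := not_subset.1 hn
  obtain ⟨c, hc, hyc, V, hV, -, hyV, p, F, hF, hAF⟩ := h₁.2 y (hMU hyM)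
  obtain ⟨i, hi⟩ := not_forall.1 fun h => hyA ((hAF y hyc hyV (hMU hyM)).2 h)
  have hco : ContinuousOn (fun x => F i (c.φ x)) (c.U ∩ c.φ ⁻¹' V) :=
    (hF i).continuousOn.comp (c.contOn.mono inter_subset_left) fun x hx => hx.2
  refine h₂.subset_of_isPreconnected hM hMo hMc hMU ⟨y, hyM, mem_interior.2 ⟨_, ?_,
    (hco.isOpen_inter_preimage (c.contOn.isOpen_inter_preimage c.openU hV)
      isOpen_compl_singleton).inter hMo, ⟨⟨hyc, hyV⟩, hi⟩, hyM⟩⟩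
  rintro x ⟨⟨⟨hx1, hx2⟩, hx3⟩, hx4⟩
  grind

theorem IsCoord.spacePSHOn (hX : IsManifoldIn S univ) (hγ : IsCoord S γ)
    {ψ : Cn m → EReal} (hu : PSHOnE ψ (ball 0 2))
    (hψ : ∀ z ∈ ball (0 : Cn m) 2, ψ z = u (γ z)) :
    SpacePSHOn S u (γ '' ball 0 2) := by
  have h23 : ball (0 : Cn m) 2 ⊆ ball 0 3 := ball_subset_ball (by norm_num)
  refine ⟨?_, fun C hC => ?_, fun x hx => hγ.pshOnE h23 isOpen_ball hu hψ hx⟩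
  · rintro _ ⟨z, hz, rfl⟩
    exact hψ z hz ▸ hu.1 z hz
  · have h := hC.2 _ (.of_isPreconnected (fun x _ => hX x (mem_univ x))
      (hγ.isOpen_image h23 isOpen_ball) ((convex_ball (0 : Cn m) 2).isPreconnected.image γ
        (hγ.holParam.continuousOn.mono h23)) (Nonempty.image _ ⟨0, mem_ball_self two_pos⟩) subset_rfl
      (by simp)) hC.1.1.1
    by_contra hcon
    push Not at hcon
    rw [← h] at hcon
    exact hu.2.2.1 ⟨_, subset_rfl, isOpen_ball, ⟨0, mem_ball_self two_pos⟩, fun z hz =>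
      (hψ z hz).trans (hcon _ (mem_image_of_mem γ hz))⟩

theorem SpacePSHOn.exists_bound {D : Set X} (hu : SpacePSHOn S u D) {x : X}
    (hx : x ∈ D) : ∃ K : ℝ, 0 ≤ K ∧ ∀ᶠ y in 𝓝 x, u y ≤ K := by
  obtain ⟨c, hc, hxc, V, hV, -, hxV, -, ψ, hψ, hψe⟩ := hu.2.2 x hx
  obtain ⟨M, hM, -⟩ := exists_rat_btwn_of_lt (hψ.1 _ hxV)
  obtain ⟨O, hO, hOe⟩ := upperSemicontinuousOn_iff_preimage_Iio.1 hψ.2.1 ((M : ℝ) : EReal)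
  refine ⟨|(M : ℝ)|, abs_nonneg _, ?_⟩
  filter_upwards [(c.contOn.isOpen_inter_preimage c.openU (hV.inter hO)).mem_nhds
    ⟨hxc, hOe.subset ⟨hxV, hM⟩⟩] with y hy
  rw [← hψe y hy.1 hy.2.1]
  exact (hOe.symm.subset hy.2).2.le.trans (coe_le_coe_iff.2 (le_abs_self _))

theorem HolParam.mono {Ω Ω' : Set (Cn m)} (h : HolParam S γ Ω) (hΩ : IsOpen Ω')
    (hs : Ω' ⊆ Ω) : HolParam S γ Ω' := fun z hz => by
  obtain ⟨c, hc, N, hN, hzN, -, h1, h2⟩ := h z (hs hz)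
  exact ⟨c, hc, N ∩ Ω', hN.inter hΩ, ⟨hzN, hz⟩, inter_subset_right, h1.mono_left inter_subset_left,
    h2.mono inter_subset_left⟩

theorem HolParam.bot_or_null_bot {Ω : Set (Cn m)} (hΩ : IsOpen Ω)
    (h : HolParam S γ Ω) {D : Set X} (hu : SpacePSHOn S u D) (hD : MapsTo γ Ω D)
    {z : Cn m} (hz : z ∈ Ω) : ∃ δ > 0, ball z δ ⊆ Ω ∧
      ((∀ y ∈ ball z δ, u (γ y) = ⊥) ∨ volume {y ∈ ball z δ | u (γ y) = ⊥} = 0) := by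
  obtain ⟨K, hK0, hK⟩ := hu.exists_bound (hD hz)
  obtain ⟨O, hO, hOo, hzO⟩ := _root_.mem_nhds_iff.1 hK
  have hΩ' : IsOpen (Ω ∩ γ ⁻¹' O) := h.continuousOn.isOpen_inter_preimage hΩ hOo
  have hb : ∀ y ∈ Ω ∩ γ ⁻¹' O, u (γ y) ≤ K := fun y hy => hO hy.2
  obtain ⟨δ, hδ, hsub, h'⟩ := _root_.bot_or_null_bot hΩ' hK0 hb (fun k =>
    (h.mono hΩ' inter_subset_left).lpsh_trunc hu (hD.mono_left inter_subset_left) hb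
      ((neg_nonpos.2 k.cast_nonneg).trans hK0)) ⟨hz, hzO⟩
  grind

theorem SpacePSHOn.null_bot (hX : IsManifoldIn S univ) (hu : SpacePSHOn S u univ)
    (hγ : IsCoord S γ) : volume {z ∈ ball (0 : Cn m) 3 | u (γ z) = ⊥} = 0 := by
  have hT : interior {x | u x = ⊥} = ∅ := by
    by_contra hne
    obtain ⟨x, hx⟩ := nonempty_iff_ne_empty.2 hne
    have hcl : IsClopen (interior {x | u x = ⊥}) := by
      refine ⟨isClosed_of_closure_subset fun y hy => ?_, isOpen_interior⟩
      obtain ⟨k, γ, hγ, rfl, -⟩ := exists_isCoord hX (mem_univ y) isOpen_univ (mem_univ y)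
      obtain ⟨δ, hδ, hδ3, h⟩ := hγ.holParam.bot_or_null_bot isOpen_ball hu (mapsTo_univ _ _)
        (mem_ball_self three_pos)
      have hop := hγ.isOpen_image hδ3 isOpen_ball
      rcases h with h | h
      · refine mem_interior.2 ⟨_, ?_, hop, 0, mem_ball_self hδ, rfl⟩
        grind
      · obtain ⟨_, ⟨z, hz, rfl⟩, hzT⟩ := mem_closure_iff.1 hy _ hop ⟨0, mem_ball_self hδ, rfl⟩
        have h1 := (hγ.holParam.continuousOn.mono hδ3).isOpen_inter_preimage isOpen_ball
          (isOpen_interior (s := {x | u x = ⊥}))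
        refine absurd (measure_mono_null ?_ h) (h1.measure_pos volume ⟨z, hz, hzT⟩).ne'
        exact fun w hw => ⟨hw.1, show γ w ∈ {x | u x = ⊥} from interior_subset hw.2⟩
    have hco : IsOpen (connectedComponent x) := isOpen_iff_mem_nhds.2 fun y hy => by
      obtain ⟨k, γ, hγ, rfl, -⟩ := exists_isCoord hX (mem_univ y) isOpen_univ (mem_univ y)
      refine mem_of_superset ((hγ.isOpen_image subset_rfl isOpen_ball).mem_nhds
        ⟨0, mem_ball_self three_pos, rfl⟩) ?_
      rw [connectedComponent_eq hy]
      exact ((convex_ball (0 : Cn k) 3).isPreconnected.image γ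
        hγ.holParam.continuousOn).subset_connectedComponent ⟨0, mem_ball_self three_pos, rfl⟩
    have hcc : IsOpen (univ \ connectedComponent x) := by
      rw [← compl_eq_univ_sdiff]; exact isClosed_connectedComponent.isOpen_compl
    obtain ⟨y, hy, hy'⟩ := hu.2.1 (connectedComponent x) (by
      refine ⟨.of_isPreconnected (fun x _ => hX x (mem_univ x)) hco isPreconnected_connectedComponent
        ⟨x, mem_connectedComponent⟩ (subset_univ _) hcc, fun C hC hsub => ?_⟩
      rcases hC.2.2 (connectedComponent x) (connectedComponent x)ᶜ
        (.of_isOpen_diff (subset_univ _) hco hcc) (.of_isOpen_diff (subset_univ _)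
          isClosed_connectedComponent.isOpen_compl (by simp_all))
        (by simp) with h | h
      · grind
      · exact absurd mem_connectedComponent (h (hsub mem_connectedComponent)))
    exact hy' (show y ∈ {x | u x = ⊥} from
      interior_subset (hcl.connectedComponent_subset hx hy))
  refine measure_null_of_locally_null _ fun z hz => ?_
  obtain ⟨δ, hδ, hδ3, h⟩ := hγ.holParam.bot_or_null_bot isOpen_ball hu (mapsTo_univ _ _) hz.1
  have h' := h.resolve_left fun h => by
    have : γ z ∈ interior {x | u x = ⊥} := mem_interior.2 ⟨γ '' ball z δ, by
      grind, hγ.isOpen_image hδ3 isOpen_ball, z, mem_ball_self hδ, rfl⟩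
    grind
  exact ⟨_, inter_mem_nhdsWithin _ (ball_mem_nhds z hδ), measure_mono_null
    (t := {y ∈ ball z δ | u (γ y) = ⊥}) (fun y hy => And.intro hy.2 hy.1.2) h'⟩

end Manifold

section RelExt

variable {X : Type*} [TopologicalSpace X] {S : CSpace X} {m : ℕ} {A D : Set X}
variable {u : X → EReal} {x : X} {c : EReal}

/-- The competitors in the definition of the relative extremal function. -/
def Comp (S : CSpace X) (A D : Set X) (u : X → EReal) : Prop :=
  SpacePSHOn S u D ∧ (∀ x ∈ D, u x ≤ 1) ∧ ∀ x ∈ A, u x ≤ 0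

theorem Comp.le_raw (hu : Comp S A D u) (x : X) : u x ≤ relExtRaw S A D x :=
  le_iSup₂ (f := fun (u : X → EReal) (_ : Comp S A D u) => u x) u hu

theorem lt_relExtRaw_iff :
    c < relExtRaw S A D x ↔ ∃ u, Comp S A D u ∧ c < u x := by
  simp only [relExtRaw, lt_iSup_iff, exists_prop]; rfl

theorem zero_mem_comp (hD : IsOpen D) : Comp S A D fun _ => ((0 : ℝ) : EReal) :=
  ⟨.const hD 0, by simp, by simp⟩

theorem relExtRaw_le_relExt (hx : x ∈ D) : relExtRaw S A D x ≤ relExt S A D x :=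
  le_of_forall_gt_imp_ge_of_dense fun _ hc =>
    ((eventually_lt_of_limsup_lt hc).self_of_nhdsWithin hx).le

theorem relExt_mem (hD : IsOpen D) (hx : x ∈ D) :
    0 ≤ relExt S A D x ∧ relExt S A D x ≤ ((1 : ℝ) : EReal) :=
  ⟨((zero_mem_comp hD).le_raw x).trans (relExtRaw_le_relExt hx),
    limsup_le_of_le (h := eventually_mem_nhdsWithin.mono fun y hy => iSup₂_le fun _ hu => hu.2.1 y hy)⟩

theorem coe_relExt (hD : IsOpen D) (hx : x ∈ D) :
    ((relExt S A D x).toReal : EReal) = relExt S A D x :=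
  coe_toReal ((relExt_mem hD hx).2.trans_lt (coe_lt_top _)).ne
    (EReal.bot_lt_zero.trans_le (relExt_mem hD hx).1).ne'

theorem relExt_toReal_mem (hD : IsOpen D) (hx : x ∈ D) :
    0 ≤ (relExt S A D x).toReal ∧ (relExt S A D x).toReal ≤ 1 := by
  have h := relExt_mem (S := S) (A := A) hD hx
  rw [← coe_relExt hD hx] at h
  exact ⟨coe_nonneg.1 h.1, coe_le_coe_iff.1 h.2⟩

theorem Comp.le_toReal (hD : IsOpen D) (hu : Comp S A D u) (hx : x ∈ D) :
    u x ≤ (relExt S A D x).toReal :=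
  ((hu.le_raw x).trans (relExtRaw_le_relExt hx)).trans (coe_relExt hD hx).ge

theorem eventually_relExt_lt (hD : IsOpen D) (hx : x ∈ D)
    (hc : relExt S A D x < c) : ∀ᶠ y in 𝓝 x, relExt S A D y < c := by
  obtain ⟨d, h1, h2⟩ := exists_between hc
  have h := eventually_lt_of_limsup_lt h1
  rw [hD.nhdsWithin_eq hx] at h
  filter_upwards [h.eventually_nhds] with y hy
  exact (limsup_le_of_le (h := (hy.filter_mono nhdsWithin_le_nhds).mono fun _ h => h.le)).trans_lt h2

theorem isOpen_relExt_lt (hD : IsOpen D) (c : EReal) : IsOpen {x ∈ D | relExt S A D x < c} :=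
  isOpen_iff_mem_nhds.2 fun _ hx => inter_mem (hD.mem_nhds hx.1) (eventually_relExt_lt hD hx.1 hx.2)

theorem frequently_lt_relExtRaw (hc : c < relExt S A D x) :
    ∃ᶠ y in 𝓝 x, c < relExtRaw S A D y ∧ y ∈ D :=
  frequently_nhdsWithin_iff.1 (frequently_lt_of_lt_limsup (h := hc))

theorem UPsh.sup {u v : Cn m → ℝ} (hu : UPsh u) (hv : UPsh v) : UPsh (u ⊔ v) :=
  ⟨hu.1.sup isOpen_ball hv.1, fun z hz => ⟨(hu.2 z hz).1.trans le_sup_left,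
    sup_le (hu.2 z hz).2 (hv.2 z hz).2⟩⟩

theorem HolParam.lpsh_comp {γ : Cn m → X} {Ω : Set (Cn m)} (h : HolParam S γ Ω)
    (hD : MapsTo γ Ω D) (hu : Comp S A D u) :
    LPSH (fun z => trunc 0 (u (γ z))) Ω ∧ ∀ z ∈ Ω, 0 ≤ trunc 0 (u (γ z)) ∧ trunc 0 (u (γ z)) ≤ 1 :=
  ⟨h.lpsh_trunc hu.1 hD (C := 1) (fun z hz => hu.2.1 _ (hD hz)) (by norm_num), fun z hz =>
    ⟨by simpa using neg_le_trunc (m := 0) (hu.1.1 _ (hD hz)),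
      trunc_le (hu.2.1 _ (hD hz)) (by norm_num)⟩⟩

/-- In local coordinates the relative extremal function is plurisubharmonic, and it vanishes
quasi-everywhere on `A`. -/
theorem IsCoord.relExt_psh {γ : Cn m → X} (hγ : IsCoord S γ) (hD : IsOpen D)
    (hγD : MapsTo γ (ball 0 3) D) : UPsh (fun z => (relExt S A D (γ z)).toReal) ∧
      ∃ ψ : Cn m → EReal, PSHOnE ψ (ball 0 2) ∧
        ∀ z ∈ Gb m, γ z ∈ A → 0 < (relExt S A D (γ z)).toReal → ψ z = ⊥ := by
  set h : Cn m → ℝ := fun z => (relExt S A D (γ z)).toReal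
  let ι := TopologicalSpace.countableBasis (Cn m) × ℚ
  have hbasis := TopologicalSpace.isBasis_countableBasis (Cn m)
  have hsel : ∀ i : ι, ∃ u, Comp S A D u ∧ ((∃ u', Comp S A D u' ∧ ∃ z ∈ i.1.1 ∩ ball 0 3,
      ((i.2 : ℝ) : EReal) < u' (γ z)) → ∃ z ∈ i.1.1 ∩ ball 0 3, ((i.2 : ℝ) : EReal) < u (γ z)) := fun i => by
    by_cases hi : ∃ u', Comp S A D u' ∧ ∃ z ∈ i.1.1 ∩ ball 0 3, ((i.2 : ℝ) : EReal) < u' (γ z)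
    · grind
    · exact ⟨_, zero_mem_comp hD, fun h => absurd h hi⟩
  choose sel hselF hsel' using hsel
  obtain ⟨B, hB, -⟩ := hbasis.exists_subset_of_mem_open (mem_univ (0 : Cn m)) isOpen_univ
  have : Nonempty ι := ⟨⟨⟨B, hB⟩, 0⟩⟩
  obtain ⟨f, hf⟩ := exists_surjective_nat ι
  let w (j : ℕ) (z : Cn m) : ℝ := trunc 0 (sel (f j) (γ z))
  let P (v : Cn m → ℝ) : Prop := UPsh v ∧ ∀ z ∈ ball 0 3, v z ≤ h z ∧ (γ z ∈ A → v z ≤ 0)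
  have hw : ∀ j, P (w j) := fun j => ⟨hγ.holParam.lpsh_comp hγD (hselF _), fun z hz =>
    ⟨trunc_le ((hselF _).le_toReal hD (hγD hz)) (by simpa using (relExt_toReal_mem hD (hγD hz)).1),
      fun hA => trunc_le ((hselF _).2.2 _ hA) (by norm_num)⟩⟩
  have hP : ∀ j, P (partialSups w j) := fun j => by
    induction j with
    | zero => simpa using hw 0
    | succ j ih =>
      rw [partialSups_add_one]
      exact ⟨ih.1.sup (hw _).1, fun z hz => ⟨sup_le (ih.2 z hz).1 ((hw _).2 z hz).1, fun hA =>
        sup_le ((ih.2 z hz).2 hA) (((hw _).2 z hz).2 hA)⟩⟩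
  let U (z : Cn m) : ℝ := ⨆ j, partialSups w j z
  have hmono : ∀ z ∈ ball (0 : Cn m) 3, Monotone fun j => partialSups w j z := fun z _ i j hij =>
    (partialSups w).monotone hij z
  have hbdd : ∀ z ∈ ball (0 : Cn m) 3, BddAbove (range fun j => partialSups w j z) := fun z hz =>
    ⟨1, by rintro _ ⟨j, rfl⟩; exact ((hP j).1.2 z hz).2⟩
  have hU : ∀ z ∈ ball (0 : Cn m) 3, Tendsto (fun j => partialSups w j z) atTop (𝓝 (U z)) :=
    fun z hz => tendsto_atTop_ciSup (hmono z hz) (hbdd z hz)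
  have hreg : IsUscReg h U (ball 0 3) := by
    refine ⟨fun z hz => ciSup_le fun j => ((hP j).2 z hz).1, fun z hz c hc => ?_, fun z hz c hc => ?_⟩
    · have h1 : relExt S A D (γ z) < (c : EReal) := by
        rw [← coe_relExt hD (hγD hz)]; exact coe_lt_coe_iff.2 hc
      have h2 := (hγ.holParam.continuousOn z hz).eventually (eventually_relExt_lt hD (hγD hz) h1)
      filter_upwards [h2, eventually_mem_nhdsWithin] with y hy hy3
      rw [← coe_relExt hD (hγD hy3)] at hy
      exact coe_lt_coe_iff.1 hy
    · have h1 : (c : EReal) < relExt S A D (γ z) := by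
        rw [← coe_relExt hD (hγD hz)]; exact coe_lt_coe_iff.2 hc
      refine frequently_iff.2 fun {N} hN => ?_
      obtain ⟨N', hN', hN'o, hzN'⟩ := _root_.mem_nhds_iff.1 hN
      obtain ⟨_, ⟨y, hy, rfl⟩, hcy, -⟩ := frequently_iff.1 (frequently_lt_relExtRaw h1)
        ((hγ.isOpen_image inter_subset_right (hN'o.inter isOpen_ball)).mem_nhds
          ⟨z, ⟨hzN', hz⟩, rfl⟩)
      obtain ⟨u, hu, huy⟩ := lt_relExtRaw_iff.1 hcy
      obtain ⟨q, hcq, hqu⟩ := exists_rat_btwn_of_lt huy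
      obtain ⟨B, hB, hyB, hBN⟩ := hbasis.exists_subset_of_mem_open hy (hN'o.inter isOpen_ball)
      obtain ⟨j, hj⟩ := hf ⟨⟨B, hB⟩, q⟩
      obtain ⟨y', hy', hqy'⟩ := hsel' ⟨⟨B, hB⟩, q⟩ ⟨u, hu, y, ⟨hyB, hy.2⟩, hqu⟩
      refine ⟨y', hN' (hBN hy'.1).1, ?_⟩
      have h2 : (c : EReal) < w j y' := by
        simp only [w, hj]
        exact (hcq.trans hqy').trans_le (le_trunc ((hselF _).1.1 _ (hγD hy'.2)))
      exact ((coe_lt_coe_iff.1 h2).trans_le (le_partialSups w j y')).trans_le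
        (le_ciSup (hbdd y' hy'.2) j)
  have hh : UPsh h := ⟨.of_uscReg isOpen_ball (C := 1) (fun j => (hP j).1.1) (fun j z hz => abs_le.2
    ⟨by linarith [((hP j).1.2 z hz).1], ((hP j).1.2 z hz).2⟩) hU hreg,
    fun z hz => relExt_toReal_mem hD (hγD hz)⟩
  obtain ⟨ψ, hψ, hψb⟩ := exists_psh_bot_of_lt_uscReg (fun j => (hP j).1) hmono hU hreg hh
  exact ⟨hh, ψ, hψ, fun z hz hA hpos => hψb z hz ((ciSup_le fun j =>
    ((hP j).2 z (Gb_subset_ball (by norm_num) hz)).2 hA).trans_lt hpos)⟩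

theorem LPSH.glue_max {E : Type*} [NormedAddCommGroup E] [NormedSpace ℂ E] {h w : E → ℝ} {Ω : Set E}
    (hΩ : IsOpen Ω) (hh : LPSH h Ω) {s : ℝ} (hw : LPSH w {z ∈ Ω | h z < s})
    (hws : ∀ z ∈ Ω, h z < s → w z ≤ s) :
    LPSH (fun z => if h z < s then max (h z) (w z) else h z) Ω := by
  obtain ⟨O, hO, hOe⟩ := upperSemicontinuousOn_iff_preimage_Iio.1 hh.1 s
  have hN : IsOpen {z ∈ Ω | h z < s} := by
    have : {z ∈ Ω | h z < s} = Ω ∩ O := hOe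
    exact this ▸ hΩ.inter hO
  have hm : LPSH (fun z => if h z < s then max (h z) (w z) else h z) {z ∈ Ω | h z < s} :=
    ((hh.mono fun z hz => hz.1).sup hN hw).congr hN fun z hz => if_pos hz.2
  have hle : ∀ z, h z ≤ if h z < s then max (h z) (w z) else h z := fun z => by grind
  obtain ⟨C, hC⟩ := hh.2.1
  obtain ⟨C', hC'⟩ := hm.2.1
  have hbd : ∃ C, ∀ z ∈ Ω, |if h z < s then max (h z) (w z) else h z| ≤ C :=
    ⟨max C C', fun z hz => by grind⟩
  have husc : UpperSemicontinuousOn (fun z => if h z < s then max (h z) (w z) else h z) Ω := fun z hz c hc => by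
    by_cases hs : h z < s
    · have := hm.1 z ⟨hz, hs⟩ c hc
      rw [hN.nhdsWithin_eq ⟨hz, hs⟩] at this
      exact this.filter_mono nhdsWithin_le_nhds
    · simp only [if_neg hs] at hc
      filter_upwards [hh.1 z hz c hc, eventually_mem_nhdsWithin] with y hy hyΩ
      grind
  refine .of_submean husc hbd fun a ha b => ?_
  by_cases hs : h a < s
  · exact hm.eventually_submean hN ⟨ha, hs⟩ b
  · filter_upwards [hh.eventually_submean hΩ ha b, eventually_line_mem hΩ ha b,
      self_mem_nhdsWithin] with ρ h1 h2 h3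
    rw [if_neg hs]
    have h4 : ∀ w ∈ sphere (0 : ℂ) |ρ|, a + w • b ∈ Ω := fun w hw => h2.2 w (by
      rw [abs_of_pos h2.1] at hw; simp_all)
    exact h1.trans (circleAverage_mono (LPSH.circleIntegrable hh.1 hh.2.1 a b h4)
      (LPSH.circleIntegrable husc hbd a b h4) fun w _ => hle _)

end RelExt

section Josefson

variable {X : Type*} [TopologicalSpace X] {S : CSpace X} {m : ℕ} {A D : Set X}

theorem IsJosefsonManifold.exists_psh_bot (hX : IsJosefsonManifold S) {γ : Cn m → X}
    (hγ : IsCoord S γ) {ψ : Cn m → EReal} (hψ : PSHOnE ψ (ball 0 2)) :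
    ∃ u : X → EReal, SpacePSHOn S u univ ∧ ∀ z ∈ Gb m, ψ z = ⊥ → u (γ z) = ⊥ := by
  have h23 : ball (0 : Cn m) 2 ⊆ ball 0 3 := ball_subset_ball (by norm_num)
  have hinv : ∀ z ∈ ball (0 : Cn m) 3, invFunOn γ (ball 0 3) (γ z) = z :=
    hγ.injOn.leftInvOn_invFunOn
  obtain ⟨u, hu, hub⟩ := hX.2 (γ '' {z ∈ Gb m | ψ z = ⊥}) fun x hx => by
    refine ⟨γ '' ball 0 2, hγ.isOpen_image h23 isOpen_ball,
      image_mono (fun z hz => Gb_subset_ball (by norm_num) hz.1) hx, subset_univ _,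
      fun y => ψ (invFunOn γ (ball 0 3) y),
      hγ.spacePSHOn hX.1 hψ fun z hz => by grind, ?_⟩
    rintro _ ⟨⟨z, hz, rfl⟩, -⟩
    exact (congrArg ψ (hinv z (Gb_subset_ball (by norm_num) hz.1))).trans hz.2
  grind

theorem SpacePSHOn.exists_bound_of_isCompact {u : X → EReal} (hu : SpacePSHOn S u univ) {K : Set X}
    (hK : IsCompact K) : ∃ C : ℝ, 0 ≤ C ∧ ∀ x ∈ K, u x ≤ C := by
  refine hK.induction_on (p := fun s => ∃ C : ℝ, 0 ≤ C ∧ ∀ x ∈ s, u x ≤ C) ⟨0, le_rfl, by simp⟩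
    (fun s t hst ⟨C, h0, h⟩ => ⟨C, h0, fun x hx => h x (hst hx)⟩)
    (fun s t ⟨C, h0, h⟩ ⟨C', h0', h'⟩ => ⟨max C C', h0.trans (le_max_left _ _), fun x hx => ?_⟩)
    fun x _ => ?_
  · rcases hx with hx | hx
    · exact (h x hx).trans (coe_le_coe_iff.2 (le_max_left _ _))
    · exact (h' x hx).trans (coe_le_coe_iff.2 (le_max_right _ _))
  · obtain ⟨C, h0, h⟩ := hu.exists_bound (mem_univ x)
    exact ⟨_, mem_nhdsWithin_of_mem_nhds h, C, h0, fun y hy => hy⟩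

/-- A bounded plurisubharmonic function equal to `-1` where one of the `ψ i` is `-∞`, and almost
`0` at a given point where all `ψ i` are finite. -/
theorem exists_sum_weight {ψ : ℕ → X → EReal} (hψ : ∀ i, SpacePSHOn S (ψ i) univ)
    (hD : IsCompact (closure D)) {x₀ : X} (hne : ∀ i, ψ i x₀ ≠ ⊥) {η : ℝ} (hη : 0 < η) :
    ∃ χ : X → ℝ, (∀ (m : ℕ) (γ : Cn m → X), HolParam S γ (ball 0 3) → MapsTo γ (ball 0 3) D →
      LPSH (fun z => χ (γ z)) (ball 0 3)) ∧
      (∀ x ∈ D, -1 ≤ χ x ∧ χ x ≤ 0 ∧ ∀ i, ψ i x = ⊥ → χ x = -1) ∧ -η ≤ χ x₀ := by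
  choose C hC0 hC using fun i => (hψ i).exists_bound_of_isCompact hD
  have hb : ∀ i, ∃ b : ℝ, (b : EReal) = ψ i x₀ := fun i =>
    ⟨_, coe_toReal ((hψ i).1 x₀ (mem_univ _)).ne (hne i)⟩
  choose b hb using hb
  let ε (i : ℕ) : ℝ := η * (1 / 2) ^ (i + 1) / (|b i| + C i + 1)
  have hp : ∀ i, 0 < |b i| + C i + 1 := fun i => by grind
  have hε : ∀ i, 0 < ε i := fun i => div_pos (by positivity) (hp i)
  have hε' : ∀ i, ε i * (|b i| + C i + 1) = η * (1 / 2) ^ (i + 1) := fun i =>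
    div_mul_cancel₀ _ (hp i).ne'
  let c (i : ℕ) (x : X) : ℝ := ε i * (trunc (1 / ε i) (ψ i x) + -C i)
  have hN : ∀ i, -(1 / ε i) ≤ C i := fun i =>
    (neg_nonpos.2 (one_div_nonneg.2 (hε i).le)).trans (hC0 i)
  have hc0 : ∀ i, ∀ x ∈ D, c i x ≤ 0 := fun i x hx => mul_nonpos_of_nonneg_of_nonpos (hε i).le
    (by linarith [trunc_le (hC i x (subset_closure hx)) (hN i)])
  let f (N : ℕ) (x : X) : ℝ := max (∑ i ∈ Finset.range N, c i x) (-1)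
  have hf : ∀ N x, -1 ≤ f N x := fun N x => le_max_right _ _
  have hanti : ∀ x ∈ D, Antitone fun N => f N x := fun x hx => antitone_nat_of_succ_le fun N =>
    max_le_max (by rw [sum_range_succ]; grind) le_rfl
  have hf0 : ∀ N, ∀ x ∈ D, f N x ≤ 0 := fun N x hx => (hanti x hx (Nat.zero_le N)).trans (by simp [f])
  have hbdd : ∀ x, BddBelow (range fun N => f N x) := fun x =>
    ⟨-1, by rintro _ ⟨N, rfl⟩; grind⟩
  have hlim : ∀ x ∈ D, Tendsto (fun N => f N x) atTop (𝓝 (⨅ N, f N x)) := fun x hx =>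
    tendsto_atTop_ciInf (hanti x hx) (hbdd x)
  refine ⟨fun x => ⨅ N, f N x, fun m γ hγ hγD => ?_, fun x hx => ⟨le_ciInf fun N => hf N x,
    (ciInf_le (hbdd x) 0).trans (hf0 0 x hx), fun i hi => ?_⟩, le_ciInf fun N => ?_⟩
  · have hl : ∀ N, LPSH (fun z => f N (γ z)) (ball 0 3) := fun N => by
      refine LPSH.sup isOpen_ball ?_ (.const _)
      induction N with
      | zero => simpa using LPSH.const 0
      | succ N ih =>
        simp only [sum_range_succ]
        exact ih.add isOpen_ball (((hγ.lpsh_trunc (hψ N) (mapsTo_univ _ _) (fun z hz =>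
          hC N _ (subset_closure (hγD hz))) (hN N)).add_const isOpen_ball _).const_mul isOpen_ball
            (hε N).le)
    exact .of_tendsto isOpen_ball (C := 1) hl (fun N z hz => abs_le.2 ⟨hf N _,
      (hf0 N _ (hγD hz)).trans zero_le_one⟩) (usc_of_antitone (fun N => (hl N).1)
        (fun z hz => hanti _ (hγD hz)) fun z hz => hlim _ (hγD hz)) fun z hz => hlim _ (hγD hz)
  · refine le_antisymm ((ciInf_le (hbdd x) (i + 1)).trans (max_le ?_ le_rfl)) (le_ciInf (hf · x))
    rw [sum_range_succ]
    have h1 : ∑ j ∈ Finset.range i, c j x ≤ 0 := sum_nonpos fun j _ => hc0 j x hx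
    have h2 : c i x ≤ -1 := by
      simp only [c, hi, trunc_bot]
      rw [mul_add, mul_neg, mul_one_div_cancel (hε i).ne', mul_neg]
      simp_all
    linarith
  · refine le_trans ?_ (le_max_left _ _)
    have h1 : ∀ i, -(η * (1 / 2) ^ (i + 1)) ≤ c i x₀ := fun i => by
      have h2 : b i ≤ trunc (1 / ε i) (ψ i x₀) := by
        rw [← coe_le_coe_iff, hb]; exact le_trunc ((hψ i).1 _ (mem_univ _))
      rw [← hε', ← mul_neg]
      exact mul_le_mul_of_nonneg_left (by grind) (hε i).le
    have h2 : ∀ N, -(η * (1 - (1 / 2) ^ N)) ≤ ∑ i ∈ Finset.range N, c i x₀ := fun N => by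
      induction N with
      | zero => simp
      | succ N ih =>
        rw [sum_range_succ]
        have := h1 N
        rw [pow_succ] at this ⊢
        linarith
    refine le_trans ?_ (h2 N)
    simp_all

theorem usc_ite {Y : Type*} [TopologicalSpace Y] {Ω : Set Y} {h W : Y → ℝ} {r : ℝ}
    (hh : UpperSemicontinuousOn h Ω) (hW : UpperSemicontinuousOn W Ω) (hle : ∀ y ∈ Ω, h y ≤ W y) :
    UpperSemicontinuousOn (fun y => if h y < r then h y else W y) Ω := fun y hy c hc => by
  by_cases hr : h y < r
  · simp only [if_pos hr] at hc
    filter_upwards [hh y hy c hc, hh y hy r hr] with x h1 h2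
    grind
  · simp only [if_neg hr] at hc
    filter_upwards [hW y hy c hc] with x h1
    grind

/-- The comparison function `max (h, r + (s - r) v)`, extended by `h` and cut off below `r`. -/
def glued (h v : X → ℝ) (r s : ℝ) (x : X) : ℝ :=
  if h x < r then h x else if h x < s then max (h x) ((s - r) * v x + r) else h x

variable {r s : ℝ} {v : X → EReal}

theorem IsJosefsonManifold.exists_local_data (hX : IsJosefsonManifold S) (hD : IsOpen D)
    (hrs : r < s) (hs : s ≤ 1)
    (hv : Comp S {x ∈ D | relExt S A D x < (r : EReal)} {x ∈ D | relExt S A D x < (s : EReal)} v)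
    {x : X} (hx : x ∈ D) : ∃ u₁ u₂ : X → EReal, SpacePSHOn S u₁ univ ∧ SpacePSHOn S u₂ univ ∧
      ∃ (m : ℕ) (γ : Cn m → X), IsCoord S γ ∧ γ 0 = x ∧ MapsTo γ (ball 0 3) D ∧
        (∀ z ∈ Gb m, γ z ∈ A → 0 < (relExt S A D (γ z)).toReal → u₁ (γ z) = ⊥) ∧
        UpperSemicontinuousOn (fun z => glued (fun x => (relExt S A D x).toReal)
          (fun x => trunc 0 (v x)) r s (γ z)) (ball 0 3) ∧
        ∃ F : ℕ → Cn m → ℝ, (∀ j, LPSH (F j) (Gb m)) ∧ (∀ j, ∀ z ∈ Gb m, 0 ≤ F j z ∧ F j z ≤ 1) ∧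
          ∀ z ∈ Gb m, u₂ (γ z) ≠ ⊥ → Tendsto (fun j => F j z) atTop (𝓝 (glued
            (fun x => (relExt S A D x).toReal) (fun x => trunc 0 (v x)) r s (γ z))) := by
  obtain ⟨m, γ, hγ, hγ0, hγD⟩ := exists_isCoord hX.1 (mem_univ x) hD hx
  obtain ⟨hh, ψ₁, hψ₁, hψ₁A⟩ := hγ.relExt_psh (A := A) hD hγD
  set h : X → ℝ := fun x => (relExt S A D x).toReal
  have hlt : ∀ {x}, x ∈ D → ∀ t : ℝ, h x < t → x ∈ {x ∈ D | relExt S A D x < (t : EReal)} :=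
    fun hx t ht => ⟨hx, by rw [← coe_relExt hD hx]; exact coe_lt_coe_iff.2 ht⟩
  obtain ⟨O, hO, hOe⟩ := upperSemicontinuousOn_iff_preimage_Iio.1 hh.1.1 s
  have hN : IsOpen {z ∈ ball (0 : Cn m) 3 | h (γ z) < s} := by
    have : {z ∈ ball (0 : Cn m) 3 | h (γ z) < s} = ball 0 3 ∩ O := hOe
    exact this ▸ isOpen_ball.inter hO
  have hw := (hγ.holParam.mono hN fun z hz => hz.1).lpsh_comp (fun z hz => hlt (hγD hz.1) s hz.2) hv
  have hws : ∀ z ∈ ball (0 : Cn m) 3, h (γ z) < s → (s - r) * trunc 0 (v (γ z)) + r ≤ s :=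
    fun z hz hzs => by nlinarith [hw.2 z ⟨hz, hzs⟩]
  let W (z : Cn m) : ℝ := if h (γ z) < s then max (h (γ z)) ((s - r) * trunc 0 (v (γ z)) + r)
    else h (γ z)
  have hle : ∀ z, h (γ z) ≤ W z := fun z => by grind
  have hW : UPsh W := by
    refine ⟨hh.1.glue_max isOpen_ball ((hw.1.const_mul hN (by linarith)).add_const hN r) hws,
      fun z hz => ⟨(hh.2 z hz).1.trans (hle z), ?_⟩⟩
    simp only [W]
    split_ifs with hzs
    exacts [max_le (hh.2 z hz).2 ((hws z hz hzs).trans hs), (hh.2 z hz).2]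
  obtain ⟨ψ₂, hψ₂, F, hF, hF01, hFt⟩ := exists_glue_psh hh hW (fun z _ => hle z) (r := r)
    fun z hz hzr => by
      have hz3 := Gb_subset_ball (by norm_num : (1 : ℝ) ≤ 3) hz
      have h0 : trunc 0 (v (γ z)) ≤ 0 := trunc_le (hv.2.2 _ (hlt (hγD hz3) r hzr)) (by norm_num)
      grind
  obtain ⟨u₁, hu₁, hu₁b⟩ := hX.exists_psh_bot hγ hψ₁
  obtain ⟨u₂, hu₂, hu₂b⟩ := hX.exists_psh_bot hγ hψ₂
  exact ⟨u₁, u₂, hu₁, hu₂, m, γ, hγ, hγ0, hγD, fun z hz hA hp => hu₁b z hz (hψ₁A z hz hA hp),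
    usc_ite hh.1.1 hW.1.1 fun z _ => hle z, F, hF, hF01, fun z hz hne =>
      hFt z hz fun hb => hne (hu₂b z hz hb)⟩

end Josefson

section Josefson

variable {X : Type*} [TopologicalSpace X] [SecondCountableTopology X] {S : CSpace X} {m : ℕ}
  {A D : Set X} {r s : ℝ} {v : X → EReal}

theorem IsJosefsonManifold.exists_exceptional (hX : IsJosefsonManifold S) (hD : IsOpen D)
    (hDc : IsCompact (closure D)) (hAD : A ⊆ D) (hne : D.Nonempty) (hr : 0 < r) (hrs : r < s) (hs : s ≤ 1)
    (hv : Comp S {x ∈ D | relExt S A D x < (r : EReal)} {x ∈ D | relExt S A D x < (s : EReal)} v) :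
    ∃ ψ₁ ψ₂ : ℕ → X → EReal, (∀ i, SpacePSHOn S (ψ₁ i) univ) ∧ (∀ i, SpacePSHOn S (ψ₂ i) univ) ∧
      ∀ x ∈ D, (∀ i, ψ₁ i x ≠ ⊥) → (∀ i, ψ₂ i x ≠ ⊥) →
        glued (fun x => (relExt S A D x).toReal) (fun x => trunc 0 (v x)) r s x ≤
          (relExt S A D x).toReal := by
  choose u₁ u₂ hu₁ hu₂ m γ hγ hγ0 hγD hγA husc F hF hF01 hFt using fun x : D =>
    hX.exists_local_data hD hrs hs hv x.2
  set h : X → ℝ := fun x => (relExt S A D x).toReal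
  set g : X → ℝ := glued h (fun x => trunc 0 (v x)) r s
  have hsub : ∀ x, Gb (m x) ⊆ ball 0 3 := fun x => Gb_subset_ball (by norm_num)
  obtain ⟨T, hT, hTe⟩ := TopologicalSpace.isOpen_iUnion_countable (fun x : D => γ x '' Gb (m x))
    fun x => (hγ x).isOpen_image (hsub x) isOpen_Gb
  have hcov : ∀ x ∈ D, ∃ t ∈ T, x ∈ γ t '' Gb (m t) := fun x hx => by
    have : x ∈ ⋃ x : D, γ x '' Gb (m x) := mem_iUnion.2 ⟨⟨x, hx⟩, 0, by simp [nsq], hγ0 _⟩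
    rw [← hTe] at this
    simpa using this
  have hTne : T.Nonempty := by
    obtain ⟨x, hx⟩ := hne
    obtain ⟨t, ht, -⟩ := hcov x hx
    exact ⟨t, ht⟩
  obtain ⟨e, rfl⟩ := hT.exists_eq_range hTne
  have hg : ∀ x ∈ D, g x ≤ 1 := fun x hx => by
    have h1 := (relExt_toReal_mem (S := S) (A := A) hD hx).2
    simp only [g, glued]
    split_ifs with h2 h3
    · exact h1
    · refine max_le h1 ?_
      have h4 : trunc 0 (v x) ≤ 1 := trunc_le (hv.2.1 x ⟨hx, by
        rw [← coe_relExt hD hx]; exact coe_lt_coe_iff.2 h3⟩) (by norm_num)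
      nlinarith
    · exact h1
  refine ⟨fun i => u₁ (e i), fun i => u₂ (e i), fun i => hu₁ _, fun i => hu₂ _,
    fun x₀ hx₀ hn₁ hn₂ => le_of_forall_pos_le_add fun η hη => ?_⟩
  obtain ⟨χ₁, hχ₁, hχ₁D, hχ₁0⟩ := exists_sum_weight (D := D) (fun i => hu₁ (e i)) hDc hn₁ (half_pos hη)
  obtain ⟨χ₂, hχ₂, hχ₂D, hχ₂0⟩ := exists_sum_weight (D := D) (fun i => hu₂ (e i)) hDc hn₂ (half_pos hη)
  have hcomp : Comp S A D fun x => ((max (g x + (χ₁ x + χ₂ x)) 0 : ℝ) : EReal) := by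
    refine ⟨.of_isCoord fun x hx => ?_, fun x hx => ?_, fun x hx => ?_⟩
    · obtain ⟨_, ⟨i, rfl⟩, hxi⟩ := hcov x hx
      set t := e i
      have hGo : IsOpen (Gb (m t)) := isOpen_Gb
      refine ⟨_, γ t, _, hγ t, hsub t, hGo, hxi, ?_, ?_⟩
      · rintro _ ⟨z, hz, rfl⟩
        exact hγD t (hsub t hz)
      have hχ := ((hχ₁ _ _ (hγ t).holParam (hγD t)).add isOpen_ball
        (hχ₂ _ _ (hγ t).holParam (hγD t))).mono (hsub t)
      have hχD : ∀ z ∈ Gb (m t), χ₁ (γ t z) + χ₂ (γ t z) ≤ 0 := fun z hz => by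
        linarith [(hχ₁D _ (hγD t (hsub t hz))).2.1, (hχ₂D _ (hγD t (hsub t hz))).2.1]
      refine .of_tendsto hGo (C := 1) (u := fun j z => max (F t j z + (χ₁ (γ t z) + χ₂ (γ t z))) 0)
        (fun j => ((hF t j).add hGo hχ).sup hGo (.const 0)) (fun j z hz => ?_) ?_ fun z hz => ?_
      · rw [abs_of_nonneg (le_max_right _ _)]
        exact max_le (by linarith [hχD z hz, (hF01 t j z hz).2]) zero_le_one
      · exact (((husc t).mono (hsub t)).add hχ.1).sup upperSemicontinuousOn_const
      · by_cases hb : u₂ t (γ t z) = ⊥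
        · have h1 := (hχ₂D _ (hγD t (hsub t hz))).2.2 i hb
          have h2 := (hχ₁D _ (hγD t (hsub t hz))).2.1
          rw [max_eq_right (by linarith [hg _ (hγD t (hsub t hz))])]
          refine tendsto_const_nhds.congr fun j => (max_eq_right ?_).symm
          linarith [(hF01 t j z hz).2]
        · exact ((hFt t z hz hb).add_const _).max tendsto_const_nhds
    · rw [← coe_one, coe_le_coe_iff]
      exact max_le (by grind) zero_le_one
    · have hxD := hAD hx
      rw [← coe_zero, coe_le_coe_iff]
      refine max_le ?_ le_rfl
      rcases (relExt_toReal_mem (S := S) (A := A) hD hxD).1.eq_or_lt with h0 | h0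
      · have : g x = 0 := by simp only [g, glued, h, ← h0, if_pos hr]
        grind
      · obtain ⟨_, ⟨i, rfl⟩, z, hz, rfl⟩ := hcov x hxD
        grind
  have h1 := coe_le_coe_iff.1 (hcomp.le_toReal (x := x₀) hD hx₀)
  grind

theorem Comp.le_annulus (hX : IsJosefsonManifold S) (hD : IsOpen D)
    (hDc : IsCompact (closure D)) (hAD : A ⊆ D) (hr : 0 < r) (hrs : r < s) (hs : s ≤ 1)
    (hv : Comp S {x ∈ D | relExt S A D x < (r : EReal)} {x ∈ D | relExt S A D x < (s : EReal)} v)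
    {x : X} (hx : x ∈ {x ∈ D | relExt S A D x < (s : EReal)}) :
    (s - r) * trunc 0 (v x) + r ≤ max (relExt S A D x).toReal r := by
  have hΔ := isOpen_relExt_lt (S := S) (A := A) hD (s : EReal)
  obtain ⟨ψ₁, ψ₂, h₁, h₂, hle⟩ := hX.exists_exceptional hD hDc hAD ⟨x, hx.1⟩ hr hrs hs hv
  obtain ⟨m, γ, hγ, rfl, hγΔ⟩ := exists_isCoord hX.1 (mem_univ x) hΔ hx
  have hγD : MapsTo γ (ball 0 3) D := fun z hz => (hγΔ hz).1
  refine LPSH.le_of_ae_le isOpen_ball (((hγ.holParam.lpsh_comp hγΔ hv).1.const_mul isOpen_ball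
    (by linarith : 0 ≤ s - r)).add_const isOpen_ball r)
    ((hγ.relExt_psh (A := A) hD hγD).1.1.sup isOpen_ball (.const r)) ?_ 0 (mem_ball_self three_pos)
  have hae : ∀ {ψ : ℕ → X → EReal}, (∀ i, SpacePSHOn S (ψ i) univ) →
      ∀ᵐ z, ∀ i, z ∈ ball (0 : Cn m) 3 → ψ i (γ z) ≠ ⊥ := fun h => ae_all_iff.2 fun i => by
    refine measure_mono_null (fun z hz => ?_) ((h i).null_bot hX.1 hγ)
    grind
  filter_upwards [hae h₁, hae h₂] with z hz₁ hz₂ hz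
  have h3 := hle _ (hγD hz) (hz₁ · hz) (hz₂ · hz)
  have hlt : (relExt S A D (γ z)).toReal < s := by
    have := (hγΔ hz).2
    rw [← coe_relExt hD (hγD hz)] at this
    simp_all
  simp only [glued] at h3
  by_cases hzr : (relExt S A D (γ z)).toReal < r
  · have h0 : trunc 0 (v (γ z)) ≤ 0 := trunc_le (hv.2.2 _ ⟨hγD hz, by
      rw [← coe_relExt hD (hγD hz)]; simp_all⟩) (by norm_num)
    exact le_max_of_le_right (by nlinarith)
  grind

theorem Comp.annulus (hX : IsManifoldIn S univ) (hD : IsOpen D) (hrs : r < s)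
    (hv : Comp S A D v) : Comp S {x ∈ D | relExt S A D x < (r : EReal)}
      {x ∈ D | relExt S A D x < (s : EReal)}
      fun x => ((max ((s - r)⁻¹ * (trunc 0 (v x) + -r)) 0 : ℝ) : EReal) := by
  have hsr : 0 < (s - r)⁻¹ := inv_pos.2 (by linarith)
  have hle : ∀ t : ℝ, 0 ≤ t → ∀ x ∈ {x ∈ D | relExt S A D x < (t : EReal)}, trunc 0 (v x) ≤ t :=
    fun t ht x hx => trunc_le (((hv.le_raw x).trans (relExtRaw_le_relExt hx.1)).trans hx.2.le)
      (by linarith)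
  have hpos : ∀ (t : ℝ), ∀ x ∈ {x ∈ D | relExt S A D x < (t : EReal)}, 0 ≤ t := fun t x hx =>
    coe_nonneg.1 ((relExt_mem hD hx.1).1.trans hx.2.le)
  refine ⟨.of_isCoord fun x hx => ?_, fun x hx => ?_, fun x hx => ?_⟩
  · obtain ⟨m, γ, hγ, hγ0, hγΔ⟩ := exists_isCoord hX (mem_univ x) (isOpen_relExt_lt hD _) hx
    exact ⟨m, γ, _, hγ, subset_rfl, isOpen_ball, ⟨0, mem_ball_self three_pos, hγ0⟩,
      hγΔ.image_subset, (((hγ.holParam.lpsh_comp (fun z hz => (hγΔ hz).1) hv).1.add_const isOpen_ball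
        (-r)).const_mul isOpen_ball hsr.le).sup isOpen_ball (.const 0)⟩
  · rw [← coe_one, coe_le_coe_iff]
    refine max_le ?_ zero_le_one
    rw [inv_mul_le_iff₀ (by linarith)]
    linarith [hle s (hpos s x hx) x hx]
  · rw [← coe_zero, coe_le_coe_iff]
    exact max_le (mul_nonpos_of_nonneg_of_nonpos hsr.le
      (by linarith [hle r (hpos r x hx) x hx])) le_rfl

theorem relExt_annulus_of_josefson (hX : IsJosefsonManifold S) (hD : IsOpen D)
    (hDc : IsCompact (closure D)) (hAD : A ⊆ D) (hr : 0 < r) (hrs : r < s) (hs : s ≤ 1) :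
    ∀ z ∈ {z ∈ D | relExt S A D z < ((s : ℝ) : EReal)},
      relExt S {z ∈ D | relExt S A D z < ((r : ℝ) : EReal)}
          {z ∈ D | relExt S A D z < ((s : ℝ) : EReal)} z =
        max 0 ((relExt S A D z - ((r : ℝ) : EReal)) / (((s - r : ℝ) : EReal))) := fun z hz => by
  set Δr := {z ∈ D | relExt S A D z < ((r : ℝ) : EReal)}
  set Δs := {z ∈ D | relExt S A D z < ((s : ℝ) : EReal)} with hΔs
  have hΔ : IsOpen Δs := isOpen_relExt_lt hD _
  have hsr : 0 < s - r := by linarith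
  refine le_antisymm (le_of_forall_gt_imp_ge_of_dense fun c hc => ?_)
    (max_le (relExt_mem hΔ hz).1 (le_of_forall_lt_imp_le_of_dense fun c hc => ?_))
  · obtain ⟨q, hq, hqc⟩ := exists_rat_btwn_of_lt hc
    obtain ⟨hq0, hq1⟩ := max_lt_iff.1 hq
    rw [← coe_relExt hD hz.1, ← coe_sub, ← coe_div, coe_lt_coe_iff,
      div_lt_iff₀ hsr] at hq1
    replace hq0 : (0 : ℝ) < q := by simp_all
    have h1 : relExt S A D z < ((q * (s - r) + r : ℝ) : EReal) := by
      rw [← coe_relExt hD hz.1]; exact coe_lt_coe_iff.2 (by linarith)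
    refine (limsup_le_of_le (h := ?_)).trans hqc.le
    filter_upwards [mem_nhdsWithin_of_mem_nhds (eventually_relExt_lt hD hz.1 h1),
      self_mem_nhdsWithin] with y hy hyΔ
    refine iSup₂_le fun v (hv : Comp S Δr Δs v) => ?_
    have h2 := hv.le_annulus hX hD hDc hAD hr hrs hs hyΔ
    have h3 : (relExt S A D y).toReal < q * (s - r) + r := by
      rw [← coe_relExt hD hyΔ.1] at hy; exact coe_lt_coe_iff.1 hy
    refine (le_trunc (m := 0) (hv.1.1 y hyΔ)).trans (coe_le_coe_iff.2 ?_)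
    have h4 : max (relExt S A D y).toReal r ≤ q * (s - r) + r :=
      max_le h3.le (by nlinarith)
    exact le_of_mul_le_mul_left (by linarith) hsr
  · obtain ⟨q, hcq, hq⟩ := exists_rat_btwn_of_lt hc
    rw [← coe_relExt hD hz.1, ← coe_sub, ← coe_div, coe_lt_coe_iff,
      lt_div_iff₀ hsr] at hq
    have h1 : ((q * (s - r) + r : ℝ) : EReal) < relExt S A D z := by
      rw [← coe_relExt hD hz.1]; exact coe_lt_coe_iff.2 (by linarith)
    refine hcq.le.trans (le_limsup_of_frequently_le ?_)
    rw [hΔ.nhdsWithin_eq hz]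
    refine (frequently_lt_relExtRaw h1).mono fun y hy => ?_
    obtain ⟨u, hu, huy⟩ := lt_relExtRaw_iff.1 hy.1
    refine le_trans (coe_le_coe_iff.2 ?_) ((hu.annulus hX.1 hD hrs).le_raw y)
    refine le_max_of_le_left ?_
    rw [le_inv_mul_iff₀ hsr]
    have := coe_lt_coe_iff.1 (huy.trans_le (le_trunc (m := 0) (hu.1.1 y hy.2)))
    linarith

end Josefson

/-- Theorem 1.1, "annulus" formula for the relative extremal function.
Let `D ⋐ X` where either (A) `D` is an irreducible, locally irreducible weakly parabolic
Stein space (with some potential `g`) and `X` is a Stein space, or (B) `D` is a Stein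
manifold and `X` is a Josefson manifold.  Let `A ⊆ D` be nonpluripolar and
`Δ(t) = {z ∈ D : h*_{A,D}(z) < t}`.  Then for `0 < r < s ≤ 1`,
`h*_{Δ(r),Δ(s)} = max {0, (h*_{A,D} - r)/(s - r)}` on `Δ(s)`. -/
theorem relExt_annulus_formula {X : Type*} [TopologicalSpace X] [T2Space X]
    [SecondCountableTopology X] [MeasurableSpace X] [BorelSpace X]
    (S : CSpace X) (D : Set X) (hDopen : IsOpen D) (hDrc : IsCompact (closure D))
    (hcase :
      (IsIrreducibleIn S D ∧ IsLocallyIrreducibleIn S D ∧ IsSteinIn S D ∧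
        (∃ (n : ℕ) (g : X → ℝ), PureDimensionIn S D n ∧ WeaklyParabolicIn S n g D) ∧
        IsSteinIn S univ) ∨
      (IsManifoldIn S D ∧ IsSteinIn S D ∧ IsJosefsonManifold S))
    (A : Set X) (hAD : A ⊆ D) (hA : ¬ IsPluripolarIn S A D)
    (r s : ℝ) (hr : 0 < r) (hrs : r < s) (hs : s ≤ 1) :
    ∀ z ∈ {z ∈ D | relExt S A D z < ((s : ℝ) : EReal)},
      relExt S {z ∈ D | relExt S A D z < ((r : ℝ) : EReal)}
          {z ∈ D | relExt S A D z < ((s : ℝ) : EReal)} z =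
        max 0 ((relExt S A D z - ((r : ℝ) : EReal)) / (((s - r : ℝ) : EReal))) := by
  rcases hcase with ⟨hirr, -, -, ⟨n, g, hpure, hg⟩, hX⟩ | ⟨-, -, hX⟩
  · rcases eq_or_ne n 0 with rfl | hn
    · obtain ⟨x, rfl⟩ := hirr.exists_eq_singleton hDopen hpure
      exact relExt_annulus_of_singleton hDopen hAD hA hr hrs
    · exact (false_of_weaklyParabolic hDopen hDrc hirr.1 hn hpure hg hX).elim
  · exact relExt_annulus_of_josefson hX hDopen hDrc hAD hr hrs hs
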